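/- For each K ∈ ℕ, the K-bounded configuration reachability problem for DCPS is decidable: there is an algorithm that, given a DCPS A and a configuration c of A, decides whether there is a K-context switch bounded run from the initial configuration of A to c. -/

import Mathlib

/-!
Formalization of context-bounded liveness for dynamic networks of concurrent
pushdown systems (DCPS) and VASS with balloons (VASSB).
Global states, stack symbols, places, balloon states etc. are drawn from ℕ;
the finite components of the systems are recorded as `Finset`s.
-/

noncomputable section

namespace CBL

/-! ### Dynamic networks of concurrent pushdown systems (DCPS) -/

/-- A local configuration of a thread: its stack content (top of stack is the
head of the list) together with its context-switch number. -/
abbrev Loc : Type := List ℕ × ℕ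

/-- A DCPS `(G, Γ, Δ, g0, γ0)`.  The transition rules `Δ` are split into the
four kinds.  A creation rule `g|γ ↪ g'|w' (▷ γ')` is recorded as
`(g, γ, g', w', none/some γ')`; an interruption rule `g|γ ↦ g'|w'` as
`(g, γ, g', w')`; a resumption rule `g ↦ g' ◁ γ` as `(g, g', γ)`; a
termination rule `g ↦ g'` as `(g, g')`. -/
structure DCPS where
  glob : Finset ℕ
  alph : Finset ℕ
  creation : Finset (ℕ × ℕ × ℕ × List ℕ × Option ℕ)
  interruption : Finset (ℕ × ℕ × ℕ × List ℕ)
  resumption : Finset (ℕ × ℕ × ℕ)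
  termination : Finset (ℕ × ℕ)
  g0 : ℕ
  gamma0 : ℕ
  creation_wf : ∀ r ∈ creation, r.2.2.2.1.length ≤ 2
  interruption_wf : ∀ r ∈ interruption, 1 ≤ r.2.2.2.length ∧ r.2.2.2.length ≤ 2

/-- A configuration `⟨g, t, m⟩` of a DCPS: global state, active slot
(`none` denotes the schedule point `#`), and the multiset of local
configurations of the inactive threads. -/
structure DConfig where
  g : ℕ
  act : Option Loc
  pend : Multiset Loc

/-- The initial configuration `⟨g0, #, {(γ0, 0)}⟩`. -/
def DCPS.init (A : DCPS) : DConfig :=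
  ⟨A.g0, none, {([A.gamma0], 0)}⟩

/-- The multiset of freshly spawned threads of a creation rule. -/
def spawnOf : Option ℕ → Multiset Loc
  | none => 0
  | some gam => {([gam], 0)}

/-- A thread step: a creation rule rewrites the global state and the top of
stack of the active thread, possibly spawning a new thread. -/
def ThreadStep (A : DCPS) (c c' : DConfig) : Prop :=
  ∃ (gam : ℕ) (w : List ℕ) (i : ℕ) (g' : ℕ) (w' : List ℕ) (sp : Option ℕ),
    (c.g, gam, g', w', sp) ∈ A.creation ∧
    c.act = some (gam :: w, i) ∧ c'.g = g' ∧ c'.act = some (w' ++ w, i) ∧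
    c'.pend = c.pend + spawnOf sp

/-- The scheduler step `Swap`. -/
def SwapStep (A : DCPS) (c c' : DConfig) : Prop :=
  ∃ (gam : ℕ) (w : List ℕ) (i : ℕ) (g' : ℕ) (w' : List ℕ),
    (c.g, gam, g', w') ∈ A.interruption ∧
    c.act = some (gam :: w, i) ∧ c'.g = g' ∧ c'.act = none ∧
    c'.pend = c.pend + {(w' ++ w, i + 1)}

/-- The scheduler step `Resume`, resuming (an instance of) the local
configuration `t`. -/
def ResumeStep (A : DCPS) (t : Loc) (c c' : DConfig) : Prop :=
  ∃ (gam : ℕ) (w : List ℕ) (i : ℕ) (g' : ℕ) (p0 : Multiset Loc),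
    (c.g, g', gam) ∈ A.resumption ∧ t = (gam :: w, i) ∧
    c.act = none ∧ c.pend = p0 + {t} ∧
    c'.g = g' ∧ c'.act = some t ∧ c'.pend = p0

/-- The scheduler step `Term`, removing the active thread when its stack is
empty. -/
def TermStep (A : DCPS) (c c' : DConfig) : Prop :=
  ∃ (i : ℕ) (g' : ℕ),
    (c.g, g') ∈ A.termination ∧ c.act = some ([], i) ∧
    c'.g = g' ∧ c'.act = none ∧ c'.pend = c.pend

/-- Any single step of the DCPS. -/
def DStep (A : DCPS) (c c' : DConfig) : Prop :=
  ThreadStep A c c' ∨ SwapStep A c c' ∨ (∃ t, ResumeStep A t c c') ∨ TermStep A c c'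

/-- An infinite run of a DCPS: it starts in the initial configuration, takes a
step at each moment, performs at least one thread step between consecutive
scheduler steps (every scheduled thread executes a nonempty sequence of thread
steps), and alternates thread executions with scheduler steps forever (there
are infinitely many scheduler steps, witnessed by schedule points `#`). -/
def IsInfRunD (A : DCPS) (rho : ℕ → DConfig) : Prop :=
  rho 0 = A.init ∧ (∀ i, DStep A (rho i) (rho (i + 1))) ∧
  (∀ i, (rho i).act = none → (rho (i + 2)).act ≠ none) ∧
  (∀ i, ∃ j ≥ i, (rho j).act = none)

/-- A finite run of length `n` of a DCPS (the first `n` steps of `rho`). -/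
def IsFinRunD (A : DCPS) (rho : ℕ → DConfig) (n : ℕ) : Prop :=
  rho 0 = A.init ∧ (∀ i < n, DStep A (rho i) (rho (i + 1))) ∧
  (∀ i, i + 2 ≤ n → (rho i).act = none → (rho (i + 2)).act ≠ none)

/-- A run is `K`-context switch bounded if in every configuration the
context-switch number of the active thread is at most `K`. -/
def KBoundedD (K : ℕ) (rho : ℕ → DConfig) : Prop :=
  ∀ i w j, (rho i).act = some (w, j) → j ≤ K

/-- `K`-context switch boundedness for the first `n + 1` configurations. -/
def KBoundedUpToD (K n : ℕ) (rho : ℕ → DConfig) : Prop :=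
  ∀ i ≤ n, ∀ w j, (rho i).act = some (w, j) → j ≤ K

/-- The thread `t = (γw, i)` is ready at configuration `c = ⟨g, #, m⟩`. -/
def ReadyAt (A : DCPS) (t : Loc) (c : DConfig) : Prop :=
  c.act = none ∧ t ∈ c.pend ∧
  ∃ (gam : ℕ) (w : List ℕ) (g' : ℕ), t.1 = gam :: w ∧ (c.g, g', gam) ∈ A.resumption

/-- The thread `t` is resumed (made active) at moment `k` of the run `rho`. -/
def ResumedAt (A : DCPS) (rho : ℕ → DConfig) (k : ℕ) (t : Loc) : Prop :=
  ResumeStep A t (rho k) (rho (k + 1))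

/-- Fairness: no thread is ready at infinitely many configurations while being
resumed only finitely often. -/
def FairD (A : DCPS) (rho : ℕ → DConfig) : Prop :=
  ∀ t : Loc, (∀ N, ∃ k ≥ N, ReadyAt A t (rho k)) → (∀ N, ∃ k ≥ N, ResumedAt A rho k t)

/-- Progressiveness for a context-switch bound `K`:  the rule `Term` is only
ever applied to an active thread with exactly `K` context switches (from an
active thread with empty stack only `Term` steps are possible, so this is
expressed by requiring that an active thread with an empty stack has
context-switch number `K`), and every local configuration of an inactive
thread is resumed at some later point of the run. -/
def ProgressiveD (A : DCPS) (K : ℕ) (rho : ℕ → DConfig) : Prop :=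
  (∀ k i, (rho k).act = some ([], i) → i = K) ∧
  (∀ k, ∀ t ∈ (rho k).pend, ∃ j ≥ k, ResumedAt A rho j t)

/-- All threads (active and inactive) of a configuration. -/
def allThreads (c : DConfig) : Multiset Loc :=
  c.pend + (match c.act with | none => 0 | some t => {t})

/-- The thread `t = (w, i)` is starved in the run `rho`: from some moment `j`
on, at least one thread with local configuration `t` is always present, and
whenever `t` is resumed there are at least two of them. -/
def StarvesD (A : DCPS) (rho : ℕ → DConfig) (t : Loc) : Prop :=
  ∃ j, (∀ k ≥ j, 1 ≤ (allThreads (rho k)).count t) ∧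
       (∀ k ≥ j, ResumedAt A rho k t → 2 ≤ (allThreads (rho k)).count t)

/-- Step `k` of the run is a thread step spawning a new thread. -/
def SpawnAt (rho : ℕ → DConfig) (k : ℕ) : Prop :=
  (rho k).act ≠ none ∧ (rho (k + 1)).act ≠ none ∧
  ∃ gam : ℕ, (rho (k + 1)).pend = (rho k).pend + {([gam], 0)}

/-- A run is shallow if there is a bound `B ∈ ℕ` on the number of threads
spawned by each thread along the run, i.e. on the number of spawns performed
during any contiguous interval of the run in which a single thread stays
active. -/
def ShallowD (rho : ℕ → DConfig) : Prop :=
  ∃ B, ∀ a b : ℕ, (∀ k, a ≤ k → k ≤ b → (rho k).act ≠ none) →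
    Set.ncard {k | a ≤ k ∧ k < b ∧ SpawnAt rho k} ≤ B

/-- The number of pending threads of a configuration: the size of the multiset
of inactive threads, plus one if there is an active thread. -/
def pendCount (c : DConfig) : ℕ :=
  Multiset.card c.pend + (match c.act with | none => 0 | some _ => 1)

/-! ### Effective encodings of DCPS and their configurations -/

/-- An effective encoding of DCPS by natural numbers. -/
def encodeDCPS (A : DCPS) : ℕ :=
  Encodable.encode (A.glob.val, A.alph.val, A.creation.val, A.interruption.val,
    A.resumption.val, A.termination.val, A.g0, A.gamma0)

/-- An effective encoding of DCPS configurations by natural numbers. -/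
def encodeDConfig (c : DConfig) : ℕ :=
  Encodable.encode (c.g, c.act, c.pend)

/-! ### Functions bounded by a level of the Ackermann function -/

/-- `f` is bounded by some fixed level of the Ackermann function. -/
def AckBd (f : ℕ → ℕ) : Prop := ∃ m, ∀ n, f n ≤ ack m n

namespace AckBd

theorem of_le {f g : ℕ → ℕ} (hg : AckBd g) (h : ∀ n, f n ≤ g n) : AckBd f := by
  obtain ⟨m, hm⟩ := hg
  exact ⟨m, fun n => (h n).trans (hm n)⟩

theorem ack (m : ℕ) : AckBd (_root_.ack m) := ⟨m, fun _ => le_rfl⟩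

theorem id : AckBd (fun n => n) := ⟨0, fun n => (lt_ack_right 0 n).le⟩

theorem const (c : ℕ) : AckBd (fun _ => c) := ⟨c, fun n => (lt_ack_left c n).le⟩

theorem comp {f g : ℕ → ℕ} (hf : AckBd f) (hg : AckBd g) : AckBd (fun n => f (g n)) := by
  obtain ⟨a, ha⟩ := hf
  obtain ⟨b, hb⟩ := hg
  exact ⟨max a b + 2, fun n => (ha _).trans
    ((ack_mono_right a (hb n)).trans (ack_ack_lt_ack_max_add_two a b n).le)⟩

theorem max {f g : ℕ → ℕ} (hf : AckBd f) (hg : AckBd g) : AckBd (fun n => max (f n) (g n)) := by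
  obtain ⟨a, ha⟩ := hf
  obtain ⟨b, hb⟩ := hg
  exact ⟨Max.max a b, fun n => max_le ((ha n).trans (ack_mono_left n (le_max_left a b)))
    ((hb n).trans (ack_mono_left n (le_max_right a b)))⟩

theorem add {f g : ℕ → ℕ} (hf : AckBd f) (hg : AckBd g) : AckBd (fun n => f n + g n) :=
  ((ack 2).comp (hf.max hg)).of_le fun n => by
    rw [ack_two]
    have h1 := le_max_left (f n) (g n)
    have h2 := le_max_right (f n) (g n)
    omega

theorem two_pow {f : ℕ → ℕ} (hf : AckBd f) : AckBd (fun n => 2 ^ f n) :=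
  ((ack 3).comp hf).of_le fun n => by
    rw [ack_three, pow_add]
    have : 1 ≤ 2 ^ f n := Nat.one_le_two_pow
    omega

theorem mul {f g : ℕ → ℕ} (hf : AckBd f) (hg : AckBd g) : AckBd (fun n => f n * g n) :=
  (two_pow (hf.add hg)).of_le fun n => by
    rw [pow_add]
    exact Nat.mul_le_mul Nat.lt_two_pow_self.le Nat.lt_two_pow_self.le

theorem pow {f g : ℕ → ℕ} (hf : AckBd f) (hg : AckBd g) : AckBd (fun n => f n ^ g n) :=
  (two_pow (hf.mul hg)).of_le fun n => by
    rw [pow_mul]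
    exact Nat.pow_le_pow_left Nat.lt_two_pow_self.le _

end AckBd

theorem iterate_ack_le (a s n : ℕ) : (ack a)^[s] n ≤ ack (a + 1) (s + n) := by
  induction s with
  | zero => simpa using (lt_ack_right (a + 1) n).le
  | succ s ih =>
    rw [Function.iterate_succ_apply', Nat.succ_add, ack_succ_succ]
    exact ack_mono_right a ih

/-! ### Small solutions of systems of linear equations over the naturals -/

theorem row_decompose_aux {I : Type} [Fintype I] [DecidableEq I] (n : ℕ) (hI : Fintype.card I ≤ n)
    (a : I → ℤ) (b : ℤ) (ha : ∀ i, |a i| ≤ n) (hb : |b| ≤ n) (z : I → ℕ)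
    (hz : ∑ i, a i * z i = b) (i : I) (hi : n ^ 3 + n < z i) :
    ∃ h : I → Fin (n + 1), (∑ i, a i * (h i : ℕ) = 0) ∧ (∀ i, (h i : ℕ) ≤ z i) ∧
      ∃ i, 0 < (h i : ℕ) := by
  have hn : 1 ≤ n := le_trans (Fintype.card_pos_iff.2 ⟨i⟩) hI
  rcases eq_or_ne (a i) 0 with h0 | h0
  · refine ⟨fun k => if k = i then ⟨1, by omega⟩ else 0, ?_, ?_, i, by simp⟩
    · apply Finset.sum_eq_zero
      intro k _
      by_cases hk : k = i
      · subst hk; simp [h0]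
      · simp [hk]
    · intro k
      by_cases hk : k = i
      · subst hk; simp; omega
      · simp [hk]
  · wlog hpos : 0 < a i generalizing a b with H
    · have hneg : 0 < -a i := by
        rcases lt_or_gt_of_ne h0 with h | h
        · omega
        · exact absurd h hpos
      obtain ⟨h, h1, h2⟩ := H (fun k => -a k) (-b) (by simpa using ha) (by simpa using hb)
        (by simp [Finset.sum_neg_distrib, hz]) (by simpa using h0) hneg
      refine ⟨h, ?_, h2⟩
      simpa [Finset.sum_neg_distrib] using h1
    · have : ∃ j, a j < 0 ∧ n ≤ z j := by
        by_contra! hcon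
        have key : (a i * z i : ℤ) - n ^ 3 ≤ ∑ i, a i * z i := by
          rw [← Finset.add_sum_erase _ _ (Finset.mem_univ i)]
          have h1 : ∑ k ∈ Finset.univ.erase i, (-(n ^ 2 : ℤ)) ≤
              ∑ k ∈ Finset.univ.erase i, a k * z k := by
            apply Finset.sum_le_sum
            intro k _
            rcases lt_or_ge (a k) 0 with hk | hk
            · have h2 := hcon k hk
              have h3 := (abs_le.1 (ha k)).1
              have h4 : ((z k : ℕ) : ℤ) ≤ n := by exact_mod_cast h2.le
              have h5 : (0 : ℤ) ≤ z k := by positivity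
              nlinarith
            · have : 0 ≤ a k * z k := by positivity
              nlinarith
          rw [Finset.sum_const, nsmul_eq_mul] at h1
          have h2 : ((Finset.univ.erase i).card : ℤ) ≤ n := by
            have := Finset.card_erase_le (s := (Finset.univ : Finset I)) (a := i)
            rw [Finset.card_univ] at this
            exact_mod_cast this.trans hI
          have h3 : (0 : ℤ) ≤ (n : ℤ) ^ 2 := by positivity
          nlinarith
        rw [hz] at key
        have h1 := (abs_le.1 hb).2
        have h2 : ((n : ℤ) ^ 3 + n) < z i := by exact_mod_cast hi
        have h3 : (z i : ℤ) ≤ a i * z i := by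
          have : (0 : ℤ) ≤ z i := by positivity
          nlinarith
        omega
      obtain ⟨j, hj, hzj⟩ := this
      have hij : j ≠ i := by rintro rfl; omega
      have hai : (a i).natAbs ≤ n := by have := ha i; rw [Int.abs_eq_natAbs] at this; omega
      have haj : (a j).natAbs ≤ n := by have := ha j; rw [Int.abs_eq_natAbs] at this; omega
      refine ⟨fun k => if k = i then ⟨(a j).natAbs, by omega⟩ else
        if k = j then ⟨(a i).natAbs, by omega⟩ else 0, ?_, ?_, i, by simp; omega⟩
      · rw [← Finset.add_sum_erase _ _ (Finset.mem_univ i),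
          ← Finset.add_sum_erase _ _ (Finset.mem_erase.2 ⟨hij, Finset.mem_univ j⟩),
          Finset.sum_eq_zero]
        · simp only [if_true, hij, if_false, add_zero]
          rw [Int.natCast_natAbs, Int.natCast_natAbs, abs_of_pos hpos, abs_of_neg hj]
          ring
        · intro k hk
          simp only [Finset.mem_erase] at hk
          simp [hk.1, hk.2.1]
      · intro k
        by_cases hk : k = i
        · subst hk; simp; nlinarith [Nat.zero_le (n ^ 3)]
        · by_cases hk' : k = j
          · subst hk'; simp [hk]; omega
          · simp [hk, hk']

theorem row_decompose {I : Type} [Fintype I] [DecidableEq I] (n : ℕ) (hI : Fintype.card I ≤ n)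
    (a : I → ℤ) (b : ℤ) (ha : ∀ i, |a i| ≤ n) (hb : |b| ≤ n) (z : I → ℕ)
    (hz : ∑ i, a i * z i = b) :
    ∃ (z0 : I → ℕ) (l : (I → Fin (n + 1)) → ℕ), (∀ i, z0 i ≤ n ^ 3 + n) ∧
      (∀ h, l h ≠ 0 → ∑ i, a i * (h i : ℕ) = 0) ∧
      (∑ i, a i * z0 i = b) ∧ ∀ i, z i = z0 i + ∑ h, l h * (h i : ℕ) := by
  induction hs : ∑ i, z i using Nat.strong_induction_on generalizing z with
  | _ s ih =>
    by_cases hbig : ∃ i, n ^ 3 + n < z i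
    · obtain ⟨i, hi⟩ := hbig
      obtain ⟨h, h1, h2, k, hk⟩ := row_decompose_aux n hI a b ha hb z hz i hi
      have hlt : ∑ i, (z i - (h i : ℕ)) < s := by
        rw [← hs]
        refine Finset.sum_lt_sum (fun i _ => Nat.sub_le _ _) ⟨k, Finset.mem_univ k, ?_⟩
        have := h2 k
        omega
      obtain ⟨z0, l, hz0, hl, hb0, hzl⟩ := ih _ hlt (fun i => z i - (h i : ℕ)) (by
        rw [← hz]
        have : ∑ i, a i * ((z i : ℤ) - (h i : ℕ)) = ∑ i, a i * z i := by
          simp only [mul_sub, Finset.sum_sub_distrib, h1, sub_zero]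
        rw [← this]
        refine Finset.sum_congr rfl fun i _ => ?_
        rw [Nat.cast_sub (h2 i)]) rfl
      refine ⟨z0, fun g => l g + if g = h then 1 else 0, hz0, ?_, hb0, ?_⟩
      · intro g hg
        by_cases hgh : g = h
        · subst hgh; exact h1
        · apply hl; simpa [hgh] using hg
      · intro i
        have := hzl i
        have h3 := h2 i
        simp only [add_mul, Finset.sum_add_distrib, ite_mul, one_mul, zero_mul, Finset.sum_ite_eq',
          Finset.mem_univ, if_true]
        omega
    · push Not at hbig
      exact ⟨z, 0, hbig, by simp, hz, by simp⟩

def rowGrowth (n : ℕ) : ℕ :=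
  n + n * n * (n ^ 3 + n) + n * n * n + (n + 1) ^ n + (n ^ 3 + n) + (n + 1) ^ n * n * n

theorem le_rowGrowth (n : ℕ) : n ≤ rowGrowth n := by unfold rowGrowth; omega

theorem rowGrowth_mono : Monotone rowGrowth := by
  intro a b h
  have : (a + 1) ^ a ≤ (b + 1) ^ b :=
    (Nat.pow_le_pow_left (by omega) a).trans (Nat.pow_le_pow_right (by omega) h)
  unfold rowGrowth
  gcongr

theorem rowGrowth_bd : AckBd rowGrowth := by
  unfold rowGrowth
  have h := AckBd.id
  have hp := (h.add (AckBd.const 1)).pow h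
  have h3 := (h.pow (AckBd.const 3)).add h
  exact ((((h.add ((h.mul h).mul h3)).add ((h.mul h).mul h)).add hp).add h3).add ((hp.mul h).mul h)

theorem abs_sum_mul_le {I : Type} [Fintype I] (n N : ℕ) (hI : Fintype.card I ≤ n)
    (a : I → ℤ) (ha : ∀ i, |a i| ≤ n) (z : I → ℕ) (hz : ∀ i, z i ≤ N) :
    |∑ i, a i * z i| ≤ (n * n * N : ℕ) := by
  refine (Finset.abs_sum_le_sum_abs _ _).trans ?_
  have : ∑ i, |a i * z i| ≤ ∑ _i : I, (n * N : ℤ) := by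
    apply Finset.sum_le_sum
    intro i _
    rw [abs_mul, Nat.abs_cast]
    have h1 := ha i
    have h2 : (z i : ℤ) ≤ N := by exact_mod_cast hz i
    gcongr
  refine this.trans ?_
  rw [Finset.sum_const, nsmul_eq_mul, Finset.card_univ]
  push_cast
  have : (Fintype.card I : ℤ) ≤ n := by exact_mod_cast hI
  rw [mul_assoc]
  gcongr

theorem exists_small_solution_list (r : ℕ) : ∀ (n : ℕ) (I : Type) [Fintype I],
    Fintype.card I ≤ n → ∀ rows : List ((I → ℤ) × ℤ), rows.length ≤ r →
    (∀ q ∈ rows, (∀ i, |q.1 i| ≤ n) ∧ |q.2| ≤ n) → ∀ z : I → ℕ,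
    (∀ q ∈ rows, ∑ i, q.1 i * z i = q.2) →
    ∃ z' : I → ℕ, z' ≤ z ∧ (∀ q ∈ rows, ∑ i, q.1 i * z' i = q.2) ∧
      ∀ i, z' i ≤ rowGrowth^[2 * r] n := by
  induction r with
  | zero =>
    intro n I _ _ rows hlen _ z _
    have : rows = [] := List.eq_nil_of_length_eq_zero (by omega)
    subst this
    exact ⟨0, fun _ => Nat.zero_le _, by simp, by simp⟩
  | succ r ih =>
    intro n I _ hI rows hlen hbd z hz
    classical
    cases rows with
    | nil => exact ⟨0, fun _ => Nat.zero_le _, by simp, by simp⟩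
    | cons q rows =>
      obtain ⟨a, b⟩ := q
      obtain ⟨z0, l, hz0, hl, hb0, hzl⟩ := row_decompose n hI a b (hbd (a, b) (by simp)).1
        (hbd (a, b) (by simp)).2 z (hz (a, b) (by simp))
      have hpow : (n + 1) ^ Fintype.card I ≤ (n + 1) ^ n := Nat.pow_le_pow_right (by omega) hI
      have expand : ∀ (c : I → ℤ) (l : (I → Fin (n + 1)) → ℕ),
          ∑ i, c i * ((z0 i + ∑ h, l h * (h i : ℕ) : ℕ) : ℤ) =
            ∑ i, c i * z0 i + ∑ h, (∑ i, c i * (h i : ℕ)) * l h := by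
        intro c l
        push_cast
        simp only [mul_add, Finset.sum_add_distrib, Finset.mul_sum, Finset.sum_mul]
        congr 1
        rw [Finset.sum_comm]
        refine Finset.sum_congr rfl fun h _ => Finset.sum_congr rfl fun i _ => by ring
      obtain ⟨l', hl', hsol, hlbd⟩ := ih (rowGrowth n) (I → Fin (n + 1)) (by
          rw [Fintype.card_fun, Fintype.card_fin]; unfold rowGrowth; omega)
        (rows.map fun q => ((fun h => ∑ i, q.1 i * ((h i : ℕ) : ℤ)),
          q.2 - ∑ i, q.1 i * (z0 i : ℤ)))
        (by simpa using hlen) (by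
          intro q' hq'
          obtain ⟨q, hq, rfl⟩ := List.mem_map.1 hq'
          obtain ⟨hq1, hq2⟩ := hbd q (List.mem_cons_of_mem _ hq)
          constructor
          · intro h
            refine (abs_sum_mul_le n n hI q.1 hq1 (fun i => (h i : ℕ))
              (fun i => Nat.lt_succ_iff.1 (h i).2)).trans ?_
            norm_cast
            unfold rowGrowth; omega
          · have h1 := abs_sum_mul_le n (n ^ 3 + n) hI q.1 hq1 z0 hz0
            have h2 := abs_sub q.2 (∑ i, q.1 i * z0 i)
            have h3 : n + n * n * (n ^ 3 + n) ≤ rowGrowth n := by unfold rowGrowth; omega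
            have h4 : ((n + n * n * (n ^ 3 + n) : ℕ) : ℤ) ≤ (rowGrowth n : ℕ) := by exact_mod_cast h3
            rw [Nat.cast_add] at h4
            refine h2.trans (le_trans (add_le_add hq2 h1) h4)) l (by
          intro q' hq'
          obtain ⟨q, hq, rfl⟩ := List.mem_map.1 hq'
          have h1 := hz q (List.mem_cons_of_mem _ hq)
          have h2 := expand q.1 l
          simp only [← hzl] at h2
          simp only
          omega)
      refine ⟨fun i => z0 i + ∑ h, l' h * (h i : ℕ), ?_, ?_, ?_⟩
      · intro i
        simp only
        rw [hzl i]
        have : ∑ h, l' h * (h i : ℕ) ≤ ∑ h, l h * (h i : ℕ) :=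
          Finset.sum_le_sum fun h _ => Nat.mul_le_mul_right _ (hl' h)
        omega
      · intro q hq
        rw [expand]
        rcases List.mem_cons.1 hq with rfl | hq
        · rw [hb0, Finset.sum_eq_zero, add_zero]
          intro h _
          by_cases h0 : l' h = 0
          · simp [h0]
          · rw [hl h (by have : l' h ≤ l h := hl' h
                         omega), zero_mul]
        · have := hsol _ (List.mem_map_of_mem hq)
          simp only at this
          rw [this]; ring
      · intro i
        set M := rowGrowth^[2 * r] (rowGrowth n) with hM
        have hnM : n ≤ M := by
          have h1 : ∀ k, rowGrowth n ≤ rowGrowth^[k] (rowGrowth n) := by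
            intro k
            exact Function.id_le_iterate_of_id_le le_rowGrowth k _
          exact (le_rowGrowth n).trans (h1 _)
        have h1 : ∑ h, l' h * (h i : ℕ) ≤ ∑ _h : I → Fin (n + 1), M * n :=
          Finset.sum_le_sum fun h _ => Nat.mul_le_mul (hlbd h) (Nat.lt_succ_iff.1 (h i).2)
        rw [Finset.sum_const, Finset.card_univ, Fintype.card_fun, Fintype.card_fin,
          smul_eq_mul] at h1
        have h2 : (n + 1) ^ n ≤ (M + 1) ^ M :=
          (Nat.pow_le_pow_left (by omega) n).trans (Nat.pow_le_pow_right (by omega) hnM)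
        have h3 : (n + 1) ^ Fintype.card I * (M * n) ≤ (M + 1) ^ M * M * M := by
          rw [mul_assoc]
          exact Nat.mul_le_mul (hpow.trans h2) (Nat.mul_le_mul_left M hnM)
        have h4 : n ^ 3 + n ≤ M ^ 3 + M := by gcongr
        have h5 := hz0 i
        have h6 : rowGrowth^[2 * (r + 1)] n = rowGrowth M := by
          rw [hM, mul_add, mul_one, Function.iterate_succ_apply', Function.iterate_succ_apply]
        rw [h6]
        simp only
        unfold rowGrowth
        omega

/-- Every solution of a linear system dominates a small one. -/
theorem exists_small_solution : ∃ Q : ℕ → ℕ, AckBd Q ∧ ∀ (n : ℕ) (I R : Type) [Fintype I]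
    [Fintype R], Fintype.card I ≤ n → Fintype.card R ≤ n → ∀ (a : R → I → ℤ) (b : R → ℤ),
    (∀ r i, |a r i| ≤ n) → (∀ r, |b r| ≤ n) → ∀ z : I → ℕ, (∀ r, ∑ i, a r i * z i = b r) →
    ∃ z' : I → ℕ, z' ≤ z ∧ (∀ r, ∑ i, a r i * z' i = b r) ∧ ∀ i, z' i ≤ Q n := by
  obtain ⟨k, hk⟩ := rowGrowth_bd
  refine ⟨fun n => rowGrowth^[2 * n] n, ?_, ?_⟩
  · refine ((AckBd.ack (k + 1)).comp (((AckBd.const 2).mul AckBd.id).add AckBd.id)).of_le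
      fun n => ?_
    exact (rowGrowth_mono.iterate_le_of_le hk (2 * n) n).trans (iterate_ack_le k (2 * n) n)
  · intro n I R _ _ hI hR a b ha hb z hz
    obtain ⟨z', h1, h2, h3⟩ := exists_small_solution_list n n I hI
      ((Finset.univ : Finset R).toList.map fun r => (a r, b r))
      (by simpa using hR) (by
        intro q hq
        obtain ⟨r, _, rfl⟩ := List.mem_map.1 hq
        exact ⟨ha r, hb r⟩) z (by
        intro q hq
        obtain ⟨r, _, rfl⟩ := List.mem_map.1 hq
        exact hz r)
    refine ⟨z', h1, fun r => ?_, h3⟩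
    exact h2 (a r, b r) (List.mem_map.2 ⟨r, by simp, rfl⟩)

/-- A linear system has a bounded homogeneous solution of maximal support, and every solution is a
bounded solution plus a homogeneous one. -/
theorem exists_max_hom_solution : ∃ Q : ℕ → ℕ, AckBd Q ∧ ∀ (n : ℕ) (I R : Type) [Fintype I]
    [Fintype R], Fintype.card I ≤ n → Fintype.card R ≤ n → ∀ a : R → I → ℤ,
    (∀ r i, |a r i| ≤ n) → ∃ h : I → ℕ, (∀ r, ∑ i, a r i * h i = 0) ∧ (∀ i, h i ≤ Q n) ∧
      (∀ z : I → ℕ, (∀ r, ∑ i, a r i * z i = 0) → ∀ i, z i ≠ 0 → h i ≠ 0) ∧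
      ∀ b : R → ℤ, (∀ r, |b r| ≤ n) → ∀ z : I → ℕ, (∀ r, ∑ i, a r i * z i = b r) →
        ∃ z' : I → ℕ, z' ≤ z ∧ (∀ r, ∑ i, a r i * z' i = b r) ∧ (∀ i, z' i ≤ Q n) ∧
          ∀ i, h i = 0 → z i = z' i := by
  obtain ⟨Q, hQ, H⟩ := exists_small_solution
  refine ⟨fun n => Q n + n * (Q n + 1), hQ.add (AckBd.id.mul (hQ.add (AckBd.const 1))), ?_⟩
  intro n I R _ _ hI hR a ha
  classical
  have small : ∀ k : I, ∃ h : I → ℕ, (∀ r, ∑ i, a r i * h i = 0) ∧ (∀ i, h i ≤ Q n + 1) ∧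
      ((∃ z : I → ℕ, (∀ r, ∑ i, a r i * z i = 0) ∧ z k ≠ 0) → h k ≠ 0) := by
    intro k
    by_cases hk : ∃ z : I → ℕ, (∀ r, ∑ i, a r i * z i = 0) ∧ z k ≠ 0
    · obtain ⟨z, hz, hzk⟩ := hk
      have key : ∀ (y : I → ℕ) (r : R), ∑ i, a r i * ((y i + if i = k then 1 else 0 : ℕ) : ℤ) =
          ∑ i, a r i * y i + a r k := by
        intro y r
        push_cast
        simp [mul_add, Finset.sum_add_distrib]
      have hzy : ∀ i, (z i - if i = k then 1 else 0) + (if i = k then 1 else 0) = z i := by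
        intro i
        by_cases h : i = k
        · subst h; simp; omega
        · simp [h]
      obtain ⟨y, -, hy, hyb⟩ := H n I R hI hR a (fun r => -a r k) ha (by simpa using fun r => ha r k)
        (fun i => z i - if i = k then 1 else 0) (fun r => by
          have h1 := key (fun i => z i - if i = k then 1 else 0) r
          simp only [hzy] at h1
          have h2 := hz r
          omega)
      refine ⟨fun i => y i + if i = k then 1 else 0, fun r => ?_, fun i => ?_, fun _ => ?_⟩
      · have := hy r
        rw [key]; omega
      · have := hyb i
        simp only
        split_ifs <;> omega
      · simp
    · exact ⟨0, by simp, by simp, fun h => absurd h hk⟩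
  choose g hg hgb hgk using small
  have hom : ∀ z : I → ℕ, (∀ r, ∑ i, a r i * z i = 0) → ∀ i, z i ≠ 0 → ∑ k, g k i ≠ 0 := by
    intro z hz i hi
    have h1 := hgk i ⟨z, hz, hi⟩
    have h2 := Finset.single_le_sum (f := fun k => g k i) (fun _ _ => Nat.zero_le _)
      (Finset.mem_univ i)
    omega
  refine ⟨fun i => ∑ k, g k i, fun r => ?_, fun i => ?_, hom, ?_⟩
  · push_cast
    simp only [Finset.mul_sum]
    rw [Finset.sum_comm]
    exact Finset.sum_eq_zero fun k _ => hg k r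
  · have : ∑ k, g k i ≤ ∑ _k : I, (Q n + 1) := Finset.sum_le_sum fun k _ => hgb k i
    rw [Finset.sum_const, Finset.card_univ, smul_eq_mul] at this
    have h2 := Nat.mul_le_mul_right (Q n + 1) hI
    change ∑ k, g k i ≤ Q n + n * (Q n + 1)
    omega
  · intro b hb z hz
    obtain ⟨z', h1, h2, h3⟩ := H n I R hI hR a b ha hb z hz
    refine ⟨z', h1, h2, fun i => (h3 i).trans (Nat.le_add_right _ _), fun i hi => ?_⟩
    by_contra hne
    refine hom (fun i => z i - z' i) (fun r => ?_) i ?_ hi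
    · have : ∀ i, ((z i - z' i : ℕ) : ℤ) = z i - z' i := fun i => Nat.cast_sub (h1 i)
      simp only [this, mul_sub, Finset.sum_sub_distrib]
      rw [hz, h2, sub_self]
    · have : z' i ≤ z i := h1 i
      omega

section

/-! ### Walks -/

section Walk
variable {σ α : Type}

/-- `l` is a walk from `s` to `t`. -/
def Walk : σ → List (σ × α × σ) → σ → Prop
  | s, [], t => s = t
  | s, e :: l, t => e.1 = s ∧ Walk e.2.2 l t

theorem Walk.append {s t r : σ} {l m : List (σ × α × σ)} (h : Walk s l t) (h' : Walk t m r) :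
    Walk s (l ++ m) r := by
  induction l generalizing s with
  | nil => cases h; exact h'
  | cons e l ih => exact ⟨h.1, ih h.2⟩

theorem walk_append {s r : σ} {l m : List (σ × α × σ)} :
    Walk s (l ++ m) r ↔ ∃ t, Walk s l t ∧ Walk t m r := by
  constructor
  · intro h
    induction l generalizing s with
    | nil => exact ⟨s, rfl, h⟩
    | cons e l ih =>
      obtain ⟨t, h1, h2⟩ := ih h.2
      exact ⟨t, ⟨h.1, h1⟩, h2⟩
  · rintro ⟨t, h1, h2⟩
    exact h1.append h2

theorem Walk.src_of_append_cons {s r : σ} {l m : List (σ × α × σ)} {e : σ × α × σ}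
    (h : Walk s (l ++ e :: m) r) : Walk s l e.1 ∧ Walk e.2.2 m r := by
  obtain ⟨t, h1, h2⟩ := walk_append.1 h
  rw [h2.1]
  exact ⟨h1, h2.2⟩

theorem Walk.boundary {s t : σ} {l : List (σ × α × σ)} (h : Walk s l t) :
    t ::ₘ (l : Multiset (σ × α × σ)).map (fun e => e.1) =
      s ::ₘ (l : Multiset (σ × α × σ)).map (fun e => e.2.2) := by
  induction l generalizing s with
  | nil => cases h; rfl
  | cons e l ih =>
    have := ih h.2
    rw [← Multiset.cons_coe, Multiset.map_cons, Multiset.map_cons, h.1, Multiset.cons_swap, this]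

/-- A walk can be shortened to one that leaves each state at most once. -/
theorem Walk.exists_nodup {s t : σ} {l : List (σ × α × σ)} (h : Walk s l t) :
    ∃ l', l' ⊆ l ∧ Walk s l' t ∧ (l'.map fun e => e.1).Nodup := by
  classical
  induction hn : l.length using Nat.strong_induction_on generalizing l with
  | _ n ih =>
    by_cases hd : (l.map fun e => e.1).Nodup
    · exact ⟨l, fun _ h => h, h, hd⟩
    · have key : ∀ l : List (σ × α × σ), ¬ (l.map fun e => e.1).Nodup →
          ∃ a e b f c, l = a ++ e :: (b ++ f :: c) ∧ e.1 = f.1 := by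
        intro l
        induction l with
        | nil => simp
        | cons e l ih =>
          intro hnd
          rw [List.map_cons, List.nodup_cons] at hnd
          by_cases hmem : e.1 ∈ l.map fun e => e.1
          · obtain ⟨f, hf, hfe⟩ := List.mem_map.1 hmem
            obtain ⟨b, c, rfl⟩ := List.append_of_mem hf
            exact ⟨[], e, b, f, c, rfl, hfe.symm⟩
          · obtain ⟨a, e', b, f, c, rfl, h'⟩ := ih (fun h => hnd ⟨hmem, h⟩)
            exact ⟨e :: a, e', b, f, c, rfl, h'⟩
      obtain ⟨a, e, b, f, c, rfl, hef⟩ := key l hd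
      obtain ⟨h1, h2⟩ := h.src_of_append_cons
      obtain ⟨h3, h4⟩ := h2.src_of_append_cons
      obtain ⟨l', hl', hw, hnd⟩ := ih (a ++ f :: c).length (by rw [← hn]; simp)
        (h1.append (show Walk e.1 (f :: c) t from ⟨hef.symm, h4⟩)) rfl
      refine ⟨l', fun x hx => ?_, hw, hnd⟩
      have := hl' hx
      simp only [List.mem_append, List.mem_cons] at this ⊢
      tauto

/-- Shortening a walk whose sources lie in a finite set. -/
theorem Walk.exists_short {s t : σ} {l : List (σ × α × σ)} (h : Walk s l t) (S : Finset σ)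
    (hS : ∀ e ∈ l, e.1 ∈ S) : ∃ l', l' ⊆ l ∧ Walk s l' t ∧ l'.length ≤ S.card := by
  classical
  obtain ⟨l', h1, h2, h3⟩ := h.exists_nodup
  refine ⟨l', h1, h2, ?_⟩
  rw [← List.length_map (f := fun e : σ × α × σ => e.1), ← List.toFinset_card_of_nodup h3]
  refine Finset.card_le_card fun x hx => ?_
  obtain ⟨e, he, rfl⟩ := List.mem_map.1 (List.mem_toFinset.1 hx)
  exact hS e (h1 he)

theorem Walk.exists_short_of_edges {s t : σ} {l : List (σ × α × σ)} (h : Walk s l t)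
    (T : Finset (σ × α × σ)) (hT : ∀ e ∈ l, e ∈ T) :
    ∃ l', l' ⊆ l ∧ Walk s l' t ∧ l'.length ≤ T.card := by
  classical
  obtain ⟨l', h1, h2, h3⟩ := h.exists_short (T.image fun e => e.1)
    (fun e he => Finset.mem_image_of_mem _ (hT e he))
  exact ⟨l', h1, h2, h3.trans Finset.card_image_le⟩

/-- A trail starting at a vertex of surplus, inside a given multiset of edges. -/
theorem exists_trail (s : σ) (t : σ) (rem : Multiset (σ × α × σ))
    (h : s ::ₘ rem.map (fun e => e.1) = t ::ₘ rem.map (fun e => e.2.2)) :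
    ∃ l : List (σ × α × σ), (l : Multiset _) ≤ rem ∧ Walk t l s := by
  classical
  induction hn : Multiset.card rem using Nat.strong_induction_on generalizing t rem with
  | _ n ih =>
    by_cases hst : t = s
    · exact ⟨[], Multiset.zero_le _, hst⟩
    · have hmem : t ∈ s ::ₘ rem.map (fun e => e.1) := by rw [h]; exact Multiset.mem_cons_self _ _
      rw [Multiset.mem_cons] at hmem
      obtain ⟨e, he, rfl⟩ := Multiset.mem_map.1 (hmem.resolve_left hst)
      obtain ⟨rem', rfl⟩ := Multiset.exists_cons_of_mem he
      rw [Multiset.map_cons, Multiset.map_cons, Multiset.cons_swap,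
        Multiset.cons_inj_right] at h
      obtain ⟨l, hl, hw⟩ := ih (Multiset.card rem') (by rw [← hn]; simp) e.2.2 rem' h rfl
      exact ⟨e :: l, by rw [← Multiset.cons_coe]; exact Multiset.cons_le_cons _ hl, rfl, hw⟩

/-- A balanced multiset of edges can be spliced into a closed walk visiting all its sources. -/
theorem exists_splice (p : σ) (ψ : Multiset (σ × α × σ)) (θ : List (σ × α × σ))
    (hψ : ψ.map (fun e => e.1) = ψ.map (fun e => e.2.2)) (hθ : Walk p θ p)
    (hvis : ∀ e ∈ ψ, ∃ f ∈ θ, f.1 = e.1) :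
    ∃ l : List (σ × α × σ), Walk p l p ∧ (l : Multiset (σ × α × σ)) = (θ : Multiset (σ × α × σ)) + ψ := by
  classical
  induction hn : Multiset.card ψ using Nat.strong_induction_on generalizing ψ θ with
  | _ n ih =>
    rcases Multiset.empty_or_exists_mem ψ with rfl | ⟨e, he⟩
    · exact ⟨θ, hθ, by simp⟩
    · obtain ⟨ψ', rfl⟩ := Multiset.exists_cons_of_mem he
      rw [Multiset.map_cons, Multiset.map_cons] at hψ
      obtain ⟨l, hl, hw⟩ := exists_trail e.1 e.2.2 ψ' hψ
      obtain ⟨ψ'', rfl⟩ := Multiset.le_iff_exists_add.1 hl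
      have hb := hw.boundary
      have hbal : ψ''.map (fun e => e.1) = ψ''.map (fun e => e.2.2) := by
        rw [Multiset.map_add, Multiset.map_add, ← Multiset.cons_add, ← Multiset.cons_add,
          ← hb] at hψ
        exact add_left_cancel hψ
      obtain ⟨f, hf, hfe⟩ := hvis e he
      obtain ⟨a, b, rfl⟩ := List.append_of_mem hf
      obtain ⟨h1, h2⟩ := hθ.src_of_append_cons
      have hfb : Walk e.1 (f :: b) p := ⟨hfe, h2⟩
      have hcl : Walk e.1 (e :: l) e.1 := ⟨rfl, hw⟩
      rw [hfe] at h1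
      obtain ⟨m, hm, hmm⟩ := ih (Multiset.card ψ'') (by rw [← hn]; simp) ψ''
        (a ++ ((e :: l) ++ f :: b)) hbal (h1.append (hcl.append hfb)) (by
          intro g hg
          obtain ⟨k, hk, hkg⟩ := hvis g (by simp [hg])
          refine ⟨k, ?_, hkg⟩
          simp only [List.mem_append, List.mem_cons] at hk ⊢
          tauto) rfl
      refine ⟨m, hm, hmm.trans ?_⟩
      simp only [← Multiset.coe_add, ← Multiset.cons_coe, ← Multiset.singleton_add]
      abel

end Walk

end

section

section Circulation
variable {σ α : Type}

theorem Walk.telescope {s t : σ} {l : List (σ × α × σ)} (h : Walk s l t) (f : σ → ℤ) :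
    (l.map fun e => f e.2.2 - f e.1).sum = f t - f s := by
  induction l generalizing s with
  | nil => cases h; simp
  | cons e l ih => rw [List.map_cons, List.sum_cons, ih h.2, h.1]; ring

variable [DecidableEq (σ × α × σ)]

theorem sum_count_mul {T : Finset (σ × α × σ)} {l : List (σ × α × σ)} (h : ∀ e ∈ l, e ∈ T)
    (g : σ × α × σ → ℤ) : ∑ e ∈ T, (l.count e : ℤ) * g e = (l.map g).sum := by
  induction l with
  | nil => simp
  | cons a l ih =>
    rw [List.map_cons, List.sum_cons, ← ih fun e he => h e (List.mem_cons_of_mem _ he)]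
    simp only [List.count_cons, beq_iff_eq]
    push_cast
    simp only [add_mul, Finset.sum_add_distrib, ite_mul, one_mul, zero_mul]
    rw [Finset.sum_ite_eq, if_pos (h a (by simp)), add_comm]

/-- `φ` is a circulation on the edges of `T` (tested against potentials). -/
def Circ (T : Finset (σ × α × σ)) (φ : σ × α × σ → ℤ) : Prop :=
  ∀ f : σ → ℤ, ∑ e ∈ T, φ e * (f e.2.2 - f e.1) = 0

omit [DecidableEq (σ × α × σ)] in
theorem circ_of_kirchhoff [DecidableEq σ] {T : Finset (σ × α × σ)} {φ : σ × α × σ → ℤ}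
    (h : ∀ e ∈ T, ∀ v, v = e.1 ∨ v = e.2.2 →
      ∑ e ∈ T, φ e * ((if e.2.2 = v then 1 else 0) - (if e.1 = v then 1 else 0)) = 0) :
    Circ T φ := by
  intro f
  set S : Finset σ := T.image (fun e => e.1) ∪ T.image (fun e => e.2.2) with hS
  have hf : ∀ e ∈ T, f e.2.2 - f e.1 =
      ∑ v ∈ S, f v * ((if e.2.2 = v then 1 else 0) - (if e.1 = v then 1 else 0)) := by
    intro e he
    have h1 : e.1 ∈ S := Finset.mem_union_left _ (Finset.mem_image_of_mem _ he)
    have h2 : e.2.2 ∈ S :=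
      Finset.mem_union_right _ (Finset.mem_image_of_mem (fun e : σ × α × σ => e.2.2) he)
    simp [mul_sub, Finset.sum_sub_distrib, h1, h2]
  rw [Finset.sum_congr rfl fun e he => by rw [hf e he]]
  simp only [Finset.mul_sum]
  rw [Finset.sum_comm]
  refine Finset.sum_eq_zero fun v hv => ?_
  have : ∃ e ∈ T, v = e.1 ∨ v = e.2.2 := by
    rcases Finset.mem_union.1 hv with hv | hv <;> obtain ⟨e, he, rfl⟩ := Finset.mem_image.1 hv
    · exact ⟨e, he, Or.inl rfl⟩
    · exact ⟨e, he, Or.inr rfl⟩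
  obtain ⟨e, he, hev⟩ := this
  have h3 := h e he v hev
  calc _ = f v * ∑ e ∈ T, φ e * ((if e.2.2 = v then 1 else 0) - (if e.1 = v then 1 else 0)) := by
        rw [Finset.mul_sum]
        exact Finset.sum_congr rfl fun e _ => by ring
    _ = 0 := by rw [h3, mul_zero]

theorem Walk.circ {s : σ} {l : List (σ × α × σ)} (h : Walk s l s) {T : Finset (σ × α × σ)}
    (hT : ∀ e ∈ l, e ∈ T) : Circ T (fun e => (l.count e : ℤ)) := by
  intro f
  rw [sum_count_mul hT (fun e => f e.2.2 - f e.1), h.telescope, sub_self]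

omit [DecidableEq (σ × α × σ)] in
theorem Circ.add {T : Finset (σ × α × σ)} {φ ψ : σ × α × σ → ℤ} (h : Circ T φ) (h' : Circ T ψ) :
    Circ T (fun e => φ e + ψ e) := by
  intro f
  simp only [add_mul, Finset.sum_add_distrib, h f, h' f, add_zero]

omit [DecidableEq (σ × α × σ)] in
theorem Circ.smul {T : Finset (σ × α × σ)} {φ : σ × α × σ → ℤ} (h : Circ T φ) (c : ℤ) :
    Circ T (fun e => c * φ e) := by
  intro f
  simp only [mul_assoc, ← Finset.mul_sum, h f, mul_zero]

omit [DecidableEq (σ × α × σ)] in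
theorem Circ.sub {T : Finset (σ × α × σ)} {φ ψ : σ × α × σ → ℤ} (h : Circ T φ) (h' : Circ T ψ) :
    Circ T (fun e => φ e - ψ e) := by
  intro f
  simp only [sub_mul, Finset.sum_sub_distrib, h f, h' f, sub_zero]

omit [DecidableEq (σ × α × σ)] in
theorem Circ.congr {T : Finset (σ × α × σ)} {φ ψ : σ × α × σ → ℤ} (h : Circ T φ)
    (h' : ∀ e ∈ T, φ e = ψ e) : Circ T ψ := by
  intro f
  rw [← h f]
  exact Finset.sum_congr rfl fun e he => by rw [h' e he]

/-- Inside a closed walk, its base point and all its edges are mutually reachable. -/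
theorem Walk.exists_to {p q : σ} {γ : List (σ × α × σ)} (h : Walk p γ q) {e : σ × α × σ}
    (he : e ∈ γ) : ∃ l, l ⊆ γ ∧ Walk p l e.1 ∧ l.length ≤ γ.toFinset.card := by
  obtain ⟨a, b, rfl⟩ := List.append_of_mem he
  obtain ⟨l, h1, h2, h3⟩ := h.src_of_append_cons.1.exists_short_of_edges
    (a ++ e :: b).toFinset (fun f hf => by simp [hf])
  exact ⟨l, fun x hx => List.mem_append_left _ (h1 hx), h2, h3⟩

theorem Walk.exists_from {p q : σ} {γ : List (σ × α × σ)} (h : Walk p γ q) {e : σ × α × σ}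
    (he : e ∈ γ) : ∃ l, l ⊆ γ ∧ Walk e.2.2 l q ∧ l.length ≤ γ.toFinset.card := by
  obtain ⟨a, b, rfl⟩ := List.append_of_mem he
  obtain ⟨l, h1, h2, h3⟩ := h.src_of_append_cons.2.exists_short_of_edges
    (a ++ e :: b).toFinset (fun f hf => by simp [hf])
  refine ⟨l, fun x hx => ?_, h2, h3⟩
  have := h1 hx
  simp [this]

/-- A short closed walk through all edges of a given closed walk. -/
theorem Walk.exists_tour {p : σ} {γ : List (σ × α × σ)} (h : Walk p γ p) :
    ∃ θ, θ ⊆ γ ∧ Walk p θ p ∧ (∀ e ∈ γ, e ∈ θ) ∧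
      θ.length ≤ γ.toFinset.card * (2 * γ.toFinset.card + 1) := by
  have key : ∀ S ⊆ γ.toFinset, ∃ θ, θ ⊆ γ ∧ Walk p θ p ∧ (∀ e ∈ S, e ∈ θ) ∧
      θ.length ≤ S.card * (2 * γ.toFinset.card + 1) := by
    intro S
    induction S using Finset.induction_on with
    | empty => exact fun _ => ⟨[], by simp, rfl, by simp, by simp⟩
    | insert e S heS ih =>
      intro hS
      obtain ⟨θ, h1, h2, h3, h4⟩ := ih ((Finset.subset_insert _ _).trans hS)
      have he : e ∈ γ := List.mem_toFinset.1 (hS (Finset.mem_insert_self _ _))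
      obtain ⟨a, ha1, ha2, ha3⟩ := h.exists_to he
      obtain ⟨b, hb1, hb2, hb3⟩ := h.exists_from he
      refine ⟨θ ++ (a ++ e :: b), ?_, h2.append (ha2.append ⟨rfl, hb2⟩), ?_, ?_⟩
      · intro f hf
        simp only [List.mem_append, List.mem_cons] at hf
        rcases hf with hf | hf | rfl | hf
        exacts [h1 hf, ha1 hf, he, hb1 hf]
      · intro f hf
        rcases Finset.mem_insert.1 hf with rfl | hf
        · simp
        · simp [h3 f hf]
      · rw [Finset.card_insert_of_notMem heS, add_mul, one_mul]
        simp only [List.length_append, List.length_cons]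
        omega
  obtain ⟨θ, h1, h2, h3, h4⟩ := key _ subset_rfl
  exact ⟨θ, h1, h2, fun e he => h3 e (by simpa using he), h4⟩

/-- Every circulation dominating a covering closed walk is the Parikh image of a closed walk. -/
theorem exists_closed_walk_of_circ {p : σ} {θ : List (σ × α × σ)} (hθ : Walk p θ p)
    {T : Finset (σ × α × σ)} (hT : ∀ e, e ∈ θ ↔ e ∈ T) (φ : σ × α × σ → ℕ)
    (hφ : Circ T (fun e => (φ e : ℤ))) (hle : ∀ e ∈ T, θ.count e ≤ φ e) :
    ∃ l, Walk p l p ∧ (∀ e ∈ l, e ∈ T) ∧ ∀ e ∈ T, l.count e = φ e := by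
  have : DecidableEq σ := Classical.decEq σ
  set ψ : Multiset (σ × α × σ) := ∑ e ∈ T, (φ e - θ.count e) • {e} with hψ
  have hcount : ∀ e ∈ T, ψ.count e = φ e - θ.count e := by
    intro e he
    rw [hψ, Multiset.count_sum']
    simp only [Multiset.count_nsmul, Multiset.count_singleton, mul_ite, mul_one,
      mul_zero]
    rw [Finset.sum_ite_eq, if_pos he]
  have hmem : ∀ e ∈ ψ, e ∈ T := by
    intro e he
    rw [hψ, Multiset.mem_sum] at he
    obtain ⟨f, hf, hef⟩ := he
    rw [Multiset.mem_singleton.1 (Multiset.mem_of_mem_nsmul hef)]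
    exact hf
  have hmap : ∀ f : σ × α × σ → σ, ∀ v, (((ψ.map f).count v : ℕ) : ℤ) =
      ∑ e ∈ T, ((φ e : ℤ) - θ.count e) * (if f e = v then 1 else 0) := by
    intro f v
    rw [hψ, ← Multiset.coe_mapAddMonoidHom, map_sum, Multiset.count_sum']
    push_cast
    refine Finset.sum_congr rfl fun e he => ?_
    rw [map_nsmul, Multiset.count_nsmul]
    simp only [Multiset.coe_mapAddMonoidHom, Multiset.map_singleton, Multiset.count_singleton]
    rw [Nat.cast_mul, Nat.cast_sub (hle e he)]
    congr 1
    split_ifs with h1 h2 h2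
    exacts [rfl, absurd h1.symm h2, absurd h2.symm h1, rfl]
  obtain ⟨l, hl, hlc⟩ := exists_splice p ψ θ (by
    ext v
    have h1 := (hφ.sub (hθ.circ (T := T) fun e he => (hT e).1 he)) (fun w => if w = v then 1 else 0)
    simp only [mul_sub, Finset.sum_sub_distrib] at h1
    have h2 := hmap (fun e => e.1) v
    have h3 := hmap (fun e => e.2.2) v
    omega) hθ (fun e he => ⟨e, (hT e).2 (hmem e he), rfl⟩)
  refine ⟨l, hl, fun e he => ?_, fun e he => ?_⟩
  · have : e ∈ (l : Multiset (σ × α × σ)) := he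
    rw [hlc, Multiset.mem_add] at this
    exact this.elim (fun h => (hT e).1 h) (hmem e)
  · have := congrArg (Multiset.count e) hlc
    rw [Multiset.count_add, hcount e he, Multiset.coe_count, Multiset.coe_count] at this
    have := hle e he
    omega

theorem length_eq_sum_count {T : Finset (σ × α × σ)} {l : List (σ × α × σ)} (h : ∀ e ∈ l, e ∈ T) :
    l.length = ∑ e ∈ T, l.count e := by
  have := sum_count_mul h (fun _ => 1)
  simp only [mul_one, List.map_const', List.sum_replicate] at this
  rw [nsmul_eq_mul, mul_one] at this
  exact_mod_cast this.symm

end Circulation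

end

section

/-! ### Transitions of Petri nets -/

/-- A Petri net transition: tokens consumed and tokens produced. -/
abbrev Tr (P : Type) : Type := (P → ℕ) × (P → ℕ)

section Legality
variable {P σ : Type}

/-- The effect of a transition on a place. -/
def Tr.eff (t : Tr P) (j : P) : ℤ := (t.2 j : ℤ) - t.1 j

/-- The effect of a sequence of transitions on a place. -/
def effC (j : P) (l : List (Tr P)) : ℤ := (l.map fun t => t.eff j).sum

/-- All entries of the transition are at most `n`. -/
def TrBd (n : ℕ) (t : Tr P) : Prop := ∀ j, t.1 j ≤ n ∧ t.2 j ≤ n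

theorem TrBd.mono {n m : ℕ} {t : Tr P} (h : TrBd n t) (hnm : n ≤ m) : TrBd m t :=
  fun j => ⟨(h j).1.trans hnm, (h j).2.trans hnm⟩

theorem TrBd.abs_eff_le {n : ℕ} {t : Tr P} (h : TrBd n t) (j : P) : |t.eff j| ≤ n := by
  have := h j
  rw [abs_le]; unfold Tr.eff; omega

/-- The sequence is executable as far as place `j` is concerned. -/
def LegC (j : P) : ℤ → List (Tr P) → Prop
  | _, [] => True
  | z, t :: l => (t.1 j : ℤ) ≤ z ∧ LegC j (z + t.eff j) l

@[simp] theorem effC_nil (j : P) : effC j [] = 0 := rfl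

@[simp] theorem effC_cons (j : P) (t : Tr P) (l : List (Tr P)) :
    effC j (t :: l) = t.eff j + effC j l := rfl

@[simp] theorem effC_append (j : P) (l m : List (Tr P)) :
    effC j (l ++ m) = effC j l + effC j m := by simp [effC]

@[simp] theorem legC_nil (j : P) (z : ℤ) : LegC j z [] := trivial

@[simp] theorem legC_cons (j : P) (z : ℤ) (t : Tr P) (l : List (Tr P)) :
    LegC j z (t :: l) ↔ (t.1 j : ℤ) ≤ z ∧ LegC j (z + t.eff j) l := Iff.rfl

theorem legC_append {j : P} {z : ℤ} {l m : List (Tr P)} :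
    LegC j z (l ++ m) ↔ LegC j z l ∧ LegC j (z + effC j l) m := by
  induction l generalizing z with
  | nil => simp
  | cons t l ih => simp [ih, and_assoc, add_assoc]

theorem LegC.mono {j : P} {z z' : ℤ} {l : List (Tr P)} (h : LegC j z l) (hz : z ≤ z') :
    LegC j z' l := by
  induction l generalizing z z' with
  | nil => trivial
  | cons t l ih => exact ⟨h.1.trans hz, ih h.2 (by omega)⟩

theorem LegC.nonneg {j : P} {z : ℤ} {l : List (Tr P)} (h : LegC j z l) (hz : 0 ≤ z) :
    0 ≤ z + effC j l := by
  induction l generalizing z with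
  | nil => simpa
  | cons t l ih =>
    have h1 := ih h.2 (by have := h.1; unfold Tr.eff; omega)
    rw [effC_cons]; omega

theorem legC_of_large {j : P} {n : ℕ} {z : ℤ} {l : List (Tr P)} (hl : ∀ t ∈ l, TrBd n t)
    (hz : (l.length : ℤ) * n ≤ z) : LegC j z l := by
  induction l generalizing z with
  | nil => trivial
  | cons t l ih =>
    have ht := hl t (by simp) j
    rw [List.length_cons] at hz
    push_cast at hz
    have h0 : (0 : ℤ) ≤ (l.length : ℤ) * n := by positivity
    have h1 : ((l.length : ℤ) + 1) * n = l.length * n + n := by ring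
    refine ⟨by omega, ih (fun t ht => hl t (by simp [ht])) ?_⟩
    unfold Tr.eff; omega

theorem abs_effC_le {j : P} {n : ℕ} {l : List (Tr P)} (hl : ∀ t ∈ l, TrBd n t) :
    |effC j l| ≤ (l.length * n : ℕ) := by
  induction l with
  | nil => simp
  | cons t l ih =>
    have h1 := ih fun t ht => hl t (by simp [ht])
    have h2 := (hl t (by simp)).abs_eff_le j
    rw [effC_cons, List.length_cons, add_mul, one_mul]
    push_cast at *
    rw [abs_le] at *
    omega

theorem effC_reverse (j : P) (l : List (Tr P)) :
    effC j (l.map Prod.swap).reverse = -effC j l := by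
  induction l with
  | nil => simp
  | cons t l ih => simp [ih, Tr.eff]

theorem legC_reverse {j : P} {z : ℤ} {l : List (Tr P)} (h : LegC j z l) :
    LegC j (z + effC j l) (l.map Prod.swap).reverse := by
  induction l generalizing z with
  | nil => trivial
  | cons t l ih =>
    rw [List.map_cons, List.reverse_cons, legC_append]
    constructor
    · have := ih h.2
      rwa [effC_cons, ← add_assoc]
    · rw [effC_reverse]
      have := h.1
      simp [Tr.eff]
      omega

/-- The labels of a list of edges. -/
def lab {α : Type} (l : List (σ × α × σ)) : List α := l.map fun e => e.2.1

@[simp] theorem lab_nil {α : Type} : lab ([] : List (σ × α × σ)) = [] := rfl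
@[simp] theorem lab_cons {α : Type} (e : σ × α × σ) (l) : lab (e :: l) = e.2.1 :: lab l := rfl
@[simp] theorem lab_append {α : Type} (l m : List (σ × α × σ)) :
    lab (l ++ m) = lab l ++ lab m := by simp [lab]
@[simp] theorem length_lab {α : Type} (l : List (σ × α × σ)) : (lab l).length = l.length := by
  simp [lab]

theorem mem_lab {α : Type} {l : List (σ × α × σ)} {t : α} : t ∈ lab l ↔ ∃ e ∈ l, e.2.1 = t := by
  simp [lab]

theorem effC_lab (j : P) (l : List (σ × Tr P × σ)) :
    effC j (lab l) = (l.map fun e => e.2.1.eff j).sum := by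
  simp [effC, lab, Function.comp_def]

/-- Tracking a value along a walk. -/
def enrich {ν α : Type} (upd : ν → α → ν) :
    ν → List (σ × α × σ) → List ((σ × ν) × α × (σ × ν))
  | _, [] => []
  | v, e :: l => ((e.1, v), e.2.1, (e.2.2, upd v e.2.1)) :: enrich upd (upd v e.2.1) l

theorem lab_enrich {ν α : Type} (upd : ν → α → ν) (v : ν) (l : List (σ × α × σ)) :
    lab (enrich upd v l) = lab l := by
  induction l generalizing v with
  | nil => rfl
  | cons e l ih => simp [enrich, ih]

theorem Walk.enrich {ν α : Type} (upd : ν → α → ν) {v : ν} {s t : σ} {l : List (σ × α × σ)}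
    (h : Walk s l t) : Walk (s, v) (enrich upd v l) (t, (lab l).foldl upd v) := by
  induction l generalizing v s with
  | nil => cases h; rfl
  | cons e l ih => exact ⟨by rw [h.1], ih h.2⟩

theorem mem_enrich {ν α : Type} {upd : ν → α → ν} {v : ν} {l : List (σ × α × σ)}
    {f : (σ × ν) × α × (σ × ν)} (h : f ∈ CBL.enrich upd v l) :
    ∃ a e b, l = a ++ e :: b ∧ f = ((e.1, (lab a).foldl upd v), e.2.1,
      (e.2.2, upd ((lab a).foldl upd v) e.2.1)) := by
  induction l generalizing v with
  | nil => simp [CBL.enrich] at h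
  | cons e l ih =>
    rw [CBL.enrich, List.mem_cons] at h
    rcases h with rfl | h
    · exact ⟨[], e, l, rfl, rfl⟩
    · obtain ⟨a, e', b, rfl, rfl⟩ := ih h
      exact ⟨e :: a, e', b, rfl, rfl⟩

theorem Walk.map {σ' α : Type} (f : σ → σ') {s t : σ} {l : List (σ × α × σ)} (h : Walk s l t) :
    Walk (f s) (l.map fun e => (f e.1, e.2.1, f e.2.2)) (f t) := by
  induction l generalizing s with
  | nil => cases h; rfl
  | cons e l ih => exact ⟨congrArg f h.1, ih h.2⟩

theorem lab_map {σ' α : Type} (f : σ → σ') (l : List (σ × α × σ)) :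
    lab (l.map fun e => (f e.1, e.2.1, f e.2.2)) = lab l := by
  simp [lab]

theorem foldl_eff {J : Type} (g : J → P) (v : J → ℤ) (l : List (Tr P)) :
    l.foldl (fun v t j => v j + t.eff (g j)) v = fun j => v j + effC (g j) l := by
  induction l generalizing v with
  | nil => simp
  | cons t l ih => rw [List.foldl_cons, ih]; ext j; simp [add_assoc]

end Legality

/-- Splitting a list at the first prefix satisfying a property. -/
theorem exists_first_split {β : Type} (Q : List β → Prop) (l : List β) :
    (∀ a b, l = a ++ b → ¬ Q a) ∨
      ∃ a b, l = a ++ b ∧ Q a ∧ ∀ c d, a = c ++ d → d ≠ [] → ¬ Q c := by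
  classical
  by_cases h : ∃ k, Q (l.take k)
  · right
    refine ⟨l.take (Nat.find h), l.drop (Nat.find h), (List.take_append_drop _ _).symm,
      Nat.find_spec h, ?_⟩
    intro c d hcd hd hQ
    have hlt : c.length < Nat.find h := by
      have h1 := congrArg List.length hcd
      have h2 := List.length_pos_of_ne_nil hd
      rw [List.length_append, List.length_take] at h1
      omega
    refine Nat.find_min h hlt ?_
    have : l.take c.length = c := by
      conv_lhs => rw [← List.take_append_drop (Nat.find h) l, hcd, List.append_assoc]
      simp
    rwa [this]
  · left
    intro a b hab hQ
    exact h ⟨a.length, by rw [hab]; simpa using hQ⟩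

end

section

section Coverability
variable {P σ : Type}

/-- Length and width bounds for the coverability dichotomy. -/
def covBound (b n : ℕ) : ℕ → ℕ
  | 0 => 0
  | q + 1 => n * (b + covBound b n q * n + 1) ^ n + covBound b n q + (b + covBound b n q * n) + n

theorem covBound_mono (b n : ℕ) : Monotone (covBound b n) :=
  monotone_nat_of_le_succ fun q => by rw [covBound]; omega

theorem walk_of_tracked {J : Type} (g : J → P) {l' : List ((σ × (J → ℤ)) × Tr P × (σ × (J → ℤ)))}
    (h : ∀ f ∈ l', (∀ j, (f.2.1.1 (g j) : ℤ) ≤ f.1.2 j) ∧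
      ∀ j, f.2.2.2 j = f.1.2 j + f.2.1.eff (g j))
    {s t : σ × (J → ℤ)} (hw : Walk s l' t) (j : J) :
    LegC (g j) (s.2 j) (lab l') ∧ t.2 j = s.2 j + effC (g j) (lab l') := by
  induction l' generalizing s with
  | nil => cases hw; simp
  | cons f l' ih =>
    obtain ⟨rfl, hw⟩ := hw
    obtain ⟨h1, h2⟩ := ih (fun f hf => h f (by simp [hf])) hw
    have h3 := h f (by simp)
    rw [h3.2 j] at h1 h2
    exact ⟨⟨h3.1 j, h1⟩, by rw [h2, lab_cons, effC_cons]; ring⟩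

/-- Either all tracked places can be made large by a short walk, or the given walk is a
concatenation of few phases during each of which some tracked place stays in a bounded range. -/
theorem coverability_dichotomy (b n : ℕ) (T : Finset (σ × Tr P × σ)) (hT : T.card ≤ n)
    (q : ℕ) : ∀ (J : Finset P), J.card = q → q ≤ n → ∀ (s t : σ) (l : List (σ × Tr P × σ))
    (z : P → ℤ), Walk s l t → (∀ e ∈ l, e ∈ T) → (∀ e ∈ T, TrBd n e.2.1) → (∀ j ∈ J, 0 ≤ z j) →
    (∀ j ∈ J, LegC j (z j) (lab l)) →
    (∃ l' s', (∀ e ∈ l', e ∈ l) ∧ Walk s l' s' ∧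
      (∀ j ∈ J, LegC j (z j) (lab l') ∧ (b : ℤ) ≤ z j + effC j (lab l')) ∧
      l'.length ≤ covBound b n q) ∨
    (∃ L : List (List (σ × Tr P × σ)), L.length ≤ q ∧ L.flatten = l ∧ ∀ m ∈ L, ∃ j ∈ J,
      ∀ c d e, m = c ++ d ++ e → |effC j (lab d)| ≤ covBound b n q) := by
  classical
  induction q with
  | zero =>
    intro J hJ _ s t l z _ _ _ _ _
    rw [Finset.card_eq_zero] at hJ
    subst hJ
    exact Or.inl ⟨[], s, by simp, rfl, by simp, by simp⟩
  | succ q ih =>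
    intro J hJ hq s t l z hw hlT hbd hz hleg
    set B := b + covBound b n q * n with hB
    have hBle : B + n ≤ covBound b n (q + 1) := by rw [covBound]; omega
    have hval : ∀ j ∈ J, ∀ a c, l = a ++ c → 0 ≤ z j + effC j (lab a) := by
      intro j hj a c hac
      have := hleg j hj
      rw [hac, lab_append, legC_append] at this
      exact this.1.nonneg (hz j hj)
    rcases exists_first_split (fun a => ∃ j ∈ J, (B : ℤ) ≤ z j + effC j (lab a)) l with
      hnone | ⟨l1, l2, rfl, ⟨j, hj, hjB⟩, hfirst⟩
    · right
      obtain ⟨j, hj⟩ := Finset.card_pos.1 (by omega : 0 < J.card)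
      refine ⟨[l], by simp, by simp, fun m hm => ⟨j, hj, ?_⟩⟩
      rw [List.mem_singleton] at hm
      subst hm
      intro c d e hcd
      have h1 := hnone (c ++ d) e hcd
      have h2 := hnone c (d ++ e) (by rw [hcd]; simp)
      push Not at h1 h2
      have h1 := h1 j hj
      have h2 := h2 j hj
      have h3 := hval j hj (c ++ d) e hcd
      have h4 := hval j hj c (d ++ e) (by rw [hcd]; simp)
      rw [lab_append, effC_append] at h1 h3
      rw [abs_le]
      omega
    · obtain ⟨s1, hw1, hw2⟩ := walk_append.1 hw
      have hz1 : ∀ j' ∈ J, 0 ≤ z j' + effC j' (lab l1) := fun j' hj' => hval j' hj' l1 l2 rfl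
      rcases ih (J.erase j) (by rw [Finset.card_erase_of_mem hj, hJ]; rfl) (by omega) s1 t l2
        (fun j' => z j' + effC j' (lab l1)) hw2 (fun e he => hlT e (by simp [he])) hbd
        (fun j' hj' => hz1 j' (Finset.mem_of_mem_erase hj'))
        (fun j' hj' => by
          have := hleg j' (Finset.mem_of_mem_erase hj')
          rw [lab_append, legC_append] at this
          exact this.2) with ⟨l2', s', hl2, hw2', hcov, hlen⟩ | ⟨L, hL1, hL2, hL3⟩
      · left
        have htr := hw1.enrich (fun (v : J → ℤ) t j => v j + t.eff j.1) (v := fun j => z j.1)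
        rw [foldl_eff (fun j : J => j.1)] at htr
        obtain ⟨m, hm1, hm2, hm3⟩ := htr.exists_short
          (T.image (fun e => e.1) ×ˢ Fintype.piFinset (fun _ => Finset.Ico (0 : ℤ) B)) (by
            intro f hf
            obtain ⟨a, e, c, hac, rfl⟩ := mem_enrich hf
            rw [foldl_eff (fun j : J => j.1), Finset.mem_product, Fintype.mem_piFinset]
            refine ⟨Finset.mem_image_of_mem _ (hlT e (by simp [hac])), fun j' => ?_⟩
            have h1 := hval j'.1 j'.2 a (e :: c ++ l2) (by rw [hac]; simp)
            have h2 := hfirst a (e :: c) hac (by simp)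
            push Not at h2
            exact Finset.mem_Ico.2 ⟨h1, h2 j'.1 j'.2⟩)
        have htrack : ∀ j' ∈ J, LegC j' (z j') (lab m) ∧
            z j' + effC j' (lab l1) = z j' + effC j' (lab m) := by
          intro j' hj'
          refine walk_of_tracked (fun j : J => j.1) ?_ hm2 ⟨j', hj'⟩
          intro f hf
          obtain ⟨a, e, c, hac, rfl⟩ := mem_enrich (hm1 hf)
          rw [foldl_eff (fun j : J => j.1)]
          refine ⟨fun i => ?_, fun i => rfl⟩
          have := hleg i.1 i.2
          rw [hac, List.append_assoc, lab_append, legC_append, List.cons_append, lab_cons,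
            legC_cons] at this
          exact this.2.1
        have hmE : ∀ f ∈ m, ((f.1.1, f.2.1, f.2.2.1) : σ × Tr P × σ) ∈ l1 := by
          intro f hf
          obtain ⟨a, e, c, hac, rfl⟩ := mem_enrich (hm1 hf)
          rw [hac]
          exact List.mem_append_right _ (List.mem_cons_self)
        have hmw := hm2.map Prod.fst
        refine ⟨(m.map fun e => (e.1.1, e.2.1, e.2.2.1)) ++ l2', s', ?_, hmw.append hw2', ?_, ?_⟩
        · intro e he
          rcases List.mem_append.1 he with he | he
          · obtain ⟨f, hf, rfl⟩ := List.mem_map.1 he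
            exact List.mem_append_left _ (hmE f hf)
          · exact List.mem_append_right _ (hl2 e he)
        · intro j' hj'
          have hlm : lab (m.map fun e => ((e.1.1, e.2.1, e.2.2.1) : σ × Tr P × σ)) = lab m :=
            lab_map Prod.fst m
          rw [lab_append, hlm, legC_append, effC_append, ← add_assoc, ← (htrack j' hj').2]
          by_cases hjj : j' = j
          · subst hjj
            have hb2 : ∀ t ∈ lab l2', TrBd n t := by
              intro t ht
              obtain ⟨e, he, rfl⟩ := mem_lab.1 ht
              exact hbd e (hlT e (by simp [hl2 e he]))
            have h1 : (l2'.length * n : ℕ) ≤ covBound b n q * n := Nat.mul_le_mul_right n hlen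
            have h2 := abs_effC_le (j := j') hb2
            rw [length_lab, abs_le] at h2
            refine ⟨⟨(htrack j' hj').1, legC_of_large hb2 ?_⟩, ?_⟩
            · rw [length_lab]
              have : ((l2'.length * n : ℕ) : ℤ) = (l2'.length : ℤ) * n := by push_cast; rfl
              omega
            · omega
          · have := hcov j' (Finset.mem_erase.2 ⟨hjj, hj'⟩)
            exact ⟨⟨(htrack j' hj').1, this.1⟩, this.2⟩
        · rw [List.length_append, List.length_map, covBound]
          rw [Finset.card_product, Fintype.card_piFinset] at hm3
          simp only [Int.card_Ico, sub_zero, Int.toNat_natCast, Finset.prod_const, Finset.card_univ,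
            Fintype.card_coe] at hm3
          have h1 : (T.image fun e => e.1).card * B ^ J.card ≤ n * (B + 1) ^ n := by
            refine Nat.mul_le_mul (Finset.card_image_le.trans hT) ?_
            exact (Nat.pow_le_pow_left (by omega) _).trans
              (Nat.pow_le_pow_right (by omega) (by omega))
          rw [← hB]
          omega
      · right
        refine ⟨l1 :: L, by simp; omega, by simp [hL2], ?_⟩
        intro m hm
        rcases List.mem_cons.1 hm with rfl | hm
        · refine ⟨j, hj, fun c d e hcd => ?_⟩
          rcases List.eq_nil_or_concat d with rfl | ⟨d', e', rfl⟩
          · simp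
          · rw [List.concat_eq_append] at hcd ⊢
            have h1 := hfirst (c ++ d') (e' :: e) (by rw [hcd]; simp) (by simp)
            have h2 := hfirst c (d' ++ e' :: e) (by rw [hcd]; simp) (by simp)
            push Not at h1 h2
            have h1 := h1 j hj
            have h2 := h2 j hj
            have h3 := (hbd e' (hlT e' (by rw [hcd]; simp))).abs_eff_le j
            have h4 := hval j hj c (d' ++ e' :: e ++ l2) (by rw [hcd]; simp)
            have h5 := hval j hj (c ++ d' ++ [e']) (e ++ l2) (by rw [hcd]; simp)
            rw [abs_le] at h3 ⊢
            simp only [lab_append, effC_append, lab_cons, effC_cons, lab_nil, effC_nil] at *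
            omega
        · obtain ⟨j', hj', h⟩ := hL3 m hm
          exact ⟨j', Finset.mem_of_mem_erase hj', fun c d e hcd =>
            (h c d e hcd).trans (by exact_mod_cast covBound_mono b n (Nat.le_succ q))⟩

end Coverability

end

section

section Cycles
variable {P σ : Type}

/-- The rational space spanned by the effects of the nonnegative circulations on `T`. -/
noncomputable def cycleSpace (T : Finset (σ × Tr P × σ)) : Submodule ℚ (P → ℚ) :=
  Submodule.span ℚ {w | ∃ φ : σ × Tr P × σ → ℕ, Circ T (fun e => (φ e : ℤ)) ∧
    ∀ j, w j = ((∑ e ∈ T, (φ e : ℤ) * e.2.1.eff j : ℤ) : ℚ)}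

theorem mem_cycleSpace {T : Finset (σ × Tr P × σ)} {w : P → ℚ} (hw : w ∈ cycleSpace T) :
    ∃ (D : ℕ) (φ ψ : σ × Tr P × σ → ℕ), 0 < D ∧ Circ T (fun e => (φ e : ℤ)) ∧
      Circ T (fun e => (ψ e : ℤ)) ∧ ∀ j, (D : ℚ) * w j =
        ((∑ e ∈ T, ((φ e : ℤ) - ψ e) * e.2.1.eff j : ℤ) : ℚ) := by
  have natmul : ∀ (φ : σ × Tr P × σ → ℕ) (k : ℕ), Circ T (fun e => (φ e : ℤ)) →
      Circ T (fun e => ((k * φ e : ℕ) : ℤ)) := fun φ k h => (h.smul k).congr fun e _ => by push_cast; rfl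
  have natadd : ∀ (φ ψ : σ × Tr P × σ → ℕ), Circ T (fun e => (φ e : ℤ)) →
      Circ T (fun e => (ψ e : ℤ)) → Circ T (fun e => ((φ e + ψ e : ℕ) : ℤ)) :=
    fun φ ψ h h' => (h.add h').congr fun e _ => by push_cast; rfl
  have zero : Circ T (fun e => (((fun _ => 0 : σ × Tr P × σ → ℕ) e : ℕ) : ℤ)) := by
    intro f; simp
  induction hw using Submodule.span_induction with
  | mem w hw =>
    obtain ⟨φ, h1, h2⟩ := hw
    exact ⟨1, φ, fun _ => 0, one_pos, h1, zero, fun j => by simp [h2 j]⟩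
  | zero => exact ⟨1, fun _ => 0, fun _ => 0, one_pos, zero, zero, by simp⟩
  | add w w' _ _ ih ih' =>
    obtain ⟨D, φ, ψ, h1, h2, h3, h4⟩ := ih
    obtain ⟨D', φ', ψ', h1', h2', h3', h4'⟩ := ih'
    refine ⟨D * D', fun e => D' * φ e + D * φ' e, fun e => D' * ψ e + D * ψ' e, by positivity,
      natadd _ _ (natmul φ D' h2) (natmul φ' D h2'), natadd _ _ (natmul ψ D' h3) (natmul ψ' D h3'),
      fun j => ?_⟩
    have : (∑ e ∈ T, (((D' * φ e + D * φ' e : ℕ) : ℤ) - ((D' * ψ e + D * ψ' e : ℕ) : ℤ)) *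
        e.2.1.eff j) = D' * (∑ e ∈ T, ((φ e : ℤ) - ψ e) * e.2.1.eff j) +
          D * (∑ e ∈ T, ((φ' e : ℤ) - ψ' e) * e.2.1.eff j) := by
      rw [Finset.mul_sum, Finset.mul_sum, ← Finset.sum_add_distrib]
      refine Finset.sum_congr rfl fun e _ => ?_
      push_cast; ring
    rw [this]
    push_cast [Pi.add_apply]
    have e1 := h4 j
    have e2 := h4' j
    push_cast at e1 e2
    rw [← e1, ← e2]; ring
  | smul r w _ ih =>
    obtain ⟨D, φ, ψ, h1, h2, h3, h4⟩ := ih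
    have hr : (r.den : ℚ) * r = r.num := by rw [mul_comm]; exact Rat.mul_den_eq_num r
    rcases le_total 0 r.num with hn | hn
    · obtain ⟨k, hk⟩ := Int.eq_ofNat_of_zero_le hn
      refine ⟨D * r.den, fun e => k * φ e, fun e => k * ψ e, Nat.mul_pos h1 r.den_pos, natmul _ _ h2,
        natmul _ _ h3, fun j => ?_⟩
      have : (∑ e ∈ T, (((k * φ e : ℕ) : ℤ) - ((k * ψ e : ℕ) : ℤ)) * e.2.1.eff j) =
          k * (∑ e ∈ T, ((φ e : ℤ) - ψ e) * e.2.1.eff j) := by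
        rw [Finset.mul_sum]
        refine Finset.sum_congr rfl fun e _ => ?_
        push_cast; ring
      rw [this]
      have e1 := h4 j
      push_cast [Pi.smul_apply, smul_eq_mul] at e1 ⊢
      rw [← e1]
      have : (r.den : ℚ) * r = k := by rw [hr, hk]; simp
      rw [← this]; ring
    · obtain ⟨k, hk⟩ := Int.eq_ofNat_of_zero_le (neg_nonneg.2 hn)
      refine ⟨D * r.den, fun e => k * ψ e, fun e => k * φ e, Nat.mul_pos h1 r.den_pos, natmul _ _ h3,
        natmul _ _ h2, fun j => ?_⟩
      have : (∑ e ∈ T, (((k * ψ e : ℕ) : ℤ) - ((k * φ e : ℕ) : ℤ)) * e.2.1.eff j) =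
          -k * (∑ e ∈ T, ((φ e : ℤ) - ψ e) * e.2.1.eff j) := by
        rw [Finset.mul_sum]
        refine Finset.sum_congr rfl fun e _ => ?_
        push_cast; ring
      rw [this]
      have e1 := h4 j
      push_cast [Pi.smul_apply, smul_eq_mul] at e1 ⊢
      rw [← e1]
      have : (r.den : ℚ) * r = -k := by
        rw [hr]
        have : r.num = -k := by omega
        rw [this]; simp
      have h5 : (-k : ℚ) = (r.den : ℚ) * r := this.symm
      rw [h5]; ring

theorem cycleSpace_le_of_proj {σ' : Type} {T : Finset (σ × Tr P × σ)}
    {T' : Finset (σ' × Tr P × σ')} (f : σ' → σ)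
    (h : ∀ e ∈ T', (f e.1, e.2.1, f e.2.2) ∈ T) : cycleSpace T' ≤ cycleSpace T := by
  classical
  refine Submodule.span_le.2 ?_
  rintro w ⟨φ, h1, h2⟩
  refine Submodule.subset_span ⟨fun e => ∑ e' ∈ T' with (f e'.1, e'.2.1, f e'.2.2) = e, φ e', ?_, ?_⟩
  · intro g
    rw [← h1 (fun s => g (f s)), ← Finset.sum_fiberwise_of_maps_to h]
    refine Finset.sum_congr rfl fun e _ => ?_
    push_cast
    rw [Finset.sum_mul]
    refine Finset.sum_congr rfl fun e' he' => ?_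
    rw [← (Finset.mem_filter.1 he').2]
  · intro j
    rw [h2, ← Finset.sum_fiberwise_of_maps_to h]
    congr 1
    refine Finset.sum_congr rfl fun e _ => ?_
    push_cast
    rw [Finset.sum_mul]
    refine Finset.sum_congr rfl fun e' he' => ?_
    rw [← (Finset.mem_filter.1 he').2]

theorem cycleSpace_mono {T T' : Finset (σ × Tr P × σ)} (h : T' ⊆ T) :
    cycleSpace T' ≤ cycleSpace T :=
  cycleSpace_le_of_proj id fun _ he => h he

theorem cycleSpace_apply_eq_zero {T : Finset (σ × Tr P × σ)} (val : σ → ℤ) (j : P)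
    (h : ∀ e ∈ T, val e.2.2 = val e.1 + e.2.1.eff j) {w : P → ℚ} (hw : w ∈ cycleSpace T) :
    w j = 0 := by
  induction hw using Submodule.span_induction with
  | mem w hw =>
    obtain ⟨φ, h1, h2⟩ := hw
    have h3 : ∑ e ∈ T, (φ e : ℤ) * e.2.1.eff j = ∑ e ∈ T, (φ e : ℤ) * (val e.2.2 - val e.1) :=
      Finset.sum_congr rfl fun e he => by rw [h e he]; ring
    have : ∑ e ∈ T, (φ e : ℤ) * e.2.1.eff j = 0 := h3.trans (h1 val)
    rw [h2]
    exact_mod_cast this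
  | zero => rfl
  | add w w' _ _ h h' => simp [h, h']
  | smul r w _ h => simp [h]

theorem mem_cycleSpace_of_circ {T : Finset (σ × Tr P × σ)} {φ : σ × Tr P × σ → ℕ}
    (h : Circ T (fun e => (φ e : ℤ))) :
    (fun j => ((∑ e ∈ T, (φ e : ℤ) * e.2.1.eff j : ℤ) : ℚ)) ∈ cycleSpace T :=
  Submodule.subset_span ⟨φ, h, fun _ => rfl⟩

/-- A place is flat for `T` when no cycle changes it. -/
def Flat (T : Finset (σ × Tr P × σ)) (j : P) : Prop := ∀ w ∈ cycleSpace T, w j = 0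

theorem Flat.circ {T : Finset (σ × Tr P × σ)} {j : P} (h : Flat T j) {φ : σ × Tr P × σ → ℕ}
    (hφ : Circ T (fun e => (φ e : ℤ))) : ∑ e ∈ T, (φ e : ℤ) * e.2.1.eff j = 0 := by
  have := h _ (mem_cycleSpace_of_circ hφ)
  exact_mod_cast this

theorem Flat.walk [DecidableEq (σ × Tr P × σ)] {T : Finset (σ × Tr P × σ)} {j : P} (h : Flat T j)
    {s : σ} {l : List (σ × Tr P × σ)} (hl : Walk s l s) (hT : ∀ e ∈ l, e ∈ T) :
    effC j (lab l) = 0 := by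
  rw [effC_lab, ← sum_count_mul hT]
  exact h.circ (hl.circ hT)

end Cycles

end

section

section Marks
variable {P σ : Type} [Fintype P]

/-- Circulations `φ i` on `T i` and marks `u i` linked by the balance equations, with prescribed
values on `S`. -/
structure MarkSol (k : ℕ) (T : ℕ → Finset (σ × Tr P × σ)) (S : ℕ → P → Prop) (δ c : ℕ → P → ℤ)
    (φ : ℕ → σ × Tr P × σ → ℕ) (u : ℕ → P → ℕ) : Prop where
  circ : ∀ i < k, Circ (T i) (fun e => (φ i e : ℤ))
  bal : ∀ i < k, ∀ j, (u (i + 1) j : ℤ) =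
    u i j + ∑ e ∈ T i, (φ i e : ℤ) * e.2.1.eff j + δ i j
  spec : ∀ i ≤ k, ∀ j, S i j → (u i j : ℤ) = c i j

/-- The variables of the system of marks. -/
abbrev MarkVar (k : ℕ) (T : ℕ → Finset (σ × Tr P × σ)) : Type :=
  (Σ i : Fin k, {e // e ∈ T i}) ⊕ (Fin (k + 1) × P)

/-- The equations of the system of marks. -/
abbrev MarkRow (k : ℕ) (T : ℕ → Finset (σ × Tr P × σ)) : Type :=
  ((Σ i : Fin k, {e // e ∈ T i}) × Bool) ⊕ ((Fin k × P) ⊕ (Fin (k + 1) × P))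

open Classical in
/-- The coefficients of the system of marks. -/
noncomputable def markCoeff (k : ℕ) (T : ℕ → Finset (σ × Tr P × σ)) (S : ℕ → P → Prop) :
    MarkRow k T → MarkVar k T → ℤ
  | .inl (⟨i, e⟩, b), .inl ⟨i', e'⟩ => if i' = i then
      (if e'.1.2.2 = (if b then e.1.1 else e.1.2.2) then 1 else 0) -
        (if e'.1.1 = (if b then e.1.1 else e.1.2.2) then 1 else 0) else 0
  | .inl _, .inr _ => 0
  | .inr (.inl (i, j)), .inl ⟨i', e'⟩ => if i' = i then -e'.1.2.1.eff j else 0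
  | .inr (.inl (i, j)), .inr (i', j') => if j' = j then
      (if i' = i.succ then 1 else 0) - (if i' = i.castSucc then 1 else 0) else 0
  | .inr (.inr _), .inl _ => 0
  | .inr (.inr (i, j)), .inr v => if S i j ∧ v = (i, j) then 1 else 0

open Classical in
/-- The right-hand side of the system of marks. -/
noncomputable def markRhs (k : ℕ) (T : ℕ → Finset (σ × Tr P × σ)) (S : ℕ → P → Prop)
    (δ c : ℕ → P → ℤ) : MarkRow k T → ℤ
  | .inl _ => 0
  | .inr (.inl (i, j)) => δ i j
  | .inr (.inr (i, j)) => if S i j then c i j else 0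

theorem markSys_iff (k : ℕ) (T : ℕ → Finset (σ × Tr P × σ)) (S : ℕ → P → Prop)
    (δ c : ℕ → P → ℤ) (φ : ℕ → σ × Tr P × σ → ℕ) (u : ℕ → P → ℕ) (z : MarkVar k T → ℕ)
    (hz : z = Sum.elim (fun v => φ v.1 v.2) (fun v => u v.1 v.2)) :
    (∀ r, ∑ v, markCoeff k T S r v * z v = markRhs k T S δ c r) ↔ MarkSol k T S δ c φ u := by
  classical
  subst hz
  have h1 : ∀ (i : Fin k) (e : {e // e ∈ T i}) (b : Bool),
      (∑ v, markCoeff k T S (.inl (⟨i, e⟩, b)) v *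
        (Sum.elim (fun v => φ v.1 v.2) (fun v => u v.1 v.2) v : ℕ) : ℤ) =
      ∑ e' ∈ T i, (φ i e' : ℤ) * ((if e'.2.2 = (if b then e.1.1 else e.1.2.2) then 1 else 0) -
        (if e'.1 = (if b then e.1.1 else e.1.2.2) then 1 else 0)) := by
    intro i e b
    rw [Fintype.sum_sum_type, Fintype.sum_sigma]
    simp only [markCoeff, Sum.elim_inl, zero_mul, Finset.sum_const_zero,
      add_zero]
    rw [Finset.sum_eq_single i]
    · rw [← Finset.sum_coe_sort (T i)]
      exact Finset.sum_congr rfl fun e' _ => by rw [if_pos rfl, mul_comm]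
    · intro i' _ hi
      simp [hi]
    · simp
  have h2 : ∀ (i : Fin k) (j : P),
      (∑ v, markCoeff k T S (.inr (.inl (i, j))) v *
        (Sum.elim (fun v => φ v.1 v.2) (fun v => u v.1 v.2) v : ℕ) : ℤ) =
      u (i + 1) j - u i j - ∑ e ∈ T i, (φ i e : ℤ) * e.2.1.eff j := by
    intro i j
    rw [Fintype.sum_sum_type, Fintype.sum_sigma, Fintype.sum_prod_type]
    simp only [markCoeff, Sum.elim_inl, Sum.elim_inr]
    rw [Finset.sum_eq_single i]
    · have e1 : ∑ e' : {e // e ∈ T i}, (if i = i then -e'.1.2.1.eff j else 0) * (φ i e' : ℤ) =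
          -∑ e ∈ T i, (φ i e : ℤ) * e.2.1.eff j := by
        rw [← Finset.sum_coe_sort (T i), ← Finset.sum_neg_distrib]
        exact Finset.sum_congr rfl fun e' _ => by rw [if_pos rfl]; ring
      rw [e1]
      have e2 : ∀ i' : Fin (k + 1), ∑ j', (if j' = j then (if i' = i.succ then (1 : ℤ) else 0) -
          (if i' = i.castSucc then 1 else 0) else 0) * (u i' j' : ℤ) =
          (if i' = i.succ then (u i' j : ℤ) else 0) - (if i' = i.castSucc then (u i' j : ℤ) else 0) := by
        intro i'
        rw [Finset.sum_eq_single j]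
        · rw [if_pos rfl, sub_mul]; simp
        · intro j' _ hj; simp [hj]
        · simp
      rw [Finset.sum_congr rfl fun i' _ => e2 i']
      simp
      ring
    · intro i' _ hi
      simp [hi]
    · simp
  have h3 : ∀ (i : Fin (k + 1)) (j : P),
      (∑ v, markCoeff k T S (.inr (.inr (i, j))) v *
        (Sum.elim (fun v => φ v.1 v.2) (fun v => u v.1 v.2) v : ℕ) : ℤ) =
      if S i j then (u i j : ℤ) else 0 := by
    intro i j
    rw [Fintype.sum_sum_type]
    simp only [markCoeff, Sum.elim_inr, zero_mul, Finset.sum_const_zero, zero_add]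
    rw [Finset.sum_eq_single (i, j)]
    · by_cases h : S i j <;> simp [h]
    · intro v _ hv; simp [hv]
    · simp
  constructor
  · intro H
    refine ⟨fun i hi => circ_of_kirchhoff fun e he v hv => ?_, fun i hi j => ?_, fun i hi j hS => ?_⟩
    · rcases hv with rfl | rfl
      · have := H (.inl (⟨⟨i, hi⟩, ⟨e, he⟩⟩, true))
        rw [h1] at this
        simpa [markRhs] using this
      · have := H (.inl (⟨⟨i, hi⟩, ⟨e, he⟩⟩, false))
        rw [h1] at this
        simpa [markRhs] using this
    · have := H (.inr (.inl (⟨i, hi⟩, j)))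
      rw [h2] at this
      simp only [markRhs] at this
      linarith
    · have := H (.inr (.inr (⟨i, by omega⟩, j)))
      rw [h3] at this
      simpa [markRhs, hS] using this
  · rintro ⟨H1, H2, H3⟩ (⟨⟨i, e⟩, b⟩ | ⟨i, j⟩ | ⟨i, j⟩)
    · rw [h1]
      set v := if b then e.1.1 else e.1.2.2
      have := H1 i i.2 (fun s => if s = v then 1 else 0)
      simpa [markRhs] using this
    · rw [h2, H2 i i.2 j]
      simp only [markRhs]
      ring
    · rw [h3]
      by_cases h : S i j
      · simp [markRhs, h, H3 i (by omega) j h]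
      · simp [markRhs, h]

/-- The system of marks has a bounded homogeneous solution of maximal support, and each solution is
a bounded solution plus a homogeneous one. -/
theorem exists_max_mark : ∃ a : ℕ, ∀ (n : ℕ) (P σ : Type) [Fintype P], Fintype.card P ≤ n →
    ∀ k ≤ n, ∀ (T : ℕ → Finset (σ × Tr P × σ)) (S : ℕ → P → Prop), (∀ i < k, (T i).card ≤ n) →
    (∀ i < k, ∀ e ∈ T i, TrBd n e.2.1) →
    ∃ (φ₀ : ℕ → σ × Tr P × σ → ℕ) (u₀ : ℕ → P → ℕ), MarkSol k T S 0 0 φ₀ u₀ ∧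
      (∀ i e, φ₀ i e ≤ ack a n) ∧ (∀ i j, u₀ i j ≤ ack a n) ∧
      (∀ φ u, MarkSol k T S 0 0 φ u → (∀ i < k, ∀ e ∈ T i, φ i e ≠ 0 → φ₀ i e ≠ 0) ∧
        ∀ i ≤ k, ∀ j, u i j ≠ 0 → u₀ i j ≠ 0) ∧
      ∀ δ c : ℕ → P → ℤ, (∀ i < k, ∀ j, |δ i j| ≤ n) → (∀ i ≤ k, ∀ j, S i j → |c i j| ≤ n) →
        ∀ φ u, MarkSol k T S δ c φ u → ∃ φ' u', MarkSol k T S δ c φ' u' ∧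
          (∀ i < k, ∀ e ∈ T i, φ' i e ≤ φ i e ∧ (φ₀ i e = 0 → φ' i e = φ i e)) ∧
          (∀ i ≤ k, ∀ j, u' i j ≤ u i j ∧ (u₀ i j = 0 → u' i j = u i j)) ∧
          (∀ i e, φ' i e ≤ ack a n) ∧ ∀ i j, u' i j ≤ ack a n := by
  obtain ⟨Q, hQ, H⟩ := exists_max_hom_solution
  obtain ⟨a, ha⟩ : AckBd (fun n => Q (4 * (n * n) + 2 * n + 1)) :=
    hQ.comp ((((AckBd.const 4).mul (AckBd.id.mul AckBd.id)).add
      ((AckBd.const 2).mul AckBd.id)).add (AckBd.const 1))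
  refine ⟨a, ?_⟩
  intro n P σ _ hP k hk T S hT hbd
  classical
  set N := 4 * (n * n) + 2 * n + 1 with hN
  have hsig : Fintype.card (Σ i : Fin k, {e // e ∈ T i}) ≤ n * n := by
    rw [Fintype.card_sigma]
    calc ∑ i : Fin k, Fintype.card {e // e ∈ T i} ≤ ∑ _i : Fin k, n :=
          Finset.sum_le_sum fun i _ => by rw [Fintype.card_coe]; exact hT i i.2
      _ ≤ n * n := by simpa using Nat.mul_le_mul_right n hk
  have hkP : k * Fintype.card P ≤ n * n := Nat.mul_le_mul hk hP
  have hkP' : (k + 1) * Fintype.card P ≤ n * n + n := by rw [add_mul, one_mul]; omega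
  have hI : Fintype.card (MarkVar k T) ≤ N := by
    rw [Fintype.card_sum, Fintype.card_prod, Fintype.card_fin]; omega
  have hR : Fintype.card (MarkRow k T) ≤ N := by
    rw [Fintype.card_sum, Fintype.card_sum, Fintype.card_prod, Fintype.card_prod, Fintype.card_prod,
      Fintype.card_fin, Fintype.card_fin, Fintype.card_bool]
    omega
  have hcoef : ∀ r v, |markCoeff k T S r v| ≤ (N : ℕ) := by
    have h1 : (1 : ℤ) ≤ N := by omega
    have h0 : (n : ℤ) ≤ N := by push_cast [hN]; nlinarith
    rintro (⟨⟨i, e⟩, b⟩ | ⟨i, j⟩ | ⟨i, j⟩) (⟨i', e'⟩ | ⟨i', j'⟩) <;> simp only [markCoeff]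
    · split_ifs <;> simp <;> omega
    · simp
    · split_ifs with h
      · rw [abs_neg]
        exact ((hbd _ i'.2 _ e'.2).abs_eff_le j).trans h0
      · simp
    · split_ifs <;> simp <;> omega
    · simp
    · split_ifs <;> simp <;> omega
  -- reading off circulations and marks from a vector
  have read : ∀ z : MarkVar k T → ℕ, ∃ (φ : ℕ → σ × Tr P × σ → ℕ) (u : ℕ → P → ℕ),
      z = Sum.elim (fun v => φ v.1 v.2) (fun v => u v.1 v.2) ∧
      ∀ B, (∀ v, z v ≤ B) → (∀ i e, φ i e ≤ B) ∧ ∀ i j, u i j ≤ B := by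
    intro z
    refine ⟨fun i e => if h : ∃ hi : i < k, e ∈ T i then z (.inl ⟨⟨i, h.1⟩, ⟨e, h.2⟩⟩) else 0,
      fun i j => if h : i < k + 1 then z (.inr (⟨i, h⟩, j)) else 0, ?_, ?_⟩
    · ext (⟨i, e⟩ | ⟨i, j⟩)
      · simp
      · simp
        intro h
        omega
    · intro B hB
      constructor
      · intro i e
        dsimp only
        split_ifs
        · exact hB _
        · exact Nat.zero_le _
      · intro i e
        dsimp only
        split_ifs
        · exact hB _
        · exact Nat.zero_le _
  obtain ⟨h, hh, hb, hmax, hdec⟩ := H N (MarkVar k T) (MarkRow k T) hI hR (markCoeff k T S) hcoef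
  obtain ⟨φ₀, u₀, rfl, hB⟩ := read h
  have zeroRhs : ∀ r, markRhs k T S 0 0 r = 0 := by
    rintro (_ | _ | ⟨i, j⟩) <;> simp [markRhs]
  have hack : Q N ≤ _root_.ack a n := ha n
  refine ⟨φ₀, u₀, (markSys_iff k T S 0 0 φ₀ u₀ _ rfl).1 (fun r => by rw [zeroRhs]; exact hh r),
    fun i e => ((hB _ hb).1 i e).trans hack, fun i e => ((hB _ hb).2 i e).trans hack, ?_, ?_⟩
  · intro φ u hs
    have := hmax _ (fun r => by
      rw [(markSys_iff k T S 0 0 φ u _ rfl).2 hs r, zeroRhs])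
    exact ⟨fun i hi e he => this (.inl ⟨⟨i, hi⟩, ⟨e, he⟩⟩),
      fun i hi j => this (.inr (⟨i, by omega⟩, j))⟩
  · intro δ c hδ hc φ u hs
    have h0 : (n : ℤ) ≤ N := by push_cast [hN]; nlinarith
    have hrhs : ∀ r, |markRhs k T S δ c r| ≤ (N : ℕ) := by
      rintro (_ | ⟨i, j⟩ | ⟨i, j⟩) <;> simp only [markRhs]
      · simp
      · exact (hδ i i.2 j).trans h0
      · split_ifs with h
        · exact (hc i (by omega) j h).trans h0
        · simp
    obtain ⟨z', h1, h2, h3, h4⟩ := hdec _ hrhs _ ((markSys_iff k T S δ c φ u _ rfl).2 hs)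
    obtain ⟨φ', u', rfl, hB'⟩ := read z'
    refine ⟨φ', u', (markSys_iff k T S δ c φ' u' _ rfl).1 h2, ?_, ?_,
      fun i e => ((hB' _ h3).1 i e).trans hack, fun i e => ((hB' _ h3).2 i e).trans hack⟩
    · intro i hi e he
      exact ⟨h1 (.inl ⟨⟨i, hi⟩, ⟨e, he⟩⟩), fun h => (h4 (.inl ⟨⟨i, hi⟩, ⟨e, he⟩⟩) h).symm⟩
    · intro i hi j
      exact ⟨h1 (.inr (⟨i, by omega⟩, j)), fun h => (h4 (.inr (⟨i, by omega⟩, j)) h).symm⟩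

end Marks

end

section

/-- Splitting a list at the last element satisfying a property. -/
theorem exists_last_split {β : Type} (Q : β → Prop) (l : List β) (h : ∃ e ∈ l, Q e) :
    ∃ a e b, l = a ++ e :: b ∧ Q e ∧ ∀ f ∈ b, ¬ Q f := by
  induction l with
  | nil => simp at h
  | cons x l ih =>
    by_cases hl : ∃ e ∈ l, Q e
    · obtain ⟨a, e, b, rfl, h1, h2⟩ := ih hl
      exact ⟨x :: a, e, b, rfl, h1, h2⟩
    · refine ⟨[], x, l, rfl, ?_, fun f hf hQ => hl ⟨f, hf, hQ⟩⟩
      obtain ⟨e, he, hQ⟩ := h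
      rcases List.mem_cons.1 he with rfl | he
      · exact hQ
      · exact absurd ⟨e, he, hQ⟩ hl

/-- Edges labelled by transitions, with numbers as vertices. -/
abbrev PEdge (P : Type) : Type := ℕ × Tr P × ℕ

/-- A closed walk `γ` at `p`, started at a marking specified on `A`, and followed by `conn`. -/
structure Piece (P : Type) where
  p : ℕ
  γ : List (PEdge P)
  A : Finset P
  conn : List (Tr P)

section Pieces
variable {P : Type}

/-- The transitions of a piece. -/
def Piece.trs (π : Piece P) : List (Tr P) := lab π.γ ++ π.conn

variable [Fintype P]

/-- The edges used by a piece. -/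
def Piece.T (π : Piece P) : Finset (PEdge P) := π.γ.toFinset

/-- The piece can be executed from `u`, leading to `v`, and its size is bounded by `n`. -/
structure GoodPiece (S : Set (Tr P)) (n : ℕ) (u : P → ℤ) (π : Piece P) (v : P → ℤ) : Prop where
  nonneg : ∀ j, 0 ≤ u j
  walk : Walk π.p π.γ π.p
  leg : ∀ j, LegC j (u j) π.trs
  mem : ∀ t ∈ π.trs, t ∈ S
  card : π.T.card ≤ n
  conn : π.conn.length ≤ 1
  spec : ∀ j ∈ π.A, u j ≤ n
  eff : v = fun j => u j + effC j π.trs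

theorem GoodPiece.mono {S : Set (Tr P)} {n m : ℕ} {u v : P → ℤ} {π : Piece P}
    (h : GoodPiece S n u π v) (hnm : n ≤ m) : GoodPiece S m u π v :=
  ⟨h.nonneg, h.walk, h.leg, h.mem, h.card.trans hnm, h.conn,
    fun j hj => (h.spec j hj).trans (by exact_mod_cast hnm), h.eff⟩

theorem GoodPiece.nonneg_end {S : Set (Tr P)} {n : ℕ} {u v : P → ℤ} {π : Piece P}
    (h : GoodPiece S n u π v) (j : P) : 0 ≤ v j := by
  rw [h.eff]; exact (h.leg j).nonneg (h.nonneg j)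

/-- The pieces can be executed one after another. -/
def Good (S : Set (Tr P)) (n : ℕ) : (P → ℤ) → List (Piece P) → (P → ℤ) → Prop
  | u, [], v => u = v
  | u, π :: Ξ, v => ∃ w, GoodPiece S n u π w ∧ Good S n w Ξ v

theorem good_append {S : Set (Tr P)} {n : ℕ} {u v : P → ℤ} {Ξ Ξ' : List (Piece P)} :
    Good S n u (Ξ ++ Ξ') v ↔ ∃ w, Good S n u Ξ w ∧ Good S n w Ξ' v := by
  induction Ξ generalizing u with
  | nil => simp [Good]
  | cons π Ξ ih =>
    simp only [List.cons_append, Good, ih]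
    constructor
    · rintro ⟨w, h1, w', h2, h3⟩
      exact ⟨w', ⟨w, h1, h2⟩, h3⟩
    · rintro ⟨w', ⟨w, h1, h2⟩, h3⟩
      exact ⟨w, h1, w', h2, h3⟩

theorem Good.mono {S : Set (Tr P)} {n m : ℕ} {u v : P → ℤ} {Ξ : List (Piece P)}
    (h : Good S n u Ξ v) (hnm : n ≤ m) : Good S m u Ξ v := by
  induction Ξ generalizing u with
  | nil => exact h
  | cons π Ξ ih => exact ⟨h.choose, h.choose_spec.1.mono hnm, ih h.choose_spec.2⟩

/-- The intermediate markings of a good sequence of pieces. -/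
theorem Good.exists_marks {S : Set (Tr P)} {n : ℕ} {u v : P → ℤ} {Ξ : List (Piece P)}
    (h : Good S n u Ξ v) : ∃ X : ℕ → P → ℤ, X 0 = u ∧ X Ξ.length = v ∧
      ∀ i (hi : i < Ξ.length), GoodPiece S n (X i) Ξ[i] (X (i + 1)) := by
  induction Ξ generalizing u with
  | nil => exact ⟨fun _ => u, rfl, h, by simp⟩
  | cons π Ξ ih =>
    obtain ⟨w, h1, h2⟩ := h
    obtain ⟨X, h3, h4, h5⟩ := ih h2
    refine ⟨fun i => Nat.casesOn i u X, rfl, h4, ?_⟩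
    rintro (_ | i) hi
    · simpa [h3] using h1
    · exact h5 i (by simpa using hi)

/-- Replacing one piece of a good sequence. -/
theorem Good.split_at {S : Set (Tr P)} {n : ℕ} {u v : P → ℤ} {Ξ : List (Piece P)}
    {X : ℕ → P → ℤ} (h0 : X 0 = u) (hv : X Ξ.length = v)
    (h : ∀ i (hi : i < Ξ.length), GoodPiece S n (X i) Ξ[i] (X (i + 1))) (i : ℕ)
    (hi : i < Ξ.length) : ∃ L R, Ξ = L ++ Ξ[i] :: R ∧ Good S n u L (X i) ∧
      Good S n (X (i + 1)) R v := by
  refine ⟨Ξ.take i, Ξ.drop (i + 1), by simp, ?_, ?_⟩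
  · subst h0
    have : ∀ m ≤ Ξ.length, Good S n (X 0) (Ξ.take m) (X m) := by
      intro m
      induction m with
      | zero => intro _; simp [Good]
      | succ m ih =>
        intro hm
        rw [List.take_succ_eq_append_getElem (by omega), good_append]
        exact ⟨X m, ih (by omega), X (m + 1), h m (by omega), rfl⟩
    exact this i hi.le
  · subst hv
    have : ∀ d m, m + d = Ξ.length → Good S n (X m) (Ξ.drop m) (X Ξ.length) := by
      intro d
      induction d with
      | zero => intro m hm; simp at hm; simp [hm, Good]
      | succ d ih =>
        intro m hm
        rw [List.drop_eq_getElem_cons (by omega)]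
        exact ⟨X (m + 1), h m (by omega), ih (m + 1) (by omega)⟩
    exact this (Ξ.length - (i + 1)) (i + 1) (by omega)

/-- A walk decomposes into few pieces using only its edges. -/
theorem exists_pieces (S : Set (Tr P)) (n : ℕ) (T : Finset (PEdge P)) (hn : T.card ≤ n)
    (hS : ∀ e ∈ T, e.2.1 ∈ S) (s t : ℕ) (l : List (PEdge P)) (u : P → ℤ) (hl : Walk s l t)
    (hlT : ∀ e ∈ l, e ∈ T) (hu : ∀ j, 0 ≤ u j) (hleg : ∀ j, LegC j (u j) (lab l)) :
    ∃ Ξ, Good S n u Ξ (fun j => u j + effC j (lab l)) ∧ Ξ.length ≤ T.card ∧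
      ∀ π ∈ Ξ, π.T ⊆ T := by
  induction hc : T.card using Nat.strong_induction_on generalizing T s l u with
  | _ c ih =>
    by_cases hex : ∃ e ∈ l, e.1 = s
    · obtain ⟨a, e, b, rfl, rfl, hb⟩ := exists_last_split (fun e => e.1 = s) l hex
      have heT : e ∈ T := hlT e (by simp)
      have hw := hl.src_of_append_cons
      have hlab : lab (a ++ e :: b) = lab (a ++ [e]) ++ lab b := by simp
      have hlt : (T.filter fun f => f.1 ≠ e.1).card < T.card :=
        Finset.card_lt_card (Finset.filter_ssubset.2 ⟨e, heT, by simp⟩)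
      have hpc : GoodPiece S n u ⟨e.1, a, ∅, [e.2.1]⟩ (fun j => u j + effC j (lab (a ++ [e]))) := by
        refine ⟨hu, hw.1, fun j => ?_, ?_, ?_, le_rfl, by simp, ?_⟩
        · have := hleg j
          rw [hlab, legC_append] at this
          simpa [Piece.trs] using this.1
        · intro t ht
          rw [Piece.trs, List.mem_append, mem_lab] at ht
          rcases ht with ⟨f, hf, rfl⟩ | ht
          · exact hS f (hlT f (by simp [hf]))
          · rw [List.mem_singleton.1 ht]; exact hS e heT
        · refine (Finset.card_le_card fun f hf => ?_).trans hn
          exact hlT f (by simp [List.mem_toFinset.1 hf])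
        · funext j; simp [Piece.trs]
      obtain ⟨Ξ, h1, h2, h3⟩ := ih _ (hc ▸ hlt) (T.filter fun f => f.1 ≠ e.1) (hlt.le.trans hn)
        (fun f hf => hS f (Finset.mem_filter.1 hf).1) e.2.2 b
        (fun j => u j + effC j (lab (a ++ [e]))) hw.2
        (fun f hf => Finset.mem_filter.2 ⟨hlT f (by simp [hf]), hb f hf⟩)
        (fun j => hpc.nonneg_end j) (fun j => by
          have := hleg j
          rw [hlab, legC_append] at this
          exact this.2) rfl
      refine ⟨⟨e.1, a, ∅, [e.2.1]⟩ :: Ξ, ⟨_, hpc, ?_⟩, ?_, ?_⟩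
      · convert h1 using 1
        funext j
        rw [hlab, effC_append, add_assoc]
      · rw [List.length_cons]; omega
      · intro π hπ
        rcases List.mem_cons.1 hπ with rfl | hπ
        · intro f hf
          exact hlT f (by simp [List.mem_toFinset.1 hf])
        · exact fun f hf => (Finset.mem_filter.1 (h3 π hπ hf)).1
    · cases l with
      | nil => exact ⟨[], by simp [Good], by simp, by simp⟩
      | cons e l => exact absurd ⟨e, by simp, hl.1⟩ hex

/-- A walk leaving `T'` few times decomposes into few pieces with edges in `T'`. -/
theorem exists_pieces_avoiding (S : Set (Tr P)) (n : ℕ) (T' : Finset (PEdge P)) (hn : T'.card ≤ n)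
    (M : ℕ) (s t : ℕ) (l : List (PEdge P)) (u : P → ℤ) (hl : Walk s l t)
    (hS : ∀ e ∈ l, e.2.1 ∈ S) (hSn : ∀ e ∈ T', e.2.1 ∈ S)
    (hM : l.countP (fun e => e ∉ T') ≤ M)
    (hu : ∀ j, 0 ≤ u j) (hleg : ∀ j, LegC j (u j) (lab l)) :
    ∃ Ξ, Good S n u Ξ (fun j => u j + effC j (lab l)) ∧ Ξ.length ≤ (M + 1) * n + M ∧
      ∀ π ∈ Ξ, π.T ⊆ T' := by
  have base : ∀ (s t : ℕ) (l : List (PEdge P)) (u : P → ℤ), Walk s l t → (∀ e ∈ l, e ∈ T') →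
      (∀ j, 0 ≤ u j) → (∀ j, LegC j (u j) (lab l)) →
      ∃ Ξ, Good S n u Ξ (fun j => u j + effC j (lab l)) ∧ Ξ.length ≤ n ∧ ∀ π ∈ Ξ, π.T ⊆ T' := by
    intro s t l u hl hT hu hleg
    obtain ⟨Ξ, h1, h2, h3⟩ := exists_pieces S n T' hn hSn s t l u hl hT hu hleg
    exact ⟨Ξ, h1, h2.trans hn, h3⟩
  induction M generalizing s t l u with
  | zero =>
    obtain ⟨Ξ, h1, h2, h3⟩ := base s t l u hl (by
      have := List.countP_eq_zero.1 (Nat.le_zero.1 hM)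
      simpa using this) hu hleg
    exact ⟨Ξ, h1, by omega, h3⟩
  | succ M ih =>
    by_cases hex : ∃ e ∈ l, e ∉ T'
    · obtain ⟨a, e, b, rfl, he, hb⟩ := exists_last_split (fun e => e ∉ T') l hex
      have hw := hl.src_of_append_cons
      have hlab : lab (a ++ e :: b) = lab a ++ ([e.2.1] ++ lab b) := by simp
      have hleg' : ∀ j, LegC j (u j) (lab a) ∧ LegC j (u j + effC j (lab a)) [e.2.1] ∧
          LegC j (u j + effC j (lab a) + effC j [e.2.1]) (lab b) := by
        intro j
        have := hleg j
        rwa [hlab, legC_append, legC_append] at this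
      obtain ⟨Ξ, h1, h2, h3⟩ := ih s e.1 a u hw.1 (fun f hf => hS f (by simp [hf]))
        (by rw [List.countP_append, List.countP_cons_of_pos (by simpa using he)] at hM; omega) hu
        (fun j => (hleg' j).1)
      have hpc : GoodPiece S n (fun j => u j + effC j (lab a)) ⟨0, [], ∅, [e.2.1]⟩
          (fun j => u j + effC j (lab a) + effC j [e.2.1]) := by
        refine ⟨fun j => (hleg' j).1.nonneg (hu j), rfl, fun j => (hleg' j).2.1, ?_,
          by simp [Piece.T], by simp, by simp, rfl⟩
        intro t ht
        have : t = e.2.1 := by simpa [Piece.trs] using ht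
        rw [this]
        exact hS e (by simp)
      obtain ⟨Ξ', h1', h2', h3'⟩ := base e.2.2 t b
        (fun j => u j + effC j (lab a) + effC j [e.2.1]) hw.2
        (fun f hf => by simpa using hb f hf) (fun j => hpc.nonneg_end j) (fun j => (hleg' j).2.2)
      refine ⟨Ξ ++ (⟨0, [], ∅, [e.2.1]⟩ :: Ξ'), good_append.2 ⟨_, h1, _, hpc, ?_⟩, ?_, ?_⟩
      · convert h1' using 1
        funext j
        rw [hlab, effC_append, effC_append]
        ring
      · rw [List.length_append, List.length_cons]
        have : (M + 1 + 1) * n = (M + 1) * n + n := by ring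
        omega
      · intro π hπ
        simp only [List.mem_append, List.mem_cons] at hπ
        rcases hπ with hπ | rfl | hπ
        · exact h3 π hπ
        · simp [Piece.T]
        · exact h3' π hπ
    · obtain ⟨Ξ, h1, h2, h3⟩ := base s t l u hl (by
        push Not at hex
        exact hex) hu hleg
      refine ⟨Ξ, h1, h2.trans ?_, h3⟩
      have : (M + 1 + 1) * n = (M + 1) * n + n := by ring
      omega

/-- A walk on which the place `j` stays bounded decomposes into pieces all of whose cycles leave `j`
unchanged. -/
theorem exists_pieces_bounded (S : Set (Tr P)) (n W : ℕ) (T : Finset (PEdge P)) (hn : T.card ≤ n)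
    (hS : ∀ e ∈ T, e.2.1 ∈ S) (s t : ℕ) (l : List (PEdge P)) (u : P → ℤ) (hl : Walk s l t)
    (hlT : ∀ e ∈ l, e ∈ T) (hu : ∀ j, 0 ≤ u j) (hleg : ∀ j, LegC j (u j) (lab l)) (j : P)
    (hj : ∀ a b, l = a ++ b → |effC j (lab a)| ≤ W) :
    ∃ Ξ, Good S (n * (2 * W + 1)) u Ξ (fun j => u j + effC j (lab l)) ∧
      Ξ.length ≤ n * (2 * W + 1) ∧
      ∀ π ∈ Ξ, cycleSpace π.T ≤ cycleSpace T ∧ ∀ w ∈ cycleSpace π.T, w j = 0 := by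
  set enc : ℕ × ℤ → ℕ := Encodable.encode
  set dec : ℕ → ℕ × ℤ := fun m => (Encodable.decode (α := ℕ × ℤ) m).getD (0, 0)
  have hdec : ∀ x, dec (enc x) = x := fun x => by
    simp only [dec, enc, Encodable.encodek, Option.getD_some]
  set upd : ℤ → Tr P → ℤ := fun v t => v + t.eff j
  set edge : PEdge P × ℤ → PEdge P := fun x => (enc (x.1.1, x.2), x.1.2.1, enc (x.1.2.2, upd x.2 x.1.2.1))
  set T' : Finset (PEdge P) := (T ×ˢ Finset.Icc (-(W : ℤ)) W).image edge with hT'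
  have hcard : T'.card ≤ n * (2 * W + 1) := by
    refine Finset.card_image_le.trans ?_
    rw [Finset.card_product, Int.card_Icc]
    refine Nat.mul_le_mul hn ?_
    omega
  have hfold : ∀ (l : List (Tr P)) v, l.foldl upd v = v + effC j l := by
    intro l
    induction l with
    | nil => simp
    | cons t l ih => intro v; rw [List.foldl_cons, ih]; simp [upd, add_assoc]
  have hw := (hl.enrich upd (v := 0)).map enc
  have hlab := lab_map enc (enrich upd 0 l)
  rw [lab_enrich] at hlab
  obtain ⟨Ξ, h1, h2, h3⟩ := exists_pieces S _ T' hcard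
    (by
      intro e he
      obtain ⟨x, hx, rfl⟩ := Finset.mem_image.1 he
      exact hS x.1 (Finset.mem_product.1 hx).1) _ _ _ u hw
    (by
      intro e he
      obtain ⟨f, hf, rfl⟩ := List.mem_map.1 he
      obtain ⟨a, e, b, rfl, rfl⟩ := mem_enrich hf
      refine Finset.mem_image.2 ⟨(e, (lab a).foldl upd 0), Finset.mem_product.2 ⟨hlT e (by simp), ?_⟩,
        rfl⟩
      rw [hfold, zero_add, Finset.mem_Icc]
      exact abs_le.1 (hj a _ rfl))
    hu (by rwa [hlab])
  rw [hlab] at h1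
  refine ⟨Ξ, h1, h2.trans hcard, fun π hπ => ⟨(cycleSpace_mono (h3 π hπ)).trans ?_, fun w hw => ?_⟩⟩
  · refine cycleSpace_le_of_proj (fun m => (dec m).1) fun e he => ?_
    obtain ⟨x, hx, rfl⟩ := Finset.mem_image.1 he
    simp only [edge, hdec]
    exact (Finset.mem_product.1 hx).1
  · refine cycleSpace_apply_eq_zero (fun m => (dec m).2) j (fun e he => ?_) hw
    obtain ⟨x, hx, rfl⟩ := Finset.mem_image.1 (h3 π hπ he)
    simp only [edge, hdec, upd]

end Pieces

end

section

theorem ackBd_covBound {b : ℕ → ℕ} (hb : AckBd b) : AckBd (fun n => covBound (b n) n n) := by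
  obtain ⟨a, ha⟩ : AckBd (fun x => x * (x + x * x + 1) ^ x + x + (x + x * x) + x + x) := by
    have i := AckBd.id
    exact (((((i.mul (((i.add (i.mul i)).add (AckBd.const 1)).pow i)).add i).add
      (i.add (i.mul i))).add i).add i)
  have key : ∀ b n q, b + n + covBound b n q ≤ (_root_.ack a)^[q] (b + n) := by
    intro b n q
    induction q with
    | zero => simp [covBound]
    | succ q ih =>
      rw [Function.iterate_succ_apply']
      refine le_trans ?_ (ack_mono_right a ih)
      refine le_trans ?_ (ha _)
      set x := b + n + covBound b n q with hx
      have h1 : covBound b n q * n ≤ x * x := Nat.mul_le_mul (by omega) (by omega)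
      have h2 : n * (b + covBound b n q * n + 1) ^ n ≤ x * (x + x * x + 1) ^ x := by
        refine Nat.mul_le_mul (by omega) ((Nat.pow_le_pow_left (by omega) n).trans
          (Nat.pow_le_pow_right (by omega) (by omega)))
      rw [covBound]
      dsimp only
      omega
  refine (((AckBd.ack (a + 1)).comp (AckBd.id.add (hb.add AckBd.id))).of_le fun n => ?_)
  have := (key (b n) n n).trans (iterate_ack_le a n _)
  omega

section Pump
variable {P : Type}

/-- Either the places of `J` can be pumped up by a short closed walk, or the closed walk `γ` is a
concatenation of few phases with a bounded place of `J`. -/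
theorem pump_or_phases (n : ℕ) {σ : Type} (T : Finset (σ × Tr P × σ)) (hT : T.card ≤ n) (J : Finset P)
    (hJ : J.card ≤ n) (p : σ) (γ : List (σ × Tr P × σ)) (z : P → ℤ) (hw : Walk p γ p)
    (hγ : ∀ e ∈ γ, e ∈ T) (hbd : ∀ e ∈ T, TrBd n e.2.1) (hz : ∀ j ∈ J, 0 ≤ z j)
    (hzn : ∀ j ∈ J, z j ≤ n) (hleg : ∀ j ∈ J, LegC j (z j) (lab γ)) :
    (∃ up, up ⊆ γ ∧ Walk p up p ∧ (∀ j ∈ J, LegC j (z j) (lab up) ∧ 1 ≤ effC j (lab up)) ∧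
      up.length ≤ covBound (n * n + n + 1) n n + n) ∨
    (∃ L : List (List (σ × Tr P × σ)), L.length ≤ n ∧ L.flatten = γ ∧ ∀ m ∈ L, ∃ j ∈ J,
      ∀ c d e, m = c ++ d ++ e → |effC j (lab d)| ≤ covBound (n * n + n + 1) n n) := by
  have hmono := covBound_mono (n * n + n + 1) n hJ
  rcases coverability_dichotomy (n * n + n + 1) n T hT J.card J rfl hJ p p γ z hw hγ hbd hz hleg with
    ⟨l, s, h1, h2, h3, h4⟩ | ⟨L, h1, h2, h3⟩
  · left
    obtain ⟨r, hr1, hr2, hr3⟩ : ∃ r, r ⊆ γ ∧ Walk s r p ∧ r.length ≤ n := by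
      rcases List.eq_nil_or_concat l with rfl | ⟨l', e, rfl⟩
      · cases h2
        exact ⟨[], by simp, rfl, by simp⟩
      · classical
        obtain ⟨r, hr1, hr2, hr3⟩ := hw.exists_from (h1 e (by simp))
        have : e.2.2 = s := by
          rw [List.concat_eq_append] at h2
          have := h2.src_of_append_cons (m := [])
          exact this.2
        rw [this] at hr2
        refine ⟨r, hr1, hr2, hr3.trans ((Finset.card_le_card fun f hf => ?_).trans hT)⟩
        exact hγ f (List.mem_toFinset.1 hf)
    have hrbd : ∀ t ∈ lab r, TrBd n t := by
      intro t ht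
      obtain ⟨e, he, rfl⟩ := mem_lab.1 ht
      exact hbd e (hγ e (hr1 he))
    have hrn : ((r.length * n : ℕ) : ℤ) ≤ n * n := by
      exact_mod_cast Nat.mul_le_mul_right n hr3
    refine ⟨l ++ r, fun e he => ?_, h2.append hr2, fun j hj => ?_, ?_⟩
    · rcases List.mem_append.1 he with he | he
      exacts [h1 e he, hr1 he]
    · obtain ⟨h5, h6⟩ := h3 j hj
      push_cast at h6
      have hE := (abs_le.1 (abs_effC_le (j := j) hrbd)).1
      rw [length_lab] at hE
      have hn := hzn j hj
      rw [lab_append, effC_append]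
      refine ⟨legC_append.2 ⟨h5, legC_of_large hrbd ?_⟩, by omega⟩
      rw [length_lab]
      push_cast at hrn
      omega
    · rw [List.length_append]; omega
  · right
    refine ⟨L, h1.trans hJ, h2, fun m hm => ?_⟩
    obtain ⟨j, hj, h⟩ := h3 m hm
    exact ⟨j, hj, fun c d e hcde => (h c d e hcde).trans (by exact_mod_cast hmono)⟩

/-- Reversal of an edge. -/
def revEdge {σ : Type} (e : σ × Tr P × σ) : σ × Tr P × σ := (e.2.2, Prod.swap e.2.1, e.1)

theorem revEdge_revEdge {σ : Type} (e : σ × Tr P × σ) : revEdge (revEdge e) = e := rfl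

/-- Reversal of a walk. -/
def revWalk {σ : Type} (l : List (σ × Tr P × σ)) : List (σ × Tr P × σ) := (l.map revEdge).reverse

theorem revWalk_revWalk {σ : Type} (l : List (σ × Tr P × σ)) : revWalk (revWalk l) = l := by
  simp [revWalk, List.map_reverse, Function.comp_def, revEdge_revEdge]

theorem mem_revWalk {σ : Type} {l : List (σ × Tr P × σ)} {e : σ × Tr P × σ} :
    e ∈ revWalk l ↔ revEdge e ∈ l := by
  simp only [revWalk, List.mem_reverse, List.mem_map]
  exact ⟨fun ⟨f, hf, h⟩ => by rw [← h, revEdge_revEdge]; exact hf,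
    fun h => ⟨_, h, revEdge_revEdge e⟩⟩

theorem Walk.rev {σ : Type} {s t : σ} {l : List (σ × Tr P × σ)} (h : Walk s l t) :
    Walk t (revWalk l) s := by
  induction l generalizing s with
  | nil => cases h; rfl
  | cons e l ih =>
    obtain ⟨rfl, h⟩ := h
    rw [revWalk, List.map_cons, List.reverse_cons]
    exact (ih h).append ⟨rfl, rfl⟩

theorem lab_revWalk {σ : Type} (l : List (σ × Tr P × σ)) :
    lab (revWalk l) = ((lab l).map Prod.swap).reverse := by
  simp [lab, revWalk, List.map_reverse, Function.comp_def, revEdge]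

theorem revWalk_append {σ : Type} (l m : List (σ × Tr P × σ)) :
    revWalk (l ++ m) = revWalk m ++ revWalk l := by
  simp [revWalk]

theorem revWalk_flatten {σ : Type} (L : List (List (σ × Tr P × σ))) :
    revWalk L.flatten = (L.map revWalk).reverse.flatten := by
  induction L with
  | nil => rfl
  | cons l L ih => simp [revWalk_append, ih]

/-- The backward version of `pump_or_phases`. -/
theorem pump_or_phases_backward (n : ℕ) {σ : Type} (T : Finset (σ × Tr P × σ)) (hT : T.card ≤ n) (J : Finset P)
    (hJ : J.card ≤ n) (p : σ) (γ : List (σ × Tr P × σ)) (z : P → ℤ) (hw : Walk p γ p)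
    (hγ : ∀ e ∈ γ, e ∈ T) (hbd : ∀ e ∈ T, TrBd n e.2.1) (hz : ∀ j ∈ J, 0 ≤ z j)
    (hzn : ∀ j ∈ J, z j + effC j (lab γ) ≤ n) (hleg : ∀ j ∈ J, LegC j (z j) (lab γ)) :
    (∃ down, down ⊆ γ ∧ Walk p down p ∧
      (∀ j ∈ J, LegC j (z j + effC j (lab γ) - effC j (lab down)) (lab down) ∧
        effC j (lab down) ≤ -1) ∧
      down.length ≤ covBound (n * n + n + 1) n n + n) ∨
    (∃ L : List (List (σ × Tr P × σ)), L.length ≤ n ∧ L.flatten = γ ∧ ∀ m ∈ L, ∃ j ∈ J,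
      ∀ c d e, m = c ++ d ++ e → |effC j (lab d)| ≤ covBound (n * n + n + 1) n n) := by
  classical
  have heff : ∀ j (l : List (σ × Tr P × σ)), effC j (lab (revWalk l)) = -effC j (lab l) :=
    fun j l => by rw [lab_revWalk, effC_reverse]
  rcases pump_or_phases n (T.image revEdge) (Finset.card_image_le.trans hT) J hJ p (revWalk γ)
    (fun j => z j + effC j (lab γ)) hw.rev
    (fun e he => Finset.mem_image.2 ⟨revEdge e, hγ _ (mem_revWalk.1 he), revEdge_revEdge e⟩)
    (fun e he => by
      obtain ⟨f, hf, rfl⟩ := Finset.mem_image.1 he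
      exact fun j => ⟨(hbd f hf j).2, (hbd f hf j).1⟩)
    (fun j hj => (hleg j hj).nonneg (hz j hj)) hzn
    (fun j hj => by rw [lab_revWalk]; exact legC_reverse (hleg j hj)) with
    ⟨up, h1, h2, h3, h4⟩ | ⟨L, h1, h2, h3⟩
  · left
    refine ⟨revWalk up, fun e he => ?_, h2.rev, fun j hj => ?_, ?_⟩
    · have := mem_revWalk.1 (h1 (mem_revWalk.1 he))
      rwa [revEdge_revEdge] at this
    · obtain ⟨h5, h6⟩ := h3 j hj
      rw [heff]
      refine ⟨?_, by omega⟩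
      rw [sub_neg_eq_add, lab_revWalk]
      exact legC_reverse h5
    · simpa [revWalk] using h4
  · right
    refine ⟨(L.map revWalk).reverse, by simpa using h1, ?_, fun m hm => ?_⟩
    · rw [← revWalk_flatten, h2, revWalk_revWalk]
    · rw [List.mem_reverse, List.mem_map] at hm
      obtain ⟨m', hm', rfl⟩ := hm
      obtain ⟨j, hj, h⟩ := h3 m' hm'
      refine ⟨j, hj, fun c d e hcde => ?_⟩
      have := h (revWalk e) (revWalk d) (revWalk c) (by
        rw [← revWalk_revWalk m', hcde, revWalk_append, revWalk_append, List.append_assoc])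
      rwa [heff, abs_neg] at this

variable [Fintype P]

/-- A closed walk split in phases is replaced with pieces whose cycles span less. -/
theorem pieces_of_phases (S : Set (Tr P)) (n W : ℕ) (T : Finset (PEdge P)) (hn : T.card ≤ n)
    (hS : ∀ e ∈ T, e.2.1 ∈ S) (L : List (List (PEdge P))) (s t : ℕ) (u : P → ℤ)
    (hw : Walk s L.flatten t) (hT : ∀ e ∈ L.flatten, e ∈ T) (hu : ∀ j, 0 ≤ u j)
    (hleg : ∀ j, LegC j (u j) (lab L.flatten))
    (hL : ∀ m ∈ L, ∃ j, ¬ Flat T j ∧ ∀ c d e, m = c ++ d ++ e → |effC j (lab d)| ≤ W) :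
    ∃ Ξ, Good S (n * (2 * W + 1)) u Ξ (fun j => u j + effC j (lab L.flatten)) ∧
      Ξ.length ≤ L.length * (n * (2 * W + 1)) ∧ ∀ π ∈ Ξ, cycleSpace π.T < cycleSpace T := by
  induction L generalizing s u with
  | nil => exact ⟨[], by simp [Good], by simp, by simp⟩
  | cons m L ih =>
    rw [List.flatten_cons] at hw
    obtain ⟨r, hw1, hw2⟩ := walk_append.1 hw
    have hleg' : ∀ j, LegC j (u j) (lab m) ∧ LegC j (u j + effC j (lab m)) (lab L.flatten) := by
      intro j
      have := hleg j
      rwa [List.flatten_cons, lab_append, legC_append] at this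
    obtain ⟨j, hj1, hj2⟩ := hL m (by simp)
    obtain ⟨Ξ, h1, h2, h3⟩ := exists_pieces_bounded S n W T hn hS s r m u hw1
      (fun e he => hT e (by simp [he])) hu (fun j => (hleg' j).1) j
      (fun a b hab => hj2 [] a b (by simpa using hab))
    obtain ⟨Ξ', h1', h2', h3'⟩ := ih r (fun j => u j + effC j (lab m)) hw2
      (fun e he => hT e (by rw [List.flatten_cons]; exact List.mem_append_right _ he))
      (fun j => (hleg' j).1.nonneg (hu j)) (fun j => (hleg' j).2)
      (fun m hm => hL m (by simp [hm]))
    refine ⟨Ξ ++ Ξ', good_append.2 ⟨_, h1, ?_⟩, ?_, fun π hπ => ?_⟩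
    · convert h1' using 1
      funext j
      rw [List.flatten_cons, lab_append, effC_append, add_assoc]
    · rw [List.length_append, List.length_cons, add_mul, one_mul]; omega
    · rcases List.mem_append.1 hπ with hπ | hπ
      · refine lt_of_le_of_ne (h3 π hπ).1 fun heq => hj1 fun w hw => ?_
        rw [← heq] at hw
        exact (h3 π hπ).2 w hw
      · exact h3' π hπ

/-- Appending the connecting transition of a piece to a decomposition of its closed walk. -/
theorem GoodPiece.replace {S : Set (Tr P)} {n m : ℕ} {u v : P → ℤ} {π : Piece P}
    (h : GoodPiece S n u π v) {Ξ : List (Piece P)}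
    (hΞ : Good S m u Ξ (fun j => u j + effC j (lab π.γ))) :
    Good S m u (Ξ ++ [⟨π.p, [], ∅, π.conn⟩]) v := by
  refine good_append.2 ⟨_, hΞ, v, ⟨?_, rfl, ?_, ?_, by simp [Piece.T], h.conn, by simp, ?_⟩, rfl⟩
  · intro j
    have := h.leg j
    rw [Piece.trs, legC_append] at this
    exact this.1.nonneg (h.nonneg j)
  · intro j
    have := h.leg j
    rw [Piece.trs, legC_append] at this
    simpa [Piece.trs] using this.2
  · intro t ht
    exact h.mem t (by simpa [Piece.trs] using Or.inr ht)
  · rw [h.eff]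
    funext j
    simp [Piece.trs, add_assoc]

end Pump

end

section

section Power
variable {P σ : Type}

/-- Repetition of a list. -/
def pow (m : ℕ) {β : Type} (l : List β) : List β := (List.replicate m l).flatten

theorem pow_succ' (m : ℕ) {β : Type} (l : List β) : pow (m + 1) l = l ++ pow m l := by
  simp [pow, List.replicate_succ]

theorem mem_pow {m : ℕ} {β : Type} {l : List β} {x : β} (h : x ∈ pow m l) : x ∈ l := by
  simp only [pow, List.mem_flatten, List.mem_replicate] at h
  obtain ⟨_, ⟨_, rfl⟩, h⟩ := h
  exact h

theorem Walk.pow {p : σ} {l : List (σ × Tr P × σ)} (h : Walk p l p) (m : ℕ) :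
    Walk p (pow m l) p := by
  induction m with
  | zero => rfl
  | succ m ih => rw [pow_succ']; exact h.append ih

theorem lab_pow {α : Type} (m : ℕ) (l : List (σ × α × σ)) : lab (CBL.pow m l) = CBL.pow m (lab l) := by
  induction m with
  | zero => rfl
  | succ m ih => rw [pow_succ', pow_succ', lab_append, ih]

theorem effC_pow (j : P) (m : ℕ) (l : List (Tr P)) : effC j (pow m l) = m * effC j l := by
  induction m with
  | zero => simp [CBL.pow]
  | succ m ih => rw [pow_succ', effC_append, ih]; push_cast; ring

theorem legC_pow {j : P} {m : ℕ} {l : List (Tr P)} {z : ℤ}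
    (h : ∀ t : ℕ, t < m → LegC j (z + t * effC j l) l) : LegC j z (pow m l) := by
  induction m generalizing z with
  | zero => trivial
  | succ m ih =>
    rw [pow_succ', legC_append]
    refine ⟨by simpa using h 0 (by omega), ih fun t ht => ?_⟩
    have := h (t + 1) (by omega)
    push_cast at this
    convert this using 1
    ring

theorem length_pow (m : ℕ) {β : Type} (l : List β) : (pow m l).length = m * l.length := by
  simp [pow]

/-- A walk with the effect of a large circulation from which some closed walks are removed. -/
theorem exists_balancing_walk [DecidableEq (σ × Tr P × σ)] {T : Finset (σ × Tr P × σ)} {p : σ}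
    {γ up down : List (σ × Tr P × σ)} (hγ : Walk p γ p) (hTγ : ∀ e, e ∈ γ ↔ e ∈ T) {n : ℕ}
    (hn : T.card ≤ n) (φ : σ × Tr P × σ → ℕ) (hφ : Circ T (fun e => (φ e : ℤ)))
    (hupw : Walk p up p) (hupT : ∀ e ∈ up, e ∈ T) (hdownw : Walk p down p)
    (hdownT : ∀ e ∈ down, e ∈ T)
    (hle : ∀ e ∈ T, up.length + down.length + n * (2 * n + 1) ≤ φ e) :
    ∃ w, Walk p w p ∧ (∀ e ∈ w, e ∈ T) ∧
      (∀ j, effC j (lab w) = ∑ e ∈ T, (φ e : ℤ) * e.2.1.eff j - effC j (lab up) -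
        effC j (lab down)) ∧ w.length ≤ ∑ e ∈ T, φ e := by
  obtain ⟨θ, hθ1, hθ2, hθ3, hθ4⟩ := hγ.exists_tour
  have hθT : ∀ e, e ∈ θ ↔ e ∈ T := fun e =>
    ⟨fun h => (hTγ e).1 (hθ1 h), fun h => hθ3 e ((hTγ e).2 h)⟩
  have hT : γ.toFinset = T := by ext e; rw [List.mem_toFinset, hTγ]
  rw [hT] at hθ4
  have hθlen : θ.length ≤ n * (2 * n + 1) := hθ4.trans (Nat.mul_le_mul hn (by omega))
  have hcle : ∀ (l : List (σ × Tr P × σ)) e, l.count e ≤ l.length := fun l e => List.count_le_length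
  have hbalance : ∀ e ∈ T, up.count e + down.count e + θ.count e ≤ φ e := by
    intro e he
    have := hcle up e
    have := hcle down e
    have := hcle θ e
    have := hle e he
    omega
  obtain ⟨w, hw1, hw2, hw3⟩ := exists_closed_walk_of_circ hθ2 hθT
    (fun e => φ e - up.count e - down.count e)
    (((hφ.sub (hupw.circ hupT)).sub (hdownw.circ hdownT)).congr fun e he => by
      have := hbalance e he
      omega)
    (fun e he => by have := hbalance e he; omega)
  refine ⟨w, hw1, hw2, fun j => ?_, ?_⟩
  · rw [effC_lab, effC_lab, effC_lab, ← sum_count_mul hw2, ← sum_count_mul hupT,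
      ← sum_count_mul hdownT, ← Finset.sum_sub_distrib, ← Finset.sum_sub_distrib]
    refine Finset.sum_congr rfl fun e he => ?_
    have := hbalance e he
    have h2 : ((φ e - up.count e - down.count e : ℕ) : ℤ) =
        (φ e : ℤ) - up.count e - down.count e := by omega
    rw [hw3 e he, h2]; ring
  · rw [length_eq_sum_count hw2]
    exact Finset.sum_le_sum fun e he => by rw [hw3 e he]; omega

/-- Pumping up, balancing and pumping down is legal on a place. -/
theorem legC_pumped {j : P} {n D m c c0 : ℕ} {up w s down conn : List (Tr P)} {u₀ v₀ u₁ v₁ : ℤ}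
    (hup : ∀ t ∈ up, TrBd n t) (hw : ∀ t ∈ w, TrBd n t) (hs : ∀ t ∈ s, TrBd n t)
    (hdown : ∀ t ∈ down, TrBd n t) (hconn : ∀ t ∈ conn, TrBd n t)
    (hupD : up.length ≤ D) (hdownD : down.length ≤ D) (hwm : w.length * n ≤ m)
    (hsm : s.length * n ≤ m) (hconn1 : conn.length ≤ 1)
    (hweff : effC j w = c * (v₀ - u₀) - effC j up - effC j down)
    (hseff : effC j s = (v₁ - effC j conn - u₁) + c0 * (v₀ - u₀))
    (hu₀ : 0 ≤ u₀) (hv₀ : 0 ≤ v₀) (hu₁ : 0 ≤ u₁) (hv₁ : 0 ≤ v₁)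
    (hA : (u₀ = 0 ∧ LegC j u₁ up ∧ 1 ≤ effC j up) ∨ 1 ≤ u₀)
    (hB : (v₀ = 0 ∧ LegC j (v₁ - effC j conn - effC j down) down ∧ effC j down ≤ -1 ∧
      LegC j (v₁ - effC j conn) conn) ∨ 1 ≤ v₀)
    (hc : D * n + 1 ≤ c) (hc0 : 2 * n + D * n ≤ c0) :
    LegC j (u₁ + (c0 + m * c : ℕ) * u₀) (pow m up ++ (pow m w ++ (s ++ (pow m down ++ conn)))) := by
  have hDup : (up.length : ℤ) * n ≤ D * n := by exact_mod_cast Nat.mul_le_mul_right n hupD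
  have hDdown : (down.length : ℤ) * n ≤ D * n := by exact_mod_cast Nat.mul_le_mul_right n hdownD
  have hCn : (conn.length : ℤ) * n ≤ n := by
    exact_mod_cast (Nat.mul_le_mul_right n hconn1).trans (by omega)
  have eup := abs_le.1 (abs_effC_le (j := j) hup)
  have edown := abs_le.1 (abs_effC_le (j := j) hdown)
  have econn := abs_le.1 (abs_effC_le (j := j) hconn)
  push_cast at eup edown econn
  have hc' : (D : ℤ) * n + 1 ≤ c := by exact_mod_cast hc
  have hc0' : 2 * (n : ℤ) + D * n ≤ c0 := by exact_mod_cast hc0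
  have hDn : (0 : ℤ) ≤ (D : ℤ) * n := by positivity
  have hcn : (0 : ℤ) ≤ c := by positivity
  have hc0n : (0 : ℤ) ≤ c0 := by positivity
  have hn0 : (0 : ℤ) ≤ n := by positivity
  have hcu : 0 ≤ (c : ℤ) * u₀ := by positivity
  have hcv : 0 ≤ (c : ℤ) * v₀ := by positivity
  have hc0u : 0 ≤ (c0 : ℤ) * u₀ := by positivity
  have hc0v : 0 ≤ (c0 : ℤ) * v₀ := by positivity
  obtain ⟨α, hα⟩ : ∃ α, α = c * u₀ + effC j up := ⟨_, rfl⟩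
  obtain ⟨β, hβ⟩ : ∃ β, β = c * v₀ - effC j down := ⟨_, rfl⟩
  have hα1 : 1 ≤ α := by
    rcases hA with ⟨h, -, h'⟩ | h
    · rw [hα]; omega
    · have : (c : ℤ) * 1 ≤ c * u₀ := mul_le_mul_of_nonneg_left h hcn
      omega
  have hβ1 : 1 ≤ β := by
    rcases hB with ⟨h, -, h', -⟩ | h
    · rw [hβ]; omega
    · have : (c : ℤ) * 1 ≤ c * v₀ := mul_le_mul_of_nonneg_left h hcn
      omega
  have hup' : effC j up = α - c * u₀ := by omega
  have hdown' : effC j down = c * v₀ - β := by omega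
  have hw' : effC j w = β - α := by rw [hweff, hup', hdown']; ring
  have hmα : ∀ t : ℕ, t ≤ m → (m : ℤ) ≤ (m - t) * α + t * β := by
    intro t ht
    have ht' : (t : ℤ) ≤ m := by exact_mod_cast ht
    have : (0 : ℤ) ≤ (m - t) * (α - 1) + t * (β - 1) :=
      add_nonneg (mul_nonneg (by omega) (by omega)) (mul_nonneg (by positivity) (by omega))
    linarith
  have hwm' : (w.length : ℤ) * n ≤ m := by exact_mod_cast hwm
  have hsm' : (s.length : ℤ) * n ≤ m := by exact_mod_cast hsm
  simp only [legC_append, effC_pow]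
  refine ⟨legC_pow fun t ht => ?_, legC_pow fun t ht => ?_, ?_, legC_pow fun t ht => ?_, ?_⟩
  · have ht' : (t : ℤ) + 1 ≤ m := by exact_mod_cast ht
    have h1 : u₁ + c0 * u₀ ≤ u₁ + (c0 + m * c : ℕ) * u₀ + t * effC j up := by
      rw [hup']; push_cast
      have h2 : 0 ≤ ((m : ℤ) - t) * (c * u₀) := mul_nonneg (by omega) hcu
      have h3 : 0 ≤ (t : ℤ) * α := mul_nonneg (by positivity) (by omega)
      linarith
    rcases hA with ⟨h, h', -⟩ | h
    · exact h'.mono (by omega)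
    · refine legC_of_large hup (le_trans ?_ h1)
      have : (c0 : ℤ) * 1 ≤ c0 * u₀ := mul_le_mul_of_nonneg_left h hc0n
      omega
  · refine legC_of_large hw (hwm'.trans ((hmα t ht.le).trans ?_))
    rw [hw', hup']; push_cast
    linarith
  · refine legC_of_large hs (hsm'.trans ((hmα m le_rfl).trans ?_))
    rw [hw', hup']; push_cast
    linarith
  · have ht' : (t : ℤ) + 1 ≤ m := by exact_mod_cast ht
    have h1 : v₁ - effC j conn + c0 * v₀ + β ≤ u₁ + (c0 + m * c : ℕ) * u₀ + m * effC j up +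
        m * effC j w + effC j s + t * effC j down := by
      rw [hw', hup', hseff, hdown']; push_cast
      have h2 : 0 ≤ ((m : ℤ) - t - 1) * β := mul_nonneg (by omega) (by omega)
      have h3 : 0 ≤ (t : ℤ) * (c * v₀) := mul_nonneg (by positivity) hcv
      linarith
    rcases hB with ⟨h, h', h'', -⟩ | h
    · refine h'.mono (le_trans ?_ h1)
      omega
    · refine legC_of_large hdown (le_trans ?_ h1)
      have : (c0 : ℤ) * 1 ≤ c0 * v₀ := mul_le_mul_of_nonneg_left h hc0n
      omega
  · have h1 : v₁ - effC j conn + c0 * v₀ ≤ u₁ + (c0 + m * c : ℕ) * u₀ + m * effC j up +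
        m * effC j w + effC j s + m * effC j down := by
      rw [hw', hup', hseff, hdown']; push_cast
      have h3 : 0 ≤ (m : ℤ) * (c * v₀) := mul_nonneg (by positivity) hcv
      linarith
    rcases hB with ⟨h, -, -, h'⟩ | h
    · refine h'.mono (le_trans ?_ h1)
      omega
    · refine legC_of_large hconn (le_trans ?_ h1)
      have : (c0 : ℤ) * 1 ≤ c0 * v₀ := mul_le_mul_of_nonneg_left h hc0n
      omega

/-- Flat places do not restrict walks. -/
theorem Flat.legC [DecidableEq (σ × Tr P × σ)] {T : Finset (σ × Tr P × σ)} {j : P} (h : Flat T j)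
    {p t : σ} {γ l : List (σ × Tr P × σ)} (hγ : Walk p γ p) (hT : ∀ e, e ∈ γ ↔ e ∈ T) {z : ℤ}
    (hleg : LegC j z (lab γ)) (hl : Walk p l t) (hlT : ∀ e ∈ l, e ∈ T) : LegC j z (lab l) := by
  have key : ∀ a e b, l = a ++ e :: b → (e.2.1.1 j : ℤ) ≤ z + effC j (lab a) := by
    intro a e b hab
    subst hab
    have he : e ∈ γ := (hT e).2 (hlT e (by simp))
    obtain ⟨a', b', rfl⟩ := List.append_of_mem he
    have hw := hl.src_of_append_cons
    have hw' := hγ.src_of_append_cons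
    have h1 : effC j (lab (a ++ e :: b')) = 0 :=
      h.walk (hw.1.append ⟨rfl, hw'.2⟩) (by
        intro f hf
        rw [List.mem_append] at hf
        rcases hf with hf | hf
        · exact hlT f (by simp [hf])
        · exact (hT f).1 (by simp [List.mem_cons.1 hf]))
    have h2 : effC j (lab (a' ++ e :: b')) = 0 := h.walk hγ fun f hf => (hT f).1 hf
    rw [lab_append, effC_append] at h1 h2
    rw [lab_append, legC_append, lab_cons, legC_cons] at hleg
    have := hleg.2.1
    omega
  clear hl hlT hleg
  induction l generalizing z with
  | nil => trivial
  | cons e l ih =>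
    refine ⟨by simpa using key [] e l rfl, ih fun a f b hab => ?_⟩
    have := key (e :: a) f b (by rw [hab]; rfl)
    have h2 : effC j (lab (e :: a)) = e.2.1.eff j + effC j (lab a) := rfl
    rw [h2] at this
    beta_reduce
    omega

end Power

section Perfect
variable {P : Type} [Fintype P]

/-- A pumpable piece with fully supported homogeneous solution can be executed from the marks of
all large enough combinations of the solutions. -/
theorem perfect_piece {S : Set (Tr P)} {n D c c0 m : ℕ} {X X' : P → ℤ} {π : Piece P}
    (hS : ∀ t ∈ S, TrBd n t)
    (hπ : GoodPiece S n X π X') (B : Finset P) (φ₀ φ₁ : PEdge P → ℕ) (u₀ v₀ u₁ u₁' : P → ℕ)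
    (hc₀ : Circ π.T (fun e => (φ₀ e : ℤ))) (hc₁ : Circ π.T (fun e => (φ₁ e : ℤ)))
    (hpos : ∀ e ∈ π.T, 1 ≤ φ₀ e)
    (hbal₀ : ∀ j, (v₀ j : ℤ) = u₀ j + ∑ e ∈ π.T, (φ₀ e : ℤ) * e.2.1.eff j)
    (hbal₁ : ∀ j, (u₁' j : ℤ) = u₁ j + ∑ e ∈ π.T, (φ₁ e : ℤ) * e.2.1.eff j + effC j π.conn)
    (hA : ∀ j ∈ π.A, u₀ j = 0 ∧ (u₁ j : ℤ) = X j) (hA' : ∀ j ∉ π.A, 1 ≤ u₀ j)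
    (hB : ∀ j ∈ B, v₀ j = 0 ∧ (u₁' j : ℤ) = X' j) (hB' : ∀ j ∉ B, 1 ≤ v₀ j)
    {up down : List (PEdge P)} (hup : up ⊆ π.γ) (hupw : Walk π.p up π.p) (hupD : up.length ≤ D)
    (hupj : ∀ j ∈ π.A, ¬ Flat π.T j → LegC j (X j) (lab up) ∧ 1 ≤ effC j (lab up))
    (hdown : down ⊆ π.γ) (hdownw : Walk π.p down π.p) (hdownD : down.length ≤ D)
    (hdownj : ∀ j ∈ B, ¬ Flat π.T j →
      LegC j (X j + effC j (lab π.γ) - effC j (lab down)) (lab down) ∧ effC j (lab down) ≤ -1)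
    (hc : 2 * D + n * (2 * n + 1) + D * n + 1 ≤ c)
    (hc0 : 2 * n + D * n + n * (2 * n + 1) ≤ c0)
    (hm₀ : (∑ e ∈ π.T, c * φ₀ e) * n ≤ m) (hm₁ : (∑ e ∈ π.T, (φ₁ e + c0 * φ₀ e)) * n ≤ m) :
    ∃ l, (∀ t ∈ l, t ∈ S) ∧ (∀ j, LegC j (u₁ j + (c0 + m * c : ℕ) * u₀ j) l) ∧
      (∀ j, (u₁ j : ℤ) + (c0 + m * c : ℕ) * u₀ j + effC j l = u₁' j + (c0 + m * c : ℕ) * v₀ j) ∧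
      l.length ≤ 2 * (m * D) + m * (∑ e ∈ π.T, c * φ₀ e) + 1 +
        ∑ e ∈ π.T, (φ₁ e + c0 * φ₀ e) := by
  have hTγ : ∀ e, e ∈ π.γ ↔ e ∈ π.T := fun e => by simp [Piece.T]
  have hγS : ∀ e ∈ π.γ, e.2.1 ∈ S := fun e he =>
    hπ.mem _ (List.mem_append_left _ (mem_lab.2 ⟨e, he, rfl⟩))
  have hconnS : ∀ t ∈ π.conn, TrBd n t := fun t ht => hS t (hπ.mem _ (List.mem_append_right _ ht))
  have hc1 : ∀ e ∈ π.T, c ≤ c * φ₀ e := fun e he => Nat.le_mul_of_pos_right c (hpos e he)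
  have hc2 : ∀ e ∈ π.T, c0 ≤ c0 * φ₀ e := fun e he => Nat.le_mul_of_pos_right c0 (hpos e he)
  have hupT : ∀ e ∈ up, e ∈ π.T := fun e he => (hTγ e).1 (hup he)
  have hdownT : ∀ e ∈ down, e ∈ π.T := fun e he => (hTγ e).1 (hdown he)
  obtain ⟨w, hw1, hw2, hweff, hwlen⟩ := exists_balancing_walk hπ.walk hTγ hπ.card
    (fun e => c * φ₀ e) ((hc₀.smul c).congr fun e he => by push_cast; ring) hupw hupT hdownw hdownT
    (fun e he => by have := hc1 e he; omega)
  obtain ⟨s, hs1, hs2, hseff, hslen⟩ := exists_balancing_walk (up := []) (down := [])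
    hπ.walk hTγ hπ.card
    (fun e => φ₁ e + c0 * φ₀ e) ((hc₁.add (hc₀.smul c0)).congr fun e he => by push_cast; ring)
    rfl (by simp) rfl (by simp)
    (fun e he => by have := hc2 e he; simp only [List.length_nil]; omega)
  replace hweff : ∀ j, effC j (lab w) =
      c * ((v₀ j : ℤ) - u₀ j) - effC j (lab up) - effC j (lab down) := by
    intro j
    rw [hweff, hbal₀ j, add_sub_cancel_left, Finset.mul_sum]
    simp only [Nat.cast_mul, mul_assoc]
  replace hseff : ∀ j, effC j (lab s) =
      (u₁' j - effC j π.conn - u₁ j) + c0 * ((v₀ j : ℤ) - u₀ j) := by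
    intro j
    rw [hseff, hbal₀ j, hbal₁ j]
    simp only [Nat.cast_mul, Nat.cast_add, add_mul, Finset.sum_add_distrib, mul_assoc,
      ← Finset.mul_sum, lab_nil, effC_nil]
    ring
  have bd : ∀ l : List (PEdge P), (∀ e ∈ l, e ∈ π.T) → ∀ t ∈ lab l, TrBd n t := by
    intro l hl t ht
    obtain ⟨e, he, rfl⟩ := mem_lab.1 ht
    exact hS _ (hγS e ((hTγ e).2 (hl e he)))
  have hwn : w.length * n ≤ m := (Nat.mul_le_mul_right n hwlen).trans hm₀
  have hsn : s.length * n ≤ m := (Nat.mul_le_mul_right n hslen).trans hm₁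
  set g := pow m up ++ (pow m w ++ (s ++ pow m down)) with hg
  have hgT : ∀ e ∈ g, e ∈ π.T := by
    intro e he
    simp only [hg, List.mem_append] at he
    rcases he with he | he | he | he
    exacts [hupT e (mem_pow he), hw2 e (mem_pow he), hs2 e he, hdownT e (mem_pow he)]
  have hgw : Walk π.p g π.p := (hupw.pow m).append ((hw1.pow m).append (hs1.append (hdownw.pow m)))
  have hgeff : ∀ j, effC j (lab g) = (u₁' j - effC j π.conn - u₁ j) +
      (c0 + m * c : ℕ) * ((v₀ j : ℤ) - u₀ j) := by
    intro j
    simp only [hg, lab_append, effC_append, lab_pow, effC_pow, hweff, hseff]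
    push_cast; ring
  refine ⟨lab g ++ π.conn, ?_, fun j => ?_, fun j => ?_, ?_⟩
  · intro t ht
    rcases List.mem_append.1 ht with ht | ht
    · obtain ⟨e, he, rfl⟩ := mem_lab.1 ht
      exact hγS e ((hTγ e).2 (hgT e he))
    · exact hπ.mem _ (List.mem_append_right _ ht)
  · have hact := hπ.leg j
    rw [Piece.trs, legC_append] at hact
    have hX' : X' j = X j + effC j (lab π.γ) + effC j π.conn := by
      rw [hπ.eff]; simp [Piece.trs, add_assoc]
    by_cases hcase : Flat π.T j ∧ j ∈ π.A
    · obtain ⟨hfl, hj⟩ := hcase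
      obtain ⟨h1, h2⟩ := hA j hj
      have h3 : effC j (lab g) = 0 := hfl.walk hgw hgT
      have h4 : effC j (lab π.γ) = 0 := hfl.walk hπ.walk fun e he => (hTγ e).1 he
      rw [legC_append, h1, h2, h3]
      rw [h4] at hact
      simp only [Nat.cast_zero, mul_zero, add_zero] at hact ⊢
      exact ⟨hfl.legC hπ.walk hTγ hact.1 hgw hgT, hact.2⟩
    · have hA2 : ((u₀ j : ℤ) = 0 ∧ LegC j (u₁ j) (lab up) ∧ 1 ≤ effC j (lab up)) ∨
          (1 : ℤ) ≤ u₀ j := by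
        by_cases hj : j ∈ π.A
        · have hfl : ¬ Flat π.T j := fun h => hcase ⟨h, hj⟩
          obtain ⟨h1, h2⟩ := hA j hj
          exact Or.inl ⟨by exact_mod_cast h1, by rw [h2]; exact hupj j hj hfl⟩
        · exact Or.inr (by exact_mod_cast hA' j hj)
      have hB2 : ((v₀ j : ℤ) = 0 ∧
          LegC j (u₁' j - effC j π.conn - effC j (lab down)) (lab down) ∧
          effC j (lab down) ≤ -1 ∧ LegC j (u₁' j - effC j π.conn) π.conn) ∨ (1 : ℤ) ≤ v₀ j := by
        by_cases hj : j ∈ B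
        · obtain ⟨h1, h2⟩ := hB j hj
          have hfl : ¬ Flat π.T j := by
            intro h
            have h0 := h.circ hc₀
            have h1' := hbal₀ j
            have hjA : j ∉ π.A := fun h' => hcase ⟨h, h'⟩
            have := hA' j hjA
            rw [h0] at h1'
            omega
          obtain ⟨h3, h4⟩ := hdownj j hj hfl
          refine Or.inl ⟨by exact_mod_cast h1, ?_, h4, ?_⟩
          · rw [h2, hX']; convert h3 using 1; ring
          · rw [h2, hX']; convert hact.2 using 1; ring
        · exact Or.inr (by exact_mod_cast hB' j hj)
      have := legC_pumped (bd up hupT) (bd w hw2) (bd s hs2) (bd down hdownT) hconnS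
        (by simpa using hupD) (by simpa using hdownD) (by simpa using hwn) (by simpa using hsn)
        hπ.conn (hweff j) (hseff j) (by positivity) (by positivity) (by positivity) (by positivity)
        hA2 hB2 (by omega) (by omega)
      simpa only [hg, lab_append, lab_pow, List.append_assoc] using this
  · rw [effC_append, hgeff]; push_cast; ring
  · have h1 := hπ.conn
    have h2 : m * up.length ≤ m * D := Nat.mul_le_mul_left m hupD
    have h3 : m * down.length ≤ m * D := Nat.mul_le_mul_left m hdownD
    have h4 : m * w.length ≤ m * ∑ e ∈ π.T, c * φ₀ e := Nat.mul_le_mul_left m hwlen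
    have h5 : s.length ≤ ∑ e ∈ π.T, (φ₁ e + c0 * φ₀ e) := hslen
    simp only [hg, List.length_append, length_lab, length_pow]
    refine le_trans (le_of_eq ?_) (Nat.add_le_add (Nat.add_le_add (Nat.add_le_add
      (Nat.add_le_add h2 h3) h4) h1) h5) |>.trans (le_of_eq ?_) <;> ring

end Perfect

end

section

section Reduce
variable {P σ : Type}

/-- The Parikh image of a closed walk. -/
theorem Walk.exists_count [DecidableEq (σ × Tr P × σ)] {p : σ} {γ : List (σ × Tr P × σ)}
    (h : Walk p γ p) {T : Finset (σ × Tr P × σ)} (hT : ∀ e ∈ γ, e ∈ T) :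
    ∃ φ : σ × Tr P × σ → ℕ, Circ T (fun e => (φ e : ℤ)) ∧
      (∀ j, effC j (lab γ) = ∑ e ∈ T, (φ e : ℤ) * e.2.1.eff j) ∧ (∀ e ∈ γ, φ e ≠ 0) ∧
      ∀ T' ⊆ T, γ.countP (fun e => e ∉ T') = ∑ e ∈ T \ T', φ e := by
  refine ⟨fun e => γ.count e, h.circ hT, fun j => by rw [effC_lab, ← sum_count_mul hT],
    fun e he => (List.count_pos_iff.2 he).ne', fun T' hT' => ?_⟩
  rw [List.countP_eq_length_filter, length_eq_sum_count (T := T \ T')]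
  · refine Finset.sum_congr rfl fun e he => ?_
    rw [List.count_filter]
    simpa using (Finset.mem_sdiff.1 he).2
  · intro e he
    rw [List.mem_filter] at he
    exact Finset.mem_sdiff.2 ⟨hT e he.1, by simpa using he.2⟩

theorem Circ.extend [DecidableEq (σ × Tr P × σ)] {T T' : Finset (σ × Tr P × σ)} (hT : T' ⊆ T)
    {φ : σ × Tr P × σ → ℤ} (h : Circ T' φ) : Circ T (fun e => if e ∈ T' then φ e else 0) := by
  intro f
  refine ((Finset.sum_subset hT fun e _ he => ?_).symm.trans
    (Finset.sum_congr rfl fun e he => ?_)).trans (h f)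
  · simp only [if_neg he, zero_mul]
  · simp only [if_pos he]

/-- Removing the edges outside of the support of the homogeneous solutions decreases the cycle
space. -/
theorem cycleSpace_lt_of_max [DecidableEq (σ × Tr P × σ)] {k : ℕ}
    {T : ℕ → Finset (σ × Tr P × σ)} {S : ℕ → P → Prop} {φ₀ : ℕ → σ × Tr P × σ → ℕ}
    {u₀ : ℕ → P → ℕ} (h₀ : MarkSol k T S 0 0 φ₀ u₀)
    (hmax : ∀ φ u, MarkSol k T S 0 0 φ u → ∀ i < k, ∀ e ∈ T i, φ i e ≠ 0 → φ₀ i e ≠ 0)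
    {i : ℕ} (hi : i < k) {e : σ × Tr P × σ} (he0 : φ₀ i e = 0) {p : σ}
    {γ : List (σ × Tr P × σ)} (hγ : Walk p γ p) (hT : ∀ e ∈ γ, e ∈ T i) (heγ : e ∈ γ) :
    cycleSpace ((T i).filter fun e => φ₀ i e ≠ 0) < cycleSpace (T i) := by
  refine lt_of_le_of_ne (cycleSpace_mono (Finset.filter_subset _ _)) fun heq => ?_
  set T' := (T i).filter fun e => φ₀ i e ≠ 0 with hT'
  have hsub : T' ⊆ T i := Finset.filter_subset _ _
  obtain ⟨κ, hκ1, -, hκ3, -⟩ := hγ.exists_count hT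
  have hmem := mem_cycleSpace_of_circ hκ1
  rw [← heq] at hmem
  obtain ⟨D, ψ, χ, hD, hψ, hχ, hDw⟩ := mem_cycleSpace hmem
  replace hDw : ∀ j, (D : ℤ) * ∑ e ∈ T i, (κ e : ℤ) * e.2.1.eff j =
      ∑ e ∈ T', ((ψ e : ℤ) - χ e) * e.2.1.eff j := fun j => by exact_mod_cast hDw j
  set N := ∑ e ∈ T', ψ e with hN
  have hle : ∀ f ∈ T', ψ f ≤ N * φ₀ i f := by
    intro f hf
    have h1 : ψ f ≤ N := Finset.single_le_sum (f := ψ) (fun _ _ => Nat.zero_le _) hf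
    have h2 : φ₀ i f ≠ 0 := (Finset.mem_filter.1 hf).2
    exact h1.trans (Nat.le_mul_of_pos_right N (Nat.pos_of_ne_zero h2))
  set ρ : σ × Tr P × σ → ℕ := fun f =>
    N * φ₀ i f + D * κ f + (if f ∈ T' then χ f else 0) - if f ∈ T' then ψ f else 0 with hρ
  have hρ' : ∀ f, (ρ f : ℤ) = N * φ₀ i f + (D * κ f + ((if f ∈ T' then (χ f : ℤ) else 0) -
      if f ∈ T' then (ψ f : ℤ) else 0)) := by
    intro f
    simp only [hρ]
    split_ifs with h
    · have := hle f h
      rw [Nat.cast_sub (by omega)]; push_cast; ring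
    · simp
  refine hmax (fun l => if l = i then ρ else fun f => N * φ₀ l f) (fun l j => N * u₀ l j) ⟨?_, ?_, ?_⟩
    i hi e (hT e heγ) ?_ he0
  · intro l hl
    by_cases h : l = i
    · subst h
      simp only [if_true]
      exact (((h₀.circ l hl).smul N).add ((hκ1.smul D).add
        ((hχ.extend hsub).sub (hψ.extend hsub)))).congr fun f _ => (hρ' f).symm
    · simp only [if_neg h]
      exact ((h₀.circ l hl).smul N).congr fun f _ => by push_cast; ring
  · intro l hl j
    have hb := h₀.bal l hl j
    simp only [Pi.zero_apply, add_zero] at hb ⊢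
    push_cast
    rw [hb]
    by_cases h : l = i
    · subst h
      simp only [if_true, hρ', add_mul, sub_mul, Finset.sum_add_distrib, Finset.sum_sub_distrib,
        mul_assoc, ← Finset.mul_sum]
      have hext : ∀ ψ : σ × Tr P × σ → ℕ, ∑ f ∈ T l, (if f ∈ T' then (ψ f : ℤ) else 0) * f.2.1.eff j =
          ∑ f ∈ T', (ψ f : ℤ) * f.2.1.eff j := by
        intro ψ
        rw [← Finset.sum_subset hsub]
        · exact Finset.sum_congr rfl fun e he => by rw [if_pos he]
        · intro e _ he; rw [if_neg he, zero_mul]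
      rw [hext, hext, hDw j]
      simp only [sub_mul, Finset.sum_sub_distrib]
      ring
    · simp only [if_neg h]
      push_cast
      simp only [mul_assoc, ← Finset.mul_sum]
      ring
  · intro l hl j hS
    have := h₀.spec l hl j hS
    simp only [Pi.zero_apply] at this ⊢
    push_cast; rw [this, mul_zero]
  · have h1 : e ∉ T' := fun h => (Finset.mem_filter.1 h).2 he0
    simp only [if_true, hρ, if_neg h1, he0]
    have := Nat.mul_pos hD (Nat.pos_of_ne_zero (hκ3 e heγ))
    omega

variable [Fintype P]

theorem Good.replace {S : Set (Tr P)} {n m : ℕ} {x y v w : P → ℤ} {L R Ξ : List (Piece P)}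
    (hL : Good S n x L v) (hΞ : Good S m v Ξ w) (hR : Good S n w R y) (h : n ≤ m) :
    Good S m x (L ++ Ξ ++ R) y :=
  good_append.2 ⟨w, good_append.2 ⟨v, hL.mono h, hΞ⟩, hR.mono h⟩

/-- A piece decomposed into phases is replaced by smaller pieces. -/
theorem GoodPiece.exists_of_phases {S : Set (Tr P)} {n W : ℕ} {u v : P → ℤ} {π : Piece P}
    (h : GoodPiece S n u π v) (J : Finset P) (hJ : ∀ j ∈ J, ¬ Flat π.T j) (hJne : J.Nonempty)
    (L : List (List (PEdge P))) (hL : L.flatten = π.γ)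
    (hLW : ∀ m ∈ L, ∃ j ∈ J, ∀ c d e, m = c ++ d ++ e → |effC j (lab d)| ≤ W) :
    ∃ Ξ, Good S (n * (2 * W + 1)) u Ξ v ∧ Ξ.length ≤ L.length * (n * (2 * W + 1)) + 1 ∧
      ∀ π' ∈ Ξ, cycleSpace π'.T < cycleSpace π.T := by
  have hTγ : ∀ e ∈ π.γ, e ∈ π.T := fun e he => by simpa [Piece.T] using he
  have hS : ∀ e ∈ π.T, e.2.1 ∈ S := fun e he =>
    h.mem _ (List.mem_append_left _ (mem_lab.2 ⟨e, by simpa [Piece.T] using he, rfl⟩))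
  obtain ⟨Ξ, h1, h2, h3⟩ := pieces_of_phases S n W π.T h.card hS L π.p π.p u
    (by rw [hL]; exact h.walk) (by rw [hL]; exact hTγ) h.nonneg
    (fun j => by rw [hL]; exact (legC_append.1 (h.leg j)).1)
    (fun m hm => by
      obtain ⟨j, hj, hj'⟩ := hLW m hm
      exact ⟨j, hJ j hj, hj'⟩)
  rw [hL] at h1
  refine ⟨_, h.replace h1, by simp [h2], fun π' hπ' => ?_⟩
  rcases List.mem_append.1 hπ' with hπ' | hπ'
  · exact h3 π' hπ'
  · rw [List.mem_singleton.1 hπ']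
    obtain ⟨j, hj⟩ := hJne
    refine lt_of_le_of_ne (cycleSpace_mono (by simp [Piece.T])) fun heq => hJ j hj fun w hw => ?_
    rw [← heq] at hw
    exact cycleSpace_apply_eq_zero (fun _ => 0) j (by simp [Piece.T]) hw

/-- A piece is replaced by pieces avoiding rarely used edges. -/
theorem GoodPiece.exists_of_rare {S : Set (Tr P)} {n M : ℕ} {u v : P → ℤ} {π : Piece P}
    (h : GoodPiece S n u π v) (T' : Finset (PEdge P)) (hT' : T' ⊆ π.T)
    (hlt : cycleSpace T' < cycleSpace π.T) (hM : π.γ.countP (fun e => e ∉ T') ≤ M) :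
    ∃ Ξ, Good S n u Ξ v ∧ Ξ.length ≤ (M + 1) * n + M + 1 ∧
      ∀ π' ∈ Ξ, cycleSpace π'.T < cycleSpace π.T := by
  have hS : ∀ e ∈ π.γ, e.2.1 ∈ S := fun e he =>
    h.mem _ (List.mem_append_left _ (mem_lab.2 ⟨e, he, rfl⟩))
  obtain ⟨Ξ, h1, h2, h3⟩ := exists_pieces_avoiding S n T' ((Finset.card_le_card hT').trans h.card)
    M π.p π.p π.γ u h.walk hS (fun e he => hS e (by simpa [Piece.T] using hT' he)) hM h.nonneg
    (fun j => (legC_append.1 (h.leg j)).1)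
  refine ⟨_, h.replace h1, by simpa using h2, fun π' hπ' => ?_⟩
  refine lt_of_le_of_lt (cycleSpace_mono ?_) hlt
  rcases List.mem_append.1 hπ' with hπ' | hπ'
  · exact h3 π' hπ'
  · rw [List.mem_singleton.1 hπ']; simp [Piece.T]

end Reduce

end

section

/-- A legal run in `S` of length at most `N`. -/
def RunIn {P : Type} (S : Set (Tr P)) (N : ℕ) (x y : P → ℤ) : Prop :=
  ∃ l : List (Tr P), l.length ≤ N ∧ (∀ t ∈ l, t ∈ S) ∧ (∀ j, LegC j (x j) l) ∧
    ∀ j, x j + effC j l = y j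

theorem RunIn.trans {P : Type} {S : Set (Tr P)} {M N : ℕ} {x y z : P → ℤ} (h : RunIn S M x y)
    (h' : RunIn S N y z) : RunIn S (M + N) x z := by
  obtain ⟨l, h1, h2, h3, h4⟩ := h
  obtain ⟨l', h1', h2', h3', h4'⟩ := h'
  refine ⟨l ++ l', by simp; omega, ?_, fun j => legC_append.2 ⟨h3 j, by rw [h4]; exact h3' j⟩,
    fun j => by rw [effC_append, ← add_assoc, h4, h4']⟩
  intro t ht
  rcases List.mem_append.1 ht with h | h
  exacts [h2 t h, h2' t h]

theorem RunIn.mono {P : Type} {S : Set (Tr P)} {M N : ℕ} {x y : P → ℤ} (h : RunIn S M x y)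
    (hMN : M ≤ N) : RunIn S N x y := by
  obtain ⟨l, h1, h2⟩ := h
  exact ⟨l, h1.trans hMN, h2⟩

/-- The rank of the sequence of pieces can be decreased by refining the piece `π`. -/
def Refines {P : Type} [Fintype P] (π : Piece P) (Ξ : List (Piece P)) : Prop :=
  (∃ j, ∃ hj : j ∉ π.A, Ξ = [{ π with A := π.A.cons j hj }]) ∨
    ∀ π' ∈ Ξ, cycleSpace π'.T < cycleSpace π.T

section Step
variable {P : Type} [Fintype P]

/-- The marks used by the actual execution. -/
theorem Good.exists_markSol {S : Set (Tr P)} {n : ℕ} {Ξ : ℕ → Piece P} {X : ℕ → P → ℤ} {k : ℕ}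
    (h : ∀ i < k, GoodPiece S n (X i) (Ξ i) (X (i + 1))) (hX : ∀ i ≤ k, ∀ j, 0 ≤ X i j)
    (Sp : ℕ → P → Prop) :
    ∃ φ, MarkSol k (fun i => (Ξ i).T) Sp (fun i j => effC j (Ξ i).conn) X φ
      (fun i j => (X i j).toNat) ∧
      ∀ i < k, ∀ T' ⊆ (Ξ i).T, (Ξ i).γ.countP (fun e => e ∉ T') = ∑ e ∈ (Ξ i).T \ T', φ i e := by
  have hT : ∀ i, ∀ e ∈ (Ξ i).γ, e ∈ (Ξ i).T := fun i e he => by simpa [Piece.T] using he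
  have key : ∀ i, ∃ φ : PEdge P → ℕ, i < k → Circ (Ξ i).T (fun e => (φ e : ℤ)) ∧
      (∀ j, effC j (lab (Ξ i).γ) = ∑ e ∈ (Ξ i).T, (φ e : ℤ) * e.2.1.eff j) ∧
      (∀ e ∈ (Ξ i).γ, φ e ≠ 0) ∧
      ∀ T' ⊆ (Ξ i).T, (Ξ i).γ.countP (fun e => e ∉ T') = ∑ e ∈ (Ξ i).T \ T', φ e := by
    intro i
    by_cases hi : i < k
    · obtain ⟨φ, hφ⟩ := (h i hi).walk.exists_count (hT i)
      exact ⟨φ, fun _ => hφ⟩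
    · exact ⟨0, fun h => absurd h hi⟩
  choose φ hφ using key
  refine ⟨φ, ⟨fun i hi => (hφ i hi).1, fun i hi j => ?_, fun i hi j _ => ?_⟩,
    fun i hi => (hφ i hi).2.2.2⟩
  · rw [Int.toNat_of_nonneg (hX i hi.le j), Int.toNat_of_nonneg (hX (i + 1) hi j),
      ← (hφ i hi).2.1 j, (h i hi).eff]
    simp [Piece.trs, add_assoc]
  · exact Int.toNat_of_nonneg (hX i hi j)

end Step

theorem exists_reduction : ∃ F : ℕ → ℕ, AckBd F ∧ ∀ (n : ℕ) (P : Type) [Fintype P],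
    Fintype.card P ≤ n → ∀ S : Set (Tr P), (∀ t ∈ S, TrBd n t) → ∀ x y : P → ℤ,
    (∀ j, 0 ≤ x j ∧ x j ≤ n) → (∀ j, 0 ≤ y j ∧ y j ≤ n) → ∀ Ξ : List (Piece P), Ξ.length ≤ n →
    Good S n x Ξ y → RunIn S (F n) x y ∨
      ∃ L π R Ξ', Ξ = L ++ π :: R ∧ Good S (F n) x (L ++ Ξ' ++ R) y ∧
        (L ++ Ξ' ++ R).length ≤ F n ∧ Refines π Ξ' := by
  obtain ⟨a, H⟩ := exists_max_mark
  obtain ⟨A, hA⟩ : ∃ A : ℕ → ℕ, A = _root_.ack a := ⟨_, rfl⟩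
  obtain ⟨W, hW⟩ : ∃ W : ℕ → ℕ,
    W = fun n => covBound ((2 * n) * (2 * n) + 2 * n + 1) (2 * n) (2 * n) := ⟨_, rfl⟩
  obtain ⟨D, hD⟩ : ∃ D : ℕ → ℕ, D = fun n => W n + 2 * n := ⟨_, rfl⟩
  obtain ⟨c, hc⟩ : ∃ c : ℕ → ℕ, c = fun n => 2 * D n + n * (2 * n + 1) + D n * n + 1 := ⟨_, rfl⟩
  obtain ⟨c0, hc0⟩ : ∃ c : ℕ → ℕ, c = fun n => 2 * n + D n * n + n * (2 * n + 1) := ⟨_, rfl⟩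
  obtain ⟨s0, hs0⟩ : ∃ s : ℕ → ℕ, s = fun n => n * (c n * A n) := ⟨_, rfl⟩
  obtain ⟨s1, hs1⟩ : ∃ s : ℕ → ℕ, s = fun n => n * (A n + c0 n * A n) := ⟨_, rfl⟩
  obtain ⟨m, hm⟩ : ∃ m : ℕ → ℕ, m = fun n => (s0 n + s1 n) * n := ⟨_, rfl⟩
  obtain ⟨V, hV⟩ : ∃ V : ℕ → ℕ, V = fun n => 2 * n * (2 * W n + 1) := ⟨_, rfl⟩
  obtain ⟨M, hM⟩ : ∃ M : ℕ → ℕ, M = fun n => n * A n := ⟨_, rfl⟩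
  obtain ⟨E, hE⟩ : ∃ E : ℕ → ℕ,
    E = fun n => 2 * (m n * D n) + m n * s0 n + 1 + s1 n := ⟨_, rfl⟩
  have bi := AckBd.id
  have bc := AckBd.const
  have bA : AckBd A := hA ▸ AckBd.ack a
  have bW : AckBd W := by
    have := (ackBd_covBound (b := fun n => n * n + n + 1)
      (((bi.mul bi).add bi).add (bc 1))).comp ((bc 2).mul bi)
    rwa [hW]
  have bD : AckBd D := hD ▸ bW.add ((bc 2).mul bi)
  have bq : AckBd (fun n => n * (2 * n + 1)) := bi.mul (((bc 2).mul bi).add (bc 1))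
  have bcc : AckBd c := hc ▸ ((((bc 2).mul bD).add bq).add (bD.mul bi)).add (bc 1)
  have bc0 : AckBd c0 := hc0 ▸ (((bc 2).mul bi).add (bD.mul bi)).add bq
  have bs0 : AckBd s0 := hs0 ▸ bi.mul (bcc.mul bA)
  have bs1 : AckBd s1 := hs1 ▸ bi.mul (bA.add (bc0.mul bA))
  have bm : AckBd m := hm ▸ (bs0.add bs1).mul bi
  have bV : AckBd V := hV ▸ ((bc 2).mul bi).mul (((bc 2).mul bW).add (bc 1))
  have bM : AckBd M := hM ▸ bi.mul bA
  have bE : AckBd E := hE ▸ ((((bc 2).mul (bm.mul bD)).add (bm.mul bs0)).add (bc 1)).add bs1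
  refine ⟨fun n => n * E n + ((M n + 1) * n + M n) + (V n + 2 * n * V n) + A n + (n + 1),
    ((((bi.mul bE).add (((bM.add (bc 1)).mul bi).add bM)).add
      (bV.add (((bc 2).mul bi).mul bV))).add bA).add (bi.add (bc 1)), ?_⟩
  intro n P _ hP S hS x y hx hy Ξ hk hΞ
  beta_reduce
  obtain ⟨X, hX0, hXk, hX⟩ := hΞ.exists_marks
  set Q : ℕ → Piece P := fun i => Ξ.getD i ⟨0, [], ∅, []⟩ with hQ
  set k := Ξ.length with hkdef
  have hQi : ∀ i (hi : i < k), Q i = Ξ[i] := fun i hi => by simp [hQ, ← hkdef, hi]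
  have hG : ∀ i < k, GoodPiece S n (X i) (Q i) (X (i + 1)) := fun i hi => by
    rw [hQi i hi]; exact hX i hi
  have hXnn : ∀ i ≤ k, ∀ j, 0 ≤ X i j := by
    intro i hi j
    rcases hi.lt_or_eq with hi | rfl
    · exact (hG i hi).nonneg j
    · rw [hXk]; exact (hy j).1
  have hsplit : ∀ i < k, ∃ L R, Ξ = L ++ Q i :: R ∧ Good S n x L (X i) ∧
      Good S n (X (i + 1)) R y := fun i hi => by
    rw [hQi i hi]; exact Good.split_at hX0 hXk hX i hi
  set Sp : ℕ → P → Prop := fun i j => i = 0 ∨ i = k ∨ j ∈ (Q i).A with hSp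
  obtain ⟨φ, hφ, hcount⟩ := Good.exists_markSol hG hXnn Sp
  have hbdT : ∀ i < k, ∀ e ∈ (Q i).T, e.2.1 ∈ S := fun i hi e he =>
    (hG i hi).mem _ (List.mem_append_left _ (mem_lab.2 ⟨e, by simpa [Piece.T] using he, rfl⟩))
  obtain ⟨φ₀, u₀, hz, hφ₀A, hu₀A, hmax, hred⟩ := H n P ℕ hP k hk (fun i => (Q i).T) Sp
    (fun i hi => (hG i hi).card) (fun i hi e he => hS _ (hbdT i hi e he))
  obtain ⟨φ₁, u₁, hz₁, hφ₁, hu₁, hφ₁A, hu₁A⟩ := hred _ X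
    (fun i hi j => by
      refine (abs_effC_le fun t ht => hS t ((hG i hi).mem _ (List.mem_append_right _ ht))).trans ?_
      exact_mod_cast (Nat.mul_le_mul_right n (hG i hi).conn).trans (by omega))
    (fun i hi j hj => by
      rw [abs_of_nonneg (hXnn i hi j)]
      rcases hi.lt_or_eq with hi' | rfl
      · rcases hj with rfl | rfl | hj
        · rw [hX0]; exact (hx j).2
        · omega
        · exact (hG i hi').spec j hj
      · rw [hXk]; exact (hy j).2) φ _ hφ
  have hu₁X : ∀ i ≤ k, ∀ j, u₀ i j = 0 → (u₁ i j : ℤ) = X i j := fun i hi j hj => by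
    rw [(hu₁ i hi j).2 hj, Int.toNat_of_nonneg (hXnn i hi j)]
  rw [← hA] at hφ₀A hu₀A hφ₁A hu₁A
  -- an unspecified bounded mark
  by_cases hc1 : ∃ i < k, ∃ j, j ∉ (Q i).A ∧ u₀ i j = 0
  · obtain ⟨i, hi, j, hj, h0⟩ := hc1
    obtain ⟨L, R, hLR, hL, hR⟩ := hsplit i hi
    refine Or.inr ⟨L, Q i, R, [{ Q i with A := (Q i).A.cons j hj }], hLR, hL.replace ?_ hR ?_, ?_,
      Or.inl ⟨j, hj, rfl⟩⟩
    · refine ⟨_, ?_, rfl⟩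
      have h := (hG i hi)
      refine ⟨h.nonneg, h.walk, h.leg, h.mem, h.card.trans (by omega), h.conn, ?_, h.eff⟩
      intro j' hj'
      replace hj' : j' ∈ (Q i).A.cons j hj := hj'
      rcases Finset.mem_cons.1 hj' with rfl | hj'
      · rw [← hu₁X i hi.le j' h0]
        have := hu₁A i j'
        exact_mod_cast this.trans (by omega)
      · exact (h.spec j' hj').trans (by exact_mod_cast (by omega))
    · omega
    · have : k = L.length + R.length + 1 := by rw [hkdef, hLR]; simp; omega
      simp only [List.length_append, List.length_singleton]
      omega
  -- a rarely used edge
  by_cases hc2 : ∃ i < k, ∃ e ∈ (Q i).T, φ₀ i e = 0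
  · obtain ⟨i, hi, e, he, h0⟩ := hc2
    obtain ⟨L, R, hLR, hL, hR⟩ := hsplit i hi
    have heγ : e ∈ (Q i).γ := by simpa [Piece.T] using he
    have hlt := cycleSpace_lt_of_max hz (fun φ u h => (hmax φ u h).1) hi h0 (hG i hi).walk
      (fun e he => by simpa [Piece.T] using he) heγ
    have hcnt : (Q i).γ.countP (fun e => e ∉ (Q i).T.filter fun e => φ₀ i e ≠ 0) ≤ M n := by
      rw [hcount i hi _ (Finset.filter_subset _ _), hM]
      refine (Finset.sum_le_card_nsmul _ _ (A n) fun f hf => ?_).trans ?_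
      · rw [Finset.mem_sdiff, Finset.mem_filter] at hf
        have : φ₀ i f = 0 := by
          by_contra h
          exact hf.2 ⟨hf.1, h⟩
        rw [← (hφ₁ i hi f hf.1).2 this]
        exact hφ₁A i f
      · rw [smul_eq_mul]
        exact Nat.mul_le_mul_right _ ((Finset.card_le_card Finset.sdiff_subset).trans (hG i hi).card)
    obtain ⟨Ξ', h1, h2, h3⟩ := (hG i hi).exists_of_rare _ (Finset.filter_subset _ _) hlt hcnt
    refine Or.inr ⟨L, Q i, R, Ξ', hLR, (hL.replace h1 hR le_rfl).mono (by omega), ?_, Or.inr h3⟩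
    have : k = L.length + R.length + 1 := by rw [hkdef, hLR]; simp; omega
    simp only [List.length_append]
    omega
  have hphase : ∀ i < k, ∀ J : Finset P, (∀ j ∈ J, ¬ Flat (Q i).T j) → J.Nonempty →
      (∃ Ls : List (List (PEdge P)), Ls.length ≤ 2 * n ∧ Ls.flatten = (Q i).γ ∧ ∀ m ∈ Ls, ∃ j ∈ J,
        ∀ c d e, m = c ++ d ++ e → |effC j (lab d)| ≤ (W n : ℕ)) →
      ∃ L π R Ξ', Ξ = L ++ π :: R ∧
        Good S (n * E n + ((M n + 1) * n + M n) + (V n + 2 * n * V n) + A n + (n + 1)) x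
          (L ++ Ξ' ++ R) y ∧
        (L ++ Ξ' ++ R).length ≤
          n * E n + ((M n + 1) * n + M n) + (V n + 2 * n * V n) + A n + (n + 1) ∧
        Refines π Ξ' := by
    rintro i hi J hJ hJne ⟨Ls, hLs1, hLs2, hLs3⟩
    obtain ⟨L, R, hLR, hL, hR⟩ := hsplit i hi
    obtain ⟨Ξ', h1, h2, h3⟩ := (hG i hi).exists_of_phases J hJ hJne Ls hLs2 hLs3
    have hVn : n * (2 * W n + 1) ≤ V n := by
      rw [hV]; exact Nat.mul_le_mul_right _ (by omega)
    refine ⟨L, Q i, R, Ξ', hLR, hL.replace (h1.mono ?_) hR ?_, ?_, Or.inr h3⟩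
    · omega
    · omega
    · have : k = L.length + R.length + 1 := by rw [hkdef, hLR]; simp; omega
      have := Nat.mul_le_mul hLs1 hVn
      simp only [List.length_append]
      omega
  have hTγ : ∀ i, ∀ e ∈ (Q i).γ, e ∈ (Q i).T := fun i e he => by simpa [Piece.T] using he
  have hbd2 : ∀ i < k, ∀ e ∈ (Q i).T, TrBd (2 * n) e.2.1 := fun i hi e he =>
    (hS _ (hbdT i hi e he)).mono (by omega)
  have hDn : D n = W n + 2 * n := by rw [hD]
  have hWn : W n = covBound ((2 * n) * (2 * n) + 2 * n + 1) (2 * n) (2 * n) := by rw [hW]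
  have hcard : ∀ J : Finset P, J.card ≤ 2 * n := fun J =>
    (Finset.card_le_univ J).trans (hP.trans (by omega))
  -- no forward pumping
  by_cases hc3 : ∃ i < k, ¬ ∃ up, up ⊆ (Q i).γ ∧ Walk (Q i).p up (Q i).p ∧ (∀ j ∈ (Q i).A,
      ¬ Flat (Q i).T j → LegC j (X i j) (lab up) ∧ 1 ≤ effC j (lab up)) ∧ up.length ≤ D n
  · obtain ⟨i, hi, hno⟩ := hc3
    have := Classical.decPred fun j => ¬ Flat (Q i).T j
    set J := (Q i).A.filter fun j => ¬ Flat (Q i).T j with hJ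
    have hJ1 : ∀ j ∈ J, j ∈ (Q i).A ∧ ¬ Flat (Q i).T j := fun j hj => by simpa [hJ] using hj
    rcases J.eq_empty_or_nonempty with hJe | hJne
    · refine absurd ⟨[], by simp, rfl, fun j hj hfl => ?_, by simp⟩ hno
      have : j ∈ J := by rw [hJ, Finset.mem_filter]; exact ⟨hj, hfl⟩
      rw [hJe] at this
      simp at this
    rcases pump_or_phases (2 * n) (Q i).T ((hG i hi).card.trans (by omega)) J (hcard J) (Q i).p
      (Q i).γ (X i) (hG i hi).walk (hTγ i) (hbd2 i hi) (fun j _ => hXnn i hi.le j)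
      (fun j hj => ((hG i hi).spec j (hJ1 j hj).1).trans (by push_cast; omega))
      (fun j _ => (legC_append.1 ((hG i hi).leg j)).1) with ⟨up, h1, h2, h3, h4⟩ | h
    · refine absurd ⟨up, h1, h2, fun j hj hfl => h3 j ?_, by omega⟩ hno
      rw [hJ, Finset.mem_filter]
      exact ⟨hj, hfl⟩
    · rw [← hWn] at h
      exact Or.inr (hphase i hi J (fun j hj => (hJ1 j hj).2) hJne h)
  obtain ⟨B, hB⟩ : ∃ B : ℕ → Finset P,
      B = fun i => if i + 1 = k then Finset.univ else (Q (i + 1)).A := ⟨_, rfl⟩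
  have hBspec : ∀ i < k, ∀ j ∈ B i, Sp (i + 1) j := by
    intro i hi j hj
    rw [hB] at hj
    dsimp only at hj
    split_ifs at hj with h
    · exact Or.inr (Or.inl h)
    · exact Or.inr (Or.inr hj)
  have hXB : ∀ i < k, ∀ j ∈ B i, X (i + 1) j ≤ n := by
    intro i hi j hj
    rw [hB] at hj
    dsimp only at hj
    split_ifs at hj with h
    · rw [h, hXk]; exact (hy j).2
    · exact (hG (i + 1) (by omega)).spec j hj
  -- no backward pumping
  by_cases hc4 : ∃ i < k, ¬ ∃ down, down ⊆ (Q i).γ ∧ Walk (Q i).p down (Q i).p ∧ (∀ j ∈ B i,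
      ¬ Flat (Q i).T j → LegC j (X i j + effC j (lab (Q i).γ) - effC j (lab down)) (lab down) ∧
        effC j (lab down) ≤ -1) ∧ down.length ≤ D n
  · obtain ⟨i, hi, hno⟩ := hc4
    have := Classical.decPred fun j => ¬ Flat (Q i).T j
    set J := (B i).filter fun j => ¬ Flat (Q i).T j with hJ
    have hJ1 : ∀ j ∈ J, j ∈ B i ∧ ¬ Flat (Q i).T j := fun j hj => by simpa [hJ] using hj
    rcases J.eq_empty_or_nonempty with hJe | hJne
    · refine absurd ⟨[], by simp, rfl, fun j hj hfl => ?_, by simp⟩ hno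
      have : j ∈ J := by rw [hJ, Finset.mem_filter]; exact ⟨hj, hfl⟩
      rw [hJe] at this
      simp at this
    have hend : ∀ j ∈ J, X i j + effC j (lab (Q i).γ) ≤ (2 * n : ℕ) := by
      intro j hj
      have h1 := hXB i hi j (hJ1 j hj).1
      rw [(hG i hi).eff] at h1
      simp only [Piece.trs, effC_append] at h1
      have h2 := abs_le.1 (abs_effC_le (j := j)
        fun t ht => hS t ((hG i hi).mem _ (List.mem_append_right _ ht)))
      have h3 := Nat.mul_le_mul_right n (hG i hi).conn
      omega
    rcases pump_or_phases_backward (2 * n) (Q i).T ((hG i hi).card.trans (by omega)) J (hcard J)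
      (Q i).p (Q i).γ (X i) (hG i hi).walk (hTγ i) (hbd2 i hi) (fun j _ => hXnn i hi.le j) hend
      (fun j _ => (legC_append.1 ((hG i hi).leg j)).1) with ⟨down, h1, h2, h3, h4⟩ | h
    · refine absurd ⟨down, h1, h2, fun j hj hfl => h3 j ?_, by omega⟩ hno
      rw [hJ, Finset.mem_filter]
      exact ⟨hj, hfl⟩
    · rw [← hWn] at h
      exact Or.inr (hphase i hi J (fun j hj => (hJ1 j hj).2) hJne h)
  push Not at hc1 hc2 hc3 hc4
  -- everything is pumpable
  left
  obtain ⟨C, hC⟩ : ∃ C : ℕ, C = c0 n + m n * c n := ⟨_, rfl⟩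
  have hcn : c n = 2 * D n + n * (2 * n + 1) + D n * n + 1 := by rw [hc]
  have hc0n : c0 n = 2 * n + D n * n + n * (2 * n + 1) := by rw [hc0]
  have hs0n : s0 n = n * (c n * A n) := by rw [hs0]
  have hs1n : s1 n = n * (A n + c0 n * A n) := by rw [hs1]
  have hmn : m n = (s0 n + s1 n) * n := by rw [hm]
  have hEn : E n = 2 * (m n * D n) + m n * s0 n + 1 + s1 n := by rw [hE]
  have hstep : ∀ i < k, RunIn S (E n) (fun j => (u₁ i j : ℤ) + C * u₀ i j)
      (fun j => (u₁ (i + 1) j : ℤ) + C * u₀ (i + 1) j) := by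
    intro i hi
    obtain ⟨up, hu1, hu2, hu3, hu4⟩ := hc3 i hi
    obtain ⟨down, hd1, hd2, hd3, hd4⟩ := hc4 i hi
    have hsum0 : ∑ e ∈ (Q i).T, c n * φ₀ i e ≤ s0 n := by
      refine (Finset.sum_le_card_nsmul _ _ (c n * A n) fun e _ =>
        Nat.mul_le_mul_left _ (hφ₀A i e)).trans ?_
      rw [smul_eq_mul, hs0n]
      exact Nat.mul_le_mul_right _ (hG i hi).card
    have hsum1 : ∑ e ∈ (Q i).T, (φ₁ i e + c0 n * φ₀ i e) ≤ s1 n := by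
      refine (Finset.sum_le_card_nsmul _ _ (A n + c0 n * A n) fun e _ =>
        Nat.add_le_add (hφ₁A i e) (Nat.mul_le_mul_left _ (hφ₀A i e))).trans ?_
      rw [smul_eq_mul, hs1n]
      exact Nat.mul_le_mul_right _ (hG i hi).card
    obtain ⟨l, hl1, hl2, hl3, hl4⟩ := perfect_piece (c := c n) (c0 := c0 n) (m := m n) (D := D n)
      hS (hG i hi) (B i) (φ₀ i) (φ₁ i) (u₀ i) (u₀ (i + 1)) (u₁ i) (u₁ (i + 1))
      (hz.circ i hi) (hz₁.circ i hi)
      (fun e he => Nat.pos_of_ne_zero (hc2 i hi e he))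
      (fun j => by simpa using hz.bal i hi j) (hz₁.bal i hi)
      (fun j hj => by
        have h0 : u₀ i j = 0 := by simpa using hz.spec i hi.le j (Or.inr (Or.inr hj))
        exact ⟨h0, hu₁X i hi.le j h0⟩)
      (fun j hj => Nat.pos_of_ne_zero (hc1 i hi j hj))
      (fun j hj => by
        have h0 : u₀ (i + 1) j = 0 := by simpa using hz.spec (i + 1) hi j (hBspec i hi j hj)
        exact ⟨h0, hu₁X (i + 1) hi j h0⟩)
      (fun j hj => by
        rw [hB] at hj
        dsimp only at hj
        split_ifs at hj with h
        · simp at hj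
        · exact Nat.pos_of_ne_zero (hc1 (i + 1) (by omega) j hj))
      hu1 hu2 hu4 hu3 hd1 hd2 hd4 hd3 hcn.ge hc0n.ge
      ((Nat.mul_le_mul_right n hsum0).trans (by rw [hmn, add_mul]; omega))
      ((Nat.mul_le_mul_right n hsum1).trans (by rw [hmn, add_mul]; omega))
    rw [← hC] at hl2 hl3
    have := Nat.mul_le_mul_left (m n) hsum0
    exact ⟨l, by omega, hl1, hl2, hl3⟩
  have hall : ∀ i ≤ k, RunIn S (i * E n) (fun j => (u₁ 0 j : ℤ) + C * u₀ 0 j)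
      (fun j => (u₁ i j : ℤ) + C * u₀ i j) := by
    intro i
    induction i with
    | zero => exact fun _ => ⟨[], by simp, by simp, fun _ => trivial, by simp⟩
    | succ i ih =>
      intro hi
      rw [add_mul, one_mul]
      exact (ih (by omega)).trans (hstep i hi)
  have hend : ∀ i ≤ k, (∀ j, Sp i j) → (fun j => (u₁ i j : ℤ) + C * u₀ i j) = X i := by
    intro i hi hSpi
    funext j
    have h0 : u₀ i j = 0 := by simpa using hz.spec i hi j (hSpi j)
    rw [h0, hu₁X i hi j h0]
    simp
  have := hall k le_rfl
  rw [hend 0 (by omega) fun j => Or.inl rfl, hend k le_rfl fun j => Or.inr (Or.inl rfl), hX0,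
    hXk] at this
  have h1 := Nat.mul_le_mul_right (E n) hk
  exact this.mono (by omega)

end

section

section Rank
variable {P : Type} [Fintype P]

/-- The weight of the pieces whose cycle space has dimension `k`. -/
noncomputable def rank (k : ℕ) (Ξ : List (Piece P)) : ℕ :=
  (Ξ.map fun π => if Module.finrank ℚ (cycleSpace π.T) = k then 1 + (Fintype.card P - π.A.card)
    else 0).sum

theorem rank_append (k : ℕ) (Ξ Ξ' : List (Piece P)) :
    rank k (Ξ ++ Ξ') = rank k Ξ + rank k Ξ' := by simp [rank]

theorem rank_le (k : ℕ) (Ξ : List (Piece P)) : rank k Ξ ≤ Ξ.length * (Fintype.card P + 1) := by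
  induction Ξ with
  | nil => simp [rank]
  | cons π Ξ ih =>
    have : rank k (π :: Ξ) = (if Module.finrank ℚ (cycleSpace π.T) = k then
      1 + (Fintype.card P - π.A.card) else 0) + rank k Ξ := by simp [rank]
    rw [this, List.length_cons, add_mul]
    split_ifs <;> omega

theorem rank_eq_zero {k : ℕ} {Ξ : List (Piece P)}
    (h : ∀ π ∈ Ξ, Module.finrank ℚ (cycleSpace π.T) ≠ k) : rank k Ξ = 0 := by
  rw [rank, List.sum_eq_zero]
  intro a ha
  obtain ⟨π, hπ, rfl⟩ := List.mem_map.1 ha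
  rw [if_neg (h π hπ)]

theorem rank_update (k : ℕ) (π : Piece P) (B : Finset P) : rank k [{ π with A := B }] =
    if Module.finrank ℚ (cycleSpace π.T) = k then 1 + (Fintype.card P - B.card) else 0 :=
  List.sum_singleton

theorem rank_of_card_lt {k : ℕ} (Ξ : List (Piece P)) (hk : Fintype.card P < k) : rank k Ξ = 0 :=
  rank_eq_zero fun π _ => by
    have := Submodule.finrank_le (cycleSpace π.T)
    rw [Module.finrank_fintype_fun_eq_card] at this
    omega

/-- The ranks of `Ξ'` are lexicographically smaller, with the difference at level `k` or above. -/
def RankLT (k : ℕ) (Ξ' Ξ : List (Piece P)) : Prop :=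
  ∃ i ≥ k, rank i Ξ' < rank i Ξ ∧ ∀ l > i, rank l Ξ' = rank l Ξ

theorem Refines.rankLT {π : Piece P} {Ξ' : List (Piece P)} (h : Refines π Ξ')
    (L R : List (Piece P)) : RankLT 0 (L ++ Ξ' ++ R) (L ++ π :: R) := by
  have hr : ∀ k, rank k (L ++ π :: R) = rank k L + rank k [π] + rank k R := fun k => by
    rw [← List.singleton_append, ← List.append_assoc, rank_append, rank_append]
  have hr' : ∀ k, rank k (L ++ Ξ' ++ R) = rank k L + rank k Ξ' + rank k R := fun k => by
    rw [rank_append, rank_append]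
  refine ⟨Module.finrank ℚ (cycleSpace π.T), Nat.zero_le _, ?_, ?_⟩
  · rw [hr, hr']
    suffices rank (Module.finrank ℚ (cycleSpace π.T)) Ξ' <
      rank (Module.finrank ℚ (cycleSpace π.T)) [π] by omega
    rcases h with ⟨j, hj, rfl⟩ | h
    · have : (π.A.cons j hj).card ≤ Fintype.card P := Finset.card_le_univ _
      rw [Finset.card_cons] at this
      rw [rank_update, rank_update _ π π.A, if_pos rfl, if_pos rfl, Finset.card_cons]
      omega
    · rw [rank_eq_zero fun π' hπ' => (Submodule.finrank_lt_finrank_of_lt (h π' hπ')).ne]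
      simp [rank]
  · intro l hl
    rw [hr, hr']
    suffices rank l Ξ' = rank l [π] by omega
    rcases h with ⟨j, hj, rfl⟩ | h
    · rw [rank_update, rank_update _ π π.A, if_neg hl.ne, if_neg hl.ne]
    · rw [rank_eq_zero fun π' hπ' =>
        ((Submodule.finrank_lt_finrank_of_lt (h π' hπ')).trans hl).ne]
      rw [rank_eq_zero]
      simpa using hl.ne

end Rank

theorem ack_iterate_mono {a : ℕ} {s t : ℕ} (h : s ≤ t) (n : ℕ) :
    (ack a)^[s] n ≤ (ack a)^[t] n :=
  Function.monotone_iterate_of_id_le (fun n => (lt_ack_right a n).le) h n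

theorem exists_rank_bound : ∃ m : ℕ, ∀ (n : ℕ) (P : Type) [Fintype P],
    Fintype.card P ≤ n → ∀ S : Set (Tr P), (∀ t ∈ S, TrBd n t) → ∀ x y : P → ℤ,
    (∀ j, 0 ≤ x j ∧ x j ≤ n) → (∀ j, 0 ≤ y j ∧ y j ≤ n) → ∀ k N, n ≤ N → ∀ Ξ : List (Piece P),
    Ξ.length ≤ N → Good S N x Ξ y → RunIn S (ack (m + 3 * k) N) x y ∨
      ∃ Ξ', Ξ'.length ≤ ack (m + 3 * k) N ∧ Good S (ack (m + 3 * k) N) x Ξ' y ∧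
        RankLT k Ξ' Ξ := by
  obtain ⟨F, ⟨a, ha⟩, hF⟩ := exists_reduction
  obtain ⟨b, hb⟩ : AckBd fun N => N * (N + 1) + 1 + N :=
    ((AckBd.id.mul (AckBd.id.add (AckBd.const 1))).add (AckBd.const 1)).add AckBd.id
  refine ⟨a + b, ?_⟩
  intro n P _ hP S hS x y hx hy k
  induction k with
  | zero =>
    intro N hN Ξ hlen hΞ
    have hle : F N ≤ ack (a + b + 3 * 0) N := (ha N).trans (ack_mono_left _ (by omega))
    rcases hF N P (hP.trans hN) S (fun t ht => (hS t ht).mono hN) x y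
      (fun j => ⟨(hx j).1, (hx j).2.trans (by exact_mod_cast hN)⟩)
      (fun j => ⟨(hy j).1, (hy j).2.trans (by exact_mod_cast hN)⟩) Ξ hlen hΞ with
      h | ⟨L, π, R, Ξ', rfl, h1, h2, h3⟩
    · exact Or.inl (h.mono hle)
    · exact Or.inr ⟨_, h2.trans hle, h1.mono hle, h3.rankLT L R⟩
  | succ k ih =>
    intro N hN Ξ hlen hΞ
    obtain ⟨c, hc⟩ : ∃ c, c = a + b + 3 * k := ⟨_, rfl⟩
    rw [← hc] at ih
    have key : ∀ s M, n ≤ M → ∀ Ξ' : List (Piece P), Ξ'.length ≤ M → Good S M x Ξ' y →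
        (∀ l > k, rank l Ξ' = rank l Ξ) → rank k Ξ' ≤ s →
        RunIn S ((ack c)^[s + 1] M) x y ∨ ∃ Ξ'', Ξ''.length ≤ (ack c)^[s + 1] M ∧
          Good S ((ack c)^[s + 1] M) x Ξ'' y ∧ RankLT (k + 1) Ξ'' Ξ := by
      intro s
      induction s with
      | zero =>
        intro M hM Ξ' h1 h2 h3 h4
        rcases ih M hM Ξ' h1 h2 with h | ⟨Ξ'', h5, h6, i, hi, h7, h8⟩
        · exact Or.inl h
        · have : i ≠ k := by rintro rfl; omega
          exact Or.inr ⟨Ξ'', h5, h6, i, by omega, by rw [← h3 i (by omega)]; exact h7,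
            fun l hl => by rw [← h3 l (by omega)]; exact h8 l hl⟩
      | succ s ihs =>
        intro M hM Ξ' h1 h2 h3 h4
        have hle : ack c M ≤ (ack c)^[s + 1 + 1] M := by
          have := ack_iterate_mono (a := c) (show 1 ≤ s + 1 + 1 by omega) M
          simpa using this
        rcases ih M hM Ξ' h1 h2 with h | ⟨Ξ'', h5, h6, i, hi, h7, h8⟩
        · exact Or.inl (h.mono hle)
        · rcases eq_or_ne i k with rfl | hik
          · exact ihs (ack c M) (hM.trans (lt_ack_right _ _).le) Ξ'' h5 h6
              (fun l hl => by rw [h8 l hl, h3 l hl]) (by omega)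
          · exact Or.inr ⟨Ξ'', h5.trans hle, h6.mono hle, i, by omega,
              by rw [← h3 i (by omega)]; exact h7,
              fun l hl => by rw [← h3 l (by omega)]; exact h8 l hl⟩
    have hr : rank k Ξ ≤ N * (N + 1) :=
      (rank_le k Ξ).trans (Nat.mul_le_mul hlen (by omega))
    have hle : (ack c)^[N * (N + 1) + 1] N ≤ ack (a + b + 3 * (k + 1)) N := by
      refine (iterate_ack_le _ _ _).trans ((ack_mono_right _ (hb N)).trans
        ((ack_ack_lt_ack_max_add_two _ _ _).le.trans (ack_mono_left _ ?_)))
      have : max (c + 1) b = c + 1 := max_eq_left (by omega)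
      omega
    rcases key _ N hN Ξ hlen hΞ (fun _ _ => rfl) hr with h | ⟨Ξ', h1, h2, h3⟩
    · exact Or.inl (h.mono hle)
    · exact Or.inr ⟨Ξ', h1.trans hle, h2.mono hle, h3⟩

theorem walk_loop {α : Type} (l : List α) : Walk 0 (l.map fun t => ((0 : ℕ), t, (0 : ℕ))) 0 := by
  induction l with
  | nil => rfl
  | cons t l ih => exact ⟨rfl, ih⟩

theorem lab_loop {α : Type} (l : List α) : lab (l.map fun t => ((0 : ℕ), t, (0 : ℕ))) = l := by
  simp [lab, Function.comp_def]

theorem card_of_trBd {P : Type} [Fintype P] {n : ℕ} (hP : Fintype.card P ≤ n) (T : Finset (Tr P))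
    (hT : ∀ t ∈ T, TrBd n t) : T.card ≤ (n + 1) ^ n * (n + 1) ^ n := by
  classical
  have hsub : T ⊆ (Fintype.piFinset fun _ : P => Finset.range (n + 1)) ×ˢ
      (Fintype.piFinset fun _ : P => Finset.range (n + 1)) := by
    intro t ht
    simp only [Finset.mem_product, Fintype.mem_piFinset, Finset.mem_range]
    exact ⟨fun j => by have := (hT t ht j).1; omega, fun j => by have := (hT t ht j).2; omega⟩
  refine (Finset.card_le_card hsub).trans ?_
  rw [Finset.card_product, Fintype.card_piFinset, Finset.prod_const, Finset.card_range,
    Finset.card_univ]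
  have := Nat.pow_le_pow_right (n := n + 1) (by omega) hP
  exact Nat.mul_le_mul this this

/-- Reachability in vector addition systems has an Ackermannian bound on the length of runs. -/
theorem exists_runIn_bound : ∃ m : ℕ, ∀ (n : ℕ) (P : Type) [Fintype P],
    Fintype.card P ≤ n → ∀ S : Set (Tr P), (∀ t ∈ S, TrBd n t) → ∀ x y : P → ℤ,
    (∀ j, 0 ≤ x j ∧ x j ≤ n) → (∀ j, 0 ≤ y j ∧ y j ≤ n) → ∀ N, RunIn S N x y →
      RunIn S (ack (m + 3 * n) n) x y := by
  obtain ⟨a, H⟩ := exists_rank_bound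
  have bp : AckBd fun n => (n + 1) ^ n := (AckBd.id.add (AckBd.const 1)).pow AckBd.id
  obtain ⟨b, hb⟩ : AckBd fun n => (n + 1) ^ n * (n + 1) ^ n + (n + 1) :=
    (bp.mul bp).add (AckBd.id.add (AckBd.const 1))
  refine ⟨a + b + 5, ?_⟩
  intro n P _ hP S hS x y hx hy N hrun
  obtain ⟨l, -, hl1, hl2, hl3⟩ := hrun
  classical
  set N₀ := (n + 1) ^ n * (n + 1) ^ n + (n + 1) with hN₀
  have hG : Good S N₀ x [⟨0, l.map fun t => (0, t, 0), ∅, []⟩] y := by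
    refine ⟨y, ⟨fun j => (hx j).1, walk_loop l, ?_, ?_, ?_, by simp, by simp, ?_⟩, rfl⟩
    · simpa [Piece.trs, lab_loop] using hl2
    · simpa [Piece.trs, lab_loop] using hl1
    · refine le_trans ?_ (Nat.le_add_right _ _)
      refine le_trans ?_ (card_of_trBd hP l.toFinset
        fun t ht => hS t (hl1 t (by simpa using ht)))
      refine Finset.card_le_card_of_injOn (fun e => e.2.1) ?_ ?_
      · intro e he
        simp only [Piece.T, Finset.mem_coe, List.mem_toFinset, List.mem_map] at he ⊢
        obtain ⟨t, ht, rfl⟩ := he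
        exact ht
      · intro e he e' he' h
        simp only [Piece.T, Finset.mem_coe, List.mem_toFinset, List.mem_map] at he he'
        obtain ⟨t, ht, rfl⟩ := he
        obtain ⟨t', ht', rfl⟩ := he'
        simp only at h
        rw [h]
    · funext j
      simpa [Piece.trs, lab_loop] using (hl3 j).symm
  rcases H n P hP S hS x y hx hy (n + 1) N₀ (by omega) _ (by simp; omega) hG with
    h | ⟨Ξ', -, -, i, hi, h, -⟩
  · refine h.mono ((ack_mono_right _ (hb n)).trans
      ((ack_ack_lt_ack_max_add_two _ _ _).le.trans (ack_mono_left _ ?_)))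
    have : max (a + 3 * (n + 1)) b ≤ a + 3 * (n + 1) + b := max_le (by omega) (by omega)
    omega
  · rw [rank_of_card_lt _ (show Fintype.card P < i by omega),
      rank_of_card_lt _ (show Fintype.card P < i by omega)] at h
    exact absurd h (lt_irrefl _)

end

section

/-! ### Context-free grammars with weights in `V → ℕ` -/

/-- A grammar in which every production has at most two nonterminals on its right-hand side. -/
structure Gram (N V : Type) where
  R0 : N → (V → ℕ) → Prop
  R1 : N → (V → ℕ) → N → Prop
  R2 : N → (V → ℕ) → N → N → Prop

namespace Gram
variable {N V : Type} [DecidableEq N] (G : Gram N V)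

/-- Derivation trees of a given height, with the set of nonterminals used and the weight. -/
inductive Der : ℕ → N → Finset N → (V → ℕ) → Prop
  | leaf {X v} : G.R0 X v → Der 1 X {X} v
  | one {X v Y h U u} : G.R1 X v Y → Der h Y U u → Der (h + 1) X (insert X U) (v + u)
  | two {X v Y Z h k U W u w} : G.R2 X v Y Z → Der h Y U u → Der k Z W w →
      Der (max h k + 1) X (insert X (U ∪ W)) (v + u + w)

/-- Derivation trees with a hole at a nonterminal. -/
inductive Cx (A : N) : N → Finset N → (V → ℕ) → Prop
  | hole : Cx A A ∅ 0
  | one {X v Y S p} : G.R1 X v Y → Cx A Y S p → Cx A X (insert X S) (v + p)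
  | left {X v Y Z S p h W w} : G.R2 X v Y Z → Cx A Y S p → Der G h Z W w →
      Cx A X (insert X (S ∪ W)) (v + p + w)
  | right {X v Y Z S p h U u} : G.R2 X v Y Z → Der G h Y U u → Cx A Z S p →
      Cx A X (insert X (U ∪ S)) (v + u + p)

variable {G}

theorem Der.subset {N₀ : Finset N} (h0 : ∀ X v, G.R0 X v → X ∈ N₀) (h1 : ∀ X v Y, G.R1 X v Y → X ∈ N₀)
    (h2 : ∀ X v Y Z, G.R2 X v Y Z → X ∈ N₀) {h : ℕ} {X : N} {U : Finset N} {v : V → ℕ}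
    (d : G.Der h X U v) : U ⊆ N₀ := by
  induction d with
  | leaf h => simpa using h0 _ _ h
  | one h _ ih => exact Finset.insert_subset (h1 _ _ _ h) ih
  | two h _ _ ih ih' => exact Finset.insert_subset (h2 _ _ _ _ h) (Finset.union_subset ih ih')

theorem Cx.plug {A X : N} {S : Finset N} {p : V → ℕ} (c : G.Cx A X S p) {h : ℕ} {U : Finset N}
    {v : V → ℕ} (d : G.Der h A U v) : ∃ k, G.Der k X (S ∪ U) (p + v) := by
  induction c with
  | hole => exact ⟨h, by simpa using d⟩
  | one r _ ih =>
    obtain ⟨k, hk⟩ := ih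
    exact ⟨_, by simpa [Finset.insert_union, add_assoc] using Der.one r hk⟩
  | @left X x Y Z S p l W w r _ d' ih =>
    obtain ⟨k, hk⟩ := ih
    have := Der.two r hk d'
    rw [show insert X ((S ∪ U) ∪ W) = insert X (S ∪ W) ∪ U from by ext; simp; tauto,
      show x + (p + v) + w = x + p + w + v from by abel] at this
    exact ⟨_, this⟩
  | right r d' _ ih =>
    obtain ⟨k, hk⟩ := ih
    have := Der.two r d' hk
    rw [← Finset.union_assoc, ← Finset.insert_union, ← add_assoc] at this
    exact ⟨_, this⟩

theorem Der.insert_pump {A : N} {S : Finset N} {p : V → ℕ} (c : G.Cx A A S p) {h : ℕ} {X : N}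
    {U : Finset N} {v : V → ℕ} (d : G.Der h X U v) (hA : A ∈ U) :
    ∃ k, G.Der k X (U ∪ S) (v + p) := by
  induction d with
  | leaf r =>
    obtain rfl : A = _ := by simpa using hA
    obtain ⟨k, hk⟩ := c.plug (Der.leaf r)
    exact ⟨k, by rwa [Finset.union_comm, add_comm p] at hk⟩
  | @one X v Y h U u r d ih =>
    by_cases hAX : A = X
    · subst hAX
      obtain ⟨k, hk⟩ := c.plug (Der.one r d)
      exact ⟨k, by rwa [Finset.union_comm, add_comm p] at hk⟩
    · obtain ⟨k, hk⟩ := ih (by simpa [hAX] using hA)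
      exact ⟨_, by simpa [Finset.insert_union, add_assoc] using Der.one r hk⟩
  | @two X v Y Z h k U W u w r d d' ih ih' =>
    by_cases hAX : A = X
    · subst hAX
      obtain ⟨k, hk⟩ := c.plug (Der.two r d d')
      exact ⟨k, by rwa [Finset.union_comm, add_comm p] at hk⟩
    · have : A ∈ U ∨ A ∈ W := by simpa [hAX] using hA
      rcases this with hA | hA
      · obtain ⟨k, hk⟩ := ih hA
        have := Der.two r hk d'
        rw [show insert X ((U ∪ S) ∪ W) = insert X (U ∪ W) ∪ S from by ext; simp; tauto,
          show v + (u + p) + w = v + u + w + p from by abel] at this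
        exact ⟨_, this⟩
      · obtain ⟨k, hk⟩ := ih' hA
        have := Der.two r d hk
        rw [← Finset.union_assoc, ← Finset.insert_union, ← add_assoc] at this
        exact ⟨_, this⟩

section Bound
variable {τ : V} (t0 : ∀ X v, G.R0 X v → v τ = 1) (t1 : ∀ X v Y, G.R1 X v Y → v τ = 1)
  (t2 : ∀ X v Y Z, G.R2 X v Y Z → v τ = 1)
include t0 t1 t2

theorem Der.tick_lt {h : ℕ} {X : N} {U : Finset N} {v : V → ℕ} (d : G.Der h X U v) :
    v τ < 2 ^ h := by
  induction d with
  | leaf r => simp [t0 _ _ r]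
  | one r _ ih => simp only [Pi.add_apply, t1 _ _ _ r, pow_succ]; omega
  | @two X v Y Z h k U W u w r _ _ ih ih' =>
    have h1 : 2 ^ h ≤ 2 ^ max h k := Nat.pow_le_pow_right (by simp) (le_max_left _ _)
    have h2 : 2 ^ k ≤ 2 ^ max h k := Nat.pow_le_pow_right (by simp) (le_max_right _ _)
    simp only [Pi.add_apply, t2 _ _ _ _ r, pow_succ]; omega


theorem Der.pump_or_context {N₀ : Finset N} (h0 : ∀ X v, G.R0 X v → X ∈ N₀)
    (h1 : ∀ X v Y, G.R1 X v Y → X ∈ N₀) (h2 : ∀ X v Y Z, G.R2 X v Y Z → X ∈ N₀)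
    {h : ℕ} {X : N} {U : Finset N} {v : V → ℕ} (d : G.Der h X U v) :
    ∀ D ⊆ N₀ ×ˢ N₀.powerset, (N₀ ×ˢ N₀.powerset).card < D.card + h →
      (∃ A UA S p v' k, (A, UA) ∈ D ∧ G.Cx A X S p ∧ S ∪ UA = U ∧ G.Der k A UA v' ∧ v = p + v') ∨
      (∃ A S p v' k, G.Der k X U v' ∧ v = v' + p ∧ G.Cx A A S p ∧ A ∈ U ∧ S ⊆ U ∧ 1 ≤ p τ) := by
  induction d with
  | @leaf X v r =>
    intro D hD hc
    by_cases hX : (X, {X}) ∈ D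
    · exact .inl ⟨X, {X}, ∅, 0, v, 1, hX, .hole, by simp, .leaf r, by simp⟩
    · have hm := h0 _ _ r
      have : insert (X, {X}) D ⊆ N₀ ×ˢ N₀.powerset :=
        Finset.insert_subset (by simpa using hm) hD
      have := Finset.card_le_card this
      rw [Finset.card_insert_of_notMem hX] at this
      omega
  | @one X v Y h U u r d ih =>
    intro D hD hc
    by_cases hX : (X, insert X U) ∈ D
    · exact .inl ⟨X, _, ∅, 0, _, _, hX, .hole, by simp, .one r d, by simp⟩
    have hm : (X, insert X U) ∈ N₀ ×ˢ N₀.powerset := by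
      have := (Der.one r d).subset h0 h1 h2
      simpa using ⟨h1 _ _ _ r, this⟩
    rcases ih (insert (X, insert X U) D) (Finset.insert_subset hm hD)
      (by rw [Finset.card_insert_of_notMem hX]; omega) with
      ⟨A, UA, S, p, v', k, hA, hc, hS, hd, rfl⟩ | ⟨A, S, p, v', k, hd, rfl, hc, hA, hS, hp⟩
    · rcases Finset.mem_insert.1 hA with hA | hA
      · obtain ⟨rfl, rfl⟩ := Prod.mk.inj hA
        refine .inr ⟨A, _, v + p, v', k, hd, by abel, .one r hc, by simp, ?_, ?_⟩
        · rw [← hS]; intro; simp; tauto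
        · simp [t1 _ _ _ r]
      · refine .inl ⟨A, UA, _, v + p, v', k, hA, .one r hc, ?_, hd, by abel⟩
        rw [← hS, Finset.insert_union]
    · refine .inr ⟨A, S, p, _, _, .one r hd, by abel, hc, by simp [hA], ?_, hp⟩
      exact hS.trans (Finset.subset_insert _ _)
  | @two X v Y Z h k U W u w r d d' ih ih' =>
    intro D hD hc
    by_cases hX : (X, insert X (U ∪ W)) ∈ D
    · exact .inl ⟨X, _, ∅, 0, _, _, hX, .hole, by simp, .two r d d', by simp⟩
    have hm : (X, insert X (U ∪ W)) ∈ N₀ ×ˢ N₀.powerset := by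
      have := (Der.two r d d').subset h0 h1 h2
      simpa using ⟨h2 _ _ _ _ r, this⟩
    have hD' := Finset.insert_subset hm hD
    have hcard := Finset.card_insert_of_notMem hX
    rcases le_total k h with hk | hk
    · rw [max_eq_left hk] at hc
      rcases ih (insert (X, insert X (U ∪ W)) D) hD' (by omega) with
        ⟨A, UA, S, p, v', l, hA, hc, hS, hd, rfl⟩ | ⟨A, S, p, v', l, hd, rfl, hc, hA, hS, hp⟩
      · rcases Finset.mem_insert.1 hA with hA | hA
        · obtain ⟨rfl, rfl⟩ := Prod.mk.inj hA
          refine .inr ⟨A, _, v + p + w, v', l, hd, by abel, .left r hc d', by simp, ?_, ?_⟩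
          · rw [← hS]; intro; simp; tauto
          · simp [t2 _ _ _ _ r]; omega
        · refine .inl ⟨A, UA, _, v + p + w, v', l, hA, .left r hc d', ?_, hd, by abel⟩
          rw [← hS]; ext; simp; tauto
      · refine .inr ⟨A, S, p, _, _, .two r hd d', by abel, hc, by simp [hA], ?_, hp⟩
        exact hS.trans (by intro; simp; tauto)
    · rw [max_eq_right hk] at hc
      rcases ih' (insert (X, insert X (U ∪ W)) D) hD' (by omega) with
        ⟨A, UA, S, p, v', l, hA, hc, hS, hd, rfl⟩ | ⟨A, S, p, v', l, hd, rfl, hc, hA, hS, hp⟩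
      · rcases Finset.mem_insert.1 hA with hA | hA
        · obtain ⟨rfl, rfl⟩ := Prod.mk.inj hA
          refine .inr ⟨A, _, v + u + p, v', l, hd, by abel, .right r d hc, by simp, ?_, ?_⟩
          · rw [← hS]; intro; simp; tauto
          · simp [t2 _ _ _ _ r]; omega
        · refine .inl ⟨A, UA, _, v + u + p, v', l, hA, .right r d hc, ?_, hd, by abel⟩
          rw [← hS]; ext; simp
      · refine .inr ⟨A, S, p, _, _, .two r d hd, by abel, hc, by simp [hA], ?_, hp⟩
        exact hS.trans (by intro; simp; tauto)

theorem Der.exists_pump {N₀ : Finset N} (h0 : ∀ X v, G.R0 X v → X ∈ N₀)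
    (h1 : ∀ X v Y, G.R1 X v Y → X ∈ N₀) (h2 : ∀ X v Y Z, G.R2 X v Y Z → X ∈ N₀)
    {h : ℕ} {X : N} {U : Finset N} {v : V → ℕ} (d : G.Der h X U v) {M : ℕ}
    (hM : (N₀ ×ˢ N₀.powerset).card = M) :
    M < h → ∃ A S p v' k, G.Der k X U v' ∧ v = v' + p ∧ G.Cx A A S p ∧ A ∈ U ∧ S ⊆ U ∧
      1 ≤ p τ ∧ p τ < 2 ^ (M + 1) := by
  have base : ∀ {X U v}, G.Der (M + 1) X U v → ∃ A S p v' k, G.Der k X U v' ∧ v = v' + p ∧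
      G.Cx A A S p ∧ A ∈ U ∧ S ⊆ U ∧ 1 ≤ p τ ∧ p τ < 2 ^ (M + 1) := by
    intro X U v d
    rcases d.pump_or_context t0 t1 t2 h0 h1 h2 ∅ (by simp)
        (by simp only [Finset.card_empty]; omega) with
      ⟨_, _, _, _, _, _, hA, _⟩ | ⟨A, S, p, v', k, hd, hv, hc, hA, hS, hp⟩
    · simp at hA
    · have := d.tick_lt t0 t1 t2
      refine ⟨A, S, p, v', k, hd, hv, hc, hA, hS, hp, ?_⟩
      rw [hv, Pi.add_apply] at this
      omega
  induction d with
  | leaf r =>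
    intro hh
    obtain rfl : M = 0 := by omega
    exact base (.leaf r)
  | @one X v Y h U u r d ih =>
    intro hh
    rcases Nat.lt_or_ge M h with hl | hl
    · obtain ⟨A, S, p, v', k, hd, rfl, hc, hA, hS, hp⟩ := ih hl
      exact ⟨A, S, p, _, _, .one r hd, by abel, hc, by simp [hA],
        hS.trans (Finset.subset_insert _ _), hp⟩
    · obtain rfl : h = M := by omega
      exact base (.one r d)
  | @two X v Y Z h k U W u w r d d' ih ih' =>
    intro hh
    by_cases hl : M < h
    · obtain ⟨A, S, p, v', k, hd, rfl, hc, hA, hS, hp⟩ := ih hl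
      exact ⟨A, S, p, _, _, .two r hd d', by abel, hc, by simp [hA],
        hS.trans (by intro; simp; tauto), hp⟩
    by_cases hl' : M < k
    · obtain ⟨A, S, p, v', k, hd, rfl, hc, hA, hS, hp⟩ := ih' hl'
      exact ⟨A, S, p, _, _, .two r d hd, by abel, hc, by simp [hA],
        hS.trans (by intro; simp; tauto), hp⟩
    have : max h k = M := by omega
    have := Der.two r d d'
    rw [‹max h k = M›] at this
    exact base this

theorem Der.exists_base {N₀ : Finset N} (h0 : ∀ X v, G.R0 X v → X ∈ N₀)
    (h1 : ∀ X v Y, G.R1 X v Y → X ∈ N₀) (h2 : ∀ X v Y Z, G.R2 X v Y Z → X ∈ N₀) {M : ℕ}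
    (hM : (N₀ ×ˢ N₀.powerset).card = M) {h : ℕ} {X : N} {U : Finset N} {v : V → ℕ}
    (d : G.Der h X U v) : ∃ (b : V → ℕ) (ps : Multiset (V → ℕ)), v = b + ps.sum ∧
      b τ < 2 ^ (M + 1) ∧ (∃ k, G.Der k X U b) ∧
      ∀ p ∈ ps, 1 ≤ p τ ∧ p τ < 2 ^ (M + 1) ∧ ∃ A ∈ U, ∃ S ⊆ U, G.Cx A A S p := by
  induction hn : v τ using Nat.strong_induction_on generalizing v h with
  | _ n ih =>
    rcases Nat.lt_or_ge M h with hl | hl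
    · obtain ⟨A, S, p, v', k, hd, rfl, hc, hA, hS, hp, hp'⟩ := d.exists_pump t0 t1 t2 h0 h1 h2 hM hl
      obtain ⟨b, ps, rfl, hb, hk, hps⟩ := ih (v' τ) (by rw [← hn, Pi.add_apply]; omega) hd rfl
      refine ⟨b, p ::ₘ ps, by rw [Multiset.sum_cons]; abel, hb, hk, ?_⟩
      intro q hq
      rcases Multiset.mem_cons.1 hq with rfl | hq
      · exact ⟨hp, hp', A, hA, S, hS, hc⟩
      · exact hps q hq
    · refine ⟨v, 0, by simp, (d.tick_lt t0 t1 t2).trans_le ?_, ⟨h, d⟩, by simp⟩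
      exact Nat.pow_le_pow_right (by simp) (by omega)

/-- Parikh-style decomposition of a derivation into a bounded base derivation and bounded
pumps which can be repeated arbitrarily often. -/
theorem Der.parikh {N₀ : Finset N} (h0 : ∀ X v, G.R0 X v → X ∈ N₀)
    (h1 : ∀ X v Y, G.R1 X v Y → X ∈ N₀) (h2 : ∀ X v Y Z, G.R2 X v Y Z → X ∈ N₀) {M : ℕ}
    (hM : (N₀ ×ˢ N₀.powerset).card = M) {h : ℕ} {X : N} {U : Finset N} {v : V → ℕ}
    (d : G.Der h X U v) : ∃ (b : V → ℕ) (ps : Multiset (V → ℕ)), v = b + ps.sum ∧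
      b τ < 2 ^ (M + 1) ∧ (∀ p ∈ ps, 1 ≤ p τ ∧ p τ < 2 ^ (M + 1)) ∧
      ∀ ms : Multiset (V → ℕ), (∀ p ∈ ms, p ∈ ps) → ∃ k U', G.Der k X U' (b + ms.sum) := by
  obtain ⟨b, ps, hv, hb, hd, hps⟩ := d.exists_base t0 t1 t2 h0 h1 h2 hM
  refine ⟨b, ps, hv, hb, fun p hp => ⟨(hps p hp).1, (hps p hp).2.1⟩, fun ms => ?_⟩
  suffices (∀ p ∈ ms, p ∈ ps) → ∃ k, G.Der k X U (b + ms.sum) from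
    fun hm => (this hm).imp fun k hk => ⟨U, hk⟩
  induction ms using Multiset.induction with
  | empty => intro; simpa using hd
  | cons p ms ih =>
    intro hm
    obtain ⟨k, hk⟩ := ih fun q hq => hm q (Multiset.mem_cons_of_mem hq)
    obtain ⟨_, _, A, hA, S, hS, hc⟩ := hps p (hm p (Multiset.mem_cons_self _ _))
    obtain ⟨l, hl⟩ := hk.insert_pump hc hA
    rw [Finset.union_eq_left.2 hS, add_assoc, add_comm _ p, ← Multiset.sum_cons] at hl
    exact ⟨l, hl⟩

end Bound
end Gram

end

section

/-! ### Pushdown automata with weights -/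

/-- `PT δ q w v q'`: from state `q`, the stack content `w` can be popped entirely, ending in `q'`,
with total weight `v`. -/
inductive PT {Q V : Type} (δ : Q → ℕ → Q → List ℕ → (V → ℕ) → Prop) :
    Q → List ℕ → (V → ℕ) → Q → Prop
  | nil (q) : PT δ q [] 0 q
  | cons {q a q' u v w v' q''} : δ q a q' u v → PT δ q' (u ++ w) v' q'' →
      PT δ q (a :: w) (v + v') q''

namespace PT
variable {Q V : Type} {δ : Q → ℕ → Q → List ℕ → (V → ℕ) → Prop}

theorem append {q : Q} {w : List ℕ} {v : V → ℕ} {q' : Q} (h : PT δ q w v q') :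
    ∀ {w' v' q''}, PT δ q' w' v' q'' → PT δ q (w ++ w') (v + v') q'' := by
  induction h with
  | nil q => intro w' v' q'' h'; simpa using h'
  | cons hd _ ih =>
    intro w' v' q'' h'
    rw [add_assoc]
    exact .cons hd (by simpa using ih h')

/-- The grammar whose nonterminals are the triples `(q, a, q')`. -/
def gram (δ : Q → ℕ → Q → List ℕ → (V → ℕ) → Prop) (N₀ : Finset (Q × ℕ × Q)) :
    Gram (Q × ℕ × Q) V where
  R0 X v := X ∈ N₀ ∧ δ X.1 X.2.1 X.2.2 [] v
  R1 X v Y := X ∈ N₀ ∧ δ X.1 X.2.1 Y.1 [Y.2.1] v ∧ Y.2.2 = X.2.2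
  R2 X v Y Z := X ∈ N₀ ∧ δ X.1 X.2.1 Y.1 [Y.2.1, Z.2.1] v ∧ Y.2.2 = Z.1 ∧ Z.2.2 = X.2.2

theorem of_der [DecidableEq Q] {N₀ : Finset (Q × ℕ × Q)} {h : ℕ} {X : Q × ℕ × Q}
    {U : Finset (Q × ℕ × Q)} {v : V → ℕ} (d : (gram δ N₀).Der h X U v) :
    PT δ X.1 [X.2.1] v X.2.2 := by
  induction d with
  | leaf r => simpa using PT.cons r.2 (.nil _)
  | one r _ ih => exact .cons r.2.1 (by simpa [r.2.2] using ih)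
  | two r _ _ ih ih' =>
    rw [add_assoc]
    refine .cons r.2.1 ?_
    rw [← r.2.2.1] at ih'
    simpa [r.2.2.2] using ih.append ih'

/-- A stack content split into derivations of its symbols. -/
inductive DerList [DecidableEq Q] (G : Gram (Q × ℕ × Q) V) (Q₀ : Finset Q) :
    Q → List ℕ → (V → ℕ) → Q → Prop
  | nil {q} : q ∈ Q₀ → DerList G Q₀ q [] 0 q
  | cons {q a q' h U v w v' q''} : q ∈ Q₀ → G.Der h (q, a, q') U v → DerList G Q₀ q' w v' q'' →
      DerList G Q₀ q (a :: w) (v + v') q''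

theorem DerList.mem [DecidableEq Q] {G : Gram (Q × ℕ × Q) V} {Q₀ : Finset Q} {q q' : Q}
    {w : List ℕ} {v : V → ℕ} (h : DerList G Q₀ q w v q') : q ∈ Q₀ := by
  cases h <;> assumption

theorem derList [DecidableEq Q] {Q₀ : Finset Q} {Γ₀ : Finset ℕ}
    (hlen : ∀ q a q' u v, δ q a q' u v → u.length ≤ 2)
    (hcl : ∀ q a q' u v, δ q a q' u v → q ∈ Q₀ → a ∈ Γ₀ → q' ∈ Q₀ ∧ ∀ x ∈ u, x ∈ Γ₀)
    {q : Q} {w : List ℕ} {v : V → ℕ} {q' : Q} (h : PT δ q w v q') (hq : q ∈ Q₀)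
    (hw : ∀ x ∈ w, x ∈ Γ₀) : DerList (gram δ (Q₀ ×ˢ Γ₀ ×ˢ Q₀)) Q₀ q w v q' := by
  induction h with
  | nil q => exact .nil hq
  | @cons q a q' u v w v' q'' hd _ ih =>
    have ha : a ∈ Γ₀ := hw a (by simp)
    obtain ⟨hq', hu⟩ := hcl _ _ _ _ _ hd hq ha
    have ih := ih hq' (by
      intro x hx
      rcases List.mem_append.1 hx with hx | hx
      · exact hu x hx
      · exact hw x (by simp [hx]))
    have hl := hlen _ _ _ _ _ hd
    match u, hl, hd, ih with
    | [], _, hd, ih =>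
      refine .cons hq (.leaf ⟨?_, hd⟩) ih
      simp [hq, ha, hq']
    | [x], _, hd, ih =>
      cases ih with
      | @cons _ _ p h U v1 _ v2 _ _ hx hr =>
        rw [← add_assoc]
        refine .cons hq (.one (Y := (q', x, p)) ⟨?_, hd, rfl⟩ hx) hr
        simp [hq, ha, hr.mem]
    | [x, y], _, hd, ih =>
      cases ih with
      | @cons _ _ p h U v1 _ v2 _ _ hx hr =>
        cases hr with
        | @cons _ _ p' h' U' v1' _ v2' _ _ hy hr' =>
          rw [← add_assoc, ← add_assoc]
          refine .cons hq (.two (Y := (q', x, p)) (Z := (p, y, p')) ⟨?_, hd, rfl, rfl⟩ hx hy) hr'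
          simp [hq, ha, hr'.mem]

/-- Parikh-style decomposition of the runs of a pushdown automaton. -/
theorem parikh {Q₀ : Finset Q} {Γ₀ : Finset ℕ} {τ : V}
    (hτ : ∀ q a q' u v, δ q a q' u v → v τ = 1)
    (hlen : ∀ q a q' u v, δ q a q' u v → u.length ≤ 2)
    (hcl : ∀ q a q' u v, δ q a q' u v → q ∈ Q₀ → a ∈ Γ₀ → q' ∈ Q₀ ∧ ∀ x ∈ u, x ∈ Γ₀)
    {N M : ℕ} (hN : Q₀.card * (Γ₀.card * Q₀.card) ≤ N) (hM : N * 2 ^ N ≤ M)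
    {q : Q} {a : ℕ} {v : V → ℕ} {q' : Q} (h : PT δ q [a] v q') (hq : q ∈ Q₀) (ha : a ∈ Γ₀) :
    ∃ (b : V → ℕ) (ps : Multiset (V → ℕ)), v = b + ps.sum ∧
      b τ < 2 ^ (M + 1) ∧ (∀ p ∈ ps, 1 ≤ p τ ∧ p τ < 2 ^ (M + 1)) ∧
      ∀ ms : Multiset (V → ℕ), (∀ p ∈ ms, p ∈ ps) → PT δ q [a] (b + ms.sum) q' := by
  classical
  have hd := derList hlen hcl h hq (by simpa using ha)
  cases hd with
  | @cons _ _ p h U v1 _ v2 _ _ hx hr =>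
    cases hr with
    | nil hq' =>
      set N₀ := Q₀ ×ˢ Γ₀ ×ˢ Q₀
      have hM' : (N₀ ×ˢ N₀.powerset).card ≤ M := by
        simp only [Finset.card_product, Finset.card_powerset, N₀]
        exact (Nat.mul_le_mul hN (Nat.pow_le_pow_right (by simp) hN)).trans hM
      have hp : 2 ^ ((N₀ ×ˢ N₀.powerset).card + 1) ≤ 2 ^ (M + 1) :=
        Nat.pow_le_pow_right (by simp) (by omega)
      obtain ⟨b, ps, hv, hb, hps, hms⟩ := Gram.Der.parikh (G := gram δ N₀) (τ := τ) (N₀ := N₀)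
        (fun X v r => hτ _ _ _ _ _ r.2) (fun X v Y r => hτ _ _ _ _ _ r.2.1)
        (fun X v Y Z r => hτ _ _ _ _ _ r.2.1) (fun X v r => r.1) (fun X v Y r => r.1)
        (fun X v Y Z r => r.1) rfl hx
      refine ⟨b, ps, by simpa using hv, hb.trans_le hp,
        fun p h => ⟨(hps p h).1, (hps p h).2.trans_le hp⟩, fun ms h => ?_⟩
      obtain ⟨k, U', hk⟩ := hms ms h
      exact of_der hk

theorem le_tick {τ : V} (hτ : ∀ q a q' u v, δ q a q' u v → v τ = 1) {x : V}
    (hx : ∀ q a q' u v, δ q a q' u v → v x ≤ 1) {q : Q} {w : List ℕ} {v : V → ℕ} {q' : Q}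
    (h : PT δ q w v q') : v x ≤ v τ := by
  induction h with
  | nil q => simp
  | cons hd _ ih =>
    have h1 := hτ _ _ _ _ _ hd
    have h2 := hx _ _ _ _ _ hd
    simp only [Pi.add_apply]
    omega

end PT

end

section

/-! ### The pushdown automaton of a single thread -/

/-- Weights: `none` counts steps, `some (l, x)` counts spawns of `x` in the segment with `l`
segments remaining (including itself). -/
abbrev Vec : Type := Option (ℕ × ℕ) → ℕ

/-- The weight of a step spawning `sp` with `l` segments remaining. -/
def stepVec (l : ℕ) (sp : Option ℕ) : Vec
  | none => 1
  | some (a, x) => if a = l ∧ sp = some x then 1 else 0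

/-- A segment of a thread: the global state at its start and after its end (`none` if the run ends
inside of the segment). -/
abbrev Seg : Type := ℕ × Option ℕ

/-- States of the automaton of a thread. -/
inductive TQ
  | wait (σ : List Seg)
  | run (g : ℕ) (σ : List Seg) (f : Bool)
  | flush (ρ : List ℕ)

/-- The thread may stop at a state with the given stack content. Here `k` is the total number of
segments, and `r` is the stack content of the thread if it is pending at the end. -/
def Stops (A : DCPS) (c : DConfig) (k : ℕ) (r : Option (List ℕ)) : TQ → List ℕ → Prop
  | .wait [], ρ => r = some ρ
  | .run g [(_, some g')] true, ρ => r = none ∧ (g, g') ∈ A.termination ∧ ρ = []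
  | .run g [(_, none)] _, ρ => r = none ∧ g = c.g ∧ c.act = some (ρ, k - 1)
  | _, _ => False

/-- The steps of the automaton of a thread. -/
inductive TStep (A : DCPS) (c : DConfig) (k : ℕ) (r : Option (List ℕ)) :
    TQ → ℕ → TQ → List ℕ → Vec → Prop
  | resume {s : Seg} {σ g' x} : (s.1, g', x) ∈ A.resumption →
      TStep A c k r (.wait (s :: σ)) x (.run g' (s :: σ) false) [x] (stepVec 0 none)
  | thread {g σ f x g' w sp} : (g, x, g', w, sp) ∈ A.creation →
      TStep A c k r (.run g σ f) x (.run g' σ true) w (stepVec σ.length sp)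
  | swap {g g₁ g' σ x w} : (g, x, g', w) ∈ A.interruption →
      TStep A c k r (.run g ((g₁, some g') :: σ) true) x (.wait σ) w (stepVec 0 none)
  | halt {q x ρ} : Stops A c k r q (x :: ρ) → TStep A c k r q x (.flush ρ) [] (stepVec 0 none)
  | flush {x ρ} : TStep A c k r (.flush (x :: ρ)) x (.flush ρ) [] (stepVec 0 none)

/-- `TAcc A c k r q w v`: the thread automaton accepts from state `q` and stack content `w`, with
weight `v`. -/
def TAcc (A : DCPS) (c : DConfig) (k : ℕ) (r : Option (List ℕ)) (q : TQ) (w : List ℕ) (v : Vec) :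
    Prop :=
  ∃ q', PT (TStep A c k r) q w v q' ∧ (Stops A c k r q' [] ∨ q' = .flush [])

variable {A : DCPS} {c : DConfig} {k : ℕ} {r : Option (List ℕ)}

theorem TStep.tick {q : TQ} {x : ℕ} {q' : TQ} {u : List ℕ} {v : Vec} (h : TStep A c k r q x q' u v) :
    v none = 1 := by
  cases h <;> rfl

theorem stepVec_le (l : ℕ) (sp : Option ℕ) (o : Option (ℕ × ℕ)) : stepVec l sp o ≤ 1 := by
  unfold stepVec; split
  · exact le_rfl
  · split <;> omega

theorem TStep.le_one {q : TQ} {x : ℕ} {q' : TQ} {u : List ℕ} {v : Vec}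
    (h : TStep A c k r q x q' u v) (o : Option (ℕ × ℕ)) : v o ≤ 1 := by
  cases h <;> exact stepVec_le _ _ _

theorem TStep.length_le {q : TQ} {x : ℕ} {q' : TQ} {u : List ℕ} {v : Vec}
    (h : TStep A c k r q x q' u v) : u.length ≤ 2 := by
  cases h with
  | thread h => exact A.creation_wf _ h
  | swap h => exact (A.interruption_wf _ h).2
  | _ => simp

/-- The number of remaining segments. -/
def TQ.rem : TQ → ℕ
  | .wait σ => σ.length
  | .run _ σ _ => σ.length
  | .flush _ => 0

theorem TStep.rem_le {q : TQ} {x : ℕ} {q' : TQ} {u : List ℕ} {v : Vec}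
    (h : TStep A c k r q x q' u v) : q'.rem ≤ q.rem := by
  cases h <;> simp [TQ.rem]

theorem stepVec_none_some (l : ℕ) (y : ℕ × ℕ) : stepVec l none (some y) = 0 := by
  simp [stepVec]

theorem PT.eq_zero_of_rem {q : TQ} {w : List ℕ} {v : Vec} {q' : TQ}
    (h : PT (TStep A c k r) q w v q') {l : ℕ} (hl : q.rem < l) (y : ℕ) : v (some (l, y)) = 0 := by
  induction h with
  | nil q => rfl
  | cons hd _ ih =>
    have := ih (hd.rem_le.trans_lt hl)
    rw [Pi.add_apply, this, add_zero]
    cases hd with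
    | thread h => 
      simp only [TQ.rem] at hl
      simp [stepVec, hl.ne']
    | _ => exact stepVec_none_some _ _

theorem TAcc.eq_zero {q : TQ} {w : List ℕ} {v : Vec} (h : TAcc A c k r q w v) {l : ℕ}
    (hl : q.rem < l) (y : ℕ) : v (some (l, y)) = 0 := by
  obtain ⟨q', h, -⟩ := h
  exact h.eq_zero_of_rem hl y

/-- The weights that occur only at positive stages and at bounded symbols. -/
def VecIn (k n : ℕ) (v : Vec) : Prop :=
  ∀ l x, (l = 0 ∨ k < l ∨ n < x) → v (some (l, x)) = 0

/-- All the symbols of the system and of the target configuration are bounded by `n`. -/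
structure SizeBd (A : DCPS) (c : DConfig) (n : ℕ) : Prop where
  creation : ∀ g x g' w sp, (g, x, g', w, sp) ∈ A.creation →
    x ≤ n ∧ g' ≤ n ∧ (∀ y ∈ w, y ≤ n) ∧ ∀ y, sp = some y → y ≤ n
  interruption : ∀ g x g' w, (g, x, g', w) ∈ A.interruption → g' ≤ n ∧ ∀ y ∈ w, y ≤ n
  resumption : ∀ g g' x, (g, g', x) ∈ A.resumption → g ≤ n ∧ g' ≤ n ∧ x ≤ n
  termination : ∀ g g', (g, g') ∈ A.termination → g' ≤ n
  gamma0 : A.gamma0 ≤ n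
  g0 : A.g0 ≤ n
  cg : c.g ≤ n
  act : ∀ w i, c.act = some (w, i) → w.length ≤ n ∧ ∀ x ∈ w, x ≤ n
  pend : ∀ w i, (w, i) ∈ c.pend → w.length ≤ n ∧ ∀ x ∈ w, x ≤ n
  card : Multiset.card c.pend ≤ n

end

section

variable {A : DCPS} {c : DConfig} {k : ℕ} {r : Option (List ℕ)}

/-- Run states have a current segment. -/
def TQ.Ok : TQ → Prop
  | .run _ σ _ => σ ≠ []
  | _ => True

theorem TStep.ok {q : TQ} {x : ℕ} {q' : TQ} {u : List ℕ} {v : Vec}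
    (h : TStep A c k r q x q' u v) (hq : q.Ok) : q'.Ok := by
  cases h with
  | resume _ => exact List.cons_ne_nil _ _
  | thread _ => exact hq
  | _ => trivial

theorem PT.vecIn {n K : ℕ} (hs : SizeBd A c n) {q : TQ} {w : List ℕ} {v : Vec} {q' : TQ}
    (h : PT (TStep A c k r) q w v q') (hq : q.Ok) (hl : q.rem ≤ K) : VecIn K n v := by
  induction h with
  | nil q => intro _ _ _; rfl
  | cons hd _ ih =>
    have := ih (hd.ok hq) (hd.rem_le.trans hl)
    intro l x hlx
    rw [Pi.add_apply, this l x hlx, add_zero]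
    cases hd with
    | @thread g σ f y g' w sp h =>
      have h1 := (hs.creation _ _ _ _ _ h).2.2.2
      have h2 : 0 < σ.length := List.length_pos_iff.2 hq
      simp only [stepVec, ite_eq_right_iff, and_imp]
      rintro rfl hsp
      have := h1 x hsp
      simp only [TQ.rem] at hl
      omega
    | _ => exact stepVec_none_some _ _

theorem TAcc.vecIn {n K : ℕ} (hs : SizeBd A c n) {σ : List Seg} {w : List ℕ} {v : Vec}
    (h : TAcc A c k r (.wait σ) w v) (hl : σ.length ≤ K) : VecIn K n v := by
  obtain ⟨q', h, -⟩ := h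
  exact h.vecIn hs trivial hl

/-- The stack of the active thread. -/
def actStack (c : DConfig) : List ℕ := (c.act.getD ([], 0)).1

open Classical in
/-- The states that are reachable from `wait σ`. -/
noncomputable def tqSet (n : ℕ) (σ : List Seg) (ρ ρ' : List ℕ) : Finset TQ :=
  σ.tails.toFinset.image TQ.wait ∪
    (Finset.range (n + 1) ×ˢ σ.tails.toFinset ×ˢ (Finset.univ : Finset Bool)).image
      (fun t => TQ.run t.1 t.2.1 t.2.2) ∪
    (ρ.tails.toFinset.image TQ.flush ∪ ρ'.tails.toFinset.image TQ.flush)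

theorem wait_mem_tqSet {n : ℕ} {σ σ' : List Seg} {ρ ρ' : List ℕ} :
    TQ.wait σ' ∈ tqSet n σ ρ ρ' ↔ σ' <:+ σ := by
  simp [tqSet]

theorem run_mem_tqSet {n g : ℕ} {σ σ' : List Seg} {ρ ρ' : List ℕ} {f : Bool} :
    TQ.run g σ' f ∈ tqSet n σ ρ ρ' ↔ g ≤ n ∧ σ' <:+ σ := by
  simp [tqSet]

theorem flush_mem_tqSet {n : ℕ} {σ : List Seg} {ρ ρ' μ : List ℕ} :
    TQ.flush μ ∈ tqSet n σ ρ ρ' ↔ μ <:+ ρ ∨ μ <:+ ρ' := by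
  simp [tqSet]

theorem card_tqSet_le {n : ℕ} {σ : List Seg} {ρ ρ' : List ℕ} (h1 : σ.length ≤ n)
    (h2 : ρ.length ≤ n) (h3 : ρ'.length ≤ n) : (tqSet n σ ρ ρ').card ≤ 5 * (n + 1) ^ 2 := by
  classical
  have ht : ∀ {α : Type} [DecidableEq α] (l : List α), l.length ≤ n →
      l.tails.toFinset.card ≤ n + 1 := fun l h =>
    (List.toFinset_card_le _).trans (by simpa using h)
  have e1 := Finset.card_image_le (s := σ.tails.toFinset) (f := TQ.wait)
  have e2 := Finset.card_image_le
    (s := Finset.range (n + 1) ×ˢ σ.tails.toFinset ×ˢ (Finset.univ : Finset Bool))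
    (f := fun t => TQ.run t.1 t.2.1 t.2.2)
  have e3 := Finset.card_image_le (s := ρ.tails.toFinset) (f := TQ.flush)
  have e4 := Finset.card_image_le (s := ρ'.tails.toFinset) (f := TQ.flush)
  have f1 := ht σ h1
  have f2 := ht ρ h2
  have f3 := ht ρ' h3
  have f4 : (Finset.range (n + 1) ×ˢ σ.tails.toFinset ×ˢ (Finset.univ : Finset Bool)).card ≤
      (n + 1) * ((n + 1) * 2) := by
    simp only [Finset.card_product, Finset.card_range, Finset.card_univ, Fintype.card_bool]
    gcongr
  unfold tqSet
  refine (Finset.card_union_le _ _).trans ((Nat.add_le_add (Finset.card_union_le _ _)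
    (Finset.card_union_le _ _)).trans ?_)
  nlinarith

theorem tqSet_closed {n : ℕ} (hs : SizeBd A c n) {σ : List Seg} {q : TQ} {x : ℕ} {q' : TQ}
    {u : List ℕ} {v : Vec} (h : TStep A c k r q x q' u v)
    (hq : q ∈ tqSet n σ (r.getD []) (actStack c)) (hx : x ∈ Finset.range (n + 1)) :
    q' ∈ tqSet n σ (r.getD []) (actStack c) ∧ ∀ y ∈ u, y ∈ Finset.range (n + 1) := by
  simp only [Finset.mem_range, Nat.lt_succ_iff] at *
  cases h with
  | resume h =>
    rw [wait_mem_tqSet] at hq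
    exact ⟨run_mem_tqSet.2 ⟨(hs.resumption _ _ _ h).2.1, hq⟩, by simpa using hx⟩
  | thread h =>
    rw [run_mem_tqSet] at hq
    have := hs.creation _ _ _ _ _ h
    exact ⟨run_mem_tqSet.2 ⟨this.2.1, hq.2⟩, this.2.2.1⟩
  | swap h =>
    rw [run_mem_tqSet] at hq
    have := hs.interruption _ _ _ _ h
    exact ⟨wait_mem_tqSet.2 ((List.suffix_cons _ _).trans hq.2), this.2⟩
  | @halt q x ρ h =>
    refine ⟨flush_mem_tqSet.2 ?_, by simp⟩
    unfold Stops at h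
    split at h
    · left; simp [h]
    · simp at h
    · right; simp [actStack, h.2.2]
    · exact h.elim
  | flush =>
    rw [flush_mem_tqSet] at hq
    exact ⟨flush_mem_tqSet.2 (hq.imp (List.suffix_cons _ _).trans (List.suffix_cons _ _).trans),
      by simp⟩

/-- A bound for the weights of the base part and of the pumps of a thread. -/
def vecBound (n : ℕ) : ℕ :=
  let N := 5 * (n + 1) ^ 2 * ((n + 1) * (5 * (n + 1) ^ 2))
  2 ^ (N * 2 ^ N + 2)

theorem TAcc.parikh {n : ℕ} (hs : SizeBd A c n) {σ : List Seg} (hσ : σ.length ≤ n)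
    (hr : (r.getD []).length ≤ n) {x : ℕ} (hx : x ≤ n) {v : Vec}
    (h : TAcc A c k r (.wait σ) [x] v) : ∃ (b : Vec) (ps : Multiset Vec), v = b + ps.sum ∧
      (∀ o, b o < vecBound n) ∧ (∀ p ∈ ps, 1 ≤ p none ∧ ∀ o, p o < vecBound n) ∧
      ∀ ms : Multiset Vec, (∀ p ∈ ms, p ∈ ps) → TAcc A c k r (.wait σ) [x] (b + ms.sum) := by
  obtain ⟨q', h, ha⟩ := h
  have hact : (actStack c).length ≤ n := by
    unfold actStack
    cases hc : c.act with
    | none => simp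
    | some t => exact (hs.act _ _ hc).1
  have hcard := card_tqSet_le (n := n) hσ hr hact
  obtain ⟨b, ps, hv, hb, hps, hms⟩ := PT.parikh (τ := none)
    (Q₀ := tqSet n σ (r.getD []) (actStack c)) (Γ₀ := Finset.range (n + 1))
    (N := 5 * (n + 1) ^ 2 * ((n + 1) * (5 * (n + 1) ^ 2)))
    (fun _ _ _ _ _ h => h.tick) (fun _ _ _ _ _ h => h.length_le)
    (fun _ _ _ _ _ h => tqSet_closed hs h)
    (by rw [Finset.card_range]; gcongr) le_rfl h
    (wait_mem_tqSet.2 (List.suffix_refl _)) (by simpa [Nat.lt_succ_iff] using hx)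
  have key : ∀ ms : Multiset Vec, (∀ p ∈ ms, p ∈ ps) → ∀ o, (b + ms.sum) o ≤ (b + ms.sum) none :=
    fun ms h o => (hms ms h).le_tick (fun _ _ _ _ _ h => h.tick) (fun _ _ _ _ _ h => h.le_one _)
  refine ⟨b, ps, hv, fun o => ?_, fun p hp => ⟨(hps p hp).1, fun o => ?_⟩,
    fun ms h => ⟨q', hms ms h, ha⟩⟩
  · have := key 0 (by simp) o
    simp only [Multiset.sum_zero, add_zero] at this
    simp only [vecBound]
    rw [pow_succ 2 (_ + 1)]
    omega
  · have := key {p} (by simpa using hp) o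
    have := (hps p hp).2
    simp only [Multiset.sum_singleton, Pi.add_apply] at *
    simp only [vecBound]
    rw [pow_succ 2 (_ + 1)]
    omega

end

/-! ### Runs with explicit scheduling flags -/

/-- Steps of configurations with a flag recording that the active thread has just been resumed. -/
inductive FStep (A : DCPS) (K : ℕ) : DConfig × Bool → DConfig × Bool → Prop
  | thread {p p' : DConfig} (f) : ThreadStep A p p' → FStep A K (p, f) (p', false)
  | swap {p p' : DConfig} : SwapStep A p p' → FStep A K (p, false) (p', false)
  | term {p p' : DConfig} : TermStep A p p' → FStep A K (p, false) (p', false)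
  | resume {p p' : DConfig} (f) {t : Loc} : ResumeStep A t p p' → t.2 ≤ K →
      FStep A K (p, f) (p', true)

/-- Runs of a given length. -/
inductive FRun (A : DCPS) (K : ℕ) : ℕ → DConfig × Bool → DConfig × Bool → Prop
  | refl (p) : FRun A K 0 p p
  | head {n p q s} : FStep A K p q → FRun A K n q s → FRun A K (n + 1) p s

theorem FRun.trans {A : DCPS} {K m n : ℕ} {p q s : DConfig × Bool} (h : FRun A K m p q)
    (h' : FRun A K n q s) : FRun A K (m + n) p s := by
  induction h with
  | refl p => simpa using h'
  | head hs _ ih => rw [Nat.add_right_comm]; exact .head hs (ih h')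

theorem FRun.exists_seq {A : DCPS} {K n : ℕ} {p q : DConfig × Bool} (h : FRun A K n p q) :
    ∃ s : ℕ → DConfig × Bool, s 0 = p ∧ s n = q ∧ ∀ i < n, FStep A K (s i) (s (i + 1)) := by
  induction h with
  | refl p => exact ⟨fun _ => p, rfl, rfl, by simp⟩
  | @head n p q t hs _ ih =>
    obtain ⟨s, h0, hn, hi⟩ := ih
    refine ⟨fun i => Nat.casesOn i p s, rfl, hn, fun i hlt => ?_⟩
    cases i with
    | zero => simpa [h0] using hs
    | succ i => exact hi i (by omega)

theorem FRun.of_seq {A : DCPS} {K : ℕ} {s : ℕ → DConfig × Bool} (n : ℕ)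
    (h : ∀ i < n, FStep A K (s i) (s (i + 1))) : FRun A K n (s 0) (s n) := by
  induction n with
  | zero => exact .refl _
  | succ n ih =>
    exact (ih fun i hi => h i (by omega)).trans (.head (h n (by omega)) (.refl _))

theorem exists_finRun_iff (A : DCPS) (K : ℕ) (c : DConfig) :
    (∃ (rho : ℕ → DConfig) (n : ℕ), IsFinRunD A rho n ∧ KBoundedUpToD K n rho ∧ rho n = c) ↔
      ∃ n f, FRun A K n (A.init, false) (c, f) := by
  classical
  constructor
  · rintro ⟨rho, n, ⟨h0, hst, hne⟩, hK, rfl⟩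
    let s : ℕ → DConfig × Bool := fun i => (rho i, decide (∃ j, i = j + 1 ∧ (rho j).act = none))
    have hs : ∀ i < n, FStep A K (s i) (s (i + 1)) := by
      intro i hi
      have hsi : s (i + 1) = (rho (i + 1), decide ((rho i).act = none)) := by simp [s]
      have hfalse : (rho i).act ≠ none → (rho (i + 1)).act = none → s i = (rho i, false) := by
        intro h1 h2
        simp only [s, Prod.mk.injEq, true_and, decide_eq_false_iff_not]
        rintro ⟨j, rfl, hj⟩
        exact hne j (by omega) hj h2
      rw [hsi]
      rcases hst i hi with h | h | ⟨t, h⟩ | h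
      · have : (rho i).act ≠ none := by
          obtain ⟨_, _, _, _, _, _, _, h, _⟩ := h; simp [h]
        simpa [this] using FStep.thread (A := A) (K := K) (s i).2 h
      · have h1 : (rho i).act ≠ none := by
          obtain ⟨_, _, _, _, _, _, h, _⟩ := h; simp [h]
        have h2 : (rho (i + 1)).act = none := by
          obtain ⟨_, _, _, _, _, _, _, _, h, _⟩ := h; exact h
        rw [hfalse h1 h2]
        simpa [h1] using FStep.swap (A := A) (K := K) h
      · have h1 : (rho i).act = none := by
          obtain ⟨_, _, _, _, _, _, _, h, _⟩ := h; exact h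
        have h2 : (rho (i + 1)).act = some t := by
          obtain ⟨_, _, _, _, _, _, _, _, _, _, h, _⟩ := h; exact h
        simpa [h1] using FStep.resume (A := A) (K := K) (s i).2 h (hK (i + 1) hi t.1 t.2 h2)
      · have h1 : (rho i).act ≠ none := by
          obtain ⟨_, _, _, h, _⟩ := h; simp [h]
        have h2 : (rho (i + 1)).act = none := by
          obtain ⟨_, _, _, _, _, h, _⟩ := h; exact h
        rw [hfalse h1 h2]
        simpa [h1] using FStep.term (A := A) (K := K) h
    have := FRun.of_seq n hs
    rw [show s 0 = (A.init, false) by simp [s, h0]] at this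
    exact ⟨n, _, this⟩
  · rintro ⟨n, f, h⟩
    obtain ⟨s, h0, hn, hs⟩ := h.exists_seq
    refine ⟨fun i => (s i).1, n, ⟨by simp [h0], fun i hi => ?_, fun i hi hnone => ?_⟩, ?_, by simp [hn]⟩
    · have := hs i hi
      revert this
      beta_reduce
      generalize s i = a
      generalize s (i + 1) = b
      rintro (⟨_, h⟩ | h | h | ⟨_, h, _⟩)
      · exact .inl h
      · exact .inr (.inl h)
      · exact .inr (.inr (.inr h))
      · exact .inr (.inr (.inl ⟨_, h⟩))
    · have h1 := hs i (by omega)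
      have h2 := hs (i + 1) (by omega)
      revert h1 h2 hnone
      beta_reduce
      rw [show i + 1 + 1 = i + 2 from rfl]
      generalize s i = a
      generalize s (i + 1) = b
      generalize s (i + 2) = d
      intro hnone h1 h2
      have hb : b.2 = true ∧ b.1.act ≠ none := by
        cases h1 with
        | thread _ h => obtain ⟨_, _, _, _, _, _, _, h, _⟩ := h; simp [h] at hnone
        | swap h => obtain ⟨_, _, _, _, _, _, h, _⟩ := h; simp [h] at hnone
        | term h => obtain ⟨_, _, _, h, _⟩ := h; simp [h] at hnone
        | resume _ h _ => obtain ⟨_, _, _, _, _, _, _, _, _, _, h, _⟩ := h; simp [h]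
      cases h2 with
      | thread _ h => obtain ⟨_, _, _, _, _, _, _, _, _, h, _⟩ := h; simp [h]
      | swap h => simp at hb
      | term h => simp at hb
      | resume _ h _ => obtain ⟨_, _, _, _, _, _, _, _, _, _, h, _⟩ := h; simp [h]
    · intro i
      induction i with
      | zero => intro _ w j; simp [h0, DCPS.init]
      | succ i ih =>
        intro hi w j
        have := hs i (by omega)
        replace ih := ih (by omega)
        revert this ih
        beta_reduce
        generalize s i = a
        generalize s (i + 1) = b
        intro h1 ih hb
        cases h1 with
        | thread _ h =>
          obtain ⟨_, _, _, _, _, _, _, h, _, h', _⟩ := h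
          rw [h'] at hb
          obtain ⟨-, rfl⟩ := Prod.mk.inj (Option.some.inj hb)
          exact ih _ _ h
        | swap h => obtain ⟨_, _, _, _, _, _, _, _, h, _⟩ := h; simp [h] at hb
        | term h => obtain ⟨_, _, _, _, _, h, _⟩ := h; simp [h] at hb
        | resume _ h hK =>
          obtain ⟨_, _, _, _, _, _, _, _, _, _, h, _⟩ := h
          rw [h] at hb
          obtain rfl := Option.some.inj hb
          exact hK

section

/-- A freshly spawned thread. -/
def fr (x : ℕ) : Loc := ([x], 0)

/-- `F` is the multiset of the symbols spawned at stage `l` according to the weight `v`. -/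
def Spawns (F : Multiset ℕ) (v : Vec) (l : ℕ) : Prop := ∀ x, F.count x = v (some (l, x))

variable {A : DCPS} {c : DConfig} {k : ℕ} {r : Option (List ℕ)} {K : ℕ}

/-- The possible outcomes of a segment `s` of a thread, with remaining segments `σ`, weight `v`,
context-switch number `i`, and inactive threads `P`. -/
def SegOut (A : DCPS) (K : ℕ) (c : DConfig) (k : ℕ) (r : Option (List ℕ)) (o : Option ℕ)
    (σ : List Seg) (v : Vec) (i : ℕ) (P : Multiset Loc) (m₀ : ℕ) (p : DConfig × Bool) : Prop :=
  ∃ F m, Spawns F v (σ.length + 1) ∧ m ≤ m₀ ∧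
    ((o = none ∧ σ = [] ∧ r = none ∧ ∃ f', FRun A K m p (⟨c.g, c.act, P + F.map fr⟩, f')) ∨
      ∃ g', o = some g' ∧
        ((σ = [] ∧ r = none ∧ FRun A K m p (⟨g', none, P + F.map fr⟩, false)) ∨
          ∃ w' v', TAcc A c k r (.wait σ) w' v' ∧ v' none ≤ v none ∧
            (∀ l ≤ σ.length, ∀ x, v' (some (l, x)) = v (some (l, x))) ∧
            FRun A K m p (⟨g', none, P + F.map fr + {(w', i + 1)}⟩, false)))

theorem spawnOf_eq (sp : Option ℕ) : spawnOf sp = (sp.elim 0 fun x => {x} : Multiset ℕ).map fr := by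
  cases sp <;> simp [spawnOf, fr]

theorem PT.flush_eq {q q' : TQ} {w ρ : List ℕ} {v : Vec} (h : PT (TStep A c k r) q w v q')
    (hq : q = .flush ρ) (ha : Stops A c k r q' [] ∨ q' = .flush []) : w = ρ := by
  induction h generalizing ρ with
  | nil q =>
    subst hq
    rcases ha with ha | ha
    · exact ha.elim
    · exact (TQ.flush.inj ha).symm
  | cons hd _ ih =>
    subst hq
    cases hd with
    | halt h => exact h.elim
    | flush => rw [← ih rfl ha, List.nil_append]

theorem Stops.segOut {g g₁ : ℕ} {o : Option ℕ} {σ : List Seg} {f : Bool} {i : ℕ} {w : List ℕ}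
    (hik : i + 1 + σ.length = k) (P : Multiset Loc)
    (hs : Stops A c k r (.run g ((g₁, o) :: σ) f) w) {v : Vec}
    (hv : ∀ x, v (some (σ.length + 1, x)) = 0) :
    SegOut A K c k r o σ v i P (v none + 1) (⟨g, some (w, i), P⟩, !f) := by
  have hF : Spawns 0 v (σ.length + 1) := fun x => by simpa using (hv x).symm
  match o, σ, f, hs with
  | some g', [], true, hs =>
    obtain ⟨rfl, ht, rfl⟩ := hs
    refine ⟨0, 1, hF, by omega, .inr ⟨g', rfl, .inl ⟨rfl, rfl, ?_⟩⟩⟩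
    exact .head (.term ⟨i, g', ht, rfl, rfl, rfl, by simp⟩) (.refl _)
  | none, [], f, hs =>
    obtain ⟨rfl, rfl, ht⟩ : r = none ∧ g = c.g ∧ c.act = some (w, k - 1) := by
      cases f <;> exact hs
    refine ⟨0, 0, hF, by omega, .inl ⟨rfl, rfl, rfl, !f, ?_⟩⟩
    have : i = k - 1 := by simp at hik; omega
    rw [ht, this]
    simpa using FRun.refl _
  | some _, [], false, hs => exact hs.elim
  | some _, _ :: _, true, hs => exact hs.elim
  | some _, _ :: _, false, hs => exact hs.elim
  | none, _ :: _, true, hs => exact hs.elim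
  | none, _ :: _, false, hs => exact hs.elim

theorem TAcc.run_segOut {q : TQ} {w : List ℕ} {v : Vec} (h : TAcc A c k r q w v) {g g₁ : ℕ}
    {o : Option ℕ} {σ : List Seg} {f : Bool} (hq : q = .run g ((g₁, o) :: σ) f) {i : ℕ}
    (hik : i + 1 + σ.length = k) (P : Multiset Loc) :
    SegOut A K c k r o σ v i P (v none + 1) (⟨g, some (w, i), P⟩, !f) := by
  obtain ⟨q', h, ha⟩ := h
  induction h generalizing g f P with
  | nil q =>
    subst hq
    rcases ha with ha | ha
    · exact ha.segOut hik P fun _ => rfl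
    · simp at ha
  | @cons q x q' u v w v' q'' hd hr ih =>
    subst hq
    cases hd with
    | @thread _ _ _ _ g' _ sp ht =>
      obtain ⟨F, m, hF, hm, hout⟩ := ih rfl (P + spawnOf sp) ha
      have hstep : FStep A K (⟨g, some (x :: w, i), P⟩, !f)
          (⟨g', some (u ++ w, i), P + spawnOf sp⟩, !true) :=
        .thread _ ⟨x, w, i, g', u, sp, ht, rfl, rfl, rfl, rfl⟩
      have hP : P + spawnOf sp + F.map fr = P + (sp.elim 0 (fun x => {x}) + F).map fr := by
        rw [spawnOf_eq, Multiset.map_add, add_assoc]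
      refine ⟨sp.elim 0 (fun x => {x}) + F, m + 1, fun y => ?_, ?_, ?_⟩
      · rw [Multiset.count_add, hF y]
        cases sp with
        | none => simp [stepVec]
        | some z => simp [stepVec, Multiset.count_singleton, eq_comm]
      · simp only [Pi.add_apply, stepVec]; omega
      · rw [hP] at hout
        rcases hout with ⟨h1, h2, h3, f', h4⟩ | ⟨g₂, h1, ⟨h2, h3, h4⟩ | ⟨w', v'', h2, h3, h4, h5⟩⟩
        · exact .inl ⟨h1, h2, h3, f', .head hstep h4⟩
        · exact .inr ⟨g₂, h1, .inl ⟨h2, h3, .head hstep h4⟩⟩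
        · refine .inr ⟨g₂, h1, .inr ⟨w', v'', h2, by simp only [Pi.add_apply]; omega, fun l hl y => ?_,
            .head hstep h5⟩⟩
          rw [h4 l hl y, Pi.add_apply]
          have : l ≠ σ.length + 1 := by omega
          simp [stepVec, this]
    | @swap _ _ g' _ _ _ ht =>
      have hz : ∀ x, v' (some (σ.length + 1, x)) = 0 :=
        hr.eq_zero_of_rem (by simp [TQ.rem])
      refine ⟨0, 1, fun y => by simp [hz, stepVec_none_some], by omega,
        .inr ⟨g', rfl, .inr ⟨u ++ w, v', ⟨_, hr, ha⟩, by simp, fun l hl y => ?_, ?_⟩⟩⟩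
      · simp [stepVec_none_some]
      · exact .head (.swap ⟨x, w, i, g', u, ht, rfl, rfl, rfl, by simp⟩) (.refl _)
    | halt hs =>
      have hz : ∀ x, v' (some (σ.length + 1, x)) = 0 := hr.eq_zero_of_rem (by simp [TQ.rem])
      rw [← hr.flush_eq rfl ha] at hs
      exact hs.segOut hik P fun x => by simp [hz, stepVec_none_some]

/-- The first segment of an accepting run of the thread automaton. -/
theorem TAcc.segOut {w : List ℕ} {v : Vec} {s : Seg} {σ : List Seg}
    (h : TAcc A c k r (.wait (s :: σ)) w v) {i : ℕ} (hik : i + 1 + σ.length = k) (hK : i ≤ K)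
    (P : Multiset Loc) (f : Bool) :
    SegOut A K c k r s.2 σ v i P (v none + 1) (⟨s.1, none, P + {(w, i)}⟩, f) := by
  obtain ⟨q', h, ha⟩ := h
  cases h with
  | nil q =>
    rcases ha with ha | ha
    · exact ha.elim
    · simp at ha
  | @cons _ x q' u v w v' _ hd hr =>
    cases hd with
    | @resume _ _ g' _ ht =>
      have hstep : FStep A K (⟨s.1, none, P + {(x :: w, i)}⟩, f)
          (⟨g', some (x :: w, i), P⟩, !false) :=
        .resume _ ⟨x, w, i, g', P, ht, rfl, rfl, rfl, rfl, rfl, rfl⟩ hK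
      obtain ⟨F, m, hF, hm, hout⟩ :=
        TAcc.run_segOut (K := K) (o := s.2) ⟨q', hr, ha⟩ rfl hik P
      refine ⟨F, m + 1, fun y => by simp [hF y, stepVec_none_some], ?_, ?_⟩
      · simp only [Pi.add_apply, stepVec]; omega
      · rcases hout with ⟨h1, h2, h3, f', h4⟩ | ⟨g₂, h1, ⟨h2, h3, h4⟩ | ⟨w', v'', h2, h3, h4, h5⟩⟩
        · exact .inl ⟨h1, h2, h3, f', .head hstep h4⟩
        · exact .inr ⟨g₂, h1, .inl ⟨h2, h3, .head hstep h4⟩⟩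
        · refine .inr ⟨g₂, h1, .inr ⟨w', v'', h2, by simp only [Pi.add_apply]; omega,
            fun l hl y => ?_, .head hstep h5⟩⟩
          rw [h4 l hl y, Pi.add_apply, stepVec_none_some, zero_add]
    | halt hs => exact hs.elim

end

section

/-! ### Multiset rewriting -/

/-- Runs of a multiset rewriting system with labelled rules. -/
inductive MRun {L Pl : Type} (pre post : L → Multiset Pl) : List L → Multiset Pl → Multiset Pl → Prop
  | nil (m) : MRun pre post [] m m
  | cons {a ls y} (m) : MRun pre post ls (post a + m) y → MRun pre post (a :: ls) (pre a + m) y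

namespace MRun
variable {L Pl : Type} {pre post : L → Multiset Pl}

theorem append {ls ls' : List L} {x y z : Multiset Pl} (h : MRun pre post ls x y)
    (h' : MRun pre post ls' y z) : MRun pre post (ls ++ ls') x z := by
  induction h with
  | nil m => exact h'
  | cons m _ ih => exact .cons m (ih h')

theorem add_right {ls : List L} {x y : Multiset Pl} (h : MRun pre post ls x y)
    (z : Multiset Pl) : MRun pre post ls (x + z) (y + z) := by
  induction h with
  | nil m => exact .nil _
  | cons m _ ih => rw [add_assoc]; exact .cons _ (by rwa [← add_assoc])

variable [DecidableEq Pl]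

/-- A marking restricted to finitely many places. -/
def restr (F : Finset Pl) (m : Multiset Pl) : F → ℕ := fun p => m.count p.1

theorem runIn {F : Finset Pl} {D : Set L} {ls : List L} {x y : Multiset Pl}
    (h : MRun pre post ls x y) (hls : ∀ a ∈ ls, a ∈ D) :
    RunIn (Set.image (fun a => (restr F (pre a), restr F (post a))) D) ls.length
      (fun p => restr F x p) (fun p => restr F y p) := by
  induction h with
  | nil m => exact ⟨[], by simp, by simp, by simp, by simp⟩
  | @cons a ls y m _ ih =>
    obtain ⟨l, hl, hS, hleg, heff⟩ := ih fun b hb => hls b (by simp [hb])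
    refine ⟨(restr F (pre a), restr F (post a)) :: l, by simpa using hl, ?_, fun p => ?_, fun p => ?_⟩
    · intro t ht
      rcases List.mem_cons.1 ht with rfl | ht
      · exact ⟨a, hls a (by simp), rfl⟩
      · exact hS t ht
    · have := hleg p
      rw [legC_cons]
      refine ⟨by simp [restr], ?_⟩
      convert this using 1
      simp [restr, Tr.eff]
      ring
    · have := heff p
      rw [effC_cons, ← this]
      simp [restr, Tr.eff]
      ring

theorem of_runIn {F : Finset Pl} {D : Set L} (hpre : ∀ a ∈ D, ∀ p ∈ pre a, p ∈ F)
    (hpost : ∀ a ∈ D, ∀ p ∈ post a, p ∈ F) {N : ℕ} {x y : Multiset Pl} (hx : ∀ p ∈ x, p ∈ F)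
    (hy : ∀ p ∈ y, p ∈ F)
    (h : RunIn (Set.image (fun a => (restr F (pre a), restr F (post a))) D) N
      (fun p => restr F x p) (fun p => restr F y p)) :
    ∃ ls, ls.length ≤ N ∧ (∀ a ∈ ls, a ∈ D) ∧ MRun pre post ls x y := by
  obtain ⟨l, hl, hS, hleg, heff⟩ := h
  suffices ∃ ls, ls.length = l.length ∧ (∀ a ∈ ls, a ∈ D) ∧ MRun pre post ls x y from
    this.imp fun ls h => ⟨h.1.trans_le hl, h.2⟩
  clear hl
  induction l generalizing x with
  | nil =>
    refine ⟨[], rfl, by simp, ?_⟩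
    have : x = y := by
      ext p
      by_cases hp : p ∈ F
      · have := heff ⟨p, hp⟩
        simpa [restr] using this
      · rw [Multiset.count_eq_zero_of_notMem fun h => hp (hx p h),
          Multiset.count_eq_zero_of_notMem fun h => hp (hy p h)]
    rw [this]; exact .nil _
  | cons t l ih =>
    obtain ⟨a, ha, rfl⟩ := hS t (by simp)
    have hle : pre a ≤ x := by
      rw [Multiset.le_iff_count]
      intro p
      by_cases hp : p ∈ F
      · have := (hleg ⟨p, hp⟩).1
        simpa [restr] using this
      · rw [Multiset.count_eq_zero_of_notMem fun h => hp (hpre a ha p h)]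
        exact Nat.zero_le _
    obtain ⟨z, rfl⟩ := Multiset.le_iff_exists_add.1 hle
    have hmem : ∀ p ∈ post a + z, p ∈ F := by
      intro p hp
      rcases Multiset.mem_add.1 hp with hp | hp
      · exact hpost a ha p hp
      · exact hx p (by simp [hp])
    obtain ⟨ls, h1, h2, h3⟩ := ih hmem (fun t ht => hS t (by simp [ht]))
      (fun p => by
        have := (hleg p).2
        convert this using 1
        simp [restr, Tr.eff]
        ring)
      (fun p => by
        rw [← heff p, effC_cons]
        simp [restr, Tr.eff]
        ring)
    exact ⟨a :: ls, by simp [h1], by simpa [ha] using h2, .cons z h3⟩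

end MRun

/-- Reachability in a bounded multiset rewriting system is witnessed by runs of bounded length. -/
theorem exists_mRun_bound : ∃ m, ∀ (n : ℕ) (L Pl : Type) [DecidableEq Pl] (pre post : L → Multiset Pl)
    (F : Finset Pl) (D : Set L), F.card ≤ n →
    (∀ a ∈ D, (∀ p ∈ pre a, p ∈ F) ∧ (∀ p ∈ post a, p ∈ F) ∧
      (∀ p, (pre a).count p ≤ n) ∧ ∀ p, (post a).count p ≤ n) →
    ∀ x y : Multiset Pl, (∀ p ∈ x, p ∈ F) → (∀ p ∈ y, p ∈ F) → (∀ p, x.count p ≤ n) →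
    (∀ p, y.count p ≤ n) → ∀ ls, (∀ a ∈ ls, a ∈ D) → MRun pre post ls x y →
    ∃ ls', ls'.length ≤ ack (m + 3 * n) n ∧ (∀ a ∈ ls', a ∈ D) ∧ MRun pre post ls' x y := by
  obtain ⟨m, hm⟩ := exists_runIn_bound
  refine ⟨m, fun n L Pl _ pre post F D hF hD x y hx hy hxn hyn ls hls h => ?_⟩
  refine MRun.of_runIn (fun a ha => (hD a ha).1) (fun a ha => (hD a ha).2.1) hx hy
    (hm n F (by simpa using hF) _ ?_ _ _ ?_ ?_ ls.length (h.runIn hls))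
  · rintro _ ⟨a, ha, rfl⟩ p
    exact ⟨(hD a ha).2.2.1 p, (hD a ha).2.2.2 p⟩
  · exact fun p => ⟨by positivity, by simpa [MRun.restr] using hxn p⟩
  · exact fun p => ⟨by positivity, by simpa [MRun.restr] using hyn p⟩

end

section

/-! ### The Petri net of thread types -/

/-- The type of a thread: its initial stack symbol, its segments, its remaining stack content if it
is pending at the end, and a Parikh-style description of its spawns. -/
structure Th where
  sym : ℕ
  segs : List Seg
  rest : Option (List ℕ)
  base : Vec
  pumps : Finset Vec

/-- Places of the net. -/
inductive Pl
  | glob (g : Option ℕ)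
  | pend (x : ℕ)
  | wait (θ : Th) (l : ℕ)
  | mark (θ : Th) (l : ℕ)
  | pool (θ : Th) (p : Vec) (l : ℕ)

/-- Labels of the transitions of the net. -/
inductive Lb
  | ev (θ : Th) (l : ℕ)
  | grow (θ : Th) (p : Vec)
  | emit (θ : Th) (p : Vec) (l : ℕ)
  | drain (θ : Th) (l : ℕ)

/-- The number of segments. -/
def Th.len (θ : Th) : ℕ := θ.segs.length

/-- The segment with `l` segments remaining. -/
def Th.seg (θ : Th) (l : ℕ) : Seg := (θ.segs.drop (θ.len - l)).headD (0, none)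

theorem Th.drop_eq {θ : Th} {l : ℕ} (h1 : 1 ≤ l) (h2 : l ≤ θ.len) :
    θ.segs.drop (θ.len - l) = θ.seg l :: θ.segs.drop (θ.len - (l - 1)) := by
  have h : θ.len - l < θ.segs.length := by unfold Th.len at *; omega
  unfold Th.seg
  rw [List.drop_eq_getElem_cons h, show θ.len - l + 1 = θ.len - (l - 1) by omega]
  rfl

theorem Th.length_drop {θ : Th} {l : ℕ} (h : l ≤ θ.len) :
    (θ.segs.drop (θ.len - l)).length = l := by
  rw [List.length_drop]; unfold Th.len at *; omega

/-- The symbols spawned at stage `l` according to `v`. -/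
noncomputable def spawnM (n : ℕ) (v : Vec) (l : ℕ) : Multiset ℕ :=
  ∑ x ∈ Finset.range (n + 1), Multiset.replicate (v (some (l, x))) x

theorem count_spawnM (n : ℕ) (v : Vec) (l x : ℕ) :
    (spawnM n v l).count x = if x ≤ n then v (some (l, x)) else 0 := by
  rw [spawnM, Multiset.count_sum']
  simp only [Multiset.count_replicate]
  simp

theorem spawns_spawnM {n K : ℕ} {v : Vec} (hv : VecIn K n v) (l : ℕ) :
    Spawns (spawnM n v l) v l := by
  intro x
  rw [count_spawnM]
  split
  · rfl
  · exact (hv l x (by omega)).symm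

theorem spawnM_add (n : ℕ) (v w : Vec) (l : ℕ) :
    spawnM n (v + w) l = spawnM n v l + spawnM n w l := by
  ext x; simp only [Multiset.count_add, count_spawnM]; split <;> simp

theorem spawnM_zero (n l : ℕ) : spawnM n 0 l = 0 := by
  ext x; simp [count_spawnM]

/-- The place of a thread before the segment with `l` segments remaining. -/
def Th.input (θ : Th) (l : ℕ) : Multiset Pl := if l = θ.len then {.pend θ.sym} else {.wait θ l}

/-- The tokens of a thread after the segment with `l` segments remaining. -/
def Th.output (θ : Th) (l : ℕ) : Multiset Pl :=
  if l = 1 ∧ θ.rest = none then 0 else {.wait θ (l - 1)}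

/-- Tokens consumed by a transition. -/
def Lb.pre : Lb → Multiset Pl
  | .ev θ l => {.glob (some (θ.seg l).1)} + θ.input l
  | .grow _ _ => 0
  | .emit θ p l => {.mark θ l} + {.pool θ p l}
  | .drain θ l => {.mark θ l}

/-- Tokens produced by a transition. -/
noncomputable def Lb.post (n : ℕ) : Lb → Multiset Pl
  | .ev θ l => {.glob (θ.seg l).2} + (spawnM n θ.base l).map .pend + {.mark θ l} + θ.output l
  | .grow θ p => (Finset.Icc 1 θ.len).val.map (.pool θ p)
  | .emit θ p l => {.mark θ l} + (spawnM n p l).map .pend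
  | .drain _ _ => 0

/-- The remaining stack content is admissible for the target configuration. -/
def RestOk (c : DConfig) (r : Option (List ℕ)) : Prop := ∀ ρ, r = some ρ → ∃ i, (ρ, i) ∈ c.pend

/-- The weight has bounded support and bounded entries. -/
def VecOk (K n : ℕ) (v : Vec) : Prop := VecIn (K + 1) n v ∧ ∀ o, v o < vecBound n

/-- All global states of the segment are bounded. -/
def SegOk (n : ℕ) (s : Seg) : Prop := s.1 ≤ n ∧ ∀ g, s.2 = some g → g ≤ n

/-- Correct thread types. -/
structure Th.Ok (A : DCPS) (c : DConfig) (K n : ℕ) (θ : Th) : Prop where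
  pos : 1 ≤ θ.len
  le : θ.len ≤ K + 1
  sym : θ.sym ≤ n
  segs : ∀ s ∈ θ.segs, SegOk n s
  rest : RestOk c θ.rest
  base : VecOk K n θ.base
  pumps : ∀ p ∈ θ.pumps, VecOk K n p ∧ 1 ≤ p none
  acc : ∀ ms : Multiset Vec, (∀ p ∈ ms, p ∈ θ.pumps) →
    TAcc A c θ.len θ.rest (.wait θ.segs) [θ.sym] (θ.base + ms.sum)

/-- Correct labels. -/
def Lb.Ok (A : DCPS) (c : DConfig) (K n : ℕ) : Lb → Prop
  | .ev θ l => θ.Ok A c K n ∧ 1 ≤ l ∧ l ≤ θ.len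
  | .grow θ p => θ.Ok A c K n ∧ p ∈ θ.pumps
  | .emit θ p l => θ.Ok A c K n ∧ p ∈ θ.pumps ∧ 1 ≤ l ∧ l ≤ θ.len
  | .drain θ l => θ.Ok A c K n ∧ 1 ≤ l ∧ l ≤ θ.len

/-- Runs of the net. -/
def NRun (A : DCPS) (c : DConfig) (K n : ℕ) (x y : Multiset Pl) : Prop :=
  ∃ ls, (∀ a ∈ ls, a.Ok A c K n) ∧ MRun Lb.pre (Lb.post n) ls x y

section
variable {A : DCPS} {c : DConfig} {K n : ℕ}

theorem NRun.refl (x : Multiset Pl) : NRun A c K n x x := ⟨[], by simp, .nil x⟩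

theorem NRun.trans {x y z : Multiset Pl} (h : NRun A c K n x y) (h' : NRun A c K n y z) :
    NRun A c K n x z := by
  obtain ⟨ls, h1, h2⟩ := h
  obtain ⟨ls', h1', h2'⟩ := h'
  refine ⟨ls ++ ls', fun a ha => ?_, h2.append h2'⟩
  rcases List.mem_append.1 ha with ha | ha
  exacts [h1 a ha, h1' a ha]

theorem NRun.add_right {x y : Multiset Pl} (h : NRun A c K n x y) (z : Multiset Pl) :
    NRun A c K n (x + z) (y + z) :=
  h.imp fun _ h => ⟨h.1, h.2.add_right z⟩

theorem NRun.step (a : Lb) (ha : a.Ok A c K n) : NRun A c K n a.pre (a.post n) := by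
  refine ⟨[a], by simpa using ha, ?_⟩
  have := MRun.cons (pre := Lb.pre) (post := Lb.post n) (a := a) (0 : Multiset Pl) (.nil _)
  simpa using this

/-- The surplus tokens of a thread with `l` segments remaining. -/
def poolM (θ : Th) (s : Multiset Vec) (l : ℕ) : Multiset Pl :=
  s.bind fun p => (Finset.Icc 1 l).val.map (.pool θ p)

theorem poolM_cons (θ : Th) (p : Vec) (s : Multiset Vec) (l : ℕ) :
    poolM θ (p ::ₘ s) l = (Finset.Icc 1 l).val.map (.pool θ p) + poolM θ s l :=
  Multiset.cons_bind _ _ _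

theorem poolM_zero (θ : Th) (s : Multiset Vec) : poolM θ s 0 = 0 := by
  induction s using Multiset.induction with
  | empty => rfl
  | cons p s ih => rw [poolM_cons, ih]; rfl

theorem Icc_succ_val (l : ℕ) : (Finset.Icc 1 (l + 1)).val = (l + 1) ::ₘ (Finset.Icc 1 l).val := by
  rw [← Finset.insert_Icc_right_eq_Icc_add_one (by omega), Finset.insert_val_of_notMem (by simp)]

theorem nRun_grow {θ : Th} (hθ : θ.Ok A c K n) {s : Multiset Vec} (hs : ∀ p ∈ s, p ∈ θ.pumps) :
    NRun A c K n 0 (poolM θ s θ.len) := by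
  induction s using Multiset.induction with
  | empty => exact .refl _
  | cons p s ih =>
    have h1 := NRun.step (.grow θ p) (A := A) (c := c) (K := K) (n := n) ⟨hθ, hs p (by simp)⟩
    have h2 := h1.trans (by simpa using (ih fun q hq => hs q (by simp [hq])).add_right _)
    rw [poolM_cons, add_comm]
    exact h2

theorem nRun_emit {θ : Th} (hθ : θ.Ok A c K n) {l : ℕ} (hl : l + 1 ≤ θ.len) {s : Multiset Vec}
    (hs : ∀ p ∈ s, p ∈ θ.pumps) :
    NRun A c K n ({.mark θ (l + 1)} + poolM θ s (l + 1))
      ({.mark θ (l + 1)} + (spawnM n s.sum (l + 1)).map .pend + poolM θ s l) := by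
  induction s using Multiset.induction with
  | empty => rw [Multiset.sum_zero, spawnM_zero]; exact .refl _
  | cons p s ih =>
    have h1 := NRun.step (.emit θ p (l + 1)) (A := A) (c := c) (K := K) (n := n)
      ⟨hθ, hs p (by simp), by omega, hl⟩
    have h2 := (ih fun q hq => hs q (by simp [hq])).add_right
      ((spawnM n p (l + 1)).map .pend + (Finset.Icc 1 l).val.map (.pool θ p))
    have h3 := h1.add_right ((Finset.Icc 1 l).val.map (.pool θ p) + poolM θ s (l + 1))
    rw [poolM_cons, poolM_cons, Multiset.sum_cons, spawnM_add, Multiset.map_add, Icc_succ_val,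
      Multiset.map_cons, ← Multiset.singleton_add]
    convert h3.trans (y := _) (z := _) (by convert h2 using 1; simp only [Lb.post]; abel) using 1
    · simp only [Lb.pre]; abel
    · abel

/-- The execution of the segment with `l` segments remaining, with surplus `s`. -/
theorem nRun_ev {θ : Th} (hθ : θ.Ok A c K n) {l : ℕ} (h1 : 1 ≤ l) (hl : l ≤ θ.len)
    {s : Multiset Vec} (hs : ∀ p ∈ s, p ∈ θ.pumps) :
    NRun A c K n ({.glob (some (θ.seg l).1)} + θ.input l + poolM θ s l)
      ({.glob (θ.seg l).2} + (spawnM n (θ.base + s.sum) l).map .pend + θ.output l +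
        poolM θ s (l - 1)) := by
  obtain ⟨l, rfl⟩ : ∃ m, l = m + 1 := ⟨l - 1, by omega⟩
  have e1 := (NRun.step (.ev θ (l + 1)) (A := A) (c := c) (K := K) (n := n)
    ⟨hθ, by omega, hl⟩).add_right (poolM θ s (l + 1))
  have e2 := (nRun_emit hθ hl hs).add_right
    ({.glob (θ.seg (l + 1)).2} + (spawnM n θ.base (l + 1)).map .pend + θ.output (l + 1))
  have e3 := (NRun.step (.drain θ (l + 1)) (A := A) (c := c) (K := K) (n := n)
    ⟨hθ, by omega, hl⟩).add_right ({.glob (θ.seg (l + 1)).2} +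
      (spawnM n (θ.base + s.sum) (l + 1)).map .pend + θ.output (l + 1) + poolM θ s l)
  refine e1.trans ?_
  simp only [Lb.post, Lb.pre, zero_add, spawnM_add, Multiset.map_add, Nat.add_sub_cancel] at *
  convert e2.trans (z := _) (by convert e3 using 1; abel) using 1
  abel
end

end

section

/-! ### From runs of the system to runs of the net -/

/-- The future of a thread: its number of segments, its remaining segments, its final stack content
if it is pending at the end, and its future spawns. -/
abbrev Plan : Type := ℕ × List Seg × Option (List ℕ) × Vec

/-- The restriction of a weight to the stages at most `l`. -/
def mask (l : ℕ) (v : Vec) : Vec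
  | none => 0
  | some (a, x) => if 1 ≤ a ∧ a ≤ l then v (some (a, x)) else 0

theorem mask_congr {l : ℕ} {v w : Vec} (h : ∀ a x, a ≤ l → v (some (a, x)) = w (some (a, x))) :
    mask l v = mask l w := by
  funext o
  rcases o with _ | ⟨a, x⟩
  · rfl
  · simp only [mask]
    split
    · exact h _ _ (by omega)
    · rfl

theorem mask_mask {l m : ℕ} (h : l ≤ m) (v : Vec) : mask l (mask m v) = mask l v := by
  funext o
  rcases o with _ | ⟨a, x⟩
  · rfl
  · simp only [mask]
    split
    · rw [if_pos (by omega)]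
    · rfl

theorem mask_zero (v : Vec) : mask 0 v = 0 := by
  funext o
  rcases o with _ | ⟨a, x⟩
  · rfl
  · simp only [mask]
    rw [if_neg (by omega)]; rfl

theorem spawnM_congr {n l : ℕ} {v w : Vec} (h : ∀ x, v (some (l, x)) = w (some (l, x))) :
    spawnM n v l = spawnM n w l := by
  simp only [spawnM, h]

theorem spawnM_mask {n l m : ℕ} (v : Vec) (h1 : 1 ≤ l) (h : l ≤ m) :
    spawnM n (mask m v) l = spawnM n v l :=
  spawnM_congr fun x => by simp [mask, h1, h]

/-- The thread types in the net, with surplus and number of remaining segments. -/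
abbrev Tok : Type := Th × Multiset Vec × ℕ

/-- The future of a token. -/
def Tok.plan (t : Tok) : Plan :=
  (t.1.len, t.1.segs.drop (t.1.len - t.2.2), t.1.rest, mask t.2.2 (t.1.base + t.2.1.sum))

/-- The tokens of the net. -/
def Tok.toks (t : Tok) : Multiset Pl := {.wait t.1 t.2.2} + poolM t.1 t.2.1 t.2.2

/-- Correct tokens. -/
def Tok.Ok (A : DCPS) (c : DConfig) (K n : ℕ) (t : Tok) : Prop :=
  t.1.Ok A c K n ∧ t.2.2 < t.1.len ∧ ∀ p ∈ t.2.1, p ∈ t.1.pumps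

/-- The thread can follow the plan. -/
def PAcc (A : DCPS) (c : DConfig) (K n : ℕ) (t : Loc × Plan) : Prop :=
  t.2.1 = t.1.2 + t.2.2.1.length ∧ RestOk c t.2.2.2.1 ∧ (∀ s ∈ t.2.2.1, SegOk n s) ∧
    (t.2.2.1 ≠ [] → t.2.1 ≤ K + 1) ∧ 
    ∃ v, TAcc A c t.2.1 t.2.2.2.1 (.wait t.2.2.1) t.1.1 v ∧ t.2.2.2.2 = mask t.2.2.1.length v

/-- The markings of the net that correspond to the target configuration. -/
def IsTarget (A : DCPS) (c : DConfig) (K n : ℕ) (y : Multiset Pl) : Prop :=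
  ∃ (F : Multiset ℕ) (O : Multiset Loc) (W : Multiset Th), (∀ θ ∈ W, θ.Ok A c K n) ∧
    (∀ t ∈ O, 1 ≤ t.2) ∧ c.pend = F.map fr + O ∧
    y = {.glob (if c.act = none then some c.g else none)} + F.map .pend + W.map (.wait · 0) ∧
    (∀ θ ∈ W, θ.rest ≠ none) ∧ W.map (fun θ => (θ.rest.getD [], θ.len)) = O

/-- The tokens following the plans can reach the target. -/
def Reaches (A : DCPS) (c : DConfig) (K n : ℕ) (T : Multiset Plan) (m : Multiset Pl) : Prop :=
  ∀ X : Multiset Tok, (∀ t ∈ X, t.Ok A c K n) → X.map Tok.plan = T →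
    ∃ y, IsTarget A c K n y ∧ NRun A c K n (m + X.bind Tok.toks) y

/-- The net can reach the target from the schedule point. -/
def SchedOk (A : DCPS) (c : DConfig) (K n : ℕ) (g : ℕ) (F : Multiset ℕ) (O : Multiset Loc) : Prop :=
  ∃ T : Multiset (Loc × Plan), T.map Prod.fst = O ∧ (∀ t ∈ T, PAcc A c K n t) ∧
    Reaches A c K n (T.map Prod.snd) ({.glob (some g)} + F.map .pend)

/-- The net can reach the target from the end of the current segment. -/
def ActOk (A : DCPS) (c : DConfig) (K n : ℕ) (g : ℕ) (w : List ℕ) (i : ℕ) (f : Bool)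
    (F : Multiset ℕ) (O : Multiset Loc) : Prop :=
  ∃ (T : Multiset (Loc × Plan)) (o : Option ℕ) (σ : List Seg) (r : Option (List ℕ)) (v : Vec),
    T.map Prod.fst = O ∧ (∀ t ∈ T, PAcc A c K n t) ∧ (∀ g', o = some g' → g' ≤ n) ∧
    (∀ s ∈ σ, SegOk n s) ∧ RestOk c r ∧ (σ ≠ [] → i + 1 + σ.length ≤ K + 1) ∧
    (∀ g₁, TAcc A c (i + 1 + σ.length) r (.run g ((g₁, o) :: σ) (!f)) w v) ∧
    Reaches A c K n
      (T.map Prod.snd + if σ = [] ∧ r = none then 0 else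
        {(i + 1 + σ.length, σ, r, mask σ.length v)})
      ({.glob o} + F.map .pend + (spawnM n v (σ.length + 1)).map .pend)

variable {A : DCPS} {c : DConfig} {K n : ℕ}

theorem nsmul_stepVec_none_some (m l : ℕ) (y : ℕ × ℕ) : (m • stepVec l none) (some y) = 0 := by
  rw [Pi.smul_apply, stepVec_none_some, smul_zero]

theorem Stops.tAcc {k : ℕ} {r : Option (List ℕ)} {q : TQ} {w : List ℕ}
    (h : Stops A c k r q w) : TAcc A c k r q w (w.length • stepVec 0 none) := by
  have hf : ∀ w : List ℕ, PT (TStep A c k r) (.flush w) w (w.length • stepVec 0 none)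
      (.flush []) := by
    intro w
    induction w with
    | nil => rw [List.length_nil, zero_smul]; exact .nil _
    | cons x w ih =>
      rw [List.length_cons, succ_nsmul']
      exact .cons .flush (by simpa using ih)
  cases w with
  | nil => rw [List.length_nil, zero_smul]; exact ⟨q, .nil _, .inl h⟩
  | cons x w =>
    rw [List.length_cons, succ_nsmul']
    exact ⟨_, .cons (.halt h) (by simpa using hf w), .inr rfl⟩

theorem TAcc.cons {k : ℕ} {r : Option (List ℕ)} {q q' : TQ} {x : ℕ} {u w : List ℕ} {v v' : Vec}
    (hs : TStep A c k r q x q' u v) (h : TAcc A c k r q' (u ++ w) v') :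
    TAcc A c k r q (x :: w) (v + v') := by
  obtain ⟨p, h1, h2⟩ := h
  exact ⟨p, .cons hs h1, h2⟩

theorem TAcc.rest_ne_none {k : ℕ} {r : Option (List ℕ)} {w : List ℕ} {v : Vec}
    (h : TAcc A c k r (.wait []) w v) : r ≠ none := by
  rintro rfl
  obtain ⟨q, h, hq⟩ := h
  cases h with
  | nil => rcases hq with hq | hq <;> cases hq
  | cons hs _ =>
    cases hs with
    | halt h => cases h

theorem exists_eq_add_of_map_eq {α β : Type} {f : α → β} {X : Multiset α} {T : Multiset β} {a : β}
    (h : X.map f = T + {a}) : ∃ X' t, X = X' + {t} ∧ f t = a ∧ X'.map f = T := by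
  have : a ∈ X.map f := by rw [h]; simp
  obtain ⟨t, ht, rfl⟩ := Multiset.mem_map.1 this
  obtain ⟨X', rfl⟩ := Multiset.exists_cons_of_mem ht
  refine ⟨X', t, by rw [add_comm, Multiset.singleton_add], rfl, ?_⟩
  rw [Multiset.map_cons, ← Multiset.singleton_add, add_comm] at h
  exact add_right_cancel h

/-- The plans at the end of the run. -/
theorem exists_final_plans (F : Multiset ℕ) (O : Multiset Loc) (h : c.pend = F.map fr + O)
    (hO : ∀ t ∈ O, 1 ≤ t.2) : ∃ T : Multiset (Loc × Plan), T.map Prod.fst = O ∧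
      (∀ t ∈ T, PAcc A c K n t) ∧ Reaches A c K n (T.map Prod.snd)
        ({.glob (if c.act = none then some c.g else none)} + F.map .pend) := by
  refine ⟨O.map fun t => (t, (t.2, [], some t.1, 0)), by simp, ?_, ?_⟩
  · intro t ht
    obtain ⟨t, ht', rfl⟩ := Multiset.mem_map.1 ht
    have hv := Stops.tAcc (A := A) (c := c) (k := t.2) (r := some t.1)
      (q := .wait []) (w := t.1) rfl
    refine ⟨by simp, ?_, by simp, by simp, _, hv, by simp [mask_zero]⟩
    rintro ρ hρ
    simp only [Option.some.injEq] at hρ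
    subst hρ
    exact ⟨t.2, by rw [h]; simp [ht']⟩
  · intro X hX hXT
    rw [Multiset.map_map] at hXT
    have hp : ∀ t ∈ X, t.2.2 = 0 ∧ t.1.rest ≠ none := by
      intro t ht
      have := Multiset.mem_map_of_mem Tok.plan ht
      rw [hXT] at this
      obtain ⟨s, hs, he⟩ := Multiset.mem_map.1 this
      simp only [Function.comp, Tok.plan, Prod.mk.injEq] at he
      have h1 := Th.length_drop (hX t ht).2.1.le
      rw [← he.2.1] at h1
      exact ⟨by simpa using h1.symm, by rw [← he.2.2.1]; simp⟩
    refine ⟨_, ⟨F, O, X.map Prod.fst, ?_, hO, h, ?_, ?_, ?_⟩, .refl _⟩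
    · intro θ hθ
      obtain ⟨t, ht, rfl⟩ := Multiset.mem_map.1 hθ
      exact (hX t ht).1
    · congr 1
      rw [Multiset.map_map, ← Multiset.bind_singleton]
      refine Multiset.bind_congr fun t ht => ?_
      simp [Tok.toks, (hp t ht).1, poolM_zero]
    · intro θ hθ
      obtain ⟨t, ht, rfl⟩ := Multiset.mem_map.1 hθ
      exact (hp t ht).2
    · have := congrArg (Multiset.map fun p : Plan => (p.2.2.1.getD [], p.1)) hXT
      rw [Multiset.map_map, Multiset.map_map] at this
      rw [Multiset.map_map]
      simpa [Function.comp_def, Tok.plan] using this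

theorem ActOk.final {w : List ℕ} {i : ℕ} {f : Bool} (F : Multiset ℕ) (O : Multiset Loc)
    (h : c.pend = F.map fr + O) (hO : ∀ t ∈ O, 1 ≤ t.2) (hc : c.act = some (w, i)) :
    ActOk A c K n c.g w i f F O := by
  obtain ⟨T, h1, h2, h3⟩ := exists_final_plans (A := A) (K := K) (n := n) F O h hO
  refine ⟨T, none, [], none, w.length • stepVec 0 none, h1, h2, by simp, by simp,
    fun _ h => (by cases h), by simp, fun g₁ => Stops.tAcc ⟨rfl, rfl, hc⟩, ?_⟩
  rw [spawnM_congr (w := 0) fun x => nsmul_stepVec_none_some _ _ _, spawnM_zero]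
  simpa [hc] using h3

theorem ActOk.thread {g x g' : ℕ} {w' w : List ℕ} {i : ℕ} {f : Bool} {sp : Option ℕ}
    {F : Multiset ℕ} {O : Multiset Loc} (hs : SizeBd A c n) (hr : (g, x, g', w', sp) ∈ A.creation)
    (h : ActOk A c K n g' (w' ++ w) i false (F + sp.elim 0 singleton) O) :
    ActOk A c K n g (x :: w) i f F O := by
  obtain ⟨T, o, σ, r, v, h1, h2, h3, h4, h5, h6, h7, h8⟩ := h
  refine ⟨T, o, σ, r, stepVec (σ.length + 1) sp + v, h1, h2, h3, h4, h5, h6, fun g₁ =>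
    .cons (.thread hr) (h7 g₁), ?_⟩
  have e1 : mask σ.length (stepVec (σ.length + 1) sp + v) = mask σ.length v := by
    refine mask_congr fun a x ha => ?_
    have : a ≠ σ.length + 1 := by omega
    simp [stepVec, this]
  have e2 : spawnM n (stepVec (σ.length + 1) sp + v) (σ.length + 1) =
      sp.elim 0 singleton + spawnM n v (σ.length + 1) := by
    rw [spawnM_add]
    congr 1
    ext y
    rw [count_spawnM]
    have := (hs.creation _ _ _ _ _ hr).2.2.2
    cases sp with
    | none => simp [stepVec]
    | some z =>
      have := this z rfl
      simp only [stepVec, true_and, Option.some.injEq, Option.elim, Multiset.count_singleton]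
      by_cases hy : y = z
      · subst hy; simp [this]
      · simp [hy, Ne.symm hy]
  rw [e1, e2]
  convert h8 using 1
  simp only [Multiset.map_add]
  abel

theorem ActOk.swap {g x g' : ℕ} {w' w : List ℕ} {i : ℕ}
    {F : Multiset ℕ} {O : Multiset Loc} (hs : SizeBd A c n) (hr : (g, x, g', w') ∈ A.interruption)
    (h : SchedOk A c K n g' F (O + {(w' ++ w, i + 1)})) :
    ActOk A c K n g (x :: w) i false F O := by
  obtain ⟨T, h1, h2, h3⟩ := h
  obtain ⟨T, ⟨t, p⟩, rfl, ht, rfl⟩ := exists_eq_add_of_map_eq h1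
  simp only at ht
  subst ht
  obtain ⟨k, σ, r, u⟩ := p
  obtain ⟨p1, p2, p3, p4, v, p5, p6⟩ := h2 ((w' ++ w, i + 1), k, σ, r, u) (by simp)
  simp only at p1 p2 p3 p4 p5 p6
  subst p1 p6
  refine ⟨T, some g', σ, r, stepVec 0 none + v, rfl, fun t ht => h2 t (by simp [ht]), ?_, p3, p2, p4,
    fun g₁ => .cons (.swap hr) p5, ?_⟩
  · rintro _ ⟨⟩; exact (hs.interruption _ _ _ _ hr).1
  · have e1 : mask σ.length (stepVec 0 none + v) = mask σ.length v :=
      mask_congr fun a x ha => by rw [Pi.add_apply, stepVec_none_some, zero_add]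
    have e2 : spawnM n (stepVec 0 none + v) (σ.length + 1) = 0 := by
      rw [← spawnM_zero n (σ.length + 1)]
      exact spawnM_congr fun x => by
        rw [Pi.add_apply, stepVec_none_some, zero_add, p5.eq_zero (by simp [TQ.rem])]; rfl
    have e3 : ¬ (σ = [] ∧ r = none) := by
      rintro ⟨rfl, rfl⟩
      exact p5.rest_ne_none rfl
    rw [if_neg e3, e1, e2]
    simpa using h3

theorem ActOk.term {g g' : ℕ} {i : ℕ} {F : Multiset ℕ} {O : Multiset Loc} (hs : SizeBd A c n)
    (hr : (g, g') ∈ A.termination) (h : SchedOk A c K n g' F O) :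
    ActOk A c K n g [] i false F O := by
  obtain ⟨T, h1, h2, h3⟩ := h
  refine ⟨T, some g', [], none, 0, h1, h2, ?_, by simp, fun _ h => (by cases h), by simp,
    fun g₁ => ⟨_, .nil _, .inl ⟨rfl, hr, rfl⟩⟩, ?_⟩
  · rintro _ ⟨⟩; exact hs.termination _ _ hr
  · rw [spawnM_zero]; simpa using h3

/-- The execution of a segment by a token. -/
theorem Reaches.seg {T : Multiset Plan} {θ : Th} (hθ : θ.Ok A c K n) {l : ℕ} (h1 : 1 ≤ l)
    (hl : l ≤ θ.len) {s : Multiset Vec} (hs : ∀ p ∈ s, p ∈ θ.pumps) {g : ℕ} {o : Option ℕ}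
    {σ : List Seg} (hσ : θ.segs.drop (θ.len - l) = (g, o) :: σ) {F : Multiset ℕ}
    (h : Reaches A c K n
      (T + if σ = [] ∧ θ.rest = none then 0 else
        {(θ.len, σ, θ.rest, mask σ.length (θ.base + s.sum))})
      ({.glob o} + F.map .pend + (spawnM n (θ.base + s.sum) (σ.length + 1)).map .pend))
    {X : Multiset Tok} (hX : ∀ t ∈ X, t.Ok A c K n) (hXT : X.map Tok.plan = T) :
    ∃ y, IsTarget A c K n y ∧
      NRun A c K n ({.glob (some g)} + F.map .pend + X.bind Tok.toks + θ.input l + poolM θ s l)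
        y := by
  have hll : σ.length + 1 = l := by
    have := Th.length_drop hl
    rw [hσ] at this
    simpa using this
  rw [Th.drop_eq h1 hl] at hσ
  obtain ⟨e1, e2⟩ := List.cons.inj hσ
  have hrun := (nRun_ev hθ h1 hl hs).add_right (F.map .pend + X.bind Tok.toks)
  rw [e1] at hrun
  have hlt : (l - 1) < θ.len := by omega
  by_cases hc : σ = [] ∧ θ.rest = none
  · rw [if_pos hc, add_zero] at h
    obtain ⟨y, hy, hr⟩ := h X hX hXT
    refine ⟨y, hy, ?_⟩
    have : l = 1 := by rw [← hll, hc.1]; rfl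
    convert hrun.trans (z := y) ?_ using 1
    · abel
    · convert hr using 1
      rw [Th.output, if_pos ⟨this, hc.2⟩, this, poolM_zero]
      subst this
      rw [hll]
      abel
  · rw [if_neg hc] at h
    obtain ⟨y, hy, hr⟩ := h (X + {(θ, s, l - 1)}) (by
      intro t ht
      rcases Multiset.mem_add.1 ht with ht | ht
      · exact hX t ht
      · rw [Multiset.mem_singleton.1 ht]
        exact ⟨hθ, hlt, hs⟩) (by
      rw [Multiset.map_add, hXT, Multiset.map_singleton, Tok.plan]
      simp only [e2]
      rw [← hll, Nat.add_sub_cancel])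
    refine ⟨y, hy, ?_⟩
    convert hrun.trans (z := y) ?_ using 1
    · abel
    · convert hr using 1
      have hne : ¬ (l = 1 ∧ θ.rest = none) := by
        rintro ⟨rfl, h⟩
        exact hc ⟨by simpa using hll, h⟩
      rw [Th.output, if_neg hne, Multiset.add_bind, Multiset.singleton_bind, hll, Tok.toks]
      abel

theorem SchedOk.resume_old {g g' x : ℕ} {w : List ℕ} {i : ℕ} {F : Multiset ℕ} {O : Multiset Loc}
    (hs : SizeBd A c n) (hr : (g, g', x) ∈ A.resumption) (hi : i ≤ K)
    (h : ActOk A c K n g' (x :: w) i true F O) :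
    SchedOk A c K n g F (O + {(x :: w, i)}) := by
  obtain ⟨T, o, σ, r, v, h1, h2, h3, h4, h5, h6, h7, h8⟩ := h
  have hlen : i + 1 + σ.length ≤ K + 1 := by
    by_cases h : σ = []
    · subst h; simpa using hi
    · exact h6 h
  refine ⟨T + {((x :: w, i), (i + 1 + σ.length, (g, o) :: σ, r, mask (σ.length + 1) v))}, by simp [h1],
    ?_, ?_⟩
  · intro t ht
    rcases Multiset.mem_add.1 ht with ht | ht
    · exact h2 t ht
    rw [Multiset.mem_singleton.1 ht]
    refine ⟨by simp; omega, h5, ?_, fun _ => hlen, stepVec 0 none + v, .cons (.resume hr) ?_, ?_⟩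
    · intro s hs'
      rcases List.mem_cons.1 hs' with rfl | hs'
      · exact ⟨(hs.resumption _ _ _ hr).1, h3⟩
      · exact h4 s hs'
    · exact h7 g
    · exact mask_congr fun a x ha => by rw [Pi.add_apply, stepVec_none_some, zero_add]
  · intro X hX hXT
    rw [Multiset.map_add, Multiset.map_singleton] at hXT
    obtain ⟨X, t, rfl, ht, hXT'⟩ := exists_eq_add_of_map_eq hXT
    obtain ⟨θ, s, l⟩ := t
    obtain ⟨hθ, hl, hs'⟩ := hX (θ, s, l) (by simp)
    simp only at hθ hl hs'
    simp only [Tok.plan, Prod.mk.injEq] at ht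
    obtain ⟨t1, t2, t3, t4⟩ := ht
    have hll : l = σ.length + 1 := by
      have := Th.length_drop hl.le
      rw [t2] at this
      simpa using this.symm
    subst hll
    obtain ⟨y, hy, hrun⟩ := Reaches.seg (T := T.map Prod.snd) (F := F) hθ (by omega) hl.le hs' t2 (by
      rw [t1, t3, ← mask_mask (Nat.le_succ _) (θ.base + s.sum), t4, mask_mask (Nat.le_succ _),
        ← spawnM_mask (θ.base + s.sum) (by omega) le_rfl, t4, spawnM_mask _ (by omega) le_rfl]
      exact h8)
      (X := X) (fun t ht => hX t (by simp [ht])) hXT'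
    refine ⟨y, hy, ?_⟩
    rw [Th.input, if_neg hl.ne] at hrun
    convert hrun using 1
    rw [Multiset.add_bind, Multiset.singleton_bind, Tok.toks]
    abel

theorem SchedOk.resume_fresh {g g' x : ℕ} {F : Multiset ℕ} {O : Multiset Loc}
    (hs : SizeBd A c n) (hKn : K + 1 ≤ n) (hr : (g, g', x) ∈ A.resumption)
    (h : ActOk A c K n g' [x] 0 true F O) :
    SchedOk A c K n g (F + {x}) O := by
  classical
  obtain ⟨T, o, σ, r, v, h1, h2, h3, h4, h5, h6, h7, h8⟩ := h
  have hlen : 0 + 1 + σ.length ≤ K + 1 := by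
    by_cases h : σ = []
    · subst h; simp
    · exact h6 h
  have hacc : TAcc A c (0 + 1 + σ.length) r (.wait ((g, o) :: σ)) [x] (stepVec 0 none + v) :=
    .cons (.resume hr) (h7 g)
  obtain ⟨b, ps, hv, hb, hps, hms⟩ := hacc.parikh hs (by simp; omega) (by
    cases r with
    | none => simp
    | some ρ =>
      obtain ⟨i, hi⟩ := h5 ρ rfl
      exact (hs.pend _ _ hi).1) (hs.resumption _ _ _ hr).2.2
  have hin : ∀ ms : Multiset Vec, (∀ p ∈ ms, p ∈ ps) → VecIn (K + 1) n (b + ms.sum) := fun ms h =>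
    (hms ms h).vecIn hs (by simp; omega)
  have hbin : VecIn (K + 1) n b := by simpa using hin 0 (by simp)
  have hθ : Th.Ok A c K n ⟨x, (g, o) :: σ, r, b, ps.toFinset⟩ := by
    refine ⟨by simp [Th.len], by simp [Th.len]; omega, (hs.resumption _ _ _ hr).2.2, ?_, h5,
      ⟨hbin, hb⟩, ?_, ?_⟩
    · intro s hs'
      rcases List.mem_cons.1 hs' with rfl | hs'
      · exact ⟨(hs.resumption _ _ _ hr).1, h3⟩
      · exact h4 s hs'
    · intro p hp
      have hp := Multiset.mem_toFinset.1 hp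
      refine ⟨⟨fun l y hly => ?_, (hps p hp).2⟩, (hps p hp).1⟩
      have := hin {p} (by simpa using hp) l y hly
      rw [Multiset.sum_singleton, Pi.add_apply] at this
      omega
    · intro ms hm
      have := hms ms fun p hp => Multiset.mem_toFinset.1 (hm p hp)
      convert this using 1
      simp [Th.len]; omega
  generalize hΘ : (⟨x, (g, o) :: σ, r, b, ps.toFinset⟩ : Th) = θ at hθ
  have hlenθ : θ.len = σ.length + 1 := by rw [← hΘ]; rfl
  have hsum : θ.base + ps.sum = stepVec 0 none + v := by rw [hv, ← hΘ]
  have hpm : ∀ p ∈ ps, p ∈ θ.pumps := by rw [← hΘ]; exact fun p hp => Multiset.mem_toFinset.2 hp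
  have hrest : θ.rest = r := by rw [← hΘ]
  have hsym : θ.sym = x := by rw [← hΘ]
  refine ⟨T, h1, h2, fun X hX hXT => ?_⟩
  have e0 : ∀ a y, v (some (a, y)) = (θ.base + ps.sum) (some (a, y)) := fun a y => by
    rw [hsum, Pi.add_apply, stepVec_none_some, zero_add]
  obtain ⟨y, hy, hrun⟩ := Reaches.seg (T := T.map Prod.snd) (F := F) (g := g) (o := o) (σ := σ)
    hθ hθ.pos le_rfl hpm (by rw [Nat.sub_self, ← hΘ]; rfl) (by
      rw [hrest, hlenθ, mask_congr fun a y _ => (e0 a y).symm, spawnM_congr fun y => (e0 _ y).symm]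
      rw [zero_add, add_comm 1] at h8
      exact h8) hX hXT
  refine ⟨y, hy, ?_⟩
  have hg := (nRun_grow hθ hpm).add_right
    ({.glob (some g)} + (F + {x}).map .pend + X.bind Tok.toks)
  rw [zero_add] at hg
  refine hg.trans ?_
  convert hrun using 1
  rw [Th.input, if_pos rfl, hsym, Multiset.map_add, Multiset.map_singleton]
  abel

/-- Every run of the system is followed by a run of the net. -/
theorem FRun.actOk_schedOk (hs : SizeBd A c n) (hKn : K + 1 ≤ n) {m : ℕ} {p q : DConfig × Bool}
    (h : FRun A K m p q) (hq : q.1 = c) : ∀ (F : Multiset ℕ) (O : Multiset Loc),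
    p.1.pend = F.map fr + O → (∀ t ∈ O, 1 ≤ t.2) →
      (p.1.act = none → SchedOk A c K n p.1.g F O) ∧
      ∀ w i, p.1.act = some (w, i) → ActOk A c K n p.1.g w i p.2 F O := by
  induction h with
  | refl p =>
    subst hq
    intro F O hF hO
    refine ⟨fun ha => ?_, fun w i hw => .final F O hF hO hw⟩
    have := exists_final_plans (A := A) (K := K) (n := n) F O hF hO
    rw [if_pos ha] at this
    exact this
  | head hst _ ih =>
    intro F O hF hO
    replace ih := ih hq
    cases hst with
    | thread f hst =>
      obtain ⟨x, w, i, g', w', sp, hr, ha, rfl, ha', hp⟩ := hst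
      refine ⟨fun h => (by rw [h] at ha; cases ha), fun w₁ i₁ h => ?_⟩
      rw [ha] at h
      cases h
      refine .thread hs hr ((ih (F + sp.elim 0 singleton) O ?_ hO).2 _ _ ha')
      rw [hp, hF, Multiset.map_add]
      have : spawnOf sp = (sp.elim 0 singleton : Multiset ℕ).map fr := by
        cases sp with
        | none => rfl
        | some y => exact (Multiset.map_singleton fr y).symm
      rw [this]
      abel
    | swap hst =>
      obtain ⟨x, w, i, g', w', hr, ha, rfl, ha', hp⟩ := hst
      refine ⟨fun h => (by rw [h] at ha; cases ha), fun w₁ i₁ h => ?_⟩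
      rw [ha] at h
      cases h
      refine .swap hs hr ((ih F _ (by rw [hp, hF, add_assoc]) ?_).1 ha')
      intro t ht
      rcases Multiset.mem_add.1 ht with ht | ht
      · exact hO t ht
      · rw [Multiset.mem_singleton.1 ht]; omega
    | term hst =>
      obtain ⟨i, g', hr, ha, rfl, ha', hp⟩ := hst
      refine ⟨fun h => (by rw [h] at ha; cases ha), fun w₁ i₁ h => ?_⟩
      rw [ha] at h
      cases h
      exact .term hs hr ((ih F O (by rw [hp, hF]) hO).1 ha')
    | resume f hst hi =>
      obtain ⟨x, w, i, g', p₀, hr, rfl, ha, hp, rfl, ha', rfl⟩ := hst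
      refine ⟨fun _ => ?_, fun w i h => (by rw [h] at ha; cases ha)⟩
      rw [hF] at hp
      have hmem : (x :: w, i) ∈ F.map fr + O := by rw [hp]; simp
      rcases Multiset.mem_add.1 hmem with hm | hm
      · obtain ⟨y, hy, he⟩ := Multiset.mem_map.1 hm
        cases he
        obtain ⟨F, rfl⟩ := Multiset.exists_cons_of_mem hy
        have e : x ::ₘ F = F + {x} := by rw [add_comm]; rfl
        rw [e]
        refine .resume_fresh hs hKn hr ((ih F O ?_ hO).2 _ _ ha')
        refine add_right_cancel (b := {([x], 0)}) ?_
        rw [← hp, e, Multiset.map_add, Multiset.map_singleton, add_right_comm]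
        rfl
      · obtain ⟨O, rfl⟩ := Multiset.exists_cons_of_mem hm
        have e : (x :: w, i) ::ₘ O = O + {(x :: w, i)} := by rw [add_comm]; rfl
        rw [e]
        refine .resume_old hs hr hi ((ih F O ?_ fun t ht => hO t (by simp [ht])).2 _ _ ha')
        refine add_right_cancel (b := {(x :: w, i)}) ?_
        rw [← hp, e, add_assoc]

theorem FRun.exists_nRun (hs : SizeBd A c n) (hKn : K + 1 ≤ n) {m : ℕ} {f : Bool}
    (h : FRun A K m (A.init, false) (c, f)) : ∃ y, IsTarget A c K n y ∧
      NRun A c K n ({.glob (some A.g0)} + {.pend A.gamma0}) y := by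
  obtain ⟨T, h1, h2, h3⟩ := (h.actOk_schedOk hs hKn rfl {A.gamma0} 0 rfl (by simp)).1 rfl
  rw [Multiset.map_eq_zero] at h1
  subst h1
  simpa [DCPS.init] using h3 0 (by simp) rfl

end

section

/-! ### From runs of the net to runs of the system -/

/-- A thread with its type and its number of remaining segments. -/
abbrev TLoc : Type := Loc × Th × ℕ

/-- The place of a thread. -/
def TLoc.place (z : TLoc) : Pl := .wait z.2.1 z.2.2

/-- The thread can finish with future spawns given by `u`, in at most `B` steps. -/
def TLoc.Acc (A : DCPS) (c : DConfig) (B : ℕ) (z : TLoc) (u : Vec) : Prop :=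
  z.1.2 + z.2.2 = z.2.1.len ∧ ∃ v, TAcc A c z.2.1.len z.2.1.rest
    (.wait (z.2.1.segs.drop (z.2.1.len - z.2.2))) z.1.1 v ∧ v none ≤ B ∧
    ∀ a, 1 ≤ a → a ≤ z.2.2 → ∀ x, v (some (a, x)) = u (some (a, x))

variable {A : DCPS} {c : DConfig} {K n B : ℕ}

theorem TLoc.Acc.congr {z : TLoc} {u u' : Vec} (h : z.Acc A c B u)
    (hu : ∀ a, 1 ≤ a → a ≤ z.2.2 → ∀ x, u (some (a, x)) = u' (some (a, x))) : z.Acc A c B u' := by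
  obtain ⟨h1, v, h2, h3, h4⟩ := h
  exact ⟨h1, v, h2, h3, fun a ha ha' x => (h4 a ha ha' x).trans (hu a ha ha' x)⟩

/-- The system reaches a schedule point, or the target if there is no global state. -/
def RunTo (A : DCPS) (K : ℕ) (c : DConfig) (m : ℕ) (p : DConfig × Bool) (G : Option ℕ)
    (P : Multiset Loc) : Prop :=
  (G = none ∧ ∃ f, FRun A K m p (⟨c.g, c.act, P⟩, f)) ∨
    ∃ g, G = some g ∧ FRun A K m p (⟨g, none, P⟩, false)

/-- The execution of a segment by a thread. -/
theorem TLoc.Acc.advance {θ : Th} (hθ : θ.Ok A c K n) {l : ℕ} (hl : 1 ≤ l) (hl' : l ≤ θ.len)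
    {t : Loc} {u : Vec} (h : TLoc.Acc A c B (t, θ, l) u) (hu : VecIn (K + 1) n u)
    (P : Multiset Loc) (f : Bool) : ∃ m ≤ B + 1, ∃ Z : Multiset TLoc,
      θ.output l = Z.map TLoc.place ∧ (∀ z ∈ Z, z.2 = (θ, l - 1) ∧ z.Acc A c B u) ∧
      (Z = 0 ∨ ∃ z, Z = {z}) ∧
      RunTo A K c m (⟨(θ.seg l).1, none, P + {t}⟩, f) (θ.seg l).2
        (P + (spawnM n u l).map fr + Z.map Prod.fst) := by
  obtain ⟨w, i⟩ := t
  obtain ⟨hi, v, hv, hB, hvu⟩ := h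
  simp only at hi hv hB hvu
  have hlen : (θ.segs.drop (θ.len - (l - 1))).length + 1 = l := by
    rw [Th.length_drop (by omega)]; omega
  rw [Th.drop_eq hl hl'] at hv
  have hle := hθ.le
  obtain ⟨F, m, hF, hm, hout⟩ := hv.segOut (K := K) (i := i) (by omega) (by omega) P f
  rw [hlen] at hF
  have hFe : F = spawnM n u l := by
    ext x
    rw [hF x, hvu l hl le_rfl, spawns_spawnM hu l x]
  subst hFe
  refine ⟨m, by omega, ?_⟩
  have hnil : θ.segs.drop (θ.len - (l - 1)) = [] → l = 1 := by
    intro h; rw [h] at hlen; simpa using hlen.symm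
  rcases hout with ⟨ho, hσ, hr, f', hrun⟩ | ⟨g', ho, ⟨hσ, hr, hrun⟩ | ⟨w', v', hacc, hv1, hv2, hrun⟩⟩
  · refine ⟨0, ?_, by simp, .inl rfl, .inl ⟨ho, f', by simpa using hrun⟩⟩
    rw [Th.output, if_pos ⟨hnil hσ, hr⟩]; rfl
  · refine ⟨0, ?_, by simp, .inl rfl, .inr ⟨g', ho, by simpa using hrun⟩⟩
    rw [Th.output, if_pos ⟨hnil hσ, hr⟩]; rfl
  · refine ⟨{((w', i + 1), θ, l - 1)}, ?_, ?_, .inr ⟨_, rfl⟩, .inr ⟨g', ho, by simpa using hrun⟩⟩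
    · rw [Th.output, if_neg, Multiset.map_singleton]; · rfl
      rintro ⟨rfl, hr⟩
      have h0 := List.length_eq_zero_iff.1 (Nat.succ_injective hlen)
      rw [h0] at hacc
      exact hacc.rest_ne_none hr
    · intro z hz
      rw [Multiset.mem_singleton.1 hz]
      refine ⟨rfl, by simp only; omega, v', hacc, hv1.trans hB, fun a ha ha' x => ?_⟩
      simp only at ha'
      rw [hv2 a (by omega) x, hvu a ha (by omega)]

/-- The emissions of a label. -/
def Lb.em : Lb → Multiset (Th × Vec × ℕ)
  | .emit θ p l => {(θ, p, l)}
  | _ => 0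

/-- The relation between markings of the net and configurations of the system. -/
structure Sim (A : DCPS) (c : DConfig) (n B : ℕ) (S : Th → Multiset Vec) (ls : List Lb)
    (x : Multiset Pl) (G : Option ℕ) (P : Multiset Loc) (D : Multiset ℕ)
    (O : Multiset (Th × Vec × ℕ)) (Zn Zs : Multiset TLoc) (J : Multiset Pl) (f : Th → ℕ) :
    Prop where
  marking : x = {.glob G} + D.map .pend + (Zn + Zs).map TLoc.place + J
  pend : P = (D + O.bind fun e => spawnM n e.2.1 e.2.2).map fr + (Zn + Zs).map Prod.fst
  junk : ∀ t ∈ J, (∃ θ l, t = .mark θ l ∧ f θ < l) ∨ ∃ θ p l, t = .pool θ p l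
  em : open Classical in ∀ θ p l, (ls.map Lb.em).sum.count (θ, p, l) =
    O.count (θ, p, l) + if 1 ≤ l ∧ l ≤ f θ then (S θ).count p else 0
  le_len : ∀ θ, f θ ≤ θ.len
  normal : ∀ z ∈ Zn, z.Acc A c B z.2.1.base ∧ f z.2.1 ≤ z.2.2 ∧ z.2.2 < z.2.1.len
  special : ∀ z ∈ Zs, z.Acc A c B (z.2.1.base + (S z.2.1).sum) ∧ z.2.2 = f z.2.1 ∧ 0 < z.2.2 ∧
    z.2.2 < z.2.1.len
  nodup : (Zs.map fun z => z.2.1).Nodup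
  exists_special : ∀ θ, 0 < f θ → f θ < θ.len → θ ∈ Zs.map fun z => z.2.1

variable {S : Th → Multiset Vec} {ls : List Lb} {x : Multiset Pl} {G : Option ℕ}
  {P : Multiset Loc} {D : Multiset ℕ} {O : Multiset (Th × Vec × ℕ)} {Zn Zs : Multiset TLoc}
  {J : Multiset Pl} {f : Th → ℕ}

theorem Sim.glob_eq (h : Sim A c n B S ls x G P D O Zn Zs J f) {g : Option ℕ}
    (hg : .glob g ∈ x) : g = G := by
  rw [h.marking] at hg
  simp only [Multiset.mem_add, Multiset.mem_singleton, Multiset.mem_map, TLoc.place, Pl.glob.injEq,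
    reduceCtorEq, and_false, exists_false, or_false] at hg
  rcases hg with hg | hg
  · exact hg
  · rcases h.junk _ hg with ⟨θ, l, h, -⟩ | ⟨θ, p, l, h⟩ <;> cases h

theorem Sim.mem_pend (h : Sim A c n B S ls x G P D O Zn Zs J f) {a : ℕ}
    (hg : .pend a ∈ x) : a ∈ D := by
  rw [h.marking] at hg
  simp only [Multiset.mem_add, Multiset.mem_singleton, Multiset.mem_map, TLoc.place,
    reduceCtorEq, and_false, exists_false, or_false, false_or, Pl.pend.injEq, exists_eq_right] at hg
  rcases hg with hg | hg
  · exact hg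
  · rcases h.junk _ hg with ⟨θ, l, h, -⟩ | ⟨θ, p, l, h⟩ <;> cases h

theorem Sim.mem_wait (h : Sim A c n B S ls x G P D O Zn Zs J f) {θ : Th} {l : ℕ}
    (hg : .wait θ l ∈ x) : ∃ t, (t, θ, l) ∈ Zn + Zs := by
  rw [h.marking] at hg
  rw [Multiset.mem_add, Multiset.mem_add, Multiset.mem_add] at hg
  rcases hg with ((hg | hg) | hg) | hg
  · simp at hg
  · simp at hg
  · obtain ⟨⟨t, θ, l⟩, hz, he⟩ := Multiset.mem_map.1 hg
    cases he
    exact ⟨t, hz⟩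
  · rcases h.junk _ hg with ⟨θ, l, h, -⟩ | ⟨θ, p, l, h⟩ <;> cases h

theorem Sim.mem_junk (h : Sim A c n B S ls x G P D O Zn Zs J f) {t : Pl}
    (ht : (∃ θ l, t = .mark θ l) ∨ ∃ θ p l, t = .pool θ p l) (hg : t ∈ x) : t ∈ J := by
  rw [h.marking] at hg
  rw [Multiset.mem_add, Multiset.mem_add, Multiset.mem_add] at hg
  rcases hg with ((hg | hg) | hg) | hg
  · rw [Multiset.mem_singleton] at hg; subst hg; simp at ht
  · obtain ⟨a, -, rfl⟩ := Multiset.mem_map.1 hg; simp at ht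
  · obtain ⟨z, -, rfl⟩ := Multiset.mem_map.1 hg; simp [TLoc.place] at ht
  · exact hg

/-- The selection of the thread that executes a segment. -/
theorem Sim.select (h : Sim A c n B S ls x G P D O Zn Zs J f) {θ : Th} (hθ : θ.Ok A c K n) {l : ℕ}
    (h1 : 1 ≤ l) (hl : l ≤ θ.len) (hin : ∀ t ∈ θ.input l, t ∈ x)
    (hb : θ.base none ≤ B) (hB : (θ.base + (S θ).sum) none ≤ B) (hS : ∀ p ∈ S θ, p ∈ θ.pumps) :
    ∃ (t : Loc) (D' : Multiset ℕ) (Zn' Zs' : Multiset TLoc) (u : Vec),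
      D.map Pl.pend + (Zn + Zs).map TLoc.place =
        θ.input l + D'.map Pl.pend + (Zn' + Zs').map TLoc.place ∧
      D.map fr + (Zn + Zs).map Prod.fst = {t} + D'.map fr + (Zn' + Zs').map Prod.fst ∧
      TLoc.Acc A c B (t, θ, l) u ∧ Zn' ≤ Zn ∧ Zs' ≤ Zs ∧
      ((u = θ.base + (S θ).sum ∧ l = f θ ∧ (∀ z ∈ Zs', z.2.1 ≠ θ) ∧
          ∀ θ', θ' ≠ θ → θ' ∈ Zs.map (fun z => z.2.1) → θ' ∈ Zs'.map fun z => z.2.1) ∨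
        (u = θ.base ∧ f θ < l ∧ Zs' = Zs)) := by
  by_cases hlen : l = θ.len
  · subst hlen
    have hD := h.mem_pend (hin (.pend θ.sym) (by simp [Th.input]))
    obtain ⟨D, rfl⟩ := Multiset.exists_cons_of_mem hD
    have e : ∀ u, TAcc A c θ.len θ.rest (.wait θ.segs) [θ.sym] u → u none ≤ B →
        TLoc.Acc A c B (fr θ.sym, θ, θ.len) u := fun u hu hu' =>
      ⟨by simp [fr], u, by simpa [fr] using hu, hu', fun _ _ _ _ => rfl⟩
    by_cases hf : θ.len = f θ
    · refine ⟨fr θ.sym, D, Zn, Zs, _, ?_, ?_, e _ (hθ.acc _ hS) hB, le_rfl, le_rfl,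
        .inl ⟨rfl, hf, fun z hz hzθ => ?_, fun _ _ h => h⟩⟩
      · rw [Th.input, if_pos rfl, Multiset.map_cons, ← Multiset.singleton_add]
      · rw [Multiset.map_cons, ← Multiset.singleton_add]
      · obtain ⟨-, h2, -, h3⟩ := h.special z hz
        rw [hzθ] at h2 h3
        omega
    · refine ⟨fr θ.sym, D, Zn, Zs, _, ?_, ?_, e _ (by simpa using hθ.acc 0 (by simp)) hb, le_rfl,
        le_rfl, .inr ⟨rfl, lt_of_le_of_ne (h.le_len θ) (Ne.symm hf), rfl⟩⟩
      · rw [Th.input, if_pos rfl, Multiset.map_cons, ← Multiset.singleton_add]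
      · rw [Multiset.map_cons, ← Multiset.singleton_add]
  · rw [Th.input, if_neg hlen] at hin ⊢
    obtain ⟨t, ht⟩ := h.mem_wait (hin (.wait θ l) (by simp))
    have hfl : f θ ≤ l := by
      rcases Multiset.mem_add.1 ht with ht | ht
      · exact (h.normal _ ht).2.1
      · exact (h.special _ ht).2.1.ge
    rcases hfl.eq_or_lt with hfl | hfl
    · obtain ⟨⟨t, θ', l'⟩, hz, hzθ⟩ := Multiset.mem_map.1
        (h.exists_special θ (by omega) (by omega))
      simp only at hzθ
      subst hzθ
      obtain ⟨hacc, h3, -⟩ := h.special _ hz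
      simp only at h3
      obtain rfl : l' = l := by omega
      obtain ⟨Zs, rfl⟩ := Multiset.exists_cons_of_mem hz
      have hnd := h.nodup
      rw [Multiset.map_cons, Multiset.nodup_cons] at hnd
      refine ⟨t, D, Zn, Zs, _, ?_, ?_, hacc, le_rfl, Multiset.le_cons_self _ _,
        .inl ⟨rfl, h3, fun z hz' hzθ => hnd.1 (Multiset.mem_map.2 ⟨z, hz', hzθ⟩), ?_⟩⟩
      · rw [Multiset.map_add, Multiset.map_add, Multiset.map_cons, ← Multiset.singleton_add]
        simp only [TLoc.place]
        abel
      · rw [Multiset.map_add, Multiset.map_add, Multiset.map_cons, ← Multiset.singleton_add]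
        abel
      · intro θ'' hne hm
        rw [Multiset.map_cons, Multiset.mem_cons] at hm
        exact hm.resolve_left hne
    · have hz : (t, θ, l) ∈ Zn := by
        rcases Multiset.mem_add.1 ht with ht | ht
        · exact ht
        · exact absurd (h.special _ ht).2.1 hfl.ne'
      obtain ⟨Zn, rfl⟩ := Multiset.exists_cons_of_mem hz
      refine ⟨t, D, Zn, Zs, _, ?_, ?_, (h.normal _ hz).1, Multiset.le_cons_self _ _, le_rfl,
        .inr ⟨rfl, hfl, rfl⟩⟩
      · rw [Multiset.map_add, Multiset.map_add, Multiset.map_cons, ← Multiset.singleton_add]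
        simp only [TLoc.place]
        abel
      · rw [Multiset.map_add, Multiset.map_add, Multiset.map_cons, ← Multiset.singleton_add]
        abel

theorem mark_ne {θ : Th} {l : ℕ} {J : Multiset Pl}
    (hJ : ∀ t ∈ J, (∃ θ l, t = .mark θ l ∧ f θ < l) ∨ ∃ θ p l, t = .pool θ p l)
    (h : .mark θ l ∈ J) : f θ < l := by
  rcases hJ _ h with ⟨θ', l', h, hf⟩ | ⟨θ, p, l, h⟩ <;> cases h
  exact hf

theorem Sim.ev {θ : Th} {l : ℕ} {m : Multiset Pl}
    (h : Sim A c n B S (.ev θ l :: ls) (Lb.pre (.ev θ l) + m) G P D O Zn Zs J f)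
    (hok : Lb.Ok A c K n (.ev θ l)) (hb : θ.base none ≤ B) (hB : (θ.base + (S θ).sum) none ≤ B)
    (hS : ∀ p ∈ S θ, p ∈ θ.pumps) (fl : Bool) :
    ∃ g, G = some g ∧ ∃ k ≤ B + 1, ∃ G' P' D' O' Zn' Zs' J' f',
      Sim A c n B S ls (Lb.post n (.ev θ l) + m) G' P' D' O' Zn' Zs' J' f' ∧
      RunTo A K c k (⟨g, none, P⟩, fl) G' P' := by
  classical
  obtain ⟨hθ, h1, hl⟩ := hok
  have hg := h.glob_eq (g := some (θ.seg l).1) (by simp [Lb.pre])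
  obtain ⟨t, D', Zn', Zs', u, e1, e2, hacc, hZn, hZs, hu⟩ :=
    h.select hθ h1 hl (fun t ht => by simp [Lb.pre, ht]) hb hB hS
  have hsp : ∀ ms : Multiset Vec, (∀ p ∈ ms, p ∈ θ.pumps) → VecIn (K + 1) n (θ.base + ms.sum) := by
    intro ms hms a x hax
    rw [Pi.add_apply, hθ.base.1 a x hax, zero_add]
    induction ms using Multiset.induction with
    | empty => rfl
    | cons p ms ih =>
      rw [Multiset.sum_cons, Pi.add_apply, ih fun q hq => hms q (by simp [hq]),
        (hθ.pumps p (hms p (by simp))).1.1 a x hax]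
  have hu_in : VecIn (K + 1) n u := by
    rcases hu with ⟨rfl, -⟩ | ⟨rfl, -⟩
    · exact hsp _ hS
    · exact hθ.base.1
  obtain ⟨k, hk, Z, hZ, hZacc, hZc, hrun⟩ := hacc.advance hθ h1 hl hu_in
    ((D' + O.bind fun e => spawnM n e.2.1 e.2.2).map fr + (Zn' + Zs').map Prod.fst) fl
  have hP : P = (D' + O.bind fun e => spawnM n e.2.1 e.2.2).map fr + (Zn' + Zs').map Prod.fst +
      {t} := by
    rw [h.pend, Multiset.map_add, add_right_comm, e2, Multiset.map_add fr D']
    abel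
  rw [← hP] at hrun
  have hm : m = D'.map .pend + (Zn' + Zs').map TLoc.place + J := by
    have := h.marking
    rw [← hg, add_assoc {_}, e1, Lb.pre] at this
    refine add_left_cancel (a := {.glob (some (θ.seg l).1)} + θ.input l) (this.trans ?_)
    abel
  have hZlt : ∀ z ∈ Z, z.2.2 < z.2.1.len := fun z hz => by
    rw [(hZacc z hz).1]; simp only; omega
  refine ⟨_, hg.symm, k, hk, (θ.seg l).2,
    (D' + O.bind fun e => spawnM n e.2.1 e.2.2).map fr + (Zn' + Zs').map Prod.fst +
      (spawnM n u l).map fr + Z.map Prod.fst, ?_⟩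
  have hem : (ls.map Lb.em).sum = ((Lb.ev θ l :: ls).map Lb.em).sum := by
    simp [Lb.em]
  rcases hu with ⟨rfl, hlf, hZs', hZs''⟩ | ⟨rfl, hlf, rfl⟩
  · have hO : (O + (S θ).map fun p => (θ, p, l)).bind (fun e => spawnM n e.2.1 e.2.2) =
        O.bind (fun e => spawnM n e.2.1 e.2.2) + spawnM n (S θ).sum l := by
      rw [Multiset.add_bind, Multiset.bind_map]
      congr 1
      induction S θ using Multiset.induction with
      | empty => simp [spawnM_zero]
      | cons p s ih => rw [Multiset.cons_bind, ih, Multiset.sum_cons, spawnM_add]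
    have hsplit : Zn' + (if l = 1 then Z else 0) + (Zs' + (if l = 1 then 0 else Z)) =
        Zn' + Zs' + Z := by
      split
      · rw [add_zero, add_right_comm]
      · rw [add_zero, add_assoc]
    have hfu : ∀ θ', θ' ≠ θ → Function.update f θ (l - 1) θ' = f θ' := fun θ' h =>
      Function.update_of_ne h _ _
    have hfl : Function.update f θ (l - 1) θ = l - 1 := Function.update_self _ _ _
    have hfle : ∀ θ', Function.update f θ (l - 1) θ' ≤ f θ' := by
      intro θ'
      by_cases h : θ' = θ
      · subst h; omega
      · rw [hfu _ h]
    refine ⟨D' + spawnM n θ.base l, O + (S θ).map fun p => (θ, p, l),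
      Zn' + (if l = 1 then Z else 0), Zs' + (if l = 1 then 0 else Z),
      {.mark θ l} + J, Function.update f θ (l - 1), ⟨?_, ?_, ?_, ?_, ?_, ?_, ?_, ?_, ?_⟩, hrun⟩
    · rw [hm, Lb.post, hZ, hsplit]
      simp only [Multiset.map_add]
      abel
    · rw [hO, spawnM_add, hsplit]
      simp only [Multiset.map_add]
      abel
    · intro t ht
      rcases Multiset.mem_add.1 ht with ht | ht
      · exact .inl ⟨θ, l, Multiset.mem_singleton.1 ht, by omega⟩
      · rcases h.junk t ht with ⟨θ', l', rfl, hl'⟩ | h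
        · exact .inl ⟨θ', l', rfl, (hfle _).trans_lt hl'⟩
        · exact .inr h
    · intro θ' p l'
      rw [hem, h.em]
      rw [Multiset.count_add]
      by_cases hθ' : θ' = θ
      · subst hθ'
        rw [hfl]
        have hmc : ((S θ').map fun p => (θ', p, l)).count (θ', p, l') =
            if l' = l then (S θ').count p else 0 := by
          split
          · next h =>
            subst h
            exact Multiset.count_map_eq_count' (fun p => (θ', p, l')) _
              (fun p q hpq => by simpa using hpq) _
          · next h =>
            refine Multiset.count_eq_zero_of_notMem fun hm => ?_
            obtain ⟨q, -, hq⟩ := Multiset.mem_map.1 hm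
            simp only [Prod.mk.injEq] at hq
            exact h hq.2.2.symm
        rw [hmc, ← hlf]
        by_cases a1 : l' = l
        · subst a1
          rw [if_pos ⟨h1, le_rfl⟩, if_pos rfl, if_neg (by omega)]; rfl
        · rw [if_neg a1, add_zero]
          congr 1
          exact if_congr (by omega) rfl rfl
      · rw [hfu _ hθ', Multiset.count_eq_zero_of_notMem (s := (S θ).map _), add_zero]
        intro hm
        obtain ⟨q, -, hq⟩ := Multiset.mem_map.1 hm
        simp only [Prod.mk.injEq] at hq
        exact hθ' hq.1.symm
    · exact fun θ' => (hfle θ').trans (h.le_len θ')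
    · intro z hz
      rcases Multiset.mem_add.1 hz with hz | hz
      · obtain ⟨a1, a2, a3⟩ := h.normal z (Multiset.mem_of_le hZn hz)
        exact ⟨a1, (hfle _).trans a2, a3⟩
      · split at hz
        · obtain ⟨a1, a2⟩ := hZacc z hz
          refine ⟨a2.congr fun a ha ha' x => ?_, ?_, hZlt z hz⟩
          · rw [a1] at ha'; simp only at ha'; omega
          · rw [a1]; simp [hfl]
        · simp at hz
    · intro z hz
      rcases Multiset.mem_add.1 hz with hz | hz
      · obtain ⟨a1, a2, a3⟩ := h.special z (Multiset.mem_of_le hZs hz)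
        refine ⟨a1, ?_, a3⟩
        rw [hfu _ (hZs' z hz)]; exact a2
      · split at hz
        · simp at hz
        · obtain ⟨a1, a2⟩ := hZacc z hz
          have b1 : z.2.1 = θ := by rw [a1]
          have b2 : z.2.2 = l - 1 := by rw [a1]
          refine ⟨by rw [b1]; exact a2, by rw [b1, b2, hfl], by omega, hZlt z hz⟩
    · have hnd : (Zs'.map fun z => z.2.1).Nodup :=
        Multiset.nodup_of_le (Multiset.map_le_map hZs) h.nodup
      split
      · simpa using hnd
      · rcases hZc with rfl | ⟨z, rfl⟩
        · simpa using hnd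
        · have hz : z.2.1 = θ := by rw [(hZacc z (by simp)).1]
          rw [Multiset.map_add, Multiset.map_singleton, add_comm, Multiset.singleton_add,
            Multiset.nodup_cons]
          refine ⟨fun hm => ?_, hnd⟩
          obtain ⟨z', hz', he⟩ := Multiset.mem_map.1 hm
          exact hZs' z' hz' (he.trans hz)
    · intro θ' h0 hlt
      by_cases hθ' : θ' = θ
      · subst hθ'
        rw [hfl] at h0
        have hl1 : l ≠ 1 := by omega
        rw [Multiset.map_add, if_neg hl1]
        rcases hZc with rfl | ⟨z, rfl⟩
        · rw [Th.output, if_neg (by tauto)] at hZ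
          simp at hZ
        · have := (hZacc z (by simp)).1
          simp [this]
      · rw [hfu _ hθ'] at h0 hlt
        rw [Multiset.map_add]
        exact Multiset.mem_add.2 (.inl (hZs'' _ hθ' (h.exists_special _ h0 hlt)))
  · refine ⟨D' + spawnM n θ.base l, O, Zn' + Z, Zs', {.mark θ l} + J, f, ⟨?_, ?_, ?_, ?_, h.le_len, ?_,
      h.special, h.nodup, h.exists_special⟩, hrun⟩
    · rw [hm, Lb.post, hZ]
      simp only [Multiset.map_add]
      abel
    · simp only [Multiset.map_add]
      abel
    · intro t ht
      rcases Multiset.mem_add.1 ht with ht | ht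
      · exact .inl ⟨θ, l, Multiset.mem_singleton.1 ht, hlf⟩
      · exact h.junk t ht
    · intro θ' p l'
      rw [hem, h.em]
    · intro z hz
      rcases Multiset.mem_add.1 hz with hz | hz
      · exact h.normal z (Multiset.mem_of_le hZn hz)
      · obtain ⟨a1, a2⟩ := hZacc z hz
        have b1 : z.2.1 = θ := by rw [a1]
        have b2 : z.2.2 = l - 1 := by rw [a1]
        exact ⟨by rw [b1]; exact a2, by rw [b1, b2]; omega, hZlt z hz⟩

end

section

variable {A : DCPS} {c : DConfig} {K n B : ℕ} {S : Th → Multiset Vec} {ls : List Lb}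
  {x : Multiset Pl} {G : Option ℕ} {P : Multiset Loc} {D : Multiset ℕ}
  {O : Multiset (Th × Vec × ℕ)} {Zn Zs : Multiset TLoc} {J : Multiset Pl} {f : Th → ℕ}

theorem Sim.emit {θ : Th} {p : Vec} {l : ℕ} {m : Multiset Pl}
    (h : Sim A c n B S (.emit θ p l :: ls) (Lb.pre (.emit θ p l) + m) G P D O Zn Zs J f) :
    ∃ D' O' J', Sim A c n B S ls (Lb.post n (.emit θ p l) + m) G P D' O' Zn Zs J' f := by
  classical
  have h1 : Pl.mark θ l ∈ J := h.mem_junk (.inl ⟨_, _, rfl⟩) (by simp [Lb.pre])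
  have h2 : Pl.pool θ p l ∈ J := h.mem_junk (.inr ⟨_, _, _, rfl⟩) (by simp [Lb.pre])
  have hlt := mark_ne h.junk h1
  have hem : ∀ e, (((Lb.emit θ p l :: ls).map Lb.em).sum).count e =
      (if e = (θ, p, l) then 1 else 0) + ((ls.map Lb.em).sum).count e := by
    intro e
    rw [List.map_cons, List.sum_cons, Multiset.count_add, Lb.em, Multiset.count_singleton]
  have hO : (θ, p, l) ∈ O := by
    have := h.em θ p l
    rw [hem, if_pos rfl, if_neg (by omega)] at this
    exact Multiset.count_pos.1 (by omega)
  obtain ⟨J, rfl⟩ := Multiset.exists_cons_of_mem h1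
  obtain ⟨J, rfl⟩ := Multiset.exists_cons_of_mem ((Multiset.mem_cons.1 h2).resolve_left (by simp))
  obtain ⟨O, rfl⟩ := Multiset.exists_cons_of_mem hO
  have hm : m = {.glob G} + D.map .pend + (Zn + Zs).map TLoc.place + J := by
    have := h.marking
    rw [Lb.pre, ← Multiset.singleton_add, ← Multiset.singleton_add] at this
    refine add_left_cancel (a := {Pl.mark θ l} + {Pl.pool θ p l}) (this.trans ?_)
    abel
  refine ⟨D + spawnM n p l, O, Pl.mark θ l ::ₘ J, ⟨?_, ?_, ?_, ?_, h.le_len, h.normal, h.special,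
    h.nodup, h.exists_special⟩⟩
  · rw [hm, Lb.post, ← Multiset.singleton_add, Multiset.map_add _ D]
    abel
  · rw [h.pend, Multiset.cons_bind, add_assoc D]
  · intro t ht
    exact h.junk t (by rw [Multiset.mem_cons] at ht ⊢; simp only [Multiset.mem_cons]; tauto)
  · intro θ' p' l'
    have := h.em θ' p' l'
    rw [hem, Multiset.count_cons] at this
    omega

theorem Sim.grow {θ : Th} {p : Vec} {m : Multiset Pl}
    (h : Sim A c n B S (.grow θ p :: ls) (Lb.pre (.grow θ p) + m) G P D O Zn Zs J f) :
    ∃ J', Sim A c n B S ls (Lb.post n (.grow θ p) + m) G P D O Zn Zs J' f := by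
  refine ⟨(Finset.Icc 1 θ.len).val.map (.pool θ p) + J, ⟨?_, h.pend, ?_, ?_, h.le_len, h.normal,
    h.special, h.nodup, h.exists_special⟩⟩
  · have := h.marking
    rw [Lb.pre, zero_add] at this
    rw [this, Lb.post]
    abel
  · intro t ht
    rcases Multiset.mem_add.1 ht with ht | ht
    · obtain ⟨l, -, rfl⟩ := Multiset.mem_map.1 ht
      exact .inr ⟨_, _, _, rfl⟩
    · exact h.junk t ht
  · simpa [Lb.em] using h.em

theorem Sim.drain {θ : Th} {l : ℕ} {m : Multiset Pl}
    (h : Sim A c n B S (.drain θ l :: ls) (Lb.pre (.drain θ l) + m) G P D O Zn Zs J f) :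
    ∃ J', Sim A c n B S ls (Lb.post n (.drain θ l) + m) G P D O Zn Zs J' f := by
  have h1 : Pl.mark θ l ∈ J := h.mem_junk (.inl ⟨_, _, rfl⟩) (by simp [Lb.pre])
  obtain ⟨J, rfl⟩ := Multiset.exists_cons_of_mem h1
  refine ⟨J, ⟨?_, h.pend, fun t ht => h.junk t (Multiset.mem_cons_of_mem ht), ?_, h.le_len,
    h.normal, h.special, h.nodup, h.exists_special⟩⟩
  · have := h.marking
    rw [Lb.pre, ← Multiset.singleton_add] at this
    refine add_left_cancel (a := {Pl.mark θ l}) ?_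
    rw [Lb.post, zero_add, this]
    abel
  · simpa [Lb.em] using h.em

theorem TAcc.rest_eq {k : ℕ} {r : Option (List ℕ)} {w : List ℕ} {v : Vec}
    (h : TAcc A c k r (.wait []) w v) : r = some w := by
  obtain ⟨q, h, hq⟩ := h
  cases h with
  | nil =>
    rcases hq with hq | hq
    · exact hq
    · cases hq
  | cons hs h =>
    cases hs with
    | halt hs =>
      rw [List.nil_append] at h
      rw [h.flush_eq rfl hq]
      exact hs

/-- The part of a marking on the places of fresh threads. -/
def Pl.freshPart : Pl → Option ℕ
  | .pend x => some x
  | _ => none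

/-- The part of a marking on the places of interrupted threads. -/
def Pl.waitPart : Pl → Option (Th × ℕ)
  | .wait θ l => some (θ, l)
  | _ => none

theorem filterMap_eq_zero {α β : Type} {f : α → Option β} {s : Multiset α}
    (h : ∀ a ∈ s, f a = none) : s.filterMap f = 0 := by
  refine Multiset.eq_zero_of_forall_notMem fun b hb => ?_
  obtain ⟨a, ha, hab⟩ := (Multiset.mem_filterMap _ _).1 hb
  rw [h a ha] at hab
  cases hab

theorem Sim.final (h : Sim A c n B S [] x G P D O Zn Zs J f) (hx : IsTarget A c K n x) :
    P = c.pend ∧ G = if c.act = none then some c.g else none := by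
  obtain ⟨F, O', W, -, -, hc, hxe, hW, hWO⟩ := hx
  have hO : O = 0 := by
    classical
    refine Multiset.eq_zero_of_forall_notMem fun e he => ?_
    have := h.em e.1 e.2.1 e.2.2
    have := Multiset.count_pos.2 he
    simp at *
    omega
  subst hO
  have hg := h.glob_eq (g := if c.act = none then some c.g else none) (by rw [hxe]; simp)
  refine ⟨?_, hg.symm⟩
  have hJ1 : J.filterMap Pl.freshPart = 0 := by
    refine filterMap_eq_zero fun t ht => ?_
    rcases h.junk t ht with ⟨θ, l, rfl, -⟩ | ⟨θ, p, l, rfl⟩ <;> rfl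
  have hJ2 : J.filterMap Pl.waitPart = 0 := by
    refine filterMap_eq_zero fun t ht => ?_
    rcases h.junk t ht with ⟨θ, l, rfl, -⟩ | ⟨θ, p, l, rfl⟩ <;> rfl
  have hm := h.marking.symm.trans hxe
  have e1 := congrArg (Multiset.filterMap Pl.freshPart) hm
  have e2 := congrArg (Multiset.filterMap Pl.waitPart) hm
  have hmap : ∀ {α β : Type} {g : Pl → Option β} (s : Multiset α) (k : α → Pl),
      (∀ a, g (k a) = none) → ∀ t ∈ s.map k, g t = none := by
    intro α β g s k hk t ht
    obtain ⟨a, -, rfl⟩ := Multiset.mem_map.1 ht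
    exact hk a
  have hD : D = F := by
    have a1 : ∀ D : Multiset ℕ, (D.map Pl.pend).filterMap Pl.freshPart = D := fun D => by
      rw [Multiset.filterMap_map, show Pl.freshPart ∘ Pl.pend = some from rfl,
        Multiset.filterMap_some]
    simp only [Multiset.filterMap_add, a1, hJ1, add_zero] at e1
    rw [filterMap_eq_zero (s := {Pl.glob _}) (by simp [Pl.freshPart]),
      filterMap_eq_zero (s := {Pl.glob _}) (by simp [Pl.freshPart]),
      filterMap_eq_zero (s := Multiset.map TLoc.place _) (hmap _ _ fun _ => rfl),
      filterMap_eq_zero (s := Multiset.map _ _) (hmap _ _ fun _ => rfl)] at e1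
    simpa using e1
  have hZ : (Zn + Zs).map Prod.snd = W.map fun θ => (θ, 0) := by
    simp only [Multiset.filterMap_add, hJ2, add_zero] at e2
    rw [filterMap_eq_zero (s := {Pl.glob _}) (by simp [Pl.waitPart]),
      filterMap_eq_zero (s := {Pl.glob _}) (by simp [Pl.waitPart]),
      filterMap_eq_zero (s := Multiset.map _ D) (hmap _ _ fun _ => rfl),
      filterMap_eq_zero (s := Multiset.map _ F) (hmap _ _ fun _ => rfl),
      Multiset.filterMap_map, Multiset.filterMap_map,
      show Pl.waitPart ∘ TLoc.place = some ∘ Prod.snd from rfl,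
      show Pl.waitPart ∘ (fun θ : Th => Pl.wait θ 0) = some ∘ fun θ => (θ, 0) from rfl,
      Multiset.filterMap_eq_map, Multiset.filterMap_eq_map] at e2
    simpa using e2
  have hloc : ∀ z ∈ Zn + Zs, z.1 = (z.2.1.rest.getD [], z.2.1.len) := by
    intro z hz
    have h0 : z.2.2 = 0 := by
      have := Multiset.mem_map_of_mem Prod.snd hz
      rw [hZ] at this
      obtain ⟨θ, -, hθ⟩ := Multiset.mem_map.1 this
      rw [← hθ]
    have hacc : ∃ u, z.Acc A c B u := by
      rcases Multiset.mem_add.1 hz with hz | hz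
      · exact ⟨_, (h.normal z hz).1⟩
      · exact ⟨_, (h.special z hz).1⟩
    obtain ⟨u, h1, v, h2, -⟩ := hacc
    rw [h0, Nat.sub_zero, Th.len, List.drop_length] at h2
    rw [h2.rest_eq, Option.getD_some, ← h1, h0]
    rfl
  rw [h.pend, Multiset.map_congr rfl hloc, hc, ← hWO, hD, Multiset.zero_bind, add_zero]
  congr 1
  have := congrArg (Multiset.map fun z : Th × ℕ => (z.1.rest.getD [], z.1.len)) hZ
  simpa [Multiset.map_map, Function.comp_def] using this

/-- A run of the net from a related marking gives a run of the system. -/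
theorem Sim.run {y : Multiset Pl} (hrun : MRun Lb.pre (Lb.post n) ls x y) (hy : IsTarget A c K n y)
    (hok : ∀ a ∈ ls, a.Ok A c K n)
    (hS : ∀ θ : Th, θ.Ok A c K n → θ.base none ≤ B ∧ (θ.base + (S θ).sum) none ≤ B ∧
      ∀ p ∈ S θ, p ∈ θ.pumps) :
    ∀ G P D O Zn Zs J f, Sim A c n B S ls x G P D O Zn Zs J f → ∀ fl,
      (G = none → P = c.pend) ∧ ∀ g, G = some g →
        ∃ m ≤ ls.length * (B + 1), ∃ f', FRun A K m (⟨g, none, P⟩, fl) (c, f') := by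
  induction hrun with
  | nil m =>
    intro G P D O Zn Zs J f h fl
    obtain ⟨h1, h2⟩ := h.final hy
    refine ⟨fun _ => h1, fun g hg => ⟨0, Nat.zero_le _, fl, ?_⟩⟩
    rw [hg] at h2
    split at h2
    · next hact =>
      cases h2
      rw [h1, ← hact]
      exact .refl _
    · cases h2
  | @cons a ls y m hr ih =>
    intro G P D O Zn Zs J f h fl
    have hoka := hok a (by simp)
    replace ih := ih hy fun b hb => hok b (by simp [hb])
    have key : ∀ {D' O' J'}, Sim A c n B S ls (Lb.post n a + m) G P D' O' Zn Zs J' f →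
        (G = none → P = c.pend) ∧ ∀ g, G = some g →
        ∃ k ≤ (a :: ls).length * (B + 1), ∃ f', FRun A K k (⟨g, none, P⟩, fl) (c, f') := by
      intro D' O' J' h'
      refine ⟨(ih _ _ _ _ _ _ _ _ h' fl).1, fun g hg => ?_⟩
      obtain ⟨k, hk, hf⟩ := (ih _ _ _ _ _ _ _ _ h' fl).2 g hg
      exact ⟨k, hk.trans (Nat.mul_le_mul_right _ (by simp)), hf⟩
    cases a with
    | ev θ l =>
      obtain ⟨b1, b2, b3⟩ := hS θ hoka.1
      obtain ⟨g, hg, k, hk, G', P', D', O', Zn', Zs', J', f', h', hrun⟩ := h.ev hoka b1 b2 b3 fl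
      refine ⟨fun h => (by rw [h] at hg; cases hg), fun g' hg' => ?_⟩
      obtain rfl : g = g' := by rw [hg] at hg'; exact Option.some.inj hg'
      rcases hrun with ⟨hG, f'', hrun⟩ | ⟨g₁, hG, hrun⟩
      · rw [(ih _ _ _ _ _ _ _ _ h' fl).1 hG] at hrun
        refine ⟨k, hk.trans ?_, f'', hrun⟩
        rw [List.length_cons, Nat.succ_mul]
        exact Nat.le_add_left _ _
      · obtain ⟨k', hk', f'', hrun'⟩ := (ih _ _ _ _ _ _ _ _ h' false).2 _ hG
        refine ⟨k + k', ?_, f'', hrun.trans hrun'⟩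
        rw [List.length_cons, Nat.succ_mul]
        omega
    | grow θ p => obtain ⟨J', h'⟩ := h.grow; exact key h'
    | emit θ p l => obtain ⟨D', O', J', h'⟩ := h.emit; exact key h'
    | drain θ l => obtain ⟨J', h'⟩ := h.drain; exact key h'

end

section

variable {A : DCPS} {c : DConfig} {K n B : ℕ}

open Classical in
/-- The surplus added to a thread type by a transition. -/
noncomputable def Lb.gain (θ : Th) : Lb → Multiset Vec
  | .grow θ' p => if θ' = θ then {p} else 0
  | _ => 0

/-- The surplus added to a thread type by a sequence of transitions. -/
noncomputable def gainM (ls : List Lb) (θ : Th) : Multiset Vec := (ls.map (Lb.gain θ)).sum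

theorem gainM_cons (a : Lb) (ls : List Lb) (θ : Th) : gainM (a :: ls) θ = a.gain θ + gainM ls θ := by
  rw [gainM, List.map_cons, List.sum_cons, gainM]

theorem card_gainM_le (ls : List Lb) (θ : Th) : Multiset.card (gainM ls θ) ≤ ls.length := by
  induction ls with
  | nil => simp [gainM]
  | cons a ls ih =>
    rw [gainM_cons, Multiset.card_add, List.length_cons]
    have : Multiset.card (a.gain θ) ≤ 1 := by
      cases a <;> simp only [Lb.gain, Multiset.card_zero, zero_le]
      split <;> simp
    omega

theorem mem_gainM {ls : List Lb} {θ : Th} (hok : ∀ a ∈ ls, a.Ok A c K n) :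
    ∀ p ∈ gainM ls θ, p ∈ θ.pumps := by
  induction ls with
  | nil => simp [gainM]
  | cons a ls ih =>
    intro p hp
    rw [gainM_cons, Multiset.mem_add] at hp
    rcases hp with hp | hp
    · have ha := hok a (by simp)
      cases a with
      | grow θ' q =>
        simp only [Lb.gain] at hp
        split at hp
        · next h =>
          subst h
          obtain rfl := Multiset.mem_singleton.1 hp
          exact ha.2
        · simp at hp
      | _ => simp [Lb.gain] at hp
    · exact ih (fun a ha => hok a (by simp [ha])) p hp

open Classical in
theorem count_pool_balance {ls : List Lb} {x y : Multiset Pl}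
    (h : MRun Lb.pre (Lb.post n) ls x y) (θ : Th) (p : Vec) (l : ℕ) :
    x.count (.pool θ p l) + (if 1 ≤ l ∧ l ≤ θ.len then (gainM ls θ).count p else 0) =
      (ls.map Lb.em).sum.count (θ, p, l) + y.count (.pool θ p l) := by
  induction h with
  | nil m => simp [gainM]
  | @cons a ls y m _ ih =>
    rw [Multiset.count_add] at ih ⊢
    rw [gainM_cons, List.map_cons, List.sum_cons, Multiset.count_add, Multiset.count_add]
    have key : a.pre.count (.pool θ p l) + (if 1 ≤ l ∧ l ≤ θ.len then (a.gain θ).count p else 0) =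
        a.em.count (θ, p, l) + (a.post n).count (.pool θ p l) := by
      cases a with
      | ev θ' l' =>
        have h1 : (Lb.ev θ' l').pre.count (.pool θ p l) = 0 := by
          refine Multiset.count_eq_zero_of_notMem fun h => ?_
          simp only [Lb.pre, Th.input] at h
          split at h <;> simp at h
        have h2 : ((Lb.ev θ' l').post n).count (.pool θ p l) = 0 := by
          refine Multiset.count_eq_zero_of_notMem fun h => ?_
          simp only [Lb.post, Th.output] at h
          split at h <;> simp at h
        rw [h1, h2]
        simp [Lb.gain, Lb.em]
      | grow θ' q =>
        have h2 : ((Lb.grow θ' q).post n).count (.pool θ p l) =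
            if θ' = θ ∧ q = p ∧ 1 ≤ l ∧ l ≤ θ.len then 1 else 0 := by
          split
          · next h =>
            obtain ⟨rfl, rfl, h⟩ := h
            rw [Lb.post, Multiset.count_map_eq_count' _ _ (fun a b h => by simpa using h)]
            exact Multiset.count_eq_one_of_mem (Finset.nodup _) (by simpa using h)
          · next h =>
            refine Multiset.count_eq_zero_of_notMem fun hm => h ?_
            simp only [Lb.post, Multiset.mem_map, Pl.pool.injEq, Finset.mem_val,
              Finset.mem_Icc] at hm
            obtain ⟨l', h1, rfl, rfl, rfl⟩ := hm
            exact ⟨rfl, rfl, h1⟩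
        rw [h2]
        simp only [Lb.pre, Lb.em, Lb.gain, Multiset.count_zero, zero_add]
        by_cases a1 : θ' = θ
        · by_cases a2 : q = p
          · simp [a1, a2]
          · simp [a1, a2, Ne.symm a2]
        · simp [a1]
      | emit θ' q l' =>
        have h2 : ((Lb.emit θ' q l').post n).count (.pool θ p l) = 0 := by
          refine Multiset.count_eq_zero_of_notMem fun h => ?_
          simp [Lb.post] at h
        rw [h2]
        simp [Lb.pre, Lb.em, Lb.gain, Multiset.count_singleton]
      | drain θ' l' => simp [Lb.pre, Lb.em, Lb.gain, Lb.post]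
    by_cases hl : 1 ≤ l ∧ l ≤ θ.len
    · rw [if_pos hl] at *
      omega
    · rw [if_neg hl] at *
      omega

theorem vec_sum_none_le {s : Multiset Vec} {b : ℕ} (h : ∀ p ∈ s, p none ≤ b) :
    s.sum none ≤ Multiset.card s * b := by
  induction s using Multiset.induction with
  | empty => simp
  | cons p s ih =>
    rw [Multiset.sum_cons, Pi.add_apply, Multiset.card_cons, Nat.succ_mul]
    have := ih fun q hq => h q (by simp [hq])
    have := h p (by simp)
    omega

theorem IsTarget.notMem_pool {y : Multiset Pl} (hy : IsTarget A c K n y) (θ : Th) (p : Vec)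
    (l : ℕ) : .pool θ p l ∉ y := by
  obtain ⟨F, O, W, -, -, -, rfl, -, -⟩ := hy
  simp

/-- A run of the net gives a short run of the system. -/
theorem FRun.of_mRun {ls : List Lb} {y : Multiset Pl} (hok : ∀ a ∈ ls, a.Ok A c K n)
    (h : MRun Lb.pre (Lb.post n) ls ({.glob (some A.g0)} + {.pend A.gamma0}) y)
    (hy : IsTarget A c K n y) : ∃ m ≤ ls.length * (vecBound n * (ls.length + 1) + 1),
      ∃ f, FRun A K m (A.init, false) (c, f) := by
  classical
  have hsim : Sim A c n (vecBound n * (ls.length + 1)) (gainM ls) ls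
      ({.glob (some A.g0)} + {.pend A.gamma0}) (some A.g0) {fr A.gamma0} {A.gamma0} 0 0 0 0
      Th.len := by
    refine ⟨by simp, by simp, by simp, fun θ p l => ?_, fun _ => le_rfl, by simp, by simp, by simp,
      fun θ h1 h2 => absurd h2 (lt_irrefl _)⟩
    have := count_pool_balance h θ p l
    rw [Multiset.count_eq_zero_of_notMem (hy.notMem_pool θ p l),
      Multiset.count_eq_zero_of_notMem (by simp)] at this
    rw [Multiset.count_zero]
    rw [zero_add, add_zero] at this
    rw [zero_add]
    convert this.symm using 2
  refine (Sim.run h hy hok (fun θ hθ => ?_) _ _ _ _ _ _ _ _ hsim false).2 A.g0 rfl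
  have hb := (hθ.base.2 none).le
  refine ⟨hb.trans (Nat.le_mul_of_pos_right _ (by omega)), ?_, mem_gainM hok⟩
  have h1 := vec_sum_none_le (s := gainM ls θ) (b := vecBound n)
    fun p hp => ((hθ.pumps p (mem_gainM hok p hp)).1.2 none).le
  have h2 := h1.trans (Nat.mul_le_mul_right _ (card_gainM_le ls θ))
  rw [Pi.add_apply, Nat.mul_succ, Nat.mul_comm (vecBound n)]
  omega

end

section

section counting

/-- Bounded weights. -/
theorem exists_finset_vec (n b : ℕ) : ∃ s : Finset Vec, s.card ≤ b ^ ((n + 1) * (n + 1) + 1) ∧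
    ∀ K v, K + 1 ≤ n → VecIn (K + 1) n v → (∀ o, v o < b) → v ∈ s := by
  classical
  let C : Finset (Option (ℕ × ℕ)) :=
    Finset.insertNone (Finset.range (n + 1) ×ˢ Finset.range (n + 1))
  refine ⟨(Fintype.piFinset fun _ : C => Finset.range b).image
    fun g o => if h : o ∈ C then g ⟨o, h⟩ else 0, ?_, fun K v hK hv hb => ?_⟩
  · refine Finset.card_image_le.trans ?_
    simp [C]
  · refine Finset.mem_image.2 ⟨fun o => v o, by simpa using fun o _ => hb o, funext fun o => ?_⟩
    split
    · rfl
    · next h =>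
      rcases o with - | ⟨l, x⟩
      · simp [C] at h
      · refine (hv l x ?_).symm
        simp only [Finset.mem_insertNone, Option.mem_def, Option.some.injEq, forall_eq',
          Finset.mem_product, Finset.mem_range, C] at h
        omega

/-- Bounded lists. -/
theorem exists_finset_list {α : Type} (s : Finset α) (k : ℕ) :
    ∃ t : Finset (List α), t.card ≤ (s.card + 1) ^ k ∧
      ∀ l : List α, l.length ≤ k → (∀ a ∈ l, a ∈ s) → l ∈ t := by
  classical
  induction k with
  | zero => exact ⟨{[]}, by simp, fun l hl _ => by simpa using hl⟩
  | succ k ih =>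
    obtain ⟨t, ht, h⟩ := ih
    refine ⟨insert [] (Finset.image₂ List.cons s t), ?_, fun l hl hls => ?_⟩
    · refine (Finset.card_insert_le _ _).trans ?_
      have h1 := Finset.card_image₂_le List.cons s t
      have h2 := Nat.mul_le_mul_left s.card ht
      have h3 : 1 ≤ (s.card + 1) ^ k := Nat.one_le_pow _ _ (by omega)
      rw [pow_succ, Nat.mul_succ, Nat.mul_comm _ s.card]
      omega
    · cases l with
      | nil => simp
      | cons a l =>
        refine Finset.mem_insert_of_mem (Finset.mem_image₂.2 ⟨a, hls a (by simp), l, h l ?_ ?_, rfl⟩)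
        · simpa using hl
        · exact fun b hb => hls b (by simp [hb])

/-- The bound on the number of bounded weights. -/
def vecCount (n : ℕ) : ℕ := vecBound n ^ ((n + 1) * (n + 1) + 1)

/-- The bound on the number of thread types. -/
def thCount (n : ℕ) : ℕ :=
  (n + 1) * (((n + 1) * (n + 2) + 1) ^ n * ((n + 1) * (vecCount n * 2 ^ vecCount n)))

/-- The bound on the size of the net. -/
def netBound (n : ℕ) : ℕ :=
  (n + 2) + (n + 1) + thCount n * (n + 1) + thCount n * (n + 1) +
    thCount n * (vecCount n * (n + 1)) + (n + 1) * vecBound n + 3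

theorem ackBd_vecBound : AckBd vecBound := by
  have h1 : AckBd fun n => n + 1 := AckBd.id.add (.const 1)
  have h2 : AckBd fun n => 5 * (n + 1) ^ 2 := (AckBd.const 5).mul (h1.pow (.const 2))
  have h3 := h2.mul (h1.mul h2)
  exact (h3.mul h3.two_pow |>.add (.const 2)).two_pow

theorem ackBd_netBound : AckBd netBound := by
  have h1 : AckBd fun n => n + 1 := AckBd.id.add (.const 1)
  have h2 : AckBd fun n => n + 2 := AckBd.id.add (.const 2)
  have hv : AckBd vecCount := ackBd_vecBound.pow ((h1.mul h1).add (.const 1))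
  have ht : AckBd thCount := h1.mul ((((h1.mul h2).add (.const 1)).pow .id).mul
    (h1.mul (hv.mul hv.two_pow)))
  exact (((((h2.add h1).add (ht.mul h1)).add (ht.mul h1)).add (ht.mul (hv.mul h1))).add
    (h1.mul ackBd_vecBound)).add (.const 3)

variable {A : DCPS} {c : DConfig} {K n : ℕ}

theorem exists_finset_th (hs : SizeBd A c n) (hK : K + 1 ≤ n) :
    ∃ t : Finset Th, t.card ≤ thCount n ∧ ∀ θ : Th, θ.Ok A c K n → θ ∈ t := by
  classical
  obtain ⟨V, hV, hV'⟩ := exists_finset_vec n (vecBound n)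
  obtain ⟨L, hL, hL'⟩ := exists_finset_list
    (Finset.range (n + 1) ×ˢ Finset.insertNone (Finset.range (n + 1))) n
  let R : Finset (Option (List ℕ)) := Finset.insertNone (c.pend.map Prod.fst).toFinset
  have hR : R.card ≤ n + 1 := by
    rw [Finset.card_insertNone]
    have := (Multiset.toFinset_card_le (c.pend.map Prod.fst))
    rw [Multiset.card_map] at this
    have := hs.card
    omega
  refine ⟨(Finset.range (n + 1) ×ˢ (L ×ˢ (R ×ˢ (V ×ˢ V.powerset)))).image
    fun e => ⟨e.1, e.2.1, e.2.2.1, e.2.2.2.1, e.2.2.2.2⟩, ?_, fun θ hθ => ?_⟩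
  · refine Finset.card_image_le.trans ?_
    simp only [Finset.card_product, Finset.card_range, Finset.card_powerset,
      Finset.card_insertNone] at hL ⊢
    exact Nat.mul_le_mul_left _ (Nat.mul_le_mul hL (Nat.mul_le_mul hR
      (Nat.mul_le_mul hV (Nat.pow_le_pow_right (by omega) hV))))
  · refine Finset.mem_image.2 ⟨(θ.sym, θ.segs, θ.rest, θ.base, θ.pumps), ?_, rfl⟩
    simp only [Finset.mem_product, Finset.mem_range, Finset.mem_powerset]
    refine ⟨Nat.lt_succ_of_le hθ.sym, hL' _ (hθ.le.trans hK) fun s h => ?_, ?_,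
      hV' K _ hK hθ.base.1 hθ.base.2, fun p hp => ?_⟩
    · have := hθ.segs s h
      simp only [Finset.mem_product, Finset.mem_range, Finset.mem_insertNone, Option.mem_def]
      exact ⟨Nat.lt_succ_of_le this.1, fun a ha => Nat.lt_succ_of_le (this.2 a ha)⟩
    · simp only [R, Finset.mem_insertNone, Option.mem_def, Multiset.mem_toFinset, Multiset.mem_map]
      intro ρ hρ
      obtain ⟨i, hi⟩ := hθ.rest ρ hρ
      exact ⟨_, hi, rfl⟩
    · have := (hθ.pumps p hp).1
      exact hV' K p hK this.1 this.2

theorem exists_finset_pl (hs : SizeBd A c n) (hK : K + 1 ≤ n) :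
    ∃ F : Finset Pl, F.card ≤ netBound n ∧ (∀ g, (∀ a, g = some a → a ≤ n) → .glob g ∈ F) ∧
      (∀ x ≤ n, .pend x ∈ F) ∧ (∀ θ : Th, θ.Ok A c K n → ∀ l ≤ n, .wait θ l ∈ F ∧ .mark θ l ∈ F ∧
        ∀ p ∈ θ.pumps, .pool θ p l ∈ F) := by
  classical
  obtain ⟨V, hV, hV'⟩ := exists_finset_vec n (vecBound n)
  obtain ⟨T, hT, hT'⟩ := exists_finset_th hs hK
  refine ⟨(Finset.insertNone (Finset.range (n + 1))).image .glob ∪ (Finset.range (n + 1)).image .pend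
    ∪ (T ×ˢ Finset.range (n + 1)).image (fun e => .wait e.1 e.2)
    ∪ (T ×ˢ Finset.range (n + 1)).image (fun e => .mark e.1 e.2)
    ∪ (T ×ˢ (V ×ˢ Finset.range (n + 1))).image (fun e => .pool e.1 e.2.1 e.2.2), ?_, ?_, ?_, ?_⟩
  · refine le_trans ?_ (Nat.le_add_right _ 3 |>.trans' (Nat.le_add_right _ _))
    refine (Finset.card_union_le _ _).trans (Nat.add_le_add ?_ ?_)
    · refine (Finset.card_union_le _ _).trans (Nat.add_le_add ?_ ?_)
      · refine (Finset.card_union_le _ _).trans (Nat.add_le_add ?_ ?_)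
        · refine (Finset.card_union_le _ _).trans (Nat.add_le_add ?_ ?_)
          · exact Finset.card_image_le.trans (by simp)
          · exact Finset.card_image_le.trans (by simp)
        · refine Finset.card_image_le.trans ?_
          simpa using hT
      · refine Finset.card_image_le.trans ?_
        simpa using hT
    · refine Finset.card_image_le.trans ?_
      rw [Finset.card_product, Finset.card_product, Finset.card_range]
      exact Nat.mul_le_mul hT (Nat.mul_le_mul_right _ hV)
  · intro g hg
    simp only [Finset.mem_union, Finset.mem_image]
    refine .inl (.inl (.inl (.inl ⟨g, ?_, rfl⟩)))
    rw [Finset.mem_insertNone]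
    exact fun a ha => Finset.mem_range.2 (Nat.lt_succ_of_le (hg a ha))
  · intro x hx
    simp only [Finset.mem_union, Finset.mem_image]
    exact .inl (.inl (.inl (.inr ⟨x, Finset.mem_range.2 (Nat.lt_succ_of_le hx), rfl⟩)))
  · intro θ hθ l hl
    have hl' := Finset.mem_range.2 (Nat.lt_succ_of_le hl)
    simp only [Finset.mem_union, Finset.mem_image]
    refine ⟨.inl (.inl (.inr ⟨(θ, l), Finset.mk_mem_product (hT' θ hθ) hl', rfl⟩)),
      .inl (.inr ⟨(θ, l), Finset.mk_mem_product (hT' θ hθ) hl', rfl⟩), fun p hp => ?_⟩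
    have := (hθ.pumps p hp).1
    exact .inr ⟨(θ, p, l), Finset.mk_mem_product (hT' θ hθ)
      (Finset.mk_mem_product (hV' K p hK this.1 this.2) hl'), rfl⟩

theorem card_spawnM_le {v : Vec} (hv : ∀ o, v o ≤ vecBound n) (l : ℕ) :
    Multiset.card (spawnM n v l) ≤ (n + 1) * vecBound n := by
  rw [spawnM, Multiset.card_sum]
  refine (Finset.sum_le_card_nsmul _ _ (vecBound n) fun x _ => ?_).trans (by simp)
  rw [Multiset.card_replicate]
  exact hv _

theorem mem_spawnM_le {v : Vec} {l x : ℕ} (h : x ∈ spawnM n v l) : x ≤ n := by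
  by_contra hx
  have := Multiset.count_pos.2 h
  rw [count_spawnM, if_neg hx] at this
  omega

theorem Lb.Ok.bounds {F : Finset Pl} (h1 : ∀ g, (∀ a, g = some a → a ≤ n) → .glob g ∈ F)
    (h2 : ∀ x ≤ n, .pend x ∈ F) (h3 : ∀ θ : Th, θ.Ok A c K n → ∀ l ≤ n, .wait θ l ∈ F ∧
      .mark θ l ∈ F ∧ ∀ p ∈ θ.pumps, .pool θ p l ∈ F) (hK : K + 1 ≤ n) {a : Lb}
    (ha : a.Ok A c K n) : (∀ p ∈ a.pre, p ∈ F) ∧ (∀ p ∈ a.post n, p ∈ F) ∧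
      Multiset.card a.pre ≤ 2 ∧ Multiset.card (a.post n) ≤ n + (n + 1) * vecBound n + 3 := by
  have hth : ∀ {θ : Th} {l}, θ.Ok A c K n → l ≤ θ.len → l ≤ n := fun h hl =>
    hl.trans (h.le.trans hK)
  cases a with
  | ev θ l =>
    obtain ⟨hθ, hl1, hl⟩ := ha
    have hln := hth hθ hl
    have hseg : SegOk n (θ.seg l) := hθ.segs _ <| by
      have := Th.drop_eq hl1 hl
      exact List.mem_of_mem_drop (this ▸ List.mem_cons_self)
    refine ⟨fun p hp => ?_, fun p hp => ?_, ?_, ?_⟩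
    · simp only [Lb.pre, Th.input, Multiset.mem_add, Multiset.mem_singleton] at hp
      rcases hp with rfl | hp
      · exact h1 _ (by rintro _ ⟨⟩; exact hseg.1)
      · split at hp <;> rw [Multiset.mem_singleton] at hp <;> subst hp
        · exact h2 _ hθ.sym
        · exact (h3 θ hθ l hln).1
    · simp only [Lb.post, Th.output, Multiset.mem_add, Multiset.mem_singleton] at hp
      rcases hp with ((rfl | hp) | rfl) | hp
      · exact h1 _ hseg.2
      · obtain ⟨x, hx, rfl⟩ := Multiset.mem_map.1 hp
        exact h2 _ (mem_spawnM_le hx)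
      · exact (h3 θ hθ l hln).2.1
      · split at hp
        · simp at hp
        · rw [Multiset.mem_singleton] at hp
          subst hp
          exact (h3 θ hθ _ (by omega)).1
    · simp only [Lb.pre, Th.input]
      split <;> simp
    · have := card_spawnM_le (n := n) (fun o => (hθ.base.2 o).le) l
      simp only [Lb.post, Th.output, Multiset.card_add, Multiset.card_map, Multiset.card_singleton]
      split <;> simp <;> omega
  | grow θ q =>
    refine ⟨by simp [Lb.pre], fun p hp => ?_, by simp [Lb.pre], ?_⟩
    · rw [Lb.post] at hp
      obtain ⟨l, hl, rfl⟩ := Multiset.mem_map.1 hp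
      simp only [Finset.mem_val, Finset.mem_Icc] at hl
      exact (h3 θ ha.1 l (hth ha.1 hl.2)).2.2 q ha.2
    · have := hth ha.1 le_rfl
      simp [Lb.post]
      omega
  | emit θ q l =>
    obtain ⟨hθ, hq, hl1, hl⟩ := ha
    have := h3 θ hθ l (hth hθ hl)
    refine ⟨?_, fun p hp => ?_, by simp [Lb.pre], ?_⟩
    · simpa [Lb.pre] using ⟨this.2.1, this.2.2 q hq⟩
    · simp only [Lb.post, Multiset.mem_add, Multiset.mem_singleton] at hp
      rcases hp with rfl | hp
      · exact this.2.1
      · obtain ⟨x, hx, rfl⟩ := Multiset.mem_map.1 hp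
        exact h2 _ (mem_spawnM_le hx)
    · have := card_spawnM_le (n := n) (fun o => ((hθ.pumps q hq).1.2 o).le) l
      simp only [Lb.post, Multiset.card_add, Multiset.card_map, Multiset.card_singleton]
      omega
  | drain θ l =>
    have := h3 θ ha.1 l (hth ha.1 ha.2.2)
    exact ⟨by simpa [Lb.pre] using this.2.1, by simp [Lb.post], by simp [Lb.pre], by simp [Lb.post]⟩

theorem IsTarget.bounds {F : Finset Pl} (hs : SizeBd A c n)
    (h1 : ∀ g, (∀ a, g = some a → a ≤ n) → .glob g ∈ F)
    (h2 : ∀ x ≤ n, .pend x ∈ F) (h3 : ∀ θ : Th, θ.Ok A c K n → ∀ l ≤ n, .wait θ l ∈ F ∧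
      .mark θ l ∈ F ∧ ∀ p ∈ θ.pumps, .pool θ p l ∈ F) {y : Multiset Pl} (hy : IsTarget A c K n y) :
    (∀ p ∈ y, p ∈ F) ∧ Multiset.card y ≤ n + 1 := by
  obtain ⟨D, O, W, hW, -, hc, rfl, -, hO⟩ := hy
  constructor
  · intro p hp
    rw [Multiset.mem_add, Multiset.mem_add, Multiset.mem_singleton] at hp
    rcases hp with (rfl | hp) | hp
    · refine h1 _ fun a ha => ?_
      split at ha
      · cases ha; exact hs.cg
      · cases ha
    · obtain ⟨x, hx, rfl⟩ := Multiset.mem_map.1 hp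
      refine h2 x ((hs.pend [x] 0 ?_).2 x (by simp))
      rw [hc]
      exact Multiset.mem_add.2 (.inl (Multiset.mem_map_of_mem fr hx))
    · obtain ⟨θ, hθ, rfl⟩ := Multiset.mem_map.1 hp
      exact (h3 θ (hW θ hθ) 0 (Nat.zero_le _)).1
  · have h4 := congrArg Multiset.card hc
    have h5 := congrArg Multiset.card hO
    have := hs.card
    simp only [Multiset.card_add, Multiset.card_map, Multiset.card_singleton] at *
    omega

/-- The bound on the length of runs. -/
def runBound (m n : ℕ) : ℕ :=
  ack (m + 3 * ack m n) (ack m n) * (ack m n * (ack (m + 3 * ack m n) (ack m n) + 1) + 1)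

theorem exists_short_run : ∃ m, ∀ (A : DCPS) (c : DConfig) (K n : ℕ), SizeBd A c n → K + 1 ≤ n →
    (∃ k f, FRun A K k (A.init, false) (c, f)) →
      ∃ k ≤ runBound m n, ∃ f, FRun A K k (A.init, false) (c, f) := by
  classical
  obtain ⟨m₁, h₁⟩ := ackBd_netBound
  obtain ⟨m₂, h₂⟩ := exists_mRun_bound
  refine ⟨max m₁ m₂, fun A c K n hs hK ⟨k, f, hrun⟩ => ?_⟩
  obtain ⟨y, hy, ls, hls, hmr⟩ := hrun.exists_nRun hs hK
  obtain ⟨F, hF, hF1, hF2, hF3⟩ := exists_finset_pl hs hK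
  have hpl : ∀ a : Lb, a.Ok A c K n → _ := fun a ha => Lb.Ok.bounds hF1 hF2 hF3 hK ha
  obtain ⟨hy1, hy2⟩ := hy.bounds hs hF1 hF2 hF3
  set N := ack (max m₁ m₂) n with hN
  have hnet : netBound n ≤ N := (h₁ n).trans (ack_mono_left n (le_max_left _ _))
  have hbig : n + (n + 1) * vecBound n + 3 ≤ netBound n := by
    unfold netBound; omega
  have hv : vecBound n ≤ N := by
    have : vecBound n ≤ (n + 1) * vecBound n := Nat.le_mul_of_pos_left _ (by omega)
    omega
  obtain ⟨ls', hlen, hls', hmr'⟩ := h₂ N Lb Pl Lb.pre (Lb.post n) F {a | a.Ok A c K n}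
    (hF.trans hnet)
    (fun a ha => ⟨(hpl a ha).1, (hpl a ha).2.1,
      fun p => (Multiset.count_le_card p _).trans ((hpl a ha).2.2.1.trans (by omega)),
      fun p => (Multiset.count_le_card p _).trans ((hpl a ha).2.2.2.trans (by omega))⟩)
    _ y (fun p hp => by
      rw [Multiset.mem_add, Multiset.mem_singleton, Multiset.mem_singleton] at hp
      rcases hp with rfl | rfl
      · exact hF1 _ (by rintro _ ⟨⟩; exact hs.g0)
      · exact hF2 _ hs.gamma0) hy1
    (fun p => (Multiset.count_le_card p _).trans (by simp; omega))
    (fun p => (Multiset.count_le_card p _).trans (by omega)) ls hls hmr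
  obtain ⟨k', hk', hf⟩ := FRun.of_mRun hls' hmr' hy
  refine ⟨k', hk'.trans ?_, hf⟩
  have hL : ls'.length ≤ ack (max m₁ m₂ + 3 * N) N :=
    hlen.trans (ack_mono_left _ (Nat.add_le_add_right (le_max_right _ _) _))
  rw [runBound, ← hN]
  exact Nat.mul_le_mul hL (Nat.add_le_add_right (Nat.mul_le_mul hv (Nat.add_le_add_right hL _)) _)

end counting

end

section

/-! ### Computability -/

open Encodable

theorem FRun.exists_snoc {A : DCPS} {K n : ℕ} {p s : DConfig × Bool} (h : FRun A K (n + 1) p s) :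
    ∃ q, FRun A K n p q ∧ FStep A K q s := by
  generalize hm : n + 1 = m at h
  induction h generalizing n with
  | refl p => omega
  | @head m p q s hs h ih =>
    obtain rfl : n = m := by omega
    cases n with
    | zero => cases h; exact ⟨p, .refl _, hs⟩
    | succ n =>
      obtain ⟨q', h1, h2⟩ := ih rfl
      exact ⟨q', .head hs h1, h2⟩

/-- Configurations with pending threads given as a list, and a flag. -/
abbrev LConf : Type := (ℕ × Option Loc × List Loc) × Bool

/-- The configuration represented by a list configuration. -/
def LConf.toConf (s : LConf) : DConfig × Bool := (⟨s.1.1, s.1.2.1, s.1.2.2⟩, s.2)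

abbrev Cre : Type := ℕ × ℕ × ℕ × List ℕ × Option ℕ
abbrev Intr : Type := ℕ × ℕ × ℕ × List ℕ

/-- Systems with rules given as lists. -/
abbrev LSys : Type :=
  List ℕ × List ℕ × List Cre × List Intr × List (ℕ × ℕ × ℕ) × List (ℕ × ℕ) × ℕ × ℕ

/-- Instances of the reachability problem. -/
abbrev LInst : Type := LSys × (ℕ × Option Loc × List Loc)

/-- Successor by a creation rule. -/
def threadSucc (s : LConf) (r : Cre) : Option LConf :=
  s.1.2.1.bind fun a => a.1.head?.bind fun y =>
    if (s.1.1, y) = (r.1, r.2.1) then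
      some ((r.2.2.1, some (r.2.2.2.1 ++ a.1.tail, a.2),
        s.1.2.2 ++ r.2.2.2.2.toList.map fun z => ([z], 0)), false)
    else none

/-- Successor by an interruption rule. -/
def swapSucc (s : LConf) (r : Intr) : Option LConf :=
  s.1.2.1.bind fun a => a.1.head?.bind fun y =>
    if (s.1.1, y, s.2) = (r.1, r.2.1, false) then
      some ((r.2.2.1, none, s.1.2.2 ++ [(r.2.2.2 ++ a.1.tail, a.2 + 1)]), false)
    else none

/-- Successor by a termination rule. -/
def termSucc (s : LConf) (r : ℕ × ℕ) : Option LConf :=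
  s.1.2.1.bind fun a =>
    if (s.1.1, a.1, s.2) = (r.1, [], false) then some ((r.2, none, s.1.2.2), false) else none

/-- Successor by a resumption rule, resuming the thread at the given position. -/
def resumeSucc (K : ℕ) (p : LConf × (ℕ × ℕ × ℕ)) (j : ℕ) : Option LConf :=
  p.1.1.2.2[j]?.bind fun a => a.1.head?.bind fun y =>
    if (p.1.1.1, y, p.1.1.2.1) = (p.2.1, p.2.2.2, none) ∧ a.2 ≤ K then
      some ((p.2.2.1, some a, p.1.1.2.2.take j ++ p.1.1.2.2.drop (j + 1)), true)
    else none

/-- All successors. -/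
def succs (K : ℕ) (t : LSys) (s : LConf) : List LConf :=
  (t.2.2.1.filterMap (threadSucc s) ++ t.2.2.2.1.filterMap (swapSucc s)) ++
  (t.2.2.2.2.2.1.filterMap (termSucc s) ++
    t.2.2.2.2.1.flatMap fun r => (List.range s.1.2.2.length).filterMap (resumeSucc K (s, r)))

/-- Everything reachable in a number of steps. -/
def reachList (K : ℕ) (t : LSys) (k : ℕ) : List LConf :=
  Nat.rec [((t.2.2.2.2.2.2.1, none, [([t.2.2.2.2.2.2.2], 0)]), false)]
    (fun _ S => S ++ S.flatMap (succs K t)) k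

/-- Number of occurrences. -/
def occ (l : List Loc) (a : Loc) : ℕ := (l.filter fun b => b = a).length

/-- Equality up to permutation of the pending threads. -/
def LMatch (s : LConf) (d : ℕ × Option Loc × List Loc) : Prop :=
  ((s.1.1, s.1.2.1) = (d.1, d.2.1)) ∧ ∀ a ∈ s.1.2.2 ++ d.2.2, occ s.1.2.2 a = occ d.2.2 a

theorem lMatch_iff {s : LConf} {d : ℕ × Option Loc × List Loc} :
    LMatch s d ↔ s.toConf.1 = ⟨d.1, d.2.1, d.2.2⟩ := by
  have ho : ∀ l a, occ l a = l.count a := fun l a => by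
    rw [occ, List.count_eq_countP, List.countP_eq_length_filter]
    congr 2; funext b; rw [Bool.eq_iff_iff]; simp
  obtain ⟨⟨g, act, l⟩, f⟩ := s
  obtain ⟨g', act', l'⟩ := d
  simp only [LMatch, ho, LConf.toConf, Prod.mk.injEq, DConfig.mk.injEq, and_assoc,
    Multiset.coe_eq_coe, List.perm_iff_count]
  refine and_congr_right fun _ => and_congr_right fun _ => ⟨fun h a => ?_, fun h a _ => h a⟩
  by_cases ha : a ∈ l ++ l'
  · exact h a ha
  · rw [List.mem_append, not_or] at ha
    rw [List.count_eq_zero.2 ha.1, List.count_eq_zero.2 ha.2]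

section primrec

variable (K : ℕ)

open Primrec

theorem primrec_threadSucc : Primrec₂ threadSucc := by
  unfold threadSucc
  refine option_bind (fst.comp (snd.comp (fst.comp fst))) ?_
  refine option_bind (list_head?.comp (fst.comp snd)) ?_
  have hs : Primrec fun x : ((LConf × Cre) × Loc) × ℕ => x.1.1.1 := fst.comp (fst.comp fst)
  have hr : Primrec fun x : ((LConf × Cre) × Loc) × ℕ => x.1.1.2 := snd.comp (fst.comp fst)
  have ha : Primrec fun x : ((LConf × Cre) × Loc) × ℕ => x.1.2 := snd.comp fst
  refine Primrec.ite (Primrec.eq.comp (pair (fst.comp (fst.comp hs)) snd)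
    (pair (fst.comp hr) (fst.comp (snd.comp hr)))) ?_ (const none)
  refine option_some.comp (pair (pair (fst.comp (snd.comp (snd.comp hr))) (pair (option_some.comp
    (pair (list_append.comp (fst.comp (snd.comp (snd.comp (snd.comp hr))))
      (list_tail.comp (fst.comp ha))) (snd.comp ha))) ?_)) (const false))
  refine list_append.comp (snd.comp (snd.comp (fst.comp hs)))
    (list_map (optionToList.comp (snd.comp (snd.comp (snd.comp (snd.comp hr))))) ?_)
  exact pair (list_cons.comp snd (const [])) (const 0)

theorem primrec_swapSucc : Primrec₂ swapSucc := by
  unfold swapSucc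
  refine option_bind (fst.comp (snd.comp (fst.comp fst))) ?_
  refine option_bind (list_head?.comp (fst.comp snd)) ?_
  have hs : Primrec fun x : ((LConf × Intr) × Loc) × ℕ => x.1.1.1 := fst.comp (fst.comp fst)
  have hr : Primrec fun x : ((LConf × Intr) × Loc) × ℕ => x.1.1.2 := snd.comp (fst.comp fst)
  have ha : Primrec fun x : ((LConf × Intr) × Loc) × ℕ => x.1.2 := snd.comp fst
  refine Primrec.ite (Primrec.eq.comp (pair (fst.comp (fst.comp hs)) (pair snd (snd.comp hs)))
    (pair (fst.comp hr) (pair (fst.comp (snd.comp hr)) (const false)))) ?_ (const none)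
  refine option_some.comp (pair (pair (fst.comp (snd.comp (snd.comp hr))) (pair (const none)
    ?_)) (const false))
  exact list_append.comp (snd.comp (snd.comp (fst.comp hs))) (list_cons.comp
    (pair (list_append.comp (snd.comp (snd.comp (snd.comp hr)))
      (list_tail.comp (fst.comp ha))) (Primrec.succ.comp (snd.comp ha))) (const []))

theorem primrec_termSucc : Primrec₂ termSucc := by
  unfold termSucc
  refine option_bind (fst.comp (snd.comp (fst.comp fst))) ?_
  have hs : Primrec fun x : (LConf × (ℕ × ℕ)) × Loc => x.1.1 := fst.comp fst
  have hr : Primrec fun x : (LConf × (ℕ × ℕ)) × Loc => x.1.2 := snd.comp fst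
  refine Primrec.ite (Primrec.eq.comp
    (pair (fst.comp (fst.comp hs)) (pair (fst.comp snd) (snd.comp hs)))
    (pair (fst.comp hr) (const ([], false)))) ?_ (const none)
  exact option_some.comp (pair (pair (snd.comp hr) (pair (const none)
    (snd.comp (snd.comp (fst.comp hs))))) (const false))

theorem primrec_resumeSucc : Primrec₂ (resumeSucc K) := by
  unfold resumeSucc
  refine option_bind (list_getElem?.comp (snd.comp (snd.comp (fst.comp (fst.comp fst)))) snd) ?_
  refine option_bind (list_head?.comp (fst.comp snd)) ?_
  have hp : Primrec fun x : (((LConf × (ℕ × ℕ × ℕ)) × ℕ) × Loc) × ℕ => x.1.1.1 :=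
    fst.comp (fst.comp fst)
  have hs := fst.comp hp
  have hr := snd.comp hp
  have hj : Primrec fun x : (((LConf × (ℕ × ℕ × ℕ)) × ℕ) × Loc) × ℕ => x.1.1.2 :=
    snd.comp (fst.comp fst)
  have ha : Primrec fun x : (((LConf × (ℕ × ℕ × ℕ)) × ℕ) × Loc) × ℕ => x.1.2 := snd.comp fst
  have hl := snd.comp (snd.comp (fst.comp hs))
  refine Primrec.ite (PrimrecPred.and (Primrec.eq.comp
    (pair (fst.comp (fst.comp hs)) (pair snd (fst.comp (snd.comp (fst.comp hs)))))
    (pair (fst.comp hr) (pair (snd.comp (snd.comp hr)) (const none))))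
    (nat_le.comp (snd.comp ha) (const K))) ?_ (const none)
  exact option_some.comp (pair (pair (fst.comp (snd.comp hr)) (pair (option_some.comp ha)
    (list_append.comp (list_take.comp hj hl) (list_drop.comp (Primrec.succ.comp hj) hl))))
    (const true))

theorem primrec_succs : Primrec₂ (succs K) := by
  unfold succs
  have ht : Primrec fun x : LSys × LConf => x.1 := fst
  have hs : Primrec fun x : LSys × LConf => x.2 := snd
  have h2 := snd.comp (snd.comp ht)
  have h4 := snd.comp (snd.comp h2)
  refine list_append.comp (list_append.comp
    (listFilterMap (fst.comp h2) (primrec_threadSucc.comp (hs.comp fst) snd))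
    (listFilterMap (fst.comp (snd.comp h2)) (primrec_swapSucc.comp (hs.comp fst) snd)))
    (list_append.comp
    (listFilterMap (fst.comp (snd.comp h4)) (primrec_termSucc.comp (hs.comp fst) snd))
    (list_flatMap (fst.comp h4) ?_))
  exact listFilterMap (list_range.comp (list_length.comp (snd.comp (snd.comp (fst.comp
    (hs.comp fst)))))) ((primrec_resumeSucc K).comp (pair (hs.comp (fst.comp fst)) (snd.comp fst))
      snd)

theorem primrec_reachList : Primrec₂ (reachList K) := by
  unfold reachList
  refine nat_rec (f := fun t : LSys =>
    [((t.2.2.2.2.2.2.1, none, [([t.2.2.2.2.2.2.2], 0)]), false)])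
    (g := fun t (p : ℕ × List LConf) => p.2 ++ p.2.flatMap (succs K t)) ?_ ?_
  · have h6 : Primrec fun t : LSys => t.2.2.2.2.2.2 :=
      snd.comp (snd.comp (snd.comp (snd.comp (snd.comp snd))))
    exact list_cons.comp (pair (pair (fst.comp h6) (pair (const none)
      (list_cons.comp (pair (list_cons.comp (snd.comp h6) (const [])) (const 0)) (const []))))
      (const false)) (const [])
  · exact list_append.comp (snd.comp snd) (list_flatMap (snd.comp snd)
      ((primrec_succs K).comp (fst.comp fst) snd))

theorem primrec_occ : Primrec₂ occ := by
  unfold occ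
  exact list_length.comp ((PrimrecRel.listFilter (Primrec.eq (α := Loc))).comp fst snd)

theorem primrecRel_lMatch : PrimrecRel LMatch := by
  unfold LMatch
  refine PrimrecPred.and (Primrec.eq.comp
    (pair (fst.comp (fst.comp fst)) (fst.comp (snd.comp (fst.comp fst))))
    (pair (fst.comp snd) (fst.comp (snd.comp snd)))) ?_
  have hr : PrimrecRel fun (a : Loc) (x : LConf × (ℕ × Option Loc × List Loc)) =>
      occ x.1.1.2.2 a = occ x.2.2.2 a :=
    Primrec.eq.comp
      (primrec_occ.comp (snd.comp (snd.comp (fst.comp (fst.comp snd)))) fst)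
      (primrec_occ.comp (snd.comp (snd.comp (snd.comp snd))) fst)
  exact hr.forall_mem_list.comp (list_append.comp (snd.comp (snd.comp (fst.comp fst)))
    (snd.comp (snd.comp snd))) .id

end primrec

end

section

open Encodable

/-- The list system represents the system. -/
structure LSys.Reps (t : LSys) (A : DCPS) : Prop where
  creation : ∀ r, r ∈ t.2.2.1 ↔ r ∈ A.creation
  interruption : ∀ r, r ∈ t.2.2.2.1 ↔ r ∈ A.interruption
  resumption : ∀ r, r ∈ t.2.2.2.2.1 ↔ r ∈ A.resumption
  termination : ∀ r, r ∈ t.2.2.2.2.2.1 ↔ r ∈ A.termination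
  g0 : t.2.2.2.2.2.2.1 = A.g0
  gamma0 : t.2.2.2.2.2.2.2 = A.gamma0

theorem spawnOf_eq_coe (sp : Option ℕ) :
    spawnOf sp = ((sp.toList.map fun z => (([z], 0) : Loc) : List Loc) : Multiset Loc) := by
  cases sp <;> rfl

theorem exists_threadSucc {A : DCPS} {t : LSys} (h : t.Reps A) (s : LConf) (q : DConfig × Bool) :
    (∃ r ∈ t.2.2.1, ∃ s' ∈ threadSucc s r, s'.toConf = q) ↔
      ThreadStep A s.toConf.1 q.1 ∧ q.2 = false := by
  obtain ⟨⟨g, act, l⟩, f⟩ := s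
  obtain ⟨⟨g', act', l'⟩, f'⟩ := q
  constructor
  · rintro ⟨⟨a, x, b, w, sp⟩, hr, s', hs, he⟩
    simp only [threadSucc, Option.mem_def, Option.bind_eq_some_iff] at hs
    obtain ⟨⟨u, i⟩, rfl, y, hy, hs⟩ := hs
    obtain ⟨v, rfl⟩ := List.head?_eq_some_iff.1 hy
    split at hs
    · rename_i hc
      simp only [Prod.mk.injEq] at hc
      obtain ⟨rfl, rfl⟩ := hc
      cases hs
      simp only [LConf.toConf, Prod.mk.injEq, DConfig.mk.injEq] at he
      obtain ⟨⟨rfl, rfl, rfl⟩, rfl⟩ := he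
      refine ⟨⟨y, v, i, b, w, sp, (h.creation _).1 hr, rfl, rfl, rfl, ?_⟩, rfl⟩
      rw [spawnOf_eq_coe]; rfl
    · cases hs
  · rintro ⟨⟨x, v, i, b, w, sp, hr, h1, h2, h3, h4⟩, h5⟩
    simp only [LConf.toConf] at hr h1 h2 h3 h4 h5
    subst h1 h2 h3 h4 h5
    refine ⟨_, (h.creation _).2 hr, ((g', some (w ++ v, i), l ++ sp.toList.map fun z => ([z], 0)),
      false), ?_, ?_⟩
    · simp [threadSucc]
    · rw [spawnOf_eq_coe]; rfl

theorem exists_swapSucc {A : DCPS} {t : LSys} (h : t.Reps A) (s : LConf) (q : DConfig × Bool) :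
    (∃ r ∈ t.2.2.2.1, ∃ s' ∈ swapSucc s r, s'.toConf = q) ↔
      SwapStep A s.toConf.1 q.1 ∧ s.2 = false ∧ q.2 = false := by
  obtain ⟨⟨g, act, l⟩, f⟩ := s
  obtain ⟨⟨g', act', l'⟩, f'⟩ := q
  constructor
  · rintro ⟨⟨a, x, b, w⟩, hr, s', hs, he⟩
    simp only [swapSucc, Option.mem_def, Option.bind_eq_some_iff] at hs
    obtain ⟨⟨u, i⟩, rfl, y, hy, hs⟩ := hs
    obtain ⟨v, rfl⟩ := List.head?_eq_some_iff.1 hy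
    split at hs
    · rename_i hc
      simp only [Prod.mk.injEq] at hc
      obtain ⟨rfl, rfl, rfl⟩ := hc
      cases hs
      simp only [LConf.toConf, Prod.mk.injEq, DConfig.mk.injEq] at he
      obtain ⟨⟨rfl, rfl, rfl⟩, rfl⟩ := he
      exact ⟨⟨y, v, i, b, w, (h.interruption _).1 hr, rfl, rfl, rfl, rfl⟩, rfl, rfl⟩
    · cases hs
  · rintro ⟨⟨x, v, i, b, w, hr, h1, h2, h3, h4⟩, h5, h6⟩
    simp only [LConf.toConf] at hr h1 h2 h3 h4 h5 h6
    subst h1 h2 h3 h4 h5 h6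
    refine ⟨_, (h.interruption _).2 hr, ((g', none, l ++ [(w ++ v, i + 1)]), false), ?_, rfl⟩
    simp [swapSucc]

theorem exists_termSucc {A : DCPS} {t : LSys} (h : t.Reps A) (s : LConf) (q : DConfig × Bool) :
    (∃ r ∈ t.2.2.2.2.2.1, ∃ s' ∈ termSucc s r, s'.toConf = q) ↔
      TermStep A s.toConf.1 q.1 ∧ s.2 = false ∧ q.2 = false := by
  obtain ⟨⟨g, act, l⟩, f⟩ := s
  obtain ⟨⟨g', act', l'⟩, f'⟩ := q
  constructor
  · rintro ⟨⟨a, b⟩, hr, s', hs, he⟩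
    simp only [termSucc, Option.mem_def, Option.bind_eq_some_iff] at hs
    obtain ⟨⟨u, i⟩, rfl, hs⟩ := hs
    split at hs
    · rename_i hc
      simp only [Prod.mk.injEq] at hc
      obtain ⟨rfl, rfl, rfl⟩ := hc
      cases hs
      simp only [LConf.toConf, Prod.mk.injEq, DConfig.mk.injEq] at he
      obtain ⟨⟨rfl, rfl, rfl⟩, rfl⟩ := he
      exact ⟨⟨i, b, (h.termination _).1 hr, rfl, rfl, rfl, rfl⟩, rfl, rfl⟩
    · cases hs
  · rintro ⟨⟨i, b, hr, h1, h2, h3, h4⟩, h5, h6⟩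
    simp only [LConf.toConf] at hr h1 h2 h3 h4 h5 h6
    subst h1 h2 h3 h4 h5 h6
    refine ⟨_, (h.termination _).2 hr, ((g', none, l), false), ?_, rfl⟩
    simp [termSucc]

theorem coe_take_append_drop {α : Type*} {l : List α} {j : ℕ} {a : α} (h : l[j]? = some a) :
    (l : Multiset α) = ((l.take j ++ l.drop (j + 1) : List α) : Multiset α) + {a} := by
  obtain ⟨hj, rfl⟩ := List.getElem?_eq_some_iff.1 h
  rw [← Multiset.coe_singleton, Multiset.coe_add, Multiset.coe_eq_coe]
  conv_lhs => rw [← List.take_append_drop j l, List.drop_eq_getElem_cons hj]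
  rw [List.append_assoc]
  exact List.Perm.append_left _ (List.perm_append_comm (l₁ := [_]))

theorem exists_resumeSucc {A : DCPS} {t : LSys} (h : t.Reps A) (K : ℕ) (s : LConf)
    (q : DConfig × Bool) :
    (∃ r ∈ t.2.2.2.2.1, ∃ j < s.1.2.2.length, ∃ s' ∈ resumeSucc K (s, r) j, s'.toConf = q) ↔
      (∃ θ, ResumeStep A θ s.toConf.1 q.1 ∧ θ.2 ≤ K) ∧ q.2 = true := by
  obtain ⟨⟨g, act, l⟩, f⟩ := s
  obtain ⟨⟨g', act', l'⟩, f'⟩ := q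
  constructor
  · rintro ⟨⟨a, b, x⟩, hr, j, hj, s', hs, he⟩
    simp only [resumeSucc, Option.mem_def, Option.bind_eq_some_iff] at hs
    obtain ⟨⟨u, i⟩, hu, y, hy, hs⟩ := hs
    obtain ⟨v, rfl⟩ := List.head?_eq_some_iff.1 hy
    split at hs
    · rename_i hc
      simp only [Prod.mk.injEq] at hc
      obtain ⟨⟨rfl, rfl, rfl⟩, hK⟩ := hc
      cases hs
      simp only [LConf.toConf, Prod.mk.injEq, DConfig.mk.injEq] at he
      obtain ⟨⟨rfl, rfl, rfl⟩, rfl⟩ := he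
      exact ⟨⟨_, ⟨y, v, i, b, _, (h.resumption _).1 hr, rfl, rfl, coe_take_append_drop hu, rfl, rfl,
        rfl⟩, hK⟩, rfl⟩
    · cases hs
  · rintro ⟨⟨θ, ⟨x, v, i, b, p, hr, h1, h2, h3, h4, h5, h6⟩, hK⟩, h7⟩
    simp only [LConf.toConf] at hr h1 h2 h3 h4 h5 h6 h7
    subst h1 h2 h4 h5 h6 h7
    have hm : ((x :: v, i) : Loc) ∈ (l : Multiset Loc) := by rw [h3]; simp
    obtain ⟨j, hj, he⟩ := List.getElem_of_mem (Multiset.mem_coe.1 hm)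
    have he' : l[j]? = some (x :: v, i) := List.getElem?_eq_some_iff.2 ⟨hj, he⟩
    refine ⟨_, (h.resumption _).2 hr, j, hj, ((g', some (x :: v, i), l.take j ++ l.drop (j + 1)),
      true), ?_, ?_⟩
    · simp only [resumeSucc, he']
      simpa using hK
    · have := (coe_take_append_drop he').symm.trans h3
      rw [add_left_inj] at this
      simp only [LConf.toConf, this]

theorem exists_succs {A : DCPS} {t : LSys} (h : t.Reps A) (K : ℕ) (s : LConf)
    (q : DConfig × Bool) :
    (∃ s' ∈ succs K t s, s'.toConf = q) ↔ FStep A K s.toConf q := by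
  have h1 := exists_threadSucc h s q
  have h2 := exists_swapSucc h s q
  have h3 := exists_termSucc h s q
  have h4 := exists_resumeSucc h K s q
  have : (∃ s' ∈ succs K t s, s'.toConf = q) ↔
      (∃ r ∈ t.2.2.1, ∃ s' ∈ threadSucc s r, s'.toConf = q) ∨
      (∃ r ∈ t.2.2.2.1, ∃ s' ∈ swapSucc s r, s'.toConf = q) ∨
      (∃ r ∈ t.2.2.2.2.2.1, ∃ s' ∈ termSucc s r, s'.toConf = q) ∨
      ∃ r ∈ t.2.2.2.2.1, ∃ j < s.1.2.2.length, ∃ s' ∈ resumeSucc K (s, r) j, s'.toConf = q := by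
    simp only [succs, List.mem_append, List.mem_filterMap, List.mem_flatMap, List.mem_range,
      Option.mem_def]
    constructor
    · rintro ⟨s', ((⟨r, hr, he⟩ | ⟨r, hr, he⟩) | (⟨r, hr, he⟩ | ⟨r, hr, j, hj, he⟩)), hq⟩
      · exact .inl ⟨r, hr, s', he, hq⟩
      · exact .inr (.inl ⟨r, hr, s', he, hq⟩)
      · exact .inr (.inr (.inl ⟨r, hr, s', he, hq⟩))
      · exact .inr (.inr (.inr ⟨r, hr, j, hj, s', he, hq⟩))
    · rintro (⟨r, hr, s', he, hq⟩ | ⟨r, hr, s', he, hq⟩ | ⟨r, hr, s', he, hq⟩ |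
        ⟨r, hr, j, hj, s', he, hq⟩)
      · exact ⟨s', .inl (.inl ⟨r, hr, he⟩), hq⟩
      · exact ⟨s', .inl (.inr ⟨r, hr, he⟩), hq⟩
      · exact ⟨s', .inr (.inl ⟨r, hr, he⟩), hq⟩
      · exact ⟨s', .inr (.inr ⟨r, hr, j, hj, he⟩), hq⟩
  rw [this, h1, h2, h3, h4]
  clear this h1 h2 h3 h4
  obtain ⟨p, f⟩ : ∃ p f, s.toConf = (p, f) := ⟨_, _, rfl⟩
  obtain ⟨q, f'⟩ := q
  have hf : s.2 = s.toConf.2 := rfl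
  rw [hf]
  generalize s.toConf = p
  obtain ⟨p, f⟩ := p
  constructor
  · rintro (⟨h, rfl⟩ | ⟨h, rfl, rfl⟩ | ⟨h, rfl, rfl⟩ | ⟨⟨θ, h, hK⟩, rfl⟩)
    · exact .thread f h
    · exact .swap h
    · exact .term h
    · exact .resume f h hK
  · rintro (⟨_, h⟩ | h | h | ⟨_, h, hK⟩)
    · exact .inl ⟨h, rfl⟩
    · exact .inr (.inl ⟨h, rfl, rfl⟩)
    · exact .inr (.inr (.inl ⟨h, rfl, rfl⟩))
    · exact .inr (.inr (.inr ⟨⟨_, h, hK⟩, rfl⟩))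

theorem exists_reachList {A : DCPS} {t : LSys} (h : t.Reps A) (K k : ℕ) (q : DConfig × Bool) :
    (∃ s ∈ reachList K t k, s.toConf = q) ↔ ∃ j ≤ k, FRun A K j (A.init, false) q := by
  induction k generalizing q with
  | zero =>
    have he : reachList K t 0 = [((t.2.2.2.2.2.2.1, none, [([t.2.2.2.2.2.2.2], 0)]), false)] := rfl
    simp only [he, List.mem_singleton, exists_eq_left, Nat.le_zero]
    have : LConf.toConf ((t.2.2.2.2.2.2.1, none, [([t.2.2.2.2.2.2.2], 0)]), false) =
      (A.init, false) := by rw [h.g0, h.gamma0]; rfl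
    rw [this]
    constructor
    · rintro rfl; exact .refl _
    · intro h; cases h; rfl
  | succ k ih =>
    have he : reachList K t (k + 1) = reachList K t k ++ (reachList K t k).flatMap (succs K t) :=
      rfl
    rw [he]
    simp only [List.mem_append, List.mem_flatMap]
    constructor
    · rintro ⟨s, hs | ⟨s₀, hs₀, hs⟩, hq⟩
      · obtain ⟨j, hj, hr⟩ := (ih q).1 ⟨s, hs, hq⟩
        exact ⟨j, by omega, hr⟩
      · obtain ⟨j, hj, hr⟩ := (ih s₀.toConf).1 ⟨s₀, hs₀, rfl⟩
        exact ⟨j + 1, by omega, hr.trans (.head ((exists_succs h K s₀ q).1 ⟨s, hs, hq⟩) (.refl _))⟩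
    · rintro ⟨j, hj, hr⟩
      rcases Nat.lt_or_ge k j with hlt | hle
      · obtain rfl : j = k + 1 := by omega
        obtain ⟨p, hp, hs⟩ := hr.exists_snoc
        obtain ⟨s₀, hs₀, rfl⟩ := (ih p).2 ⟨k, le_rfl, hp⟩
        obtain ⟨s, hs, hq⟩ := (exists_succs h K s₀ q).2 hs
        exact ⟨s, .inr ⟨s₀, hs₀, hs⟩, hq⟩
      · obtain ⟨s, hs, hq⟩ := (ih q).2 ⟨j, hle, hr⟩
        exact ⟨s, .inl hs, hq⟩

/-! ### Codes bound the size -/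

theorem encode_le_encode_list {α : Type*} [Encodable α] {a : α} {l : List α} (h : a ∈ l) :
    encode a ≤ encode l := by
  induction l with
  | nil => cases h
  | cons b l ih =>
    rw [encode_list_cons]
    rcases List.mem_cons.1 h with rfl | h
    · exact (Nat.left_le_pair _ _).trans (Nat.le_succ _)
    · exact (ih h).trans ((Nat.right_le_pair _ _).trans (Nat.le_succ _))

theorem encode_le_encode_some {α : Type*} [Encodable α] (a : α) :
    encode a ≤ encode (some a) := Nat.le_succ _

theorem exists_list_encode_eq {α : Type*} [Denumerable α] (s : Multiset α) :
    ∃ l : List α, (l : Multiset α) = s ∧ encode l = @encode _ Multiset.encodable s := by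
  have h : @decode _ Multiset.encodable (@encode _ Multiset.encodable s) = some s := encodek s
  change decodeMultiset _ = _ at h
  rw [decodeMultiset, Denumerable.decode_eq_ofNat] at h
  exact ⟨_, Option.some.inj h, Denumerable.encode_ofNat _⟩

theorem sizeBd_of_encode {A : DCPS} {t : LSys} (h : t.Reps A) (d : ℕ × Option Loc × List Loc)
    {n : ℕ} (hn : encode (t, d) ≤ n) : SizeBd A ⟨d.1, d.2.1, d.2.2⟩ n := by
  obtain ⟨t1, t2, t3, t4, t5, t6, g0, γ0⟩ := t
  obtain ⟨g, act, l⟩ := d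
  simp only [encode_prod_val] at hn
  have key : ∀ {a b : ℕ}, Nat.pair a b ≤ n → a ≤ n ∧ b ≤ n := fun h =>
    ⟨(Nat.left_le_pair _ _).trans h, (Nat.right_le_pair _ _).trans h⟩
  have hl : ∀ w : List ℕ, encode w ≤ n → w.length ≤ n ∧ ∀ x ∈ w, x ≤ n := fun w hw =>
    ⟨(length_le_encode w).trans hw, fun x hx => (encode_le_encode_list hx).trans hw⟩
  obtain ⟨ht, hd⟩ := key hn
  obtain ⟨-, ht⟩ := key ht
  obtain ⟨-, ht⟩ := key ht
  obtain ⟨h3, ht⟩ := key ht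
  obtain ⟨h4, ht⟩ := key ht
  obtain ⟨h5, ht⟩ := key ht
  obtain ⟨h6, ht⟩ := key ht
  obtain ⟨h7, h8⟩ := key ht
  obtain ⟨hg, hd⟩ := key hd
  obtain ⟨ha, hp⟩ := key hd
  have hi := h.g0
  have hγ := h.gamma0
  dsimp only at hi hγ
  refine ⟨?_, ?_, ?_, ?_, hγ ▸ h8, hi ▸ h7, hg, ?_, ?_, (length_le_encode l).trans hp⟩
  · intro g x g' w sp hr
    have := (encode_le_encode_list ((h.creation _).2 hr)).trans h3
    simp only [encode_prod_val] at this
    obtain ⟨-, this⟩ := key this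
    obtain ⟨h1, this⟩ := key this
    obtain ⟨h2, this⟩ := key this
    obtain ⟨h3, this⟩ := key this
    refine ⟨h1, h2, (hl w h3).2, ?_⟩
    rintro y rfl
    exact (encode_le_encode_some y).trans this
  · intro g x g' w hr
    have := (encode_le_encode_list ((h.interruption _).2 hr)).trans h4
    simp only [encode_prod_val] at this
    obtain ⟨-, this⟩ := key this
    obtain ⟨-, this⟩ := key this
    obtain ⟨h2, this⟩ := key this
    exact ⟨h2, (hl w this).2⟩
  · intro g g' x hr
    have := (encode_le_encode_list ((h.resumption _).2 hr)).trans h5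
    simp only [encode_prod_val] at this
    obtain ⟨h1, this⟩ := key this
    exact ⟨h1, key this⟩
  · intro g g' hr
    have := (encode_le_encode_list ((h.termination _).2 hr)).trans h6
    simp only [encode_prod_val] at this
    exact (key this).2
  · rintro w i rfl
    have := (encode_le_encode_some _).trans ha
    rw [encode_prod_val] at this
    exact hl w (key this).1
  · intro w i hw
    have := (encode_le_encode_list (Multiset.mem_coe.1 hw)).trans hp
    rw [encode_prod_val] at this
    exact hl w (key this).1

/-- Codes of systems and configurations are codes of their list versions. -/
theorem exists_inst (A : DCPS) (c : DConfig) : ∃ (t : LSys) (d : ℕ × Option Loc × List Loc),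
    t.Reps A ∧ c = ⟨d.1, d.2.1, d.2.2⟩ ∧
      encode ((t, d) : LInst) = Nat.pair (encodeDCPS A) (encodeDConfig c) := by
  obtain ⟨l1, h1, e1⟩ := exists_list_encode_eq A.glob.val
  obtain ⟨l2, h2, e2⟩ := exists_list_encode_eq A.alph.val
  obtain ⟨l3, h3, e3⟩ := exists_list_encode_eq A.creation.val
  obtain ⟨l4, h4, e4⟩ := exists_list_encode_eq A.interruption.val
  obtain ⟨l5, h5, e5⟩ := exists_list_encode_eq A.resumption.val
  obtain ⟨l6, h6, e6⟩ := exists_list_encode_eq A.termination.val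
  obtain ⟨l, h, e⟩ := exists_list_encode_eq c.pend
  refine ⟨(l1, l2, l3, l4, l5, l6, A.g0, A.gamma0), (c.g, c.act, l), ⟨?_, ?_, ?_, ?_, rfl, rfl⟩, ?_,
    ?_⟩
  · intro r; rw [← Finset.mem_val, ← h3]; rfl
  · intro r; rw [← Finset.mem_val, ← h4]; rfl
  · intro r; rw [← Finset.mem_val, ← h5]; rfl
  · intro r; rw [← Finset.mem_val, ← h6]; rfl
  · rw [h]
  · rw [encodeDCPS, encodeDConfig]
    simp only [encode_prod_val, encode_nat, e1, e2, e3, e4, e5, e6, e]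

/-! ### The decision procedure -/

theorem computable_runBound (m : ℕ) : Computable (runBound m) := by
  unfold runBound
  have hmul : Computable₂ fun a b : ℕ => a * b := Primrec.nat_mul.to_comp
  have hadd : Computable₂ fun a b : ℕ => a + b := Primrec.nat_add.to_comp
  have h1 : Computable fun n => ack m n := computable₂_ack.comp (.const m) .id
  have h2 : Computable fun n => ack (m + 3 * ack m n) (ack m n) :=
    computable₂_ack.comp (hadd.comp (.const m) (hmul.comp (.const 3) h1)) h1
  exact hmul.comp h2 (hadd.comp (hmul.comp h1 (hadd.comp h2 (.const 1))) (.const 1))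

open scoped Classical in
/-- The decision procedure on list instances, for runs of length at most `k`. -/
noncomputable def decideIn (K : ℕ) (x : LInst) (k : ℕ) : Bool :=
  decide (∃ s ∈ reachList K x.1 k, LMatch s x.2)

theorem primrec_decideIn (K : ℕ) : Primrec₂ (decideIn K) := by
  have h : PrimrecPred fun p : LInst × ℕ => ∃ s ∈ reachList K p.1.1 p.2, LMatch s p.1.2 :=
    primrecRel_lMatch.exists_mem_list.comp
      ((primrec_reachList K).comp (Primrec.fst.comp Primrec.fst) Primrec.snd)
      (Primrec.snd.comp Primrec.fst)
  classical
  exact h.decide.of_eq fun p => by simp only [decideIn]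

theorem reachability_decidable (K : ℕ) : ∃ f : ℕ → Bool, Computable f ∧
    ∀ (A : DCPS) (c : DConfig), (f (Nat.pair (encodeDCPS A) (encodeDConfig c)) = true ↔
      ∃ (rho : ℕ → DConfig) (n : ℕ), IsFinRunD A rho n ∧ KBoundedUpToD K n rho ∧ rho n = c) := by
  obtain ⟨m, hm⟩ := exists_short_run
  refine ⟨fun n => ((decode n : Option LInst).map fun x =>
    decideIn K x (runBound m (encode x + (K + 1)))).getD false, ?_, fun A c => ?_⟩
  · refine Computable.option_getD (Computable.option_map Computable.decode ?_) (.const false)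
    have hadd : Computable₂ fun a b : ℕ => a + b := Primrec.nat_add.to_comp
    exact (primrec_decideIn K).to_comp.comp .snd ((computable_runBound m).comp
      (hadd.comp (Computable.encode.comp .snd) (.const _)))
  · obtain ⟨t, d, ht, rfl, he⟩ := exists_inst A c
    beta_reduce
    rw [← he, encodek, exists_finRun_iff]
    simp only [Option.map_some, Option.getD_some, decideIn, decide_eq_true_eq, lMatch_iff]
    constructor
    · rintro ⟨s, hs, hd⟩
      obtain ⟨j, -, hr⟩ := (exists_reachList ht K _ s.toConf).1 ⟨s, hs, rfl⟩
      exact ⟨j, s.toConf.2, hd ▸ hr⟩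
    · intro hr
      obtain ⟨k, hk, f, hf⟩ := hm A _ K (encode (t, d) + (K + 1))
        (sizeBd_of_encode ht d (Nat.le_add_right _ _)) (Nat.le_add_left _ _) hr
      obtain ⟨s, hs, hq⟩ := (exists_reachList ht K _ _).2 ⟨k, hk, hf⟩
      exact ⟨s, hs, by rw [hq]⟩

end

/-- For each `K ∈ ℕ`, the `K`-bounded configuration
reachability problem for DCPS is decidable: there is an algorithm that, given
a DCPS `A` and a configuration `c` of `A`, decides whether there is a
`K`-context switch bounded run from the initial configuration of `A` to `c`. -/
theorem configuration_reachability_decidable :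
    ∀ K : ℕ,
      ∃ f : ℕ → Bool, Computable f ∧
        ∀ (A : DCPS) (c : DConfig),
          (f (Nat.pair (encodeDCPS A) (encodeDConfig c)) = true ↔
            ∃ (rho : ℕ → DConfig) (n : ℕ),
              IsFinRunD A rho n ∧ KBoundedUpToD K n rho ∧ rho n = c) :=
  reachability_decidable

end CBL
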